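/- Consider on $\mathbb{R}^2$ the inhomogeneous incompressible Navier–Stokes system $$\partial_t\rho+u\cdot\nabla\rho=0,\qquad \rho\,\partial_tu+\rho\,(u\cdot\nabla)u-\Delta u+\nabla\Pi=0,\qquad \operatorname{div}u=0,\qquad (\rho,u)|_{t=0}=(\rho_0,u_0).$$ There are an increasing function $\mathcal{C}:\mathbb{R}\to\mathbb{R}$ and a function $s\mapsto C(s)$, depending on nothing else, such that the following holds. Let $(\rho,u,\nabla\Pi)$ be a smooth global solution on $[0,\infty)\times\mathbb{R}^2$, where $\rho-1$, $u$ and $\nabla\Pi$ are smooth functions of $t\in[0,\infty)$ with values in $H^k(\mathbb{R}^2)$ for every $k$. Assume $$U_0:=\int_{\mathbb{R}^2}|x|\,|u_0(x)|\,dx<\infty,\qquad \int_{\mathbb{R}^2}\rho_0u_0\,dx=0,\qquad \tfrac34\le\rho_0\le\tfrac54 .$$ Set $$E_0=\int\rho_0|u_0|^2dx,\qquad E_1=\|\nabla u_0\|_{L^2}^2,\qquad E_2=\|\sqrt{\rho_0}\,\partial_tu|_{t=0}\|_{L^2}^2+\|\nabla u_0\|_{L^2}^4,$$ $$E_3=\|\nabla\partial_tu|_{t=0}\|_{L^2}^2+E_2^{3/2}+E_2\|\nabla\rho_0\|_{L^\infty}^2,\qquad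 T_3=\max\Big\{\frac{U_0}{E_0},\ \|\rho_0-1\|_{L^2}^2,\ \frac{E_0}{E_1},\ \frac{E_2}{E_1},\ \frac{E_2}{E_3}\Big\}$$ (quotients with zero denominator, which occur only for $u_0=0$, are read as $0$), and for $T\ge T_3$ write $\langle t\rangle_T=e+t/T$ (read as $e$ if $T=0$). Then for all $T\ge T_3$ and all $t\ge0$ the integral below converges and $$\|\nabla\partial_tu(t)\|_{L^2}^2+\int_t^\infty\big(\|\partial_t^2u(t')\|_{L^2}^2+\|\nabla^2\partial_tu(t')\|_{L^2}^2+\|\nabla\partial_t\Pi(t')\|_{L^2}^2\big)dt'\le\mathcal{C}(E_0)\,E_3\,\langle t\rangle_T^{-5}.$$ Moreover, for every $0\le s<5$ and all $0\le t_0\le t$, $$\int_{t_0}^t\langle t'\rangle_T^{s}\big(\|\partial_t^2u(t')\|_{L^2}^2+\|\nabla^2\partial_tu(t')\|_{L^2}^2+\|\nabla\partial_t\Pi(t')\|_{L^2}^2\big)dt'\le\mathcal{C}(E_0)\,C(s)\,(1+T)\,(1+\|\nabla\rho_0\|_{L^\infty}^2)\,E_3 .$$ -/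

import Mathlib

noncomputable section

open MeasureTheory Set Filter Topology
open scoped ENNReal ContDiff

namespace INS2D

/-- The plane `ℝ²` with its Euclidean norm. -/
abbrev Plane : Type := EuclideanSpace ℝ (Fin 2)

/-- The canonical basis vectors of `ℝ²`. -/
def basisVec (i : Fin 2) : Plane := EuclideanSpace.single i 1

section Operators

variable {F : Type*} [NormedAddCommGroup F] [NormedSpace ℝ F]

/-- Spatial gradient `∇f = (∂₁f, ∂₂f)`. The norm of `∇f(x)` is `(|∂₁f(x)|² + |∂₂f(x)|²)^{1/2}`,
so for vector-valued `f` it is the Frobenius norm of the Jacobian matrix; `∇²f` is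
`grad (grad f)`, and for real-valued `f` the gradient is a vector field on the plane. -/
def grad (f : Plane → F) (x : Plane) : PiLp 2 (fun _ : Fin 2 => F) :=
  WithLp.toLp 2 (fun i => fderiv ℝ f x (basisVec i))

/-- Time derivative on the half-line `[0,∞)`: one-sided at `t = 0`, the usual one for `t > 0`. -/
def dt (f : ℝ → Plane → F) (t : ℝ) (x : Plane) : F :=
  derivWithin (fun s => f s x) (Ici 0) t

/-- The `L^p(ℝ²)` norm as a real number; it is only used for functions in `L^p`. -/
def LpN (p : ℝ≥0∞) (f : Plane → F) : ℝ := (eLpNorm f p volume).toReal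

/-- `f` is smooth in time on `[0,∞)` with values in every Sobolev space `H^k(ℝ²)`:
`f` is `C^∞` on `[0,∞) × ℝ²`, and for all `j` and `k` the derivative `∇^k ∂_t^j f` is a continuous
function of `t ∈ [0,∞)` with values in `L²(ℝ²)`. -/
structure SmoothInSobolev (f : ℝ → Plane → F) : Prop where
  contDiffOn : ContDiffOn ℝ ∞ (fun q : ℝ × Plane => f q.1 q.2) (Ici 0 ×ˢ univ)
  memLp : ∀ j k : ℕ, ∀ t : ℝ, 0 ≤ t → MemLp (iteratedFDeriv ℝ k (dt^[j] f t)) 2 volume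
  continuous_L2 : ∀ j k : ℕ, ∀ t : ℝ, 0 ≤ t →
    Tendsto (fun s => eLpNorm
        (fun x => iteratedFDeriv ℝ k (dt^[j] f s) x - iteratedFDeriv ℝ k (dt^[j] f t) x) 2 volume)
      (𝓝[Ici 0] t) (𝓝 0)

end Operators

/-- Divergence of a vector field on the plane. -/
def divergence (v : Plane → Plane) (x : Plane) : ℝ := ∑ i, fderiv ℝ v x (basisVec i) i

/-- `⟨t⟩_T = e + t / T`. -/
def bracket (T t : ℝ) : ℝ := Real.exp 1 + t / T

/-- `(ρ, u, ∇P)` is a smooth global solution on `[0,∞) × ℝ²` of the inhomogeneous incompressible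
Navier–Stokes system; `ρ - 1`, `u` and `∇P` are smooth in time with values in all Sobolev
spaces. The initial data are `ρ 0` and `u 0`. -/
structure IsSmoothSolution (ρ : ℝ → Plane → ℝ) (u : ℝ → Plane → Plane) (P : ℝ → Plane → ℝ) :
    Prop where
  smooth_density : SmoothInSobolev (fun t x => ρ t x - 1)
  smooth_velocity : SmoothInSobolev u
  smooth_pressure : ContDiffOn ℝ ∞ (fun q : ℝ × Plane => P q.1 q.2) (Ici 0 ×ˢ univ)
  smooth_pressure_grad : SmoothInSobolev (fun t => grad (P t))
  mass : ∀ t, 0 ≤ t → ∀ x, dt ρ t x + fderiv ℝ (ρ t) x (u t x) = 0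
  momentum : ∀ t, 0 ≤ t → ∀ x,
    ρ t x • dt u t x + ρ t x • fderiv ℝ (u t) x (u t x)
      - Laplacian.laplacian (u t) x + grad (P t) x = 0
  incompressible : ∀ t, 0 ≤ t → ∀ x, divergence (u t) x = 0

/-- `E₀ = ∫ ρ₀ |u₀|²`. -/
def E0 (ρ : ℝ → Plane → ℝ) (u : ℝ → Plane → Plane) : ℝ := ∫ x, ρ 0 x * ‖u 0 x‖ ^ 2

/-- `E₁ = ‖∇u₀‖²_{L²}`. -/
def E1 (u : ℝ → Plane → Plane) : ℝ := LpN 2 (grad (u 0)) ^ 2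

/-- `E₂ = ‖√ρ₀ ∂ₜu|_{t=0}‖²_{L²} + ‖∇u₀‖⁴_{L²}`. -/
def E2 (ρ : ℝ → Plane → ℝ) (u : ℝ → Plane → Plane) : ℝ :=
  LpN 2 (fun x => Real.sqrt (ρ 0 x) • dt u 0 x) ^ 2 + LpN 2 (grad (u 0)) ^ 4

/-- `E₃ = ‖∇∂ₜu|_{t=0}‖²_{L²} + E₂^{3/2} + E₂ ‖∇ρ₀‖²_{L^∞}`. -/
def E3 (ρ : ℝ → Plane → ℝ) (u : ℝ → Plane → Plane) : ℝ :=
  LpN 2 (grad (dt u 0)) ^ 2 + E2 ρ u ^ ((3 : ℝ) / 2) + E2 ρ u * LpN ⊤ (grad (ρ 0)) ^ 2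

/-- `U₀ = ∫ |x| |u₀(x)| dx`. -/
def U0 (u : ℝ → Plane → Plane) : ℝ := ∫ x, ‖x‖ * ‖u 0 x‖

/-- `T₀ = max{U₀/E₀, ‖ρ₀ - 1‖²_{L²}}`. -/
def T0 (ρ : ℝ → Plane → ℝ) (u : ℝ → Plane → Plane) : ℝ :=
  max (U0 u / E0 ρ u) (LpN 2 (fun x => ρ 0 x - 1) ^ 2)

/-- `T₁ = max{T₀, E₀/E₁}`. -/
def T1 (ρ : ℝ → Plane → ℝ) (u : ℝ → Plane → Plane) : ℝ := max (T0 ρ u) (E0 ρ u / E1 u)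

/-- `T₂ = max{T₁, E₂/E₁}`. -/
def T2 (ρ : ℝ → Plane → ℝ) (u : ℝ → Plane → Plane) : ℝ := max (T1 ρ u) (E2 ρ u / E1 u)

/-- `T₃ = max{T₂, E₂/E₃}`. -/
def T3 (ρ : ℝ → Plane → ℝ) (u : ℝ → Plane → Plane) : ℝ := max (T2 ρ u) (E2 ρ u / E3 ρ u)

/-- The hypotheses on the initial data: `U₀ < ∞`, `∫ ρ₀ u₀ = 0` and `3/4 ≤ ρ₀ ≤ 5/4`. -/
structure GoodData (ρ : ℝ → Plane → ℝ) (u : ℝ → Plane → Plane) : Prop where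
  first_moment : Integrable (fun x => ‖x‖ * ‖u 0 x‖) volume
  zero_momentum : ∫ x, ρ 0 x • u 0 x = 0
  density_bounds : ∀ x, 3 / 4 ≤ ρ 0 x ∧ ρ 0 x ≤ 5 / 4

/-- `‖∂ₜ²u(t)‖²_{L²} + ‖∇²∂ₜu(t)‖²_{L²} + ‖∇∂ₜP(t)‖²_{L²}`. -/
def dissipation (u : ℝ → Plane → Plane) (P : ℝ → Plane → ℝ) (t : ℝ) : ℝ :=
  LpN 2 (dt (dt u) t) ^ 2 + LpN 2 (grad (grad (dt u t))) ^ 2 + LpN 2 (grad (dt P t)) ^ 2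

end INS2D

end

noncomputable section

open MeasureTheory Set Filter Topology
open scoped ENNReal ContDiff

namespace INS2D

/-! ### Partial derivatives on the plane -/

/-- The partial derivative `∂ᵢ f` of a scalar function. -/
def pd (i : Fin 2) (f : Plane → ℝ) : Plane → ℝ := fun x => fderiv ℝ f x (basisVec i)

/-- Iterated partial derivatives along a list of directions. -/
def pdl (l : List (Fin 2)) (f : Plane → ℝ) : Plane → ℝ := l.foldr pd f

lemma pd_contDiff {f : Plane → ℝ} (hf : ContDiff ℝ ∞ f) (i : Fin 2) : ContDiff ℝ ∞ (pd i f) := by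
  have : ContDiff ℝ ∞ (fderiv ℝ f) := hf.fderiv_right (by simp)
  exact this.clm_apply contDiff_const

lemma pd_add {f g : Plane → ℝ} (hf : Differentiable ℝ f) (hg : Differentiable ℝ g) (i : Fin 2) :
    pd i (fun x => f x + g x) = fun x => pd i f x + pd i g x := by
  funext x; simp [pd, fderiv_fun_add (hf x) (hg x)]

lemma pd_mul {f g : Plane → ℝ} (hf : Differentiable ℝ f) (hg : Differentiable ℝ g) (i : Fin 2) :
    pd i (fun x => f x * g x) = fun x => pd i f x * g x + f x * pd i g x := by
  funext x; simp [pd, fderiv_fun_mul (hf x) (hg x)]; ring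

lemma pd_const_mul {f : Plane → ℝ} (hf : Differentiable ℝ f) (c : ℝ) (i : Fin 2) :
    pd i (fun x => c * f x) = fun x => c * pd i f x := by
  funext x; simp [pd, fderiv_const_mul (hf x)]

lemma pd_comm {f : Plane → ℝ} (hf : ContDiff ℝ ∞ f) (i j : Fin 2) :
    pd i (pd j f) = pd j (pd i f) := by
  funext x
  have h2 : ∀ v w : Plane, fderiv ℝ (fun y => fderiv ℝ f y v) x w
      = fderiv ℝ (fderiv ℝ f) x w v := by
    intro v w
    have hd : DifferentiableAt ℝ (fderiv ℝ f) x :=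
      (((hf.fderiv_right (m := ∞) (by simp)).differentiable (by simp)) x)
    rw [fderiv_clm_apply hd (differentiableAt_const v)]
    simp
  unfold pd
  rw [h2, h2]
  have hs : IsSymmSndFDerivAt ℝ f x := hf.contDiffAt.isSymmSndFDerivAt (by simp; exact WithTop.coe_le_coe.2 (le_top : (2 : ℕ∞) ≤ ⊤))
  exact hs.eq _ _

/-! ### Integration along lines -/

lemma abs_le_integral_abs_deriv {h h' : ℝ → ℝ} (hd : ∀ s, HasDerivAt h (h' s) s)
    (hi : Integrable h) (hi' : Integrable h') (a : ℝ) : |h a| ≤ ∫ s, |h' s| := by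
  have h0 : Tendsto h atBot (𝓝 0) :=
    tendsto_zero_of_hasDerivAt_of_integrableOn_Iic (a := a) (fun x _ => hd x)
      hi'.integrableOn hi.integrableOn
  have := integral_Iic_of_hasDerivAt_of_tendsto' (a := a) (fun x _ => hd x) hi'.integrableOn h0
  rw [sub_zero] at this
  rw [← this]
  calc |∫ x in Iic a, h' x| ≤ ∫ x in Iic a, |h' x| := abs_integral_le_integral_abs
    _ ≤ ∫ s, |h' s| := setIntegral_le_integral hi'.abs (ae_of_all _ fun _ => abs_nonneg _)

/-- The point of the plane with given coordinates. -/
def mkP (q : ℝ × ℝ) : Plane := WithLp.toLp 2 ![q.1, q.2]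

lemma mkP_measurePreserving : MeasurePreserving mkP volume volume :=
  (PiLp.volume_preserving_toLp (Fin 2)).comp (volume_preserving_finTwoArrow ℝ).symm

lemma mkP_measurableEmbedding : MeasurableEmbedding mkP :=
  (MeasurableEquiv.toLp 2 (Fin 2 → ℝ)).measurableEmbedding.comp
    (MeasurableEquiv.finTwoArrow (α := ℝ)).symm.measurableEmbedding

lemma mkP_surj (x : Plane) : mkP (x 0, x 1) = x := by
  ext i; fin_cases i <;> simp [mkP]

lemma mkP_add_left (a b : ℝ) : mkP (a, b) = mkP (0, b) + a • basisVec 0 := by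
  ext i; fin_cases i <;> simp [mkP, basisVec]

lemma mkP_add_right (a b : ℝ) : mkP (a, b) = mkP (a, 0) + b • basisVec 1 := by
  ext i; fin_cases i <;> simp [mkP, basisVec]

lemma hasDerivAt_line {g : Plane → ℝ} (hg : Differentiable ℝ g) (y : Plane) (i : Fin 2) (s : ℝ) :
    HasDerivAt (fun s : ℝ => g (y + s • basisVec i)) (pd i g (y + s • basisVec i)) s := by
  have h1 : HasDerivAt (fun s : ℝ => y + s • basisVec i) (basisVec i) s := by
    simpa using ((hasDerivAt_id s).smul_const (basisVec i)).const_add y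
  exact (hg _).hasFDerivAt.comp_hasDerivAt s h1

lemma integrable_comp_mkP {g : Plane → ℝ} (hg : Integrable g) :
    Integrable (fun q : ℝ × ℝ => g (mkP q)) (volume.prod volume) :=
  mkP_measurePreserving.integrable_comp_of_integrable hg

lemma integral_comp_mkP (g : Plane → ℝ) : ∫ q, g (mkP q) ∂((volume : Measure ℝ).prod volume) = ∫ x, g x :=
  mkP_measurePreserving.integral_comp mkP_measurableEmbedding g

lemma ae_abs_le_line_left {g : Plane → ℝ} (hg : Differentiable ℝ g) (h0 : Integrable g)
    (h1 : Integrable (pd 0 g)) :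
    ∀ᵐ b : ℝ, ∀ a : ℝ, |g (mkP (a, b))| ≤ ∫ s, |pd 0 g (mkP (s, b))| := by
  filter_upwards [(integrable_comp_mkP h0).prod_left_ae, (integrable_comp_mkP h1).prod_left_ae]
    with b hb hb' a
  refine abs_le_integral_abs_deriv (h := fun s => g (mkP (s, b))) (fun s => ?_) hb hb' a
  have := hasDerivAt_line hg (mkP (0, b)) 0 s
  simpa only [← mkP_add_left] using this

lemma ae_abs_le_line_right {g : Plane → ℝ} (hg : Differentiable ℝ g) (h0 : Integrable g)
    (h1 : Integrable (pd 1 g)) :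
    ∀ᵐ a : ℝ, ∀ b : ℝ, |g (mkP (a, b))| ≤ ∫ s, |pd 1 g (mkP (a, s))| := by
  filter_upwards [(integrable_comp_mkP h0).prod_right_ae, (integrable_comp_mkP h1).prod_right_ae]
    with a ha ha' b
  refine abs_le_integral_abs_deriv (h := fun s => g (mkP (a, s))) (fun s => ?_) ha ha' b
  have := hasDerivAt_line hg (mkP (a, 0)) 1 s
  simpa only [← mkP_add_right] using this

/-- The embedding `W^{1,1}(ℝ²) ⊂ L²(ℝ²)`. -/
lemma integral_sq_le_of_integrable_pd {g : Plane → ℝ} (hg : Differentiable ℝ g)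
    (h0 : Integrable g) (h1 : Integrable (pd 0 g)) (h2 : Integrable (pd 1 g)) :
    ∫ x, g x ^ 2 ≤ (∫ x, |pd 0 g x|) * ∫ x, |pd 1 g x| := by
  have i1 := (integrable_comp_mkP h1).abs
  have i2 := (integrable_comp_mkP h2).abs
  rw [← integral_comp_mkP (fun x => g x ^ 2), ← integral_comp_mkP (fun x => |pd 0 g x|),
    ← integral_comp_mkP (fun x => |pd 1 g x|), integral_prod_symm _ i1, integral_prod _ i2, mul_comm,
    ← integral_prod_mul]
  refine integral_mono_of_nonneg (ae_of_all _ fun _ => sq_nonneg _)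
    (i2.integral_prod_left.mul_prod i1.integral_prod_right) ?_
  have hl := Measure.quasiMeasurePreserving_snd (μ := (volume : Measure ℝ)) (ν := (volume : Measure ℝ))
    |>.ae (ae_abs_le_line_left hg h0 h1)
  have hr := Measure.quasiMeasurePreserving_fst (μ := (volume : Measure ℝ)) (ν := (volume : Measure ℝ))
    |>.ae (ae_abs_le_line_right hg h0 h2)
  filter_upwards [hl, hr] with q hq1 hq2
  have e1 := hq1 q.1
  have e2 := hq2 q.2
  calc g (mkP q) ^ 2 = |g (mkP q)| * |g (mkP q)| := by rw [← sq, sq_abs]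
    _ ≤ _ := mul_le_mul e2 e1 (abs_nonneg _) (integral_nonneg fun _ => abs_nonneg _)

/-- The embedding `W^{2,1}(ℝ²) ⊂ L^∞(ℝ²)`. -/
lemma abs_le_integral_abs_pd_pd {g : Plane → ℝ} (hg : Differentiable ℝ g)
    (hg' : Differentiable ℝ (pd 0 g))
    (h0 : Integrable g) (h1 : Integrable (pd 0 g)) (h2 : Integrable (pd 1 (pd 0 g))) (x : Plane) :
    |g x| ≤ ∫ x, |pd 1 (pd 0 g) x| := by
  have i2 := (integrable_comp_mkP h2).abs
  have i1 := (integrable_comp_mkP h1).abs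
  have key : ∀ᵐ b : ℝ, ∀ a : ℝ, |g (mkP (a, b))| ≤ ∫ x, |pd 1 (pd 0 g) x| := by
    filter_upwards [ae_abs_le_line_left hg h0 h1, i1.prod_left_ae] with b hb hb' a
    refine (hb a).trans ?_
    rw [← integral_comp_mkP (fun x => |pd 1 (pd 0 g) x|), integral_prod _ i2]
    refine integral_mono_ae hb' i2.integral_prod_left ?_
    filter_upwards [ae_abs_le_line_right hg' h1 h2] with s hs
    exact hs b
  have hcont : Continuous fun b : ℝ => |g (mkP (x 0, b))| := by
    have h : Continuous fun b : ℝ => mkP (x 0, b) := by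
      have : (fun b : ℝ => mkP (x 0, b)) = fun b => mkP (x 0, 0) + b • basisVec 1 := by
        funext b; exact mkP_add_right _ _
      rw [this]; fun_prop
    exact (hg.continuous.comp h).abs
  have hdense : Dense {b : ℝ | ∀ a : ℝ, |g (mkP (a, b))| ≤ ∫ x, |pd 1 (pd 0 g) x|} :=
    Measure.dense_of_ae key
  have hcl : IsClosed {b : ℝ | |g (mkP (x 0, b))| ≤ ∫ x, |pd 1 (pd 0 g) x|} :=
    isClosed_le hcont continuous_const
  have : (x 1) ∈ {b : ℝ | |g (mkP (x 0, b))| ≤ ∫ x, |pd 1 (pd 0 g) x|} := by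
    have hsub : closure {b : ℝ | ∀ a : ℝ, |g (mkP (a, b))| ≤ ∫ x, |pd 1 (pd 0 g) x|} ⊆
        {b : ℝ | |g (mkP (x 0, b))| ≤ ∫ x, |pd 1 (pd 0 g) x|} :=
      hcl.closure_subset_iff.2 fun b hb => hb (x 0)
    exact hsub (hdense.closure_eq ▸ mem_univ _)
  simpa [mkP_surj] using this

/-! ### Square integrals and the Cauchy–Schwarz inequality -/

/-- The square of the `L²` norm. -/
def sqn (f : Plane → ℝ) : ℝ := ∫ x, f x ^ 2

/-- The `L²` norm. -/
def nrm (f : Plane → ℝ) : ℝ := Real.sqrt (sqn f)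

lemma sqn_nonneg (f : Plane → ℝ) : 0 ≤ sqn f := integral_nonneg fun _ => sq_nonneg _

lemma nrm_nonneg (f : Plane → ℝ) : 0 ≤ nrm f := Real.sqrt_nonneg _

lemma nrm_sq (f : Plane → ℝ) : nrm f ^ 2 = sqn f := Real.sq_sqrt (sqn_nonneg f)

lemma integrable_mul_of_memLp {f g : Plane → ℝ} (hf : MemLp f 2 volume) (hg : MemLp g 2 volume) :
    Integrable (fun x => f x * g x) := hf.integrable_mul hg

lemma integral_abs_mul_le {f g : Plane → ℝ} (hf : MemLp f 2 volume) (hg : MemLp g 2 volume) :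
    ∫ x, |f x * g x| ≤ nrm f * nrm g := by
  have h := integral_mul_norm_le_Lp_mul_Lq (μ := (volume : Measure Plane)) (f := f) (g := g)
    Real.HolderConjugate.two_two (by simpa using hf) (by simpa using hg)
  have e : ∀ f : Plane → ℝ, (∫ x, ‖f x‖ ^ (2 : ℝ)) ^ (1 / (2 : ℝ)) = nrm f := by
    intro f
    rw [nrm, Real.sqrt_eq_rpow, sqn]
    congr 2
    funext x
    rw [Real.rpow_two, Real.norm_eq_abs, sq_abs]
  rw [e, e] at h
  simpa [abs_mul] using h

lemma abs_integral_mul_le {f g : Plane → ℝ} (hf : MemLp f 2 volume) (hg : MemLp g 2 volume) :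
    |∫ x, f x * g x| ≤ nrm f * nrm g :=
  abs_integral_le_integral_abs.trans (integral_abs_mul_le hf hg)

/-! ### The class `H^∞(ℝ²)` -/

/-- Smooth functions all of whose partial derivatives are square integrable. -/
structure Hs (f : Plane → ℝ) : Prop where
  smooth : ContDiff ℝ ∞ f
  memLp : ∀ l : List (Fin 2), MemLp (pdl l f) 2 volume

lemma pdl_smooth {f : Plane → ℝ} (hf : ContDiff ℝ ∞ f) (l : List (Fin 2)) :
    ContDiff ℝ ∞ (pdl l f) := by
  induction l with
  | nil => exact hf
  | cons i l ih => exact pd_contDiff ih i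

lemma pdl_pd (l : List (Fin 2)) (i : Fin 2) (f : Plane → ℝ) :
    pdl l (pd i f) = pdl (l ++ [i]) f := by
  simp [pdl]

namespace Hs

variable {f g : Plane → ℝ}

lemma memL2 (hf : Hs f) : MemLp f 2 volume := hf.memLp []

lemma diff (hf : Hs f) : Differentiable ℝ f := hf.smooth.differentiable (by simp)

lemma cont (hf : Hs f) : Continuous f := hf.smooth.continuous

lemma pd (hf : Hs f) (i : Fin 2) : Hs (pd i f) :=
  ⟨pd_contDiff hf.smooth i, fun l => by rw [pdl_pd]; exact hf.memLp _⟩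

lemma add (hf : Hs f) (hg : Hs g) : Hs (fun x => f x + g x) := by
  refine ⟨hf.smooth.add hg.smooth, fun l => ?_⟩
  have : pdl l (fun x => f x + g x) = fun x => pdl l f x + pdl l g x := by
    induction l with
    | nil => rfl
    | cons i l ih =>
      change INS2D.pd i (pdl l _) = _
      rw [ih, pd_add ((pdl_smooth hf.smooth l).differentiable (by simp))
        ((pdl_smooth hg.smooth l).differentiable (by simp))]
      rfl
  rw [this]
  exact (hf.memLp l).add (hg.memLp l)

lemma const_mul (hf : Hs f) (c : ℝ) : Hs (fun x => c * f x) := by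
  refine ⟨contDiff_const.mul hf.smooth, fun l => ?_⟩
  have : pdl l (fun x => c * f x) = fun x => c * pdl l f x := by
    induction l with
    | nil => rfl
    | cons i l ih =>
      change INS2D.pd i (pdl l _) = _
      rw [ih, pd_const_mul ((pdl_smooth hf.smooth l).differentiable (by simp))]
      rfl
  rw [this]
  exact (hf.memLp l).const_mul c

lemma zero : Hs (fun _ => (0 : ℝ)) := by
  refine ⟨contDiff_const, fun l => ?_⟩
  have : pdl l (fun _ => (0 : ℝ)) = fun _ => 0 := by
    induction l with
    | nil => rfl
    | cons i l ih =>
      change INS2D.pd i (pdl l _) = _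
      rw [ih]; funext x; simp [INS2D.pd]
  rw [this]; exact MemLp.zero

lemma neg (hf : Hs f) : Hs (fun x => - f x) := by simpa using hf.const_mul (-1)

lemma sub (hf : Hs f) (hg : Hs g) : Hs (fun x => f x - g x) := by
  simpa [sub_eq_add_neg] using hf.add hg.neg

lemma sum {ι : Type*} (s : Finset ι) {F : ι → Plane → ℝ} (h : ∀ i ∈ s, Hs (F i)) :
    Hs (fun x => ∑ i ∈ s, F i x) := by
  classical
  induction s using Finset.induction_on with
  | empty => simpa using zero
  | insert a s ha ih =>
    simp only [Finset.sum_insert ha]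
    exact (h a (by simp)).add (ih fun i hi => h i (by simp [hi]))

lemma integrable_mul (hf : Hs f) (hg : Hs g) : Integrable (fun x => f x * g x) :=
  integrable_mul_of_memLp hf.memL2 hg.memL2

lemma integrable_sq (hf : Hs f) : Integrable (fun x => f x ^ 2) := by
  simpa [sq] using hf.integrable_mul hf

lemma sq_le (hf : Hs f) (x : Plane) :
    f x ^ 2 ≤ 2 * (nrm (INS2D.pd 0 f) * nrm (INS2D.pd 1 f)
      + nrm f * nrm (INS2D.pd 1 (INS2D.pd 0 f))) := by
  have h0 := hf.pd 0
  have h1 := hf.pd 1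
  have h10 := h0.pd 1
  have e0 : INS2D.pd 0 (fun x => f x * f x) = fun x => 2 * (INS2D.pd 0 f x * f x) := by
    rw [pd_mul hf.diff hf.diff]; funext x; ring
  have e1 : INS2D.pd 1 (INS2D.pd 0 (fun x => f x * f x)) = fun x =>
      2 * (INS2D.pd 1 (INS2D.pd 0 f) x * f x + INS2D.pd 0 f x * INS2D.pd 1 f x) := by
    rw [e0, pd_const_mul (h0.diff.fun_mul hf.diff), pd_mul h0.diff hf.diff]
  have i2 : Integrable (fun x => INS2D.pd 1 (INS2D.pd 0 f) x * f x) := h10.integrable_mul hf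
  have i3 : Integrable (fun x => INS2D.pd 0 f x * INS2D.pd 1 f x) := h0.integrable_mul h1
  have := abs_le_integral_abs_pd_pd (g := fun x => f x * f x) (hf.diff.mul hf.diff)
    (by rw [e0]; exact (differentiable_const _).mul (h0.diff.mul hf.diff)) (hf.integrable_mul hf)
    (by rw [e0]; exact (h0.integrable_mul hf).const_mul 2)
    (by rw [e1]; exact (i2.add i3).const_mul 2) x
  rw [e1] at this
  have hle : ∫ x, |2 * (INS2D.pd 1 (INS2D.pd 0 f) x * f x + INS2D.pd 0 f x * INS2D.pd 1 f x)|
      ≤ ∫ x, 2 * (|INS2D.pd 1 (INS2D.pd 0 f) x * f x| + |INS2D.pd 0 f x * INS2D.pd 1 f x|) := by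
    refine integral_mono (((i2.add i3).const_mul 2).abs) ((i2.abs.add i3.abs).const_mul 2)
      fun x => ?_
    change |2 * _| ≤ 2 * (_ + _)
    rw [abs_mul, abs_two]
    have := abs_add_le (INS2D.pd 1 (INS2D.pd 0 f) x * f x) (INS2D.pd 0 f x * INS2D.pd 1 f x)
    linarith
  rw [integral_const_mul, integral_add i2.abs i3.abs] at hle
  have c2 := integral_abs_mul_le h10.memL2 hf.memL2
  have c3 := integral_abs_mul_le h0.memL2 h1.memL2
  have e : |f x * f x| = f x ^ 2 := by rw [abs_mul_self, sq]
  rw [e] at this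
  linarith [mul_comm (nrm f) (nrm (INS2D.pd 1 (INS2D.pd 0 f)))]

lemma bounded (hf : Hs f) : ∃ C, 0 ≤ C ∧ ∀ x, |f x| ≤ C := by
  refine ⟨Real.sqrt _, Real.sqrt_nonneg _, fun x => Real.abs_le_sqrt (hf.sq_le x)⟩

lemma memLp_mul (hf : Hs f) (hg : Hs g) : MemLp (fun x => f x * g x) 2 volume := by
  obtain ⟨C, -, hC⟩ := hf.bounded
  refine hg.memL2.of_le_mul (c := C) (hf.cont.mul hg.cont).aestronglyMeasurable
    (ae_of_all _ fun x => ?_)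
  rw [norm_mul]
  exact mul_le_mul_of_nonneg_right (hC x) (norm_nonneg _)

lemma mul (hf : Hs f) (hg : Hs g) : Hs (fun x => f x * g x) := by
  refine ⟨hf.smooth.mul hg.smooth, fun l => ?_⟩
  induction l using List.reverseRecOn generalizing f g with
  | nil => exact hf.memLp_mul hg
  | append_singleton l i ih =>
    rw [← pdl_pd, pd_mul hf.diff hg.diff]
    have h1 : ContDiff ℝ ∞ fun x => INS2D.pd i f x * g x := (hf.pd i).smooth.mul hg.smooth
    have h2 : ContDiff ℝ ∞ fun x => f x * INS2D.pd i g x := hf.smooth.mul (hg.pd i).smooth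
    have : ∀ (l : List (Fin 2)) (F G : Plane → ℝ), ContDiff ℝ ∞ F → ContDiff ℝ ∞ G →
        pdl l (fun x => F x + G x) = fun x => pdl l F x + pdl l G x := by
      intro l F G hF hG
      induction l with
      | nil => rfl
      | cons i l ih =>
        change INS2D.pd i (pdl l _) = _
        rw [ih, pd_add ((pdl_smooth hF l).differentiable (by simp))
          ((pdl_smooth hG l).differentiable (by simp))]
        rfl
    rw [this l _ _ h1 h2]
    exact (ih (hf.pd i) hg).add (ih hf (hg.pd i))

lemma sq (hf : Hs f) : Hs (fun x => f x ^ 2) := by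
  simpa [_root_.sq] using hf.mul hf

lemma pow (hf : Hs f) (n : ℕ) : Hs (fun x => f x ^ (n + 1)) := by
  induction n with
  | zero => simpa using hf
  | succ n ih => simpa [pow_succ (_ : ℝ) (n + 1)] using ih.mul hf

lemma integral_mul_pd (hf : Hs f) (hg : Hs g) (i : Fin 2) :
    ∫ x, f x * INS2D.pd i g x = - ∫ x, INS2D.pd i f x * g x :=
  integral_mul_fderiv_eq_neg_fderiv_mul_of_integrable ((hf.pd i).integrable_mul hg)
    (hf.integrable_mul (hg.pd i)) (hf.integrable_mul hg) (fun x _ => hf.diff x)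
    (fun x _ => hg.diff x)

end Hs

/-- The square of the `L²` norm of the gradient. -/
def gsq (f : Plane → ℝ) : ℝ := ∑ i, sqn (pd i f)

lemma gsq_nonneg (f : Plane → ℝ) : 0 ≤ gsq f := Finset.sum_nonneg fun _ _ => sqn_nonneg _

lemma nrm_pd_mul_le (f : Plane → ℝ) : nrm (pd 0 f) * nrm (pd 1 f) ≤ gsq f / 2 := by
  simp only [gsq, Fin.sum_univ_two, ← nrm_sq]
  nlinarith [sq_nonneg (nrm (pd 0 f) - nrm (pd 1 f))]

namespace Hs

variable {f g : Plane → ℝ}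

lemma sqn_pow_succ_le (hf : Hs f) (n : ℕ) :
    sqn (fun x => f x ^ (n + 2)) ≤ (n + 2) ^ 2 / 2 * (sqn (fun x => f x ^ (n + 1)) * gsq f) := by
  have hn := hf.pow n
  have e : ∀ i, INS2D.pd i (fun x => f x ^ (n + 2))
      = fun x => ((n : ℝ) + 2) * (f x ^ (n + 1) * INS2D.pd i f x) := by
    intro i; funext x
    simp only [INS2D.pd]
    rw [fderiv_fun_pow _ (hf.diff x)]
    simp; ring
  have hint : ∀ i, Integrable (fun x => f x ^ (n + 1) * INS2D.pd i f x) :=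
    fun i => hn.integrable_mul (hf.pd i)
  have h := integral_sq_le_of_integrable_pd (g := fun x => f x ^ (n + 2))
    (hf.diff.pow _) (by simpa [pow_succ (_ : ℝ) (n + 1)] using hn.integrable_mul hf)
    (by rw [e]; exact (hint 0).const_mul _) (by rw [e]; exact (hint 1).const_mul _)
  have b : ∀ i, ∫ x, |INS2D.pd i (fun x => f x ^ (n + 2)) x|
      ≤ (n + 2) * (nrm (fun x => f x ^ (n + 1)) * nrm (INS2D.pd i f)) := by
    intro i
    rw [e]
    have : ∀ x, |((n : ℝ) + 2) * (f x ^ (n + 1) * INS2D.pd i f x)|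
        = (n + 2) * |f x ^ (n + 1) * INS2D.pd i f x| := fun x => by
      rw [abs_mul, abs_of_nonneg (by positivity : (0 : ℝ) ≤ n + 2)]
    simp only [this]
    rw [integral_const_mul]
    exact mul_le_mul_of_nonneg_left (integral_abs_mul_le hn.memL2 (hf.pd i).memL2) (by positivity)
  refine (h.trans (mul_le_mul (b 0) (b 1) (integral_nonneg fun _ => abs_nonneg _)
    (by have := nrm_nonneg (fun x => f x ^ (n + 1)); have := nrm_nonneg (INS2D.pd 0 f)
        positivity))).trans ?_
  have h1 := nrm_pd_mul_le f
  rw [← nrm_sq (fun x => f x ^ (n + 1))]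
  have := mul_le_mul_of_nonneg_left h1
    (by positivity : (0 : ℝ) ≤ (n + 2) ^ 2 * nrm (fun x => f x ^ (n + 1)) ^ 2)
  nlinarith

/-- Ladyzhenskaya's inequality. -/
lemma sqn_sq_le (hf : Hs f) : sqn (fun x => f x ^ 2) ≤ 2 * (sqn f * gsq f) := by
  have := hf.sqn_pow_succ_le 0
  norm_num at this
  linarith

lemma sqn_pow_four_le (hf : Hs f) : sqn (fun x => f x ^ 4) ≤ 72 * (sqn f * gsq f ^ 3) := by
  have h1 := hf.sqn_sq_le
  have h2 := hf.sqn_pow_succ_le 1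
  have h3 := hf.sqn_pow_succ_le 2
  norm_num at h2 h3
  have g0 := gsq_nonneg f
  calc sqn (fun x => f x ^ 4) ≤ 8 * (sqn (fun x => f x ^ 3) * gsq f) := h3
    _ ≤ 8 * ((9 / 2 * (2 * (sqn f * gsq f) * gsq f)) * gsq f) := by gcongr; exact h2.trans (by gcongr)
    _ = _ := by ring

end Hs

/-! ### Orthogonality of gradients and divergence-free fields -/

lemma norm_basisVec (i : Fin 2) : ‖basisVec i‖ = 1 := by simp [basisVec]

lemma sqn_translate (f : Plane → ℝ) (a : Plane) : sqn (fun x => f (x - a)) = sqn f :=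
  integral_sub_right_eq_self (fun x => f x ^ 2) a

lemma nrm_translate (f : Plane → ℝ) (a : Plane) : nrm (fun x => f (x - a)) = nrm f := by
  rw [nrm, sqn_translate, nrm]

lemma memLp_translate {f : Plane → ℝ} (hf : MemLp f 2 volume) (a : Plane) :
    MemLp (fun x => f (x - a)) 2 volume :=
  hf.comp_measurePreserving (measurePreserving_sub_right volume a)

lemma pd_translate (f : Plane → ℝ) (a : Plane) (i : Fin 2) :
    pd i (fun x => f (x - a)) = fun x => pd i f (x - a) := by
  funext x; simp only [pd, fderiv_comp_sub]

lemma sq_intervalIntegral_le {g : ℝ → ℝ} (hg : Continuous g) {h : ℝ} (hh : 0 < h) :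
    (∫ s in (0 : ℝ)..h, g s) ^ 2 ≤ h * ∫ s in (0 : ℝ)..h, g s ^ 2 := by
  set c := (∫ s in (0 : ℝ)..h, g s) / h with hc
  have h0 : 0 ≤ ∫ s in (0 : ℝ)..h, (g s - c) ^ 2 :=
    intervalIntegral.integral_nonneg hh.le fun _ _ => sq_nonneg _
  have i1 : IntervalIntegrable g volume 0 h := hg.intervalIntegrable _ _
  have i2 : IntervalIntegrable (fun s => g s ^ 2) volume 0 h := (hg.pow 2).intervalIntegrable _ _
  have e : (fun s => (g s - c) ^ 2) = fun s => (g s ^ 2 - 2 * c * g s) + c ^ 2 := by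
    funext s; ring
  rw [e, intervalIntegral.integral_add (i2.sub (i1.const_mul _)) (by simp),
    intervalIntegral.integral_sub i2 (i1.const_mul _), intervalIntegral.integral_const_mul,
    intervalIntegral.integral_const, smul_eq_mul, sub_zero] at h0
  have hI : ∫ s in (0 : ℝ)..h, g s = c * h := by rw [hc]; field_simp
  rw [hI] at h0 ⊢
  nlinarith

lemma memLp_sub_translate {P : Plane → ℝ} (hP : ContDiff ℝ ∞ P) (hp : Hs (pd 0 P)) {h : ℝ}
    (hh : 0 < h) : MemLp (fun x => P x - P (x - h • basisVec 0)) 2 volume := by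
  have hc : Continuous fun x => P x - P (x - h • basisVec 0) := by
    have := hP.continuous; fun_prop
  rw [memLp_two_iff_integrable_sq hc.aestronglyMeasurable]
  have hcont := hp.cont
  have hprod : Integrable (fun q : ℝ × Plane => (pd 0 P (q.2 - q.1 • basisVec 0)) ^ 2)
      ((volume.restrict (Ioc 0 h)).prod volume) := by
    rw [integrable_prod_iff (Continuous.aestronglyMeasurable (by fun_prop))]
    refine ⟨ae_of_all _ fun s => hp.integrable_sq.comp_sub_right (s • basisVec 0), ?_⟩
    have : ∀ s : ℝ, ∫ y, ‖pd 0 P (y - s • basisVec 0) ^ 2‖ = sqn (pd 0 P) := by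
      intro s
      rw [← sqn_translate (pd 0 P) (s • basisVec 0)]
      simp [sqn]
    simp only [this]
    exact integrable_const _
  refine (hprod.integral_prod_right.const_mul h).mono' (hc.pow 2).aestronglyMeasurable
    (ae_of_all _ fun x => ?_)
  have hd : ∀ s ∈ uIcc 0 h, HasDerivAt (fun s : ℝ => - P (x - s • basisVec 0))
      (pd 0 P (x - s • basisVec 0)) s := by
    intro s _
    have h1 : HasDerivAt (fun s : ℝ => x - s • basisVec 0) (-basisVec 0) s := by
      simpa using ((hasDerivAt_id s).smul_const (basisVec 0)).const_sub x
    have := ((hP.differentiable (by simp)) (x - s • basisVec 0)).hasFDerivAt.comp_hasDerivAt s h1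
    have h3 := this.neg
    rw [map_neg, neg_neg] at h3
    exact h3
  have hcs : Continuous fun s : ℝ => pd 0 P (x - s • basisVec 0) := by fun_prop
  have ftc := intervalIntegral.integral_eq_sub_of_hasDerivAt hd (hcs.intervalIntegrable _ _)
  have := sq_intervalIntegral_le hcs hh
  rw [ftc, intervalIntegral.integral_of_le hh.le] at this
  simp only [zero_smul, sub_zero] at this
  rw [Real.norm_eq_abs, abs_of_nonneg (sq_nonneg _)]
  convert this using 2
  ring

lemma tendsto_nrm_indicator {f : Plane → ℝ} (hf : MemLp f 2 volume) :
    Tendsto (fun n : ℕ => nrm (indicator {x | (n : ℝ) < ‖x‖} f)) atTop (𝓝 0) := by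
  have h2 : Integrable (fun x => f x ^ 2) := hf.integrable_sq
  have : Tendsto (fun n : ℕ => sqn (indicator {x | (n : ℝ) < ‖x‖} f)) atTop (𝓝 (∫ _ : Plane, (0 : ℝ))) := by
    refine tendsto_integral_of_dominated_convergence (fun x => f x ^ 2) (fun n => ?_) h2
      (fun n => ae_of_all _ fun x => ?_) (ae_of_all _ fun x => ?_)
    · exact ((hf.1.indicator (measurableSet_lt measurable_const measurable_norm)).pow 2)
    · by_cases hx : x ∈ {x : Plane | (n : ℝ) < ‖x‖}
      · simp [indicator_of_mem hx]
      · simp [indicator_of_notMem hx, sq_nonneg]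
    · refine tendsto_const_nhds.congr' ?_
      obtain ⟨N, hN⟩ := exists_nat_ge ‖x‖
      filter_upwards [eventually_ge_atTop N] with n hn
      have : x ∉ {x : Plane | (n : ℝ) < ‖x‖} := by
        simp only [mem_ofPred_eq, not_lt]; exact hN.trans (by exact_mod_cast hn)
      simp [indicator_of_notMem this]
  simp only [integral_zero] at this
  have := (Real.continuous_sqrt.tendsto 0).comp this
  simpa [nrm, Function.comp_def] using this

lemma abs_integral_mul_translate_le {f g : Plane → ℝ} (hf : MemLp f 2 volume)
    (hg : MemLp g 2 volume) (n : ℕ) :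
    |∫ x, f x * g (x - (2 * n + 1 : ℝ) • basisVec 0)| ≤
      nrm (indicator {x | (n : ℝ) < ‖x‖} f) * nrm g
        + nrm f * nrm (indicator {x | (n : ℝ) < ‖x‖} g) := by
  set a : Plane := (2 * n + 1 : ℝ) • basisVec 0 with ha
  have hna : ‖a‖ = 2 * n + 1 := by
    rw [ha, norm_smul, norm_basisVec, mul_one, Real.norm_eq_abs, abs_of_nonneg (by positivity)]
  have hm : MeasurableSet {x : Plane | (n : ℝ) < ‖x‖} :=
    measurableSet_lt measurable_const measurable_norm
  have hf' := hf.indicator hm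
  have hg' := memLp_translate (hg.indicator hm) a
  have hgt := memLp_translate hg a
  have i1 := (integrable_mul_of_memLp hf' hgt).abs
  have i2 := (integrable_mul_of_memLp hf hg').abs
  calc _ ≤ ∫ x, |f x * g (x - a)| := abs_integral_le_integral_abs
    _ ≤ ∫ x, (|indicator {x | (n : ℝ) < ‖x‖} f x * g (x - a)|
          + |f x * indicator {x | (n : ℝ) < ‖x‖} g (x - a)|) := by
        refine integral_mono (integrable_mul_of_memLp hf hgt).abs (i1.add i2) fun x => ?_
        dsimp only
        by_cases hx : x ∈ {x : Plane | (n : ℝ) < ‖x‖}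
        · rw [indicator_of_mem hx]
          linarith [abs_nonneg (f x * indicator {x : Plane | (n : ℝ) < ‖x‖} g (x - a))]
        · have hxa : x - a ∈ {x : Plane | (n : ℝ) < ‖x‖} := by
            simp only [mem_ofPred_eq, not_lt] at hx ⊢
            have := norm_sub_norm_le a x
            rw [norm_sub_rev] at this
            linarith
          rw [indicator_of_mem hxa]
          linarith [abs_nonneg (indicator {x : Plane | (n : ℝ) < ‖x‖} f x * g (x - a))]
    _ ≤ _ := by
        rw [integral_add i1 i2]
        have e1 := integral_abs_mul_le hf' hgt
        have e2 := integral_abs_mul_le hf hg'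
        rw [nrm_translate g a] at e1
        rw [nrm_translate (indicator {x | (n : ℝ) < ‖x‖} g) a] at e2
        exact add_le_add e1 e2

/-- Divergence-free fields in `H^∞` are orthogonal to gradients in `H^∞`. -/
theorem sum_integral_mul_pd_eq_zero {w : Fin 2 → Plane → ℝ} (hw : ∀ k, Hs (w k))
    (hdiv : ∀ x, ∑ i, pd i (w i) x = 0) {P : Plane → ℝ} (hP : ContDiff ℝ ∞ P)
    (hp : ∀ k, Hs (pd k P)) : ∑ k, ∫ x, w k x * pd k P x = 0 := by
  have key : ∀ h : ℝ, 0 < h → ∑ k, ∫ x, w k x * pd k P x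
      = ∑ k, ∫ x, w k x * pd k P (x - h • basisVec 0) := by
    intro h hh
    set a : Plane := h • basisVec 0
    have hq := memLp_sub_translate hP (hp 0) hh
    have hPd : Differentiable ℝ P := hP.differentiable (by simp)
    have hPd' : Differentiable ℝ fun x => P (x - a) := fun x =>
      (hPd _).comp x (differentiableAt_id.sub_const a)
    have hqd : Differentiable ℝ fun x => P x - P (x - a) := hPd.sub hPd'
    have hpdq : ∀ k x, fderiv ℝ (fun x => P x - P (x - a)) x (basisVec k)
        = pd k P x - pd k P (x - a) := by
      intro k x
      rw [fderiv_fun_sub (hPd x) (hPd' x)]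
      have := congrFun (pd_translate P a k) x
      simp only [pd] at this ⊢
      simp [this]
    have hqm : ∀ k, MemLp (fun x => pd k P x - pd k P (x - a)) 2 volume := fun k =>
      (hp k).memL2.sub (memLp_translate (hp k).memL2 a)
    have ibp : ∀ k, ∫ x, w k x * (pd k P x - pd k P (x - a))
        = - ∫ x, pd k (w k) x * (P x - P (x - a)) := by
      intro k
      have := integral_mul_fderiv_eq_neg_fderiv_mul_of_integrable (μ := volume) (f := w k)
        (g := fun x => P x - P (x - a)) (v := basisVec k)
        (integrable_mul_of_memLp ((hw k).pd k).memL2 hq)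
        (by simp only [hpdq]; exact integrable_mul_of_memLp (hw k).memL2 (hqm k))
        (integrable_mul_of_memLp (hw k).memL2 hq) (fun x _ => (hw k).diff x) (fun x _ => hqd x)
      simp only [hpdq] at this
      exact this
    have hz : ∑ k, ∫ x, w k x * (pd k P x - pd k P (x - a)) = 0 := by
      simp only [ibp, Finset.sum_neg_distrib, neg_eq_zero]
      rw [← integral_finsetSum _ fun k _ => integrable_mul_of_memLp ((hw k).pd k).memL2 hq]
      simp only [← Finset.sum_mul, hdiv, zero_mul, integral_zero]
    rw [← sub_eq_zero, ← hz, ← Finset.sum_sub_distrib]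
    refine Finset.sum_congr rfl fun k _ => ?_
    rw [← integral_sub ((hw k).integrable_mul (hp k))
      (integrable_mul_of_memLp (hw k).memL2 (memLp_translate (hp k).memL2 a))]
    simp only [mul_sub]
  have hlim : Tendsto (fun n : ℕ => ∑ k, (nrm (indicator {x | (n : ℝ) < ‖x‖} (w k)) * nrm (pd k P)
      + nrm (w k) * nrm (indicator {x | (n : ℝ) < ‖x‖} (pd k P)))) atTop (𝓝 0) := by
    have : ∀ k ∈ Finset.univ, Tendsto (fun n : ℕ =>
        (nrm (indicator {x | (n : ℝ) < ‖x‖} (w k)) * nrm (pd k P)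
        + nrm (w k) * nrm (indicator {x | (n : ℝ) < ‖x‖} (pd k P)))) atTop (𝓝 0) := by
      intro k _
      have h1 := (tendsto_nrm_indicator (hw k).memL2).mul_const (nrm (pd k P))
      have h2 := (tendsto_nrm_indicator (hp k).memL2).const_mul (nrm (w k))
      simpa using h1.add h2
    simpa using tendsto_finsetSum Finset.univ this
  have hle : ∀ n : ℕ, |∑ k, ∫ x, w k x * pd k P x| ≤
      ∑ k, (nrm (indicator {x | (n : ℝ) < ‖x‖} (w k)) * nrm (pd k P)
      + nrm (w k) * nrm (indicator {x | (n : ℝ) < ‖x‖} (pd k P))) := by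
    intro n
    rw [key (2 * n + 1) (by positivity)]
    refine (Finset.abs_sum_le_sum_abs _ _).trans (Finset.sum_le_sum fun k _ => ?_)
    exact abs_integral_mul_translate_le (hw k).memL2 (hp k).memL2 n
  have := ge_of_tendsto' hlim hle
  exact abs_eq_zero.1 (le_antisymm this (abs_nonneg _))

/-! ### The `L²` norm as a seminorm -/

lemma nrm_eq_toReal {f : Plane → ℝ} (hf : MemLp f 2 volume) :
    nrm f = (eLpNorm f 2 volume).toReal := by
  rw [hf.eLpNorm_eq_integral_rpow_norm (by norm_num) (by norm_num),
    ENNReal.toReal_ofReal (by positivity), nrm, Real.sqrt_eq_rpow, sqn]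
  norm_num

lemma nrm_add_le {f g : Plane → ℝ} (hf : MemLp f 2 volume) (hg : MemLp g 2 volume) :
    nrm (fun x => f x + g x) ≤ nrm f + nrm g := by
  have h : (fun x => f x + g x) = f + g := rfl
  rw [nrm_eq_toReal hf, nrm_eq_toReal hg, h, nrm_eq_toReal (hf.add hg),
    ← ENNReal.toReal_add hf.2.ne hg.2.ne]
  exact ENNReal.toReal_mono (ENNReal.add_ne_top.2 ⟨hf.2.ne, hg.2.ne⟩)
    (eLpNorm_add_le hf.1 hg.1 (by norm_num))

lemma sqn_mul_le_of_bound {f g : Plane → ℝ} {C : ℝ} (hC : ∀ x, |f x| ≤ C)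
    (hg : MemLp g 2 volume) : sqn (fun x => f x * g x) ≤ C ^ 2 * sqn g := by
  rw [sqn, sqn, ← integral_const_mul]
  refine integral_mono_of_nonneg (ae_of_all _ fun x => sq_nonneg _)
    (hg.integrable_sq.const_mul _) (ae_of_all _ fun x => ?_)
  have h := hC x
  dsimp only
  rw [mul_pow, ← sq_abs (f x)]
  gcongr

lemma nrm_mul_le_of_bound {f g : Plane → ℝ} {C : ℝ} (hC0 : 0 ≤ C) (hC : ∀ x, |f x| ≤ C)
    (hg : MemLp g 2 volume) : nrm (fun x => f x * g x) ≤ C * nrm g := by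
  rw [nrm, nrm, ← Real.sqrt_sq hC0, ← Real.sqrt_mul (sq_nonneg _)]
  exact Real.sqrt_le_sqrt (sqn_mul_le_of_bound hC hg)

lemma nrm_neg (f : Plane → ℝ) : nrm (fun x => - f x) = nrm f := by simp [nrm, sqn]

lemma nrm_const_mul (c : ℝ) (f : Plane → ℝ) : nrm (fun x => c * f x) = |c| * nrm f := by
  simp only [nrm, sqn, mul_pow]
  rw [integral_const_mul, Real.sqrt_mul (sq_nonneg _), Real.sqrt_sq_eq_abs]

/-! ### Derivatives of functions on `[0,∞) × ℝ²` -/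

/-- The closed half-space `[0,∞) × ℝ²`. -/
def halfSpace : Set (ℝ × Plane) := Ici 0 ×ˢ univ

lemma uniqueDiffOn_halfSpace : UniqueDiffOn ℝ halfSpace :=
  (uniqueDiffOn_Ici 0).prod uniqueDiffOn_univ

lemma mem_halfSpace {t : ℝ} (ht : 0 ≤ t) (x : Plane) : (t, x) ∈ halfSpace := ⟨ht, mem_univ _⟩

/-- Smoothness up to the boundary `t = 0`. -/
def SmoothOn {F : Type*} [NormedAddCommGroup F] [NormedSpace ℝ F] (f : ℝ → Plane → F) : Prop :=
  ContDiffOn ℝ ∞ (fun q : ℝ × Plane => f q.1 q.2) halfSpace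

/-- The partial derivative `∂ᵢ` of a function of time and space. -/
def xd (i : Fin 2) (f : ℝ → Plane → ℝ) : ℝ → Plane → ℝ := fun t => pd i (f t)

namespace SmoothOn

section Vector

variable {F : Type*} [NormedAddCommGroup F] [NormedSpace ℝ F] {f : ℝ → Plane → F}

lemma hasFDerivWithinAt (hf : SmoothOn f) {t : ℝ} (ht : 0 ≤ t) (x : Plane) :
    HasFDerivWithinAt (fun q : ℝ × Plane => f q.1 q.2)
      (fderivWithin ℝ (fun q : ℝ × Plane => f q.1 q.2) halfSpace (t, x)) halfSpace (t, x) :=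
  ((hf.differentiableOn (by simp)) _ (mem_halfSpace ht x)).hasFDerivWithinAt

lemma hasDerivWithinAt' (hf : SmoothOn f) {t : ℝ} (ht : 0 ≤ t) (x : Plane) :
    HasDerivWithinAt (fun s => f s x)
      (fderivWithin ℝ (fun q : ℝ × Plane => f q.1 q.2) halfSpace (t, x) (1, 0)) (Ici 0) t := by
  have h1 : HasDerivWithinAt (fun s : ℝ => (s, x)) ((1 : ℝ), (0 : Plane)) (Ici 0) t :=
    (hasDerivWithinAt_id t _).prodMk (hasDerivWithinAt_const t _ x)
  exact (hf.hasFDerivWithinAt ht x).comp_hasDerivWithinAt t h1 fun s hs => mem_halfSpace hs x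

lemma dt_eq (hf : SmoothOn f) {t : ℝ} (ht : 0 ≤ t) (x : Plane) :
    dt f t x = fderivWithin ℝ (fun q : ℝ × Plane => f q.1 q.2) halfSpace (t, x) (1, 0) :=
  (hf.hasDerivWithinAt' ht x).derivWithin (uniqueDiffOn_Ici 0 t ht)

lemma hasDerivWithinAt (hf : SmoothOn f) {t : ℝ} (ht : 0 ≤ t) (x : Plane) :
    HasDerivWithinAt (fun s => f s x) (dt f t x) (Ici 0) t := by
  rw [hf.dt_eq ht]; exact hf.hasDerivWithinAt' ht x

lemma hasDerivAt (hf : SmoothOn f) {t : ℝ} (ht : 0 < t) (x : Plane) :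
    HasDerivAt (fun s => f s x) (dt f t x) t :=
  (hf.hasDerivWithinAt ht.le x).hasDerivAt (Ici_mem_nhds ht)

lemma slice (hf : SmoothOn f) {t : ℝ} (ht : 0 ≤ t) : ContDiff ℝ ∞ (f t) := by
  rw [← contDiffOn_univ]
  exact ContDiffOn.comp (t := halfSpace) (g := fun q : ℝ × Plane => f q.1 q.2)
    (f := fun x => (t, x)) hf (contDiff_prodMk_right t).contDiffOn fun x _ => mem_halfSpace ht x

lemma of_fderivWithin (hf : SmoothOn f) (v : ℝ × Plane) :
    ContDiffOn ℝ ∞ (fun q => fderivWithin ℝ (fun q : ℝ × Plane => f q.1 q.2) halfSpace q v)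
      halfSpace :=
  (ContDiffOn.fderivWithin hf uniqueDiffOn_halfSpace (by simp)).clm_apply contDiffOn_const

lemma dt (hf : SmoothOn f) : SmoothOn (dt f) :=
  (hf.of_fderivWithin (1, 0)).congr fun q hq => hf.dt_eq hq.1 q.2

lemma iter_dt (hf : SmoothOn f) (j : ℕ) : SmoothOn (INS2D.dt^[j] f) := by
  induction j with
  | zero => exact hf
  | succ j ih => rw [Function.iterate_succ_apply']; exact ih.dt

end Vector

variable {f g : ℝ → Plane → ℝ}

lemma xd_eq (hf : SmoothOn f) {t : ℝ} (ht : 0 ≤ t) (i : Fin 2) (x : Plane) :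
    xd i f t x
      = fderivWithin ℝ (fun q : ℝ × Plane => f q.1 q.2) halfSpace (t, x) (0, basisVec i) := by
  have h1 : HasFDerivWithinAt (fun x : Plane => (t, x)) (ContinuousLinearMap.inr ℝ ℝ Plane) univ x :=
    (hasFDerivAt_prodMk_right t x).hasFDerivWithinAt
  have := (hf.hasFDerivWithinAt ht x).comp x h1 fun y _ => mem_halfSpace ht y
  rw [hasFDerivWithinAt_univ] at this
  change fderiv ℝ (f t) x (basisVec i) = _
  rw [show f t = (fun q : ℝ × Plane => f q.1 q.2) ∘ (fun x : Plane => (t, x)) from rfl, this.fderiv]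
  simp

lemma xd (hf : SmoothOn f) (i : Fin 2) : SmoothOn (xd i f) :=
  (hf.of_fderivWithin (0, basisVec i)).congr fun q hq => hf.xd_eq hq.1 i q.2

lemma dt_xd (hf : SmoothOn f) (i : Fin 2) {t : ℝ} (ht : 0 ≤ t) (x : Plane) :
    INS2D.dt (INS2D.xd i f) t x = INS2D.xd i (INS2D.dt f) t x := by
  have hx := mem_halfSpace ht x
  set F := fun q : ℝ × Plane => f q.1 q.2
  have key : ∀ v w : ℝ × Plane, fderivWithin ℝ (fun q => fderivWithin ℝ F halfSpace q v)
      halfSpace (t, x) w = fderivWithin ℝ (fderivWithin ℝ F halfSpace) halfSpace (t, x) w v := by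
    intro v w
    have hd : DifferentiableWithinAt ℝ (fderivWithin ℝ F halfSpace) halfSpace (t, x) :=
      ((ContDiffOn.fderivWithin (m := ∞) hf uniqueDiffOn_halfSpace (by simp)).differentiableOn
        (by simp)) _ hx
    rw [fderivWithin_clm_apply (uniqueDiffOn_halfSpace _ hx) hd (differentiableWithinAt_const v)]
    simp
  rw [(hf.xd i).dt_eq ht, hf.dt.xd_eq ht]
  rw [fderivWithin_congr (f := fun q => fderivWithin ℝ F halfSpace q (0, basisVec i))
      (fun q hq => hf.xd_eq hq.1 i q.2) (hf.xd_eq ht i x),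
    fderivWithin_congr (f := fun q => fderivWithin ℝ F halfSpace q (1, 0))
      (fun q hq => hf.dt_eq hq.1 q.2) (hf.dt_eq ht x), key, key]
  have hcl : (t, x) ∈ closure (interior halfSpace) := by
    simp only [halfSpace, interior_prod_eq, interior_Ici, interior_univ, closure_prod_eq,
      closure_Ioi, closure_univ]
    exact hx
  have hs := (hf (t, x) hx).isSymmSndFDerivWithinAt (n := ∞) (by simp; exact WithTop.coe_le_coe.2 (le_top : (2 : ℕ∞) ≤ ⊤))
    uniqueDiffOn_halfSpace hcl hx
  exact hs.eq _ _

lemma add (hf : SmoothOn f) (hg : SmoothOn g) : SmoothOn fun t x => f t x + g t x :=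
  ContDiffOn.add hf hg

lemma mul (hf : SmoothOn f) (hg : SmoothOn g) : SmoothOn fun t x => f t x * g t x :=
  ContDiffOn.mul hf hg

lemma const (c : ℝ) : SmoothOn fun _ _ => c := contDiffOn_const

lemma dt_add (hf : SmoothOn f) (hg : SmoothOn g) {t : ℝ} (ht : 0 ≤ t) :
    INS2D.dt (fun t x => f t x + g t x) t = fun x => INS2D.dt f t x + INS2D.dt g t x :=
  funext fun x => ((hf.hasDerivWithinAt ht x).add (hg.hasDerivWithinAt ht x)).derivWithin
    (uniqueDiffOn_Ici 0 t ht)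

lemma dt_mul (hf : SmoothOn f) (hg : SmoothOn g) {t : ℝ} (ht : 0 ≤ t) :
    INS2D.dt (fun t x => f t x * g t x) t
      = fun x => INS2D.dt f t x * g t x + f t x * INS2D.dt g t x :=
  funext fun x => ((hf.hasDerivWithinAt ht x).mul (hg.hasDerivWithinAt ht x)).derivWithin
    (uniqueDiffOn_Ici 0 t ht)

lemma continuousOn (hf : SmoothOn f) : ContinuousOn (fun q : ℝ × Plane => f q.1 q.2) halfSpace :=
  ContDiffOn.continuousOn hf

end SmoothOn

lemma dt_congr {f g : ℝ → Plane → ℝ} (h : ∀ t, 0 ≤ t → f t = g t) {t : ℝ} (ht : 0 ≤ t) :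
    dt f t = dt g t := by
  funext x
  exact derivWithin_congr (fun s hs => congrFun (h s hs) x) (congrFun (h t ht) x)

lemma iter_dt_congr {f g : ℝ → Plane → ℝ} (h : ∀ t, 0 ≤ t → f t = g t) (j : ℕ) :
    ∀ t, 0 ≤ t → dt^[j] f t = dt^[j] g t := by
  induction j with
  | zero => exact h
  | succ j ih =>
    intro t ht
    rw [Function.iterate_succ_apply', Function.iterate_succ_apply']
    exact dt_congr ih ht

lemma iter_dt_add {f g : ℝ → Plane → ℝ} (hf : SmoothOn f) (hg : SmoothOn g) (j : ℕ) :
    ∀ t, 0 ≤ t → dt^[j] (fun t x => f t x + g t x) t = fun x => dt^[j] f t x + dt^[j] g t x := by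
  induction j with
  | zero => intro t _; rfl
  | succ j ih =>
    intro t ht
    simp only [Function.iterate_succ_apply']
    rw [dt_congr (g := fun t x => dt^[j] f t x + dt^[j] g t x) ih ht]
    exact (hf.iter_dt j).dt_add (hg.iter_dt j) ht

lemma iter_dt_xd {f : ℝ → Plane → ℝ} (hf : SmoothOn f) (i : Fin 2) (j : ℕ) :
    ∀ t, 0 ≤ t → dt^[j] (xd i f) t = pd i (dt^[j] f t) := by
  induction j with
  | zero => intro t _; rfl
  | succ j ih =>
    intro t ht
    simp only [Function.iterate_succ_apply']
    rw [dt_congr (g := xd i (dt^[j] f)) ih ht]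
    exact funext fun x => (hf.iter_dt j).dt_xd i ht x

lemma pdl_add {f g : Plane → ℝ} (hf : ContDiff ℝ ∞ f) (hg : ContDiff ℝ ∞ g) (l : List (Fin 2)) :
    pdl l (fun x => f x + g x) = fun x => pdl l f x + pdl l g x := by
  induction l with
  | nil => rfl
  | cons i l ih =>
    change pd i (pdl l _) = _
    rw [ih, pd_add ((pdl_smooth hf l).differentiable (by simp))
      ((pdl_smooth hg l).differentiable (by simp))]
    rfl

/-! ### Continuity in time with values in `L²` -/

/-- `f` is a continuous function of `t ∈ [0,∞)` with values in `L²(ℝ²)`. -/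
structure CL2 (f : ℝ → Plane → ℝ) : Prop where
  memLp : ∀ t, 0 ≤ t → MemLp (f t) 2 volume
  cont : ∀ t, 0 ≤ t → Tendsto (fun s => nrm (fun x => f s x - f t x)) (𝓝[Ici 0] t) (𝓝 0)

namespace CL2

variable {f g : ℝ → Plane → ℝ}

lemma congr (hf : CL2 f) (h : ∀ t, 0 ≤ t → g t = f t) : CL2 g := by
  refine ⟨fun t ht => h t ht ▸ hf.memLp t ht, fun t ht => (hf.cont t ht).congr' ?_⟩
  filter_upwards [self_mem_nhdsWithin] with s hs
  rw [h s hs, h t ht]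

lemma add (hf : CL2 f) (hg : CL2 g) : CL2 fun t x => f t x + g t x := by
  refine ⟨fun t ht => (hf.memLp t ht).add (hg.memLp t ht), fun t ht => ?_⟩
  refine squeeze_zero' (Eventually.of_forall fun _ => nrm_nonneg _) ?_
    (by simpa using (hf.cont t ht).add (hg.cont t ht))
  filter_upwards [self_mem_nhdsWithin] with s hs
  have := nrm_add_le ((hf.memLp s hs).sub (hf.memLp t ht)) ((hg.memLp s hs).sub (hg.memLp t ht))
  refine le_of_eq_of_le ?_ this
  congr 1
  funext x
  simp only [Pi.sub_apply]
  ring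

lemma nrm_tendsto (hf : CL2 f) {t : ℝ} (ht : 0 ≤ t) :
    Tendsto (fun s => nrm (f s)) (𝓝[Ici 0] t) (𝓝 (nrm (f t))) := by
  rw [tendsto_iff_norm_sub_tendsto_zero]
  refine squeeze_zero' (Eventually.of_forall fun _ => norm_nonneg _) ?_ (hf.cont t ht)
  filter_upwards [self_mem_nhdsWithin] with s hs
  have hs' := hf.memLp s hs
  have ht' := hf.memLp t ht
  have e1 := nrm_add_le (hs'.sub ht') ht'
  have e2 := nrm_add_le (ht'.sub hs') hs'
  have e3 : nrm (f t - f s) = nrm (f s - f t) := by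
    rw [← nrm_neg (f s - f t)]; congr 1; funext x; simp
  simp only [Pi.sub_apply, sub_add_cancel] at e1 e2
  rw [Real.norm_eq_abs, abs_le]
  have e4 : nrm (f s - f t) = nrm (fun x => f s x - f t x) := rfl
  constructor <;> linarith

lemma continuousOn_nrm (hf : CL2 f) : ContinuousOn (fun t => nrm (f t)) (Ici 0) :=
  fun _ ht => hf.nrm_tendsto ht

end CL2

/-! ### Smooth functions of time with values in `H^∞` -/

/-- Scalar functions that are smooth in time with values in every Sobolev space. -/
structure Sm (f : ℝ → Plane → ℝ) : Prop where
  smooth : SmoothOn f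
  cl2 : ∀ (j : ℕ) (l : List (Fin 2)), CL2 fun t => pdl l (dt^[j] f t)

namespace Sm

variable {f g : ℝ → Plane → ℝ}

lemma toCL2 (hf : Sm f) : CL2 f := hf.cl2 0 []

lemma hs (hf : Sm f) {t : ℝ} (ht : 0 ≤ t) : Hs (f t) :=
  ⟨hf.smooth.slice ht, fun l => (hf.cl2 0 l).memLp t ht⟩

lemma dt (hf : Sm f) : Sm (dt f) := ⟨hf.smooth.dt, fun j l => hf.cl2 (j + 1) l⟩

lemma xd (hf : Sm f) (i : Fin 2) : Sm (xd i f) := by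
  refine ⟨hf.smooth.xd i, fun j l => (hf.cl2 j (l ++ [i])).congr fun t ht => ?_⟩
  rw [iter_dt_xd hf.smooth i j t ht, pdl_pd]

lemma add (hf : Sm f) (hg : Sm g) : Sm fun t x => f t x + g t x := by
  refine ⟨hf.smooth.add hg.smooth, fun j l => ((hf.cl2 j l).add (hg.cl2 j l)).congr fun t ht => ?_⟩
  rw [iter_dt_add hf.smooth hg.smooth j t ht,
    pdl_add ((hf.smooth.iter_dt j).slice ht) ((hg.smooth.iter_dt j).slice ht)]

lemma tendsto_unif (hf : Sm f) {t : ℝ} (ht : 0 ≤ t) :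
    ∃ om : ℝ → ℝ, Tendsto om (𝓝[Ici 0] t) (𝓝 0) ∧ (∀ s, 0 ≤ om s) ∧
      ∀ s, 0 ≤ s → ∀ x, |f s x - f t x| ≤ om s := by
  let n : List (Fin 2) → ℝ → ℝ := fun l s => nrm (fun x => pdl l (f s) x - pdl l (f t) x)
  have hn : ∀ l, Tendsto (n l) (𝓝[Ici 0] t) (𝓝 0) := fun l => (hf.cl2 0 l).cont t ht
  refine ⟨fun s => Real.sqrt (2 * (n [0] s * n [1] s + n [] s * n [1, 0] s)), ?_,
    fun s => Real.sqrt_nonneg _, fun s hs x => ?_⟩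
  · have h := (((hn [0]).mul (hn [1])).add ((hn []).mul (hn [1, 0]))).const_mul 2
    have := (Real.continuous_sqrt.tendsto _).comp h
    simpa [Function.comp_def] using this
  · have hss := (hf.hs hs)
    have hts := (hf.hs ht)
    have e : ∀ (i : Fin 2) {F G : Plane → ℝ}, Hs F → Hs G →
        pd i (fun x => F x - G x) = fun x => pd i F x - pd i G x := by
      intro i F G hF hG
      funext x
      simp [pd, fderiv_fun_sub (hF.diff x) (hG.diff x)]
    have := (hss.sub hts).sq_le x
    rw [e 0 hss hts, e 1 hss hts, e 1 (hss.pd 0) (hts.pd 0)] at this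
    exact Real.abs_le_sqrt this

lemma cl2_mul (hf : Sm f) (hg : Sm g) : CL2 fun t x => f t x * g t x := by
  refine ⟨fun t ht => (hf.hs ht).memLp_mul (hg.hs ht), fun t ht => ?_⟩
  obtain ⟨om, hom, hom0, hb⟩ := hf.tendsto_unif ht
  obtain ⟨C, hC0, hC⟩ := (hf.hs ht).bounded
  have hlim := (hom.mul (hg.toCL2.nrm_tendsto ht)).add ((hg.toCL2.cont t ht).const_mul C)
  refine squeeze_zero' (Eventually.of_forall fun _ => nrm_nonneg _) ?_ (by simpa using hlim)
  filter_upwards [self_mem_nhdsWithin] with s hs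
  have hs1 := hf.hs hs
  have hs2 := hg.hs hs
  have hgt := hg.hs ht
  have hft := hf.hs ht
  have e1 := nrm_mul_le_of_bound (hom0 s) (hb s hs) hs2.memL2
  have e2 := nrm_mul_le_of_bound hC0 hC (hs2.sub hgt).memL2
  have e3 := nrm_add_le ((hs1.sub hft).memLp_mul hs2) (hft.memLp_mul (hs2.sub hgt))
  refine le_of_eq_of_le ?_ (e3.trans (add_le_add e1 e2))
  congr 1
  funext x
  ring

lemma mul (hf : Sm f) (hg : Sm g) : Sm fun t x => f t x * g t x := by
  refine ⟨hf.smooth.mul hg.smooth, fun j => ?_⟩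
  induction j generalizing f g with
  | zero =>
    intro l
    induction l using List.reverseRecOn generalizing f g with
    | nil => exact hf.cl2_mul hg
    | append_singleton l i ih =>
      refine ((ih (hf.xd i) hg).add (ih hf (hg.xd i))).congr fun t ht => ?_
      have h1 := hf.hs ht
      have h2 := hg.hs ht
      simp only [Function.iterate_zero_apply]
      rw [← pdl_pd, pd_mul h1.diff h2.diff,
        pdl_add ((h1.pd i).mul h2).smooth (h1.mul (h2.pd i)).smooth]
      rfl
  | succ j ih =>
    intro l
    refine ((ih hf.dt hg l).add (ih hf hg.dt l)).congr fun t ht => ?_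
    have h1 := hf.dt.smooth.mul hg.smooth
    have h2 := hf.smooth.mul hg.dt.smooth
    rw [Function.iterate_succ_apply,
      iter_dt_congr (fun t ht => hf.smooth.dt_mul hg.smooth ht) j t ht, iter_dt_add h1 h2 j t ht,
      pdl_add ((h1.iter_dt j).slice ht) ((h2.iter_dt j).slice ht)]

end Sm

lemma CL2.const_mul {f : ℝ → Plane → ℝ} (hf : CL2 f) (c : ℝ) : CL2 fun t x => c * f t x := by
  refine ⟨fun t ht => (hf.memLp t ht).const_mul c, fun t ht => ?_⟩
  have : (fun s => nrm fun x => c * f s x - c * f t x)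
      = fun s => |c| * nrm fun x => f s x - f t x := by
    funext s
    rw [← nrm_const_mul]; congr 1; funext x; ring
  rw [this]
  simpa using (hf.cont t ht).const_mul |c|

lemma pdl_const_mul {f : Plane → ℝ} (hf : ContDiff ℝ ∞ f) (c : ℝ) (l : List (Fin 2)) :
    pdl l (fun x => c * f x) = fun x => c * pdl l f x := by
  induction l with
  | nil => rfl
  | cons i l ih =>
    change pd i (pdl l _) = _
    rw [ih, pd_const_mul ((pdl_smooth hf l).differentiable (by simp))]
    rfl

namespace Sm

variable {f g : ℝ → Plane → ℝ}

lemma congr (hf : Sm f) (h : ∀ t, 0 ≤ t → g t = f t) : Sm g :=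
  ⟨ContDiffOn.congr hf.smooth fun q hq => congrFun (h q.1 hq.1) q.2,
    fun j l => (hf.cl2 j l).congr fun t ht => by rw [iter_dt_congr h j t ht]⟩

lemma zero : Sm fun _ _ => (0 : ℝ) := by
  have h1 : ∀ j : ℕ, INS2D.dt^[j] (fun (_ : ℝ) (_ : Plane) => (0 : ℝ)) = fun _ _ => 0 := by
    intro j
    induction j with
    | zero => rfl
    | succ j ih =>
      rw [Function.iterate_succ_apply', ih]
      funext t x
      simp [INS2D.dt]
  refine ⟨SmoothOn.const 0, fun j l => ?_⟩
  have h2 : (fun t : ℝ => pdl l (INS2D.dt^[j] (fun (_ : ℝ) (_ : Plane) => (0 : ℝ)) t))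
      = fun _ _ => 0 := by
    funext t
    rw [h1]
    induction l with
    | nil => rfl
    | cons i l ih => change pd i (pdl l _) = _; rw [ih]; funext x; simp [pd]
  rw [h2]
  exact ⟨fun t _ => MemLp.zero, fun t _ => by simpa [nrm, sqn] using tendsto_const_nhds⟩

lemma const_mul (hf : Sm f) (c : ℝ) : Sm fun t x => c * f t x := by
  have h1 : ∀ j t, 0 ≤ t →
      INS2D.dt^[j] (fun t x => c * f t x) t = fun x => c * INS2D.dt^[j] f t x := by
    intro j
    induction j with
    | zero => intro t _; rfl
    | succ j ih =>
      intro t ht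
      simp only [Function.iterate_succ_apply']
      rw [dt_congr ih ht]
      exact funext fun x => (((hf.smooth.iter_dt j).hasDerivWithinAt ht x).const_mul c).derivWithin
        (uniqueDiffOn_Ici 0 t ht)
  refine ⟨(SmoothOn.const c).mul hf.smooth,
    fun j l => ((hf.cl2 j l).const_mul c).congr fun t ht => ?_⟩
  rw [h1 j t ht, pdl_const_mul ((hf.smooth.iter_dt j).slice ht)]

lemma neg (hf : Sm f) : Sm fun t x => - f t x := by simpa using hf.const_mul (-1)

lemma sum {ι : Type*} (s : Finset ι) {F : ι → ℝ → Plane → ℝ} (h : ∀ i ∈ s, Sm (F i)) :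
    Sm (fun t x => ∑ i ∈ s, F i t x) := by
  classical
  induction s using Finset.induction_on with
  | empty => simpa using zero
  | insert a s ha ih =>
    simp only [Finset.sum_insert ha]
    exact (h a (by simp)).add (ih fun i hi => h i (by simp [hi]))

lemma sq (hf : Sm f) : Sm fun t x => f t x ^ 2 := by simpa [_root_.sq] using hf.mul hf

lemma pow (hf : Sm f) (n : ℕ) : Sm fun t x => f t x ^ (n + 1) := by
  induction n with
  | zero => simpa using hf
  | succ n ih => simpa [pow_succ (_ : ℝ) (n + 1)] using ih.mul hf

end Sm

/-! ### Time derivatives of inner products -/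

/-- The `L²` inner product as a function of time. -/
def ip (f g : ℝ → Plane → ℝ) (t : ℝ) : ℝ := ∫ x, f t x * g t x

lemma ip_comm (f g : ℝ → Plane → ℝ) (t : ℝ) : ip f g t = ip g f t := by simp only [ip, mul_comm]

lemma continuousOn_ip {f g : ℝ → Plane → ℝ} (hf : CL2 f) (hg : CL2 g) :
    ContinuousOn (ip f g) (Ici 0) := by
  intro t ht
  rw [ContinuousWithinAt, tendsto_iff_norm_sub_tendsto_zero]
  have hlim := ((hf.cont t ht).mul (hg.nrm_tendsto ht)).add
    ((hg.cont t ht).const_mul (nrm (f t)))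
  refine squeeze_zero' (Eventually.of_forall fun _ => norm_nonneg _) ?_ (by simpa using hlim)
  filter_upwards [self_mem_nhdsWithin] with s hs
  have h1 := abs_integral_mul_le ((hf.memLp s hs).sub (hf.memLp t ht)) (hg.memLp s hs)
  have h2 := abs_integral_mul_le (hf.memLp t ht) ((hg.memLp s hs).sub (hg.memLp t ht))
  have i1 := integrable_mul_of_memLp ((hf.memLp s hs).sub (hf.memLp t ht)) (hg.memLp s hs)
  have i2 := integrable_mul_of_memLp (hf.memLp t ht) ((hg.memLp s hs).sub (hg.memLp t ht))
  have e : ip f g s - ip f g t = (∫ x, (f s - f t) x * g s x) + ∫ x, f t x * (g s - g t) x := by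
    rw [← integral_add i1 i2, ip, ip, ← integral_sub
      (integrable_mul_of_memLp (hf.memLp s hs) (hg.memLp s hs))
      (integrable_mul_of_memLp (hf.memLp t ht) (hg.memLp t ht))]
    congr 1
    funext x
    simp only [Pi.sub_apply]
    ring
  rw [e, Real.norm_eq_abs]
  exact (abs_add_le _ _).trans (add_le_add h1 h2)

lemma aestronglyMeasurable_restrict {f : ℝ → Plane → ℝ}
    (hf : ContinuousOn (fun q : ℝ × Plane => f q.1 q.2) halfSpace) (a b : ℝ) (ha : 0 ≤ a) :
    AEStronglyMeasurable (fun q : ℝ × Plane => f q.1 q.2)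
      ((volume.restrict (Ioc a b)).prod volume) := by
  have e : (volume.restrict (Ioc a b)).prod (volume : Measure Plane)
      = (volume.prod volume).restrict (Ioc a b ×ˢ univ) := by
    rw [← Measure.prod_restrict, Measure.restrict_univ]
  rw [e]
  refine ContinuousOn.aestronglyMeasurable (hf.mono ?_) (measurableSet_Ioc.prod MeasurableSet.univ)
  exact fun q hq => ⟨ha.trans hq.1.1.le, mem_univ _⟩

lemma integrable_prod_mul {f g : ℝ → Plane → ℝ} (hf : SmoothOn f) (hg : SmoothOn g)
    (hf' : CL2 f) (hg' : CL2 g) {a b : ℝ} (ha : 0 ≤ a) :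
    Integrable (fun q : ℝ × Plane => f q.1 q.2 * g q.1 q.2)
      ((volume.restrict (Ioc a b)).prod volume) := by
  have hm := aestronglyMeasurable_restrict (f := fun t x => f t x * g t x)
    (hf.continuousOn.mul hg.continuousOn) a b ha
  rw [integrable_prod_iff hm]
  refine ⟨?_, ?_⟩
  · filter_upwards [ae_restrict_mem measurableSet_Ioc] with t ht
    exact integrable_mul_of_memLp (hf'.memLp t (ha.trans ht.1.le)) (hg'.memLp t (ha.trans ht.1.le))
  · have hc : ContinuousOn (fun t => nrm (f t) * nrm (g t)) (Icc a b) :=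
      (hf'.continuousOn_nrm.mul hg'.continuousOn_nrm).mono fun t ht => ha.trans ht.1
    have hint : Integrable (fun t => nrm (f t) * nrm (g t)) (volume.restrict (Ioc a b)) :=
      (hc.integrableOn_compact isCompact_Icc).mono_set Ioc_subset_Icc_self
    refine hint.mono' hm.norm.integral_prod_right' ?_
    filter_upwards [ae_restrict_mem measurableSet_Ioc] with t ht
    rw [Real.norm_eq_abs, abs_of_nonneg (integral_nonneg fun _ => norm_nonneg _)]
    exact integral_abs_mul_le (hf'.memLp t (ha.trans ht.1.le)) (hg'.memLp t (ha.trans ht.1.le))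

lemma hasDerivWithinAt_of_integral_eq {φ H : ℝ → ℝ} (hH : ContinuousOn H (Ici 0))
    (h : ∀ t, 0 ≤ t → φ t = φ 0 + ∫ s in (0 : ℝ)..t, H s) {t : ℝ} (ht : 0 ≤ t) :
    HasDerivWithinAt φ (H t) (Ici 0) t := by
  have hc : Continuous fun s => H (max s 0) :=
    hH.comp_continuous (by fun_prop) fun s => mem_Ici.2 (le_max_right _ _)
  have hd : HasDerivAt (fun t => φ 0 + ∫ s in (0 : ℝ)..t, H (max s 0)) (H (max t 0)) t :=
    (intervalIntegral.integral_hasDerivAt_right (hc.intervalIntegrable _ _)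
      hc.aestronglyMeasurable.stronglyMeasurableAtFilter hc.continuousAt).const_add _
  rw [max_eq_left ht] at hd
  have e : ∀ t ∈ Ici (0 : ℝ), φ t = φ 0 + ∫ s in (0 : ℝ)..t, H (max s 0) := by
    intro t ht
    rw [h t ht]
    congr 1
    refine intervalIntegral.integral_congr fun s hs => ?_
    rw [uIcc_of_le ht] at hs
    simp only [max_eq_left hs.1]
  exact hd.hasDerivWithinAt.congr e (e t ht)

lemma hasDerivWithinAt_ip {f g : ℝ → Plane → ℝ} (hf : Sm f) (hg : Sm g) {t : ℝ} (ht : 0 ≤ t) :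
    HasDerivWithinAt (ip f g) (ip (dt f) g t + ip f (dt g) t) (Ici 0) t := by
  have hH : ContinuousOn (fun t => ip (dt f) g t + ip f (dt g) t) (Ici 0) :=
    (continuousOn_ip hf.dt.toCL2 hg.toCL2).add (continuousOn_ip hf.toCL2 hg.dt.toCL2)
  refine hasDerivWithinAt_of_integral_eq (H := fun t => ip (dt f) g t + ip f (dt g) t) hH
    (fun b hb => ?_) ht
  have j1 := integrable_prod_mul hf.dt.smooth hg.smooth hf.dt.toCL2 hg.toCL2 (a := 0) (b := b) le_rfl
  have j2 := integrable_prod_mul hf.smooth hg.dt.smooth hf.toCL2 hg.dt.toCL2 (a := 0) (b := b) le_rfl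
  have j := j1.add j2
  have hpt : ∀ x, ∫ s in (0 : ℝ)..b, (dt f s x * g s x + f s x * dt g s x)
      = f b x * g b x - f 0 x * g 0 x := by
    intro x
    have hc : ∀ {F : ℝ → Plane → ℝ}, SmoothOn F → ContinuousOn (fun s => F s x) (Icc 0 b) := by
      intro F hF s hs
      exact ((hF.hasDerivWithinAt hs.1 x).continuousWithinAt).mono Icc_subset_Ici_self
    refine intervalIntegral.integral_eq_sub_of_hasDerivAt_of_le (f := fun s => f s x * g s x) hb
      ((hc hf.smooth).mul (hc hg.smooth)) (fun s hs => ?_) ?_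
    · exact (hf.smooth.hasDerivAt hs.1 x).mul (hg.smooth.hasDerivAt hs.1 x)
    · refine ContinuousOn.intervalIntegrable ?_
      rw [uIcc_of_le hb]
      exact ((hc hf.dt.smooth).mul (hc hg.smooth)).add ((hc hf.smooth).mul (hc hg.dt.smooth))
  have hswap := intervalIntegral_integral_swap (μ := (volume : Measure Plane)) (a := 0) (b := b)
    (f := fun s x => dt f s x * g s x + f s x * dt g s x) (by rw [uIoc_of_le hb]; exact j)
  have e1 : ∫ s in (0 : ℝ)..b, (ip (dt f) g s + ip f (dt g) s)
      = ∫ s in (0 : ℝ)..b, ∫ x, (dt f s x * g s x + f s x * dt g s x) := by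
    refine intervalIntegral.integral_congr fun s hs => ?_
    rw [uIcc_of_le hb] at hs
    rw [integral_add ((hf.dt.hs hs.1).integrable_mul (hg.hs hs.1))
      ((hf.hs hs.1).integrable_mul (hg.dt.hs hs.1))]
    rfl
  rw [e1, hswap]
  simp only [hpt]
  rw [integral_sub ((hf.hs hb).integrable_mul (hg.hs hb))
    ((hf.hs le_rfl).integrable_mul (hg.hs le_rfl))]
  simp only [ip]
  ring

/-! ### Components of Sobolev-valued functions -/

section Components

variable {F : Type*} [NormedAddCommGroup F] [NormedSpace ℝ F]

lemma pdl_clm_comp (L : F →L[ℝ] ℝ) (l : List (Fin 2)) :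
    ∃ v : Fin l.length → Plane, (∀ k, ‖v k‖ = 1) ∧ ∀ g : Plane → F, ContDiff ℝ ∞ g →
      pdl l (fun x => L (g x)) = fun x => L (iteratedFDeriv ℝ l.length g x v) := by
  induction l with
  | nil => exact ⟨fun k => k.elim0, fun k => k.elim0, fun g _ => by funext x; simp [pdl]⟩
  | cons i l ih =>
    obtain ⟨v, hv, h⟩ := ih
    refine ⟨Fin.cons (basisVec i) v, fun k => ?_, fun g hg => ?_⟩
    · refine Fin.cases ?_ (fun k => ?_) k
      · simpa using norm_basisVec i
      · simpa using hv k
    · change pd i (pdl l _) = _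
      rw [h g hg]
      funext x
      have hd : DifferentiableAt ℝ (iteratedFDeriv ℝ l.length g) x :=
        (hg.differentiable_iteratedFDeriv (by exact_mod_cast WithTop.coe_lt_top _)) x
      have hd2 : HasFDerivAt (fun y => iteratedFDeriv ℝ l.length g y v)
          ((ContinuousMultilinearMap.apply ℝ (fun _ : Fin l.length => Plane) F v).comp
            (fderiv ℝ (iteratedFDeriv ℝ l.length g) x)) x :=
        (ContinuousMultilinearMap.apply ℝ (fun _ : Fin l.length => Plane) F
          v).hasFDerivAt.comp x hd.hasFDerivAt
      have hd3 := L.hasFDerivAt.comp x hd2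
      unfold pd
      rw [show (fun x => L (iteratedFDeriv ℝ l.length g x v))
        = L ∘ fun y => iteratedFDeriv ℝ l.length g y v from rfl, hd3.fderiv]
      simp only [ContinuousLinearMap.comp_apply, ContinuousMultilinearMap.apply_apply,
        List.length_cons]
      rw [iteratedFDeriv_succ_apply_left]
      simp

lemma iter_dt_clm_comp (L : F →L[ℝ] ℝ) {f : ℝ → Plane → F} (hf : SmoothOn f) (j : ℕ) :
    ∀ t, 0 ≤ t → dt^[j] (fun t x => L (f t x)) t = fun x => L (dt^[j] f t x) := by
  induction j with
  | zero => intro t _; rfl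
  | succ j ih =>
    intro t ht
    simp only [Function.iterate_succ_apply']
    rw [dt_congr ih ht]
    funext x
    exact (L.hasFDerivAt.comp_hasDerivWithinAt t
      ((hf.iter_dt j).hasDerivWithinAt ht x)).derivWithin (uniqueDiffOn_Ici 0 t ht)

lemma SmoothInSobolev.sm {f : ℝ → Plane → F} (hf : SmoothInSobolev f) (L : F →L[ℝ] ℝ) :
    Sm fun t x => L (f t x) := by
  have hs : SmoothOn f := hf.contDiffOn
  have hLs : SmoothOn fun t x => L (f t x) := L.contDiff.comp_contDiffOn hf.contDiffOn
  refine ⟨hLs, fun j l => ?_⟩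
  obtain ⟨v, hv, h⟩ := pdl_clm_comp L l
  have e : ∀ t, 0 ≤ t → pdl l (dt^[j] (fun t x => L (f t x)) t)
      = fun x => L (iteratedFDeriv ℝ l.length (dt^[j] f t) x v) := by
    intro t ht
    rw [iter_dt_clm_comp L hs j t ht, h _ ((hs.iter_dt j).slice ht)]
  have hb : ∀ A : ContinuousMultilinearMap ℝ (fun _ : Fin l.length => Plane) F,
      ‖L (A v)‖ ≤ ‖L‖ * ‖A‖ := by
    intro A
    refine (L.le_opNorm _).trans (mul_le_mul_of_nonneg_left ?_ (norm_nonneg _))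
    have := A.le_opNorm v
    simpa [hv] using this
  have hmeas : ∀ t, 0 ≤ t → MemLp (pdl l (dt^[j] (fun t x => L (f t x)) t)) 2 volume := by
    intro t ht
    refine (hf.memLp j l.length t ht).of_le_mul (c := ‖L‖)
      (pdl_smooth ((hLs.iter_dt j).slice ht) l).continuous.aestronglyMeasurable
      (ae_of_all _ fun x => ?_)
    rw [e t ht]
    exact hb _
  refine ⟨hmeas, fun t ht => ?_⟩
  have hlim := hf.continuous_L2 j l.length t ht
  have hlim2 : Tendsto (fun s => (ENNReal.ofReal ‖L‖ * eLpNorm (fun x =>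
      iteratedFDeriv ℝ l.length (dt^[j] f s) x - iteratedFDeriv ℝ l.length (dt^[j] f t) x)
      2 volume).toReal) (𝓝[Ici 0] t) (𝓝 0) := by
    have := ENNReal.Tendsto.const_mul hlim (Or.inr (ENNReal.ofReal_ne_top (r := ‖L‖)))
    rw [mul_zero] at this
    exact (ENNReal.tendsto_toReal ENNReal.zero_ne_top).comp this
  refine squeeze_zero' (Eventually.of_forall fun _ => nrm_nonneg _) ?_ hlim2
  filter_upwards [self_mem_nhdsWithin] with s hs'
  have hsub := (hf.memLp j l.length s hs').sub (hf.memLp j l.length t ht)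
  rw [show (fun x => pdl l (dt^[j] (fun t x => L (f t x)) s) x
      - pdl l (dt^[j] (fun t x => L (f t x)) t) x)
    = pdl l (dt^[j] (fun t x => L (f t x)) s) - pdl l (dt^[j] (fun t x => L (f t x)) t) from rfl,
    nrm_eq_toReal ((hmeas s hs').sub (hmeas t ht))]
  refine ENNReal.toReal_mono (ENNReal.mul_ne_top ENNReal.ofReal_ne_top hsub.2.ne) ?_
  refine eLpNorm_le_mul_eLpNorm_of_ae_le_mul (ae_of_all _ fun x => ?_) 2
  rw [Pi.sub_apply, e s hs', e t ht]
  have := hb (iteratedFDeriv ℝ l.length (dt^[j] f s) x - iteratedFDeriv ℝ l.length (dt^[j] f t) x)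
  simpa using this

end Components

/-! ### Gaussian kernels -/

/-- The heat kernel at time one. -/
def gam (z : Plane) : ℝ := (4 * Real.pi)⁻¹ * Real.exp (-(1 / 4) * ‖z‖ ^ 2)

/-- Functions obtained from the heat kernel by multiplication with coordinates and linear
combinations. -/
inductive Ker : (Plane → ℝ) → Prop
  | gam : Ker gam
  | coord (i : Fin 2) {p : Plane → ℝ} : Ker p → Ker fun z => z i * p z
  | add {p q : Plane → ℝ} : Ker p → Ker q → Ker fun z => p z + q z
  | const_mul (c : ℝ) {p : Plane → ℝ} : Ker p → Ker fun z => c * p z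

lemma contDiff_coord (i : Fin 2) : ContDiff ℝ ∞ fun z : Plane => z i := by fun_prop

lemma pd_coord (i j : Fin 2) (z : Plane) :
    pd i (fun z : Plane => z j) z = if j = i then 1 else 0 := by
  have : (fun z : Plane => z j) = EuclideanSpace.proj (𝕜 := ℝ) j := rfl
  rw [pd, this, ContinuousLinearMap.fderiv]
  simp [basisVec]

lemma gam_smooth : ContDiff ℝ ∞ gam := by
  unfold gam
  exact contDiff_const.mul (Real.contDiff_exp.comp (contDiff_const.mul (contDiff_norm_sq ℝ)))

lemma pd_gam (i : Fin 2) : pd i gam = fun z => -(1 / 2) * (z i * gam z) := by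
  funext z
  have h1 : HasFDerivAt (fun z : Plane => ‖z‖ ^ 2) (2 • innerSL ℝ z) z :=
    (hasStrictFDerivAt_norm_sq z).hasFDerivAt
  have h2 := ((h1.const_mul (-(1 / 4))).exp).const_mul ((4 * Real.pi)⁻¹)
  unfold pd
  rw [show gam = fun z => (4 * Real.pi)⁻¹ * Real.exp (-(1 / 4) * ‖z‖ ^ 2) from rfl, h2.fderiv]
  simp [basisVec, EuclideanSpace.inner_single_right]
  ring

lemma Ker.smooth {p : Plane → ℝ} (hp : Ker p) : ContDiff ℝ ∞ p := by
  induction hp with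
  | gam => exact gam_smooth
  | coord i _ ih => exact (contDiff_coord i).mul ih
  | add _ _ ih1 ih2 => exact ih1.add ih2
  | const_mul c _ ih => exact contDiff_const.mul ih

lemma Ker.diff {p : Plane → ℝ} (hp : Ker p) : Differentiable ℝ p :=
  hp.smooth.differentiable (by simp)

lemma Ker.cont {p : Plane → ℝ} (hp : Ker p) : Continuous p := hp.smooth.continuous

lemma Ker.pd {p : Plane → ℝ} (hp : Ker p) (i : Fin 2) : Ker (pd i p) := by
  induction hp with
  | gam => rw [pd_gam]; exact (Ker.gam.coord i).const_mul _
  | @coord j p hp ih =>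
    rw [pd_mul ((contDiff_coord j).differentiable (by simp)) hp.diff]
    simp only [pd_coord]
    exact (hp.const_mul _).add (ih.coord j)
  | add h1 h2 ih1 ih2 => rw [pd_add h1.diff h2.diff]; exact ih1.add ih2
  | const_mul c h ih => rw [pd_const_mul h.diff]; exact ih.const_mul c

lemma le_exp_sq {δ : ℝ} (hδ : 0 < δ) (x : ℝ) : |x| ≤ (1 + δ⁻¹) * Real.exp (δ * x ^ 2) := by
  have h1 := Real.add_one_le_exp (δ * x ^ 2)
  have h2 : δ⁻¹ * Real.exp (δ * x ^ 2) ≥ δ⁻¹ * (δ * x ^ 2 + 1) := by gcongr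
  have h3 : δ⁻¹ * (δ * x ^ 2 + 1) = x ^ 2 + δ⁻¹ := by field_simp
  have h4 : (0 : ℝ) < δ⁻¹ := by positivity
  have h5 : 0 ≤ δ * x ^ 2 := by positivity
  nlinarith [sq_abs x, sq_nonneg (|x| - 1), abs_nonneg x]

lemma Ker.bound {p : Plane → ℝ} (hp : Ker p) :
    ∀ ε : ℝ, 0 < ε → ε < 1 / 4 → ∃ C, 0 ≤ C ∧ ∀ z, |p z| ≤ C * Real.exp (-ε * ‖z‖ ^ 2) := by
  induction hp with
  | gam =>
    intro ε h0 h1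
    refine ⟨(4 * Real.pi)⁻¹, by positivity, fun z => ?_⟩
    rw [INS2D.gam, abs_of_nonneg (by positivity)]
    gcongr
  | @coord i p hp ih =>
    intro ε h0 h1
    obtain ⟨C, hC0, hC⟩ := ih ((ε + 1 / 4) / 2) (by linarith) (by linarith)
    have hδ : 0 < (1 / 4 - ε) / 2 := by linarith
    refine ⟨(1 + ((1 / 4 - ε) / 2)⁻¹) * C, by positivity, fun z => ?_⟩
    rw [abs_mul]
    have hz : |z i| ≤ ‖z‖ := by simpa using PiLp.norm_apply_le z i
    have h2 := (hz.trans (le_abs_self _)).trans (le_exp_sq hδ ‖z‖)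
    calc |z i| * |p z| ≤ ((1 + ((1 / 4 - ε) / 2)⁻¹) * Real.exp ((1 / 4 - ε) / 2 * ‖z‖ ^ 2))
          * (C * Real.exp (-((ε + 1 / 4) / 2) * ‖z‖ ^ 2)) :=
          mul_le_mul h2 (hC z) (abs_nonneg _) (by positivity)
      _ = (1 + ((1 / 4 - ε) / 2)⁻¹) * C * (Real.exp ((1 / 4 - ε) / 2 * ‖z‖ ^ 2)
          * Real.exp (-((ε + 1 / 4) / 2) * ‖z‖ ^ 2)) := by ring
      _ = _ := by rw [← Real.exp_add]; congr 2; ring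
  | add _ _ ih1 ih2 =>
    intro ε h0 h1
    obtain ⟨C, hC0, hC⟩ := ih1 ε h0 h1
    obtain ⟨D, hD0, hD⟩ := ih2 ε h0 h1
    refine ⟨C + D, by positivity, fun z => (abs_add_le _ _).trans ?_⟩
    linarith [hC z, hD z]
  | const_mul c _ ih =>
    intro ε h0 h1
    obtain ⟨C, hC0, hC⟩ := ih ε h0 h1
    refine ⟨|c| * C, by positivity, fun z => ?_⟩
    rw [abs_mul, mul_assoc]
    exact mul_le_mul_of_nonneg_left (hC z) (abs_nonneg _)

lemma integral_exp_neg {b : ℝ} (hb : 0 < b) :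
    ∫ z : Plane, Real.exp (-b * ‖z‖ ^ 2) = Real.pi / b := by
  rw [GaussianFourier.integral_rexp_neg_mul_sq_norm hb]
  simp

lemma integrable_exp_neg {b : ℝ} (hb : 0 < b) :
    Integrable fun z : Plane => Real.exp (-b * ‖z‖ ^ 2) := by
  by_contra h
  have h1 := integral_undef h
  rw [integral_exp_neg hb] at h1
  have : 0 < Real.pi / b := by positivity
  linarith

lemma Ker.integrable {p : Plane → ℝ} (hp : Ker p) : Integrable p := by
  obtain ⟨C, -, hC⟩ := hp.bound (1 / 8) (by norm_num) (by norm_num)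
  exact ((integrable_exp_neg (by norm_num : (0 : ℝ) < 1 / 8)).const_mul C).mono'
    hp.cont.aestronglyMeasurable (ae_of_all _ hC)

lemma Ker.memL2 {p : Plane → ℝ} (hp : Ker p) : MemLp p 2 volume := by
  rw [memLp_two_iff_integrable_sq hp.cont.aestronglyMeasurable]
  obtain ⟨C, h0, hC⟩ := hp.bound (1 / 8) (by norm_num) (by norm_num)
  refine ((integrable_exp_neg (by norm_num : (0 : ℝ) < 1 / 8)).const_mul (C * C)).mono'
    (hp.cont.pow 2).aestronglyMeasurable (ae_of_all _ fun z => ?_)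
  rw [Real.norm_eq_abs, abs_pow, sq, mul_assoc]
  have h1 : |p z| ≤ C := (hC z).trans (by
    have : Real.exp (-(1 / 8) * ‖z‖ ^ 2) ≤ 1 := Real.exp_le_one_iff.2 (by nlinarith [sq_nonneg ‖z‖])
    nlinarith)
  exact mul_le_mul h1 (hC z) (abs_nonneg _) h0

lemma Ker.neg {p : Plane → ℝ} (hp : Ker p) : Ker fun z => - p z := by
  simpa using hp.const_mul (-1)

lemma Ker.sub {p q : Plane → ℝ} (hp : Ker p) (hq : Ker q) : Ker fun z => p z - q z := by
  simpa [sub_eq_add_neg] using hp.add hq.neg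

lemma gam_nonneg (z : Plane) : 0 ≤ gam z := by unfold gam; positivity

lemma integral_gam : ∫ z, gam z = 1 := by
  unfold gam
  rw [integral_const_mul, integral_exp_neg (by norm_num)]
  field_simp

lemma Ker.integral_pd {p : Plane → ℝ} (hp : Ker p) (i : Fin 2) : ∫ z, INS2D.pd i p z = 0 := by
  have := integral_mul_fderiv_eq_neg_fderiv_mul_of_integrable (μ := volume)
    (f := fun _ : Plane => (1 : ℝ)) (g := p) (v := basisVec i) (by simp)
    (by simp only [one_mul]; exact (hp.pd i).integrable) (by simpa using hp.integrable)
    (fun x _ => differentiableAt_const _) (fun x _ => hp.diff x)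
  simp only [one_mul, fderiv_fun_const, Pi.zero_apply, zero_apply, zero_mul,
    integral_zero, neg_zero] at this
  exact this

/-! ### Averages against scaled kernels -/

/-- The average `∫ p(z) f(x - r z) dz`. -/
def avg (r : ℝ) (p f : Plane → ℝ) (x : Plane) : ℝ := ∫ z, p z * f (x - r • z)

section Avg

variable {p q f g : Plane → ℝ}

lemma integrable_avg (hp : Ker p) (hf : Hs f) (r : ℝ) (x : Plane) :
    Integrable fun z => p z * f (x - r • z) := by
  obtain ⟨C, -, hC⟩ := hf.bounded
  have hc := hf.cont
  exact hp.integrable.mul_bdd (c := C) (Continuous.aestronglyMeasurable (by fun_prop))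
    (ae_of_all _ fun z => hC _)

lemma avg_pd (hp : Ker p) (hf : Hs f) (i : Fin 2) (r : ℝ) (x : Plane) :
    avg r (pd i p) f x = r * avg r p (pd i f) x := by
  have hd : ∀ z, HasFDerivAt (fun z => f (x - r • z))
      ((fderiv ℝ f (x - r • z)).comp (-(r • ContinuousLinearMap.id ℝ Plane))) z := by
    intro z
    have h1 : HasFDerivAt (fun z : Plane => x - r • z) (-(r • ContinuousLinearMap.id ℝ Plane)) z := by
      simpa using ((hasFDerivAt_id z).const_smul r).const_sub x
    exact (hf.diff _).hasFDerivAt.comp z h1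
  have e : ∀ z, fderiv ℝ (fun z => f (x - r • z)) z (basisVec i) = - r * pd i f (x - r • z) := by
    intro z
    rw [(hd z).fderiv]
    simp [pd]
  have i1 := integrable_avg (hp.pd i) hf r x
  have i2 := integrable_avg hp (hf.pd i) r x
  have := integral_mul_fderiv_eq_neg_fderiv_mul_of_integrable (μ := volume)
    (f := p) (g := fun z => f (x - r • z)) (v := basisVec i) i1
    (by simp only [e]; simpa [mul_comm, mul_left_comm] using i2.const_mul (-r))
    (integrable_avg hp hf r x) (fun z _ => hp.diff z) (fun z _ => (hd z).differentiableAt)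
  simp only [e] at this
  have e2 : ∫ z, p z * (-r * pd i f (x - r • z)) = -r * avg r p (pd i f) x := by
    rw [avg, ← integral_const_mul]; congr 1; funext z; ring
  rw [e2] at this
  have e3 : avg r (pd i p) f x = ∫ z, fderiv ℝ p z (basisVec i) * f (x - r • z) := rfl
  rw [e3]
  linarith

lemma avg_add_left (hp : Ker p) (hq : Ker q) (hf : Hs f) (r : ℝ) (x : Plane) :
    avg r (fun z => p z + q z) f x = avg r p f x + avg r q f x := by
  simp only [avg, add_mul]
  exact integral_add (integrable_avg hp hf r x) (integrable_avg hq hf r x)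

lemma avg_add_right (hp : Ker p) (hf : Hs f) (hg : Hs g) (r : ℝ) (x : Plane) :
    avg r p (fun y => f y + g y) x = avg r p f x + avg r p g x := by
  simp only [avg, mul_add]
  exact integral_add (integrable_avg hp hf r x) (integrable_avg hp hg r x)

lemma avg_sub_right (hp : Ker p) (hf : Hs f) (hg : Hs g) (r : ℝ) (x : Plane) :
    avg r p (fun y => f y - g y) x = avg r p f x - avg r p g x := by
  simp only [avg, mul_sub]
  exact integral_sub (integrable_avg hp hf r x) (integrable_avg hp hg r x)

lemma avg_const_mul_left (c : ℝ) (r : ℝ) (x : Plane) :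
    avg r (fun z => c * p z) f x = c * avg r p f x := by
  simp only [avg, mul_assoc, integral_const_mul]

lemma avg_sum_right (hp : Ker p) {F : Fin 2 → Plane → ℝ} (hF : ∀ i, Hs (F i)) (r : ℝ) (x : Plane) :
    avg r p (fun y => ∑ i, F i y) x = ∑ i, avg r p (F i) x := by
  simp only [Fin.sum_univ_two]
  exact avg_add_right hp (hF 0) (hF 1) r x

lemma fderiv_apply_eq_sum (f : Plane → ℝ) (x v : Plane) :
    fderiv ℝ f x v = ∑ i, v i * pd i f x := by
  have hv : v = ∑ i, v i • basisVec i := by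
    ext j
    fin_cases j <;> simp [basisVec]
  conv_lhs => rw [hv, map_sum]
  simp [pd]

lemma hasDerivAt_avg (hp : Ker p) (hf : Hs f) (r : ℝ) (x : Plane) :
    HasDerivAt (fun r => avg r p f x) (- ∑ i, avg r (fun z => z i * p z) (pd i f) x) r := by
  have hd : ∀ (z : Plane) (r : ℝ), HasDerivAt (fun r => p z * f (x - r • z))
      (- ∑ i, z i * p z * pd i f (x - r • z)) r := by
    intro z r
    have h1 : HasDerivAt (fun r : ℝ => x - r • z) (-z) r := by
      simpa using ((hasDerivAt_id r).smul_const z).const_sub x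
    have h2 := ((hf.diff (x - r • z)).hasFDerivAt.comp_hasDerivAt r h1).const_mul (p z)
    have e : p z * fderiv ℝ f (x - r • z) (-z) = - ∑ i, z i * p z * pd i f (x - r • z) := by
      rw [map_neg, fderiv_apply_eq_sum, mul_neg, Finset.mul_sum]
      congr 1
      exact Finset.sum_congr rfl fun i _ => by ring
    rw [← e]
    exact h2
  choose C hC0 hC using fun i => (hf.pd i).bounded
  have hint : ∀ i, Integrable fun z : Plane => z i * p z * pd i f (x - r • z) := fun i =>
    integrable_avg (hp.coord i) (hf.pd i) r x
  have hm : ∀ i, Continuous fun z : Plane => z i * p z * pd i f (x - r • z) := fun i => by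
    have := (hf.pd i).cont
    have := hp.cont
    fun_prop
  have := (hasDerivAt_integral_of_dominated_loc_of_deriv_le (μ := volume) (x₀ := r)
    (F := fun r z => p z * f (x - r • z))
    (F' := fun r z => - ∑ i, z i * p z * pd i f (x - r • z)) (s := univ)
    (bound := fun z => ∑ i, |z i * p z| * C i) univ_mem
    (Eventually.of_forall fun r => (integrable_avg hp hf r x).1) (integrable_avg hp hf r x)
    (Continuous.aestronglyMeasurable (by simp only [Fin.sum_univ_two]; exact ((hm 0).add (hm 1)).neg))
    (ae_of_all _ fun z r _ => ?_)
    (integrable_finsetSum _ fun i _ => ((hp.coord i).integrable.abs).mul_const _)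
    (ae_of_all _ fun z r _ => hd z r)).2
  · rw [integral_neg, integral_finsetSum _ fun i _ => hint i] at this
    exact this
  · rw [norm_neg]
    refine (norm_sum_le _ _).trans (Finset.sum_le_sum fun i _ => ?_)
    rw [Real.norm_eq_abs, abs_mul]
    exact mul_le_mul_of_nonneg_left (hC i _) (abs_nonneg _)

lemma sqn_scale (f : Plane → ℝ) (x : Plane) {r : ℝ} (hr : 0 < r) :
    sqn (fun z => f (x - r • z)) = (r ^ 2)⁻¹ * sqn f := by
  have h1 := Measure.integral_comp_smul (volume : Measure Plane) (fun y => f (x - y) ^ 2) r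
  rw [finrank_euclideanSpace, Fintype.card_fin, abs_of_nonneg (by positivity), smul_eq_mul] at h1
  rw [sqn, h1, sqn]
  congr 1
  exact integral_sub_left_eq_self (fun y => f y ^ 2) volume x

lemma nrm_scale (f : Plane → ℝ) (x : Plane) {r : ℝ} (hr : 0 < r) :
    nrm (fun z => f (x - r • z)) = r⁻¹ * nrm f := by
  rw [nrm, sqn_scale f x hr, Real.sqrt_mul (by positivity), nrm, Real.sqrt_inv,
    Real.sqrt_sq hr.le]

lemma memLp_scale (hf : Hs f) (x : Plane) {r : ℝ} (hr : 0 < r) :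
    MemLp (fun z => f (x - r • z)) 2 volume := by
  have hc := hf.cont
  rw [memLp_two_iff_integrable_sq (Continuous.aestronglyMeasurable (by fun_prop))]
  have h2 : Integrable (fun y => f (x - y) ^ 2) := hf.integrable_sq.comp_sub_left x
  exact h2.comp_smul hr.ne'

lemma abs_avg_le (hp : MemLp p 2 volume) (hf : Hs f) (x : Plane) {r : ℝ} (hr : 0 < r) :
    |avg r p f x| ≤ nrm p * (r⁻¹ * nrm f) := by
  rw [← nrm_scale f x hr]
  exact abs_integral_mul_le hp (memLp_scale hf x hr)

lemma abs_avg_le_four (hp : Ker p) (hf : Hs f) (x : Plane) {r : ℝ} (hr : 0 < r) :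
    |avg r p f x| ≤ Real.sqrt ((∫ z, |p z|) * (nrm p * (r⁻¹ * nrm (fun y => f y ^ 2)))) := by
  have hc := hf.cont
  have hpc := hp.cont
  have h1 : MemLp (fun z => Real.sqrt |p z|) 2 volume := by
    rw [memLp_two_iff_integrable_sq (Continuous.aestronglyMeasurable (by fun_prop))]
    simpa [Real.sq_sqrt] using hp.integrable.abs
  have h2 : MemLp (fun z => Real.sqrt |p z| * |f (x - r • z)|) 2 volume := by
    rw [memLp_two_iff_integrable_sq (Continuous.aestronglyMeasurable (by fun_prop))]
    have := (integrable_avg hp hf.sq r x).abs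
    simpa [mul_pow, Real.sq_sqrt, abs_mul] using this
  have h3 := abs_integral_mul_le h1 h2
  have e1 : ∀ z, Real.sqrt |p z| * (Real.sqrt |p z| * |f (x - r • z)|) = |p z * f (x - r • z)| := by
    intro z
    rw [← mul_assoc, Real.mul_self_sqrt (abs_nonneg _), abs_mul]
  simp only [e1] at h3
  have e2 : |avg r p f x| ≤ |∫ z, (|p z * f (x - r • z)|)| :=
    abs_integral_le_integral_abs.trans (le_abs_self _)
  refine (e2.trans h3).trans ?_
  rw [nrm, nrm, ← Real.sqrt_mul (sqn_nonneg _)]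
  refine Real.sqrt_le_sqrt ?_
  have e3 : sqn (fun z => Real.sqrt |p z|) = ∫ z, |p z| := by
    simp [sqn, Real.sq_sqrt]
  have e4 : sqn (fun z => Real.sqrt |p z| * |f (x - r • z)|) = ∫ z, |p z * f (x - r • z) ^ 2| := by
    simp [sqn, mul_pow, Real.sq_sqrt, abs_mul]
  rw [e3, e4]
  refine mul_le_mul_of_nonneg_left ?_ (integral_nonneg fun _ => abs_nonneg _)
  rw [← nrm_scale (fun y => f y ^ 2) x hr]
  exact integral_abs_mul_le hp.memL2 (memLp_scale hf.sq x hr)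

end Avg

/-! ### The Laplacian and the Stokes system -/

/-- The Laplacian. -/
def lap (f : Plane → ℝ) : Plane → ℝ := fun x => ∑ i, pd i (pd i f) x

/-- The square of the `L²` norm of the Hessian. -/
def hsq (f : Plane → ℝ) : ℝ := ∑ i, ∑ j, sqn (pd i (pd j f))

lemma Hs.lap {f : Plane → ℝ} (hf : Hs f) : Hs (lap f) :=
  Hs.sum _ fun i _ => (hf.pd i).pd i

lemma pd_sum {ι : Type*} (s : Finset ι) {F : ι → Plane → ℝ} (h : ∀ i ∈ s, Differentiable ℝ (F i))
    (j : Fin 2) : pd j (fun x => ∑ i ∈ s, F i x) = fun x => ∑ i ∈ s, pd j (F i) x := by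
  funext x
  simp only [pd]
  rw [fderiv_fun_sum fun i hi => h i hi x]
  simp

lemma pd_const (c : ℝ) (i : Fin 2) : pd i (fun _ => c) = fun _ => 0 := by
  funext x; simp [pd]

lemma pd_lap {f : Plane → ℝ} (hf : ContDiff ℝ ∞ f) (j : Fin 2) : pd j (lap f) = lap (pd j f) := by
  have h : ∀ i, ContDiff ℝ ∞ (pd i f) := pd_contDiff hf
  unfold lap
  rw [pd_sum _ fun i _ => (pd_contDiff (h i) i).differentiable (by simp)]
  funext x
  refine Finset.sum_congr rfl fun i _ => ?_
  rw [pd_comm (h i) j i, pd_comm hf j i]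

lemma Hs.sqn_lap {f : Plane → ℝ} (hf : Hs f) : sqn (INS2D.lap f) = hsq f := by
  have e : ∀ i j, ∫ x, INS2D.pd i (INS2D.pd i f) x * INS2D.pd j (INS2D.pd j f) x
      = sqn (INS2D.pd i (INS2D.pd j f)) := by
    intro i j
    have hi := hf.pd i
    have hj := hf.pd j
    have hij := hj.pd i
    have h1 := (hj.pd j).integral_mul_pd hi i
    have h2 := hij.integral_mul_pd hi j
    have e1 : INS2D.pd i (INS2D.pd j (INS2D.pd j f)) = INS2D.pd j (INS2D.pd i (INS2D.pd j f)) :=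
      pd_comm hj.smooth i j
    have e2 : INS2D.pd j (INS2D.pd i f) = INS2D.pd i (INS2D.pd j f) := pd_comm hf.smooth j i
    rw [e1] at h1
    rw [e2] at h2
    simp only [mul_comm (INS2D.pd i (INS2D.pd i f) _)]
    rw [h1, ← h2, sqn]
    simp only [_root_.sq]
  have : sqn (INS2D.lap f)
      = ∫ x, ∑ i, ∑ j, INS2D.pd i (INS2D.pd i f) x * INS2D.pd j (INS2D.pd j f) x := by
    simp only [sqn, INS2D.lap]
    congr 1
    funext x
    rw [_root_.sq, Finset.sum_mul_sum]
  have hint : ∀ i j, Integrable fun x =>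
      INS2D.pd i (INS2D.pd i f) x * INS2D.pd j (INS2D.pd j f) x :=
    fun i j => ((hf.pd i).pd i).integrable_mul ((hf.pd j).pd j)
  rw [this, integral_finsetSum _ fun i _ => integrable_finsetSum _ fun j _ => hint i j]
  refine Finset.sum_congr rfl fun i _ => ?_
  rw [integral_finsetSum _ fun j _ => hint i j]
  exact Finset.sum_congr rfl fun j _ => e i j

/-- A solution of the stationary Stokes system with right-hand side `F`. -/
structure IsStokes (u : Fin 2 → Plane → ℝ) (P : Plane → ℝ) (F : Fin 2 → Plane → ℝ) : Prop where
  hu : ∀ k, Hs (u k)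
  hP : ContDiff ℝ ∞ P
  hp : ∀ k, Hs (pd k P)
  hF : ∀ k, Hs (F k)
  div : ∀ x, ∑ i, pd i (u i) x = 0
  eq : ∀ k x, - lap (u k) x + pd k P x = F k x

namespace IsStokes

variable {u F : Fin 2 → Plane → ℝ} {P : Plane → ℝ}

lemma div_lap (h : IsStokes u P F) (x : Plane) : ∑ i, pd i (lap (u i)) x = 0 := by
  have e : (fun x => ∑ i, pd i (u i) x) = fun _ => 0 := funext h.div
  have h2 : lap (fun x => ∑ i, pd i (u i) x) x = ∑ i, pd i (lap (u i)) x := by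
    simp only [pd_lap (h.hu _).smooth, lap]
    rw [Finset.sum_comm]
    refine Finset.sum_congr rfl fun j _ => ?_
    rw [pd_sum _ fun i _ => ((h.hu i).pd i).diff,
      pd_sum _ fun i _ => (((h.hu i).pd i).pd j).diff]
  rw [← h2, e]
  simp [lap, pd_const]

lemma energy (h : IsStokes u P F) :
    ∑ k, hsq (u k) + ∑ k, sqn (pd k P) = ∑ k, sqn (F k) := by
  have h0 := sum_integral_mul_pd_eq_zero (fun k => (h.hu k).lap) h.div_lap h.hP h.hp
  have e : ∀ k, sqn (F k) = sqn (lap (u k)) + sqn (pd k P) - 2 * ∫ x, lap (u k) x * pd k P x := by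
    intro k
    have i1 := (h.hu k).lap.integrable_sq
    have i2 := (h.hp k).integrable_sq
    have i3 := (h.hu k).lap.integrable_mul (h.hp k)
    have i12 : Integrable fun x => lap (u k) x ^ 2 + pd k P x ^ 2 := i1.add i2
    rw [sqn, sqn, sqn, ← integral_add i1 i2, ← integral_const_mul,
      ← integral_sub i12 (i3.const_mul 2)]
    congr 1
    funext x
    rw [← h.eq k x]
    ring
  simp only [e, Finset.sum_sub_distrib, Finset.sum_add_distrib, ← Finset.mul_sum, h0,
    fun k => (h.hu k).sqn_lap]
  ring

end IsStokes

/-! ### A pointwise bound for the velocity gradient -/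

lemma lap_gam : lap gam = fun z => -1 * gam z + 1 / 4 * (z 0 * (z 0 * gam z))
    + 1 / 4 * (z 1 * (z 1 * gam z)) := by
  funext z
  have hd : ∀ i : Fin 2, Differentiable ℝ fun z : Plane => z i := fun i =>
    (contDiff_coord i).differentiable (by simp)
  simp only [lap, pd_gam]
  have : ∀ i, pd i (fun z => -(1 / 2) * (z i * gam z)) z
      = -(1 / 2) * (gam z + z i * (-(1 / 2) * (z i * gam z))) := by
    intro i
    rw [pd_const_mul ((Ker.gam.coord i).diff), pd_mul (hd i) Ker.gam.diff, pd_gam]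
    simp [pd_coord]
  simp only [this, Fin.sum_univ_two]
  ring

lemma ker_lap_gam : Ker (lap gam) := by
  rw [lap_gam]
  exact ((Ker.gam.const_mul _).add (((Ker.gam.coord 0).coord 0).const_mul _)).add
    (((Ker.gam.coord 1).coord 1).const_mul _)

lemma coord_mul_gam_sub_lap_gam (i : Fin 2) (z : Plane) :
    z i * (gam z - lap gam z) = 2 * pd i (lap gam) z := by
  have hd : ∀ i : Fin 2, Differentiable ℝ fun z : Plane => z i := fun i =>
    (contDiff_coord i).differentiable (by simp)
  have k : ∀ j : Fin 2, Ker fun z => z j * (z j * gam z) := fun j => (Ker.gam.coord j).coord j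
  rw [lap_gam, pd_add ((Ker.gam.const_mul _).add ((k 0).const_mul _)).diff
    ((k 1).const_mul _).diff, pd_add (Ker.gam.const_mul _).diff ((k 0).const_mul _).diff,
    pd_const_mul Ker.gam.diff, pd_const_mul (k 0).diff, pd_const_mul (k 1).diff,
    pd_mul (hd 0) (Ker.gam.coord 0).diff, pd_mul (hd 1) (Ker.gam.coord 1).diff,
    pd_mul (hd 0) Ker.gam.diff, pd_mul (hd 1) Ker.gam.diff, pd_gam]
  simp only [pd_coord]
  fin_cases i <;> simp <;> ring

lemma avg_stokes {u F : Fin 2 → Plane → ℝ} {P : Plane → ℝ} (h : IsStokes u P F) (j k : Fin 2)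
    (r : ℝ) (x : Plane) :
    ∑ i, avg r (pd i (lap gam)) (pd i (pd j (u k))) x
      = ∑ l, avg r (pd j (pd k (pd l gam))) (F l) x
        - ∑ l, avg r (pd j (pd l (pd l gam))) (F k) x := by
  have kg := Ker.gam
  have kl := ker_lap_gam
  have huk := h.hu k
  have sumleft : ∀ {f : Plane → ℝ}, Hs f →
      avg r (pd j (lap gam)) f x = ∑ l, avg r (pd j (pd l (pd l gam))) f x := by
    intro f hf
    have : pd j (lap gam) = fun z => pd j (pd 0 (pd 0 gam)) z + pd j (pd 1 (pd 1 gam)) z := by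
      unfold lap
      rw [pd_sum _ fun i _ => ((kg.pd i).pd i).diff]
      simp only [Fin.sum_univ_two]
    rw [this, avg_add_left (((kg.pd 0).pd 0).pd j) (((kg.pd 1).pd 1).pd j) hf]
    simp only [Fin.sum_univ_two]
  have s1 : ∑ i, avg r (pd i (lap gam)) (pd i (pd j (u k))) x = avg r (pd j (lap gam)) (lap (u k)) x := by
    simp only [avg_pd kl ((huk.pd j).pd _) _ r x]
    rw [avg_pd kl huk.lap j r x, ← Finset.mul_sum,
      ← avg_sum_right kl fun i => ((huk.pd j).pd i).pd i]
    have : (fun y => ∑ i, pd i (pd i (pd j (u k))) y) = pd j (lap (u k)) := by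
      rw [pd_lap huk.smooth]; rfl
    rw [this]
  have s2 : lap (u k) = fun y => pd k P y - F k y := by
    funext y; rw [← h.eq k y]; ring
  have s3 : avg r (pd j (lap gam)) (pd k P) x = ∑ l, avg r (pd j (pd k (pd l gam))) (pd l P) x := by
    rw [sumleft (h.hp k)]
    refine Finset.sum_congr rfl fun l _ => ?_
    rw [pd_comm (kg.pd l).smooth j l,
      avg_pd ((kg.pd l).pd j) (h.hp k) l r x, pd_comm h.hP l k,
      ← avg_pd ((kg.pd l).pd j) (h.hp l) k r x, pd_comm (kg.pd l).smooth k j]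
  have s4 : ∑ l, avg r (pd j (pd k (pd l gam))) (lap (u l)) x = 0 := by
    have e : ∀ l, avg r (pd j (pd k (pd l gam))) (lap (u l)) x
        = r * avg r (pd j (pd k gam)) (pd l (lap (u l))) x := by
      intro l
      rw [← avg_pd ((kg.pd k).pd j) (h.hu l).lap l r x, pd_comm kg.smooth k l,
        pd_comm (kg.pd k).smooth j l]
    simp only [e]
    rw [← Finset.mul_sum, ← avg_sum_right ((kg.pd k).pd j) fun l => (h.hu l).lap.pd l]
    simp only [h.div_lap, avg, mul_zero, integral_zero]
  have s5 : ∀ l, avg r (pd j (pd k (pd l gam))) (pd l P) x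
      = avg r (pd j (pd k (pd l gam))) (F l) x + avg r (pd j (pd k (pd l gam))) (lap (u l)) x := by
    intro l
    rw [← avg_add_right (((kg.pd l).pd k).pd j) (h.hF l) (h.hu l).lap]
    congr 1
    funext y
    rw [← h.eq l y]; ring
  rw [s1, s2, avg_sub_right (kl.pd j) (h.hp k) (h.hF k), s3, sumleft (h.hF k)]
  simp only [s5, Finset.sum_add_distrib, s4, add_zero]

lemma abs_sub_le_of_deriv_le_inv_sqrt {ψ ψ' : ℝ → ℝ} {M r : ℝ} (hr : 0 < r)
    (hd : ∀ s, HasDerivAt ψ (ψ' s) s) (hb : ∀ s, 0 < s → |ψ' s| ≤ M * Real.sqrt s⁻¹) :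
    |ψ r - ψ 0| ≤ 2 * M * Real.sqrt r := by
  have key : ∀ φ φ' : ℝ → ℝ, (∀ s, HasDerivAt φ (φ' s) s) →
      (∀ s, 0 < s → φ' s ≤ M * Real.sqrt s⁻¹) → φ r - φ 0 ≤ 2 * M * Real.sqrt r := by
    intro φ φ' h1 h2
    have hm : MonotoneOn (fun s => 2 * M * Real.sqrt s - φ s) (Icc 0 r) := by
      refine monotoneOn_of_hasDerivWithinAt_nonneg (f' := fun s => 2 * M * (1 / (2 * Real.sqrt s)) - φ' s)
        (convex_Icc 0 r) ?_ ?_ ?_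
      · exact ((continuous_const.mul Real.continuous_sqrt).sub
          (continuous_iff_continuousAt.2 fun s => (h1 s).continuousAt)).continuousOn
      · intro s hs
        rw [interior_Icc] at hs
        exact (((Real.hasDerivAt_sqrt hs.1.ne').const_mul (2 * M)).sub (h1 s)).hasDerivWithinAt
      · intro s hs
        rw [interior_Icc] at hs
        have h3 := h2 s hs.1
        rw [Real.sqrt_inv] at h3
        have : 2 * M * (1 / (2 * Real.sqrt s)) = M * (Real.sqrt s)⁻¹ := by
          have := Real.sqrt_pos.2 hs.1
          field_simp
        rw [this]
        linarith
    have := hm ⟨le_rfl, hr.le⟩ ⟨hr.le, le_rfl⟩ hr.le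
    simp only [Real.sqrt_zero, mul_zero, zero_sub] at this
    linarith
  rw [abs_le]
  constructor
  · have := key (fun s => - ψ s) (fun s => - ψ' s) (fun s => (hd s).neg)
      fun s hs => (neg_le_abs _).trans (hb s hs)
    linarith
  · exact key ψ ψ' hd fun s hs => (le_abs_self _).trans (hb s hs)

theorem exists_abs_pd_le_of_stokes : ∃ C : ℝ, 0 < C ∧
    ∀ (u F : Fin 2 → Plane → ℝ) (P : Plane → ℝ), IsStokes u P F →
    ∀ (j k : Fin 2) (x : Plane) (r : ℝ), 0 < r →
      |pd j (u k) x| ≤ C * (r⁻¹ * nrm (pd j (u k))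
        + Real.sqrt r * ∑ l, Real.sqrt (nrm (fun y => F l y ^ 2))) := by
  have kg := Ker.gam
  let A : Fin 2 → Fin 2 → Fin 2 → ℝ := fun j k l =>
    Real.sqrt ((∫ z, |pd j (pd k (pd l gam)) z|) * nrm (pd j (pd k (pd l gam))))
  have hA : ∀ j k l, 0 ≤ A j k l := fun j k l => Real.sqrt_nonneg _
  let S := ∑ j, ∑ k, ∑ l, A j k l
  have hS0 : 0 ≤ S := Finset.sum_nonneg fun j _ => Finset.sum_nonneg fun k _ =>
    Finset.sum_nonneg fun l _ => hA j k l
  have hAS : ∀ j k l, A j k l ≤ S := by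
    intro j k l
    calc A j k l ≤ ∑ l, A j k l := Finset.single_le_sum (fun l _ => hA j k l) (Finset.mem_univ l)
      _ ≤ ∑ k, ∑ l, A j k l := Finset.single_le_sum (f := fun k => ∑ l, A j k l)
          (fun k _ => Finset.sum_nonneg fun l _ => hA j k l) (Finset.mem_univ k)
      _ ≤ S := Finset.single_le_sum (f := fun j => ∑ k, ∑ l, A j k l)
          (fun j _ => Finset.sum_nonneg fun k _ => Finset.sum_nonneg fun l _ => hA j k l)
          (Finset.mem_univ j)
  have kk : Ker fun z => gam z - lap gam z := kg.sub ker_lap_gam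
  have hint : ∫ z, (gam z - lap gam z) = 1 := by
    rw [integral_sub kg.integrable ker_lap_gam.integrable, integral_gam]
    have : ∫ z, lap gam z = 0 := by
      unfold lap
      rw [integral_finsetSum _ fun i _ => ((kg.pd i).pd i).integrable]
      simp [(kg.pd _).integral_pd]
    rw [this, sub_zero]
  refine ⟨nrm (fun z => gam z - lap gam z) + 16 * S + 1, by have := nrm_nonneg (fun z => gam z - lap gam z); positivity, ?_⟩
  intro u F P h j k x r hr
  have hw := (h.hu k).pd j
  set N := ∑ l, Real.sqrt (nrm (fun y => F l y ^ 2)) with hN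
  have hN0 : 0 ≤ N := Finset.sum_nonneg fun l _ => Real.sqrt_nonneg _
  have hNl : ∀ l, Real.sqrt (nrm (fun y => F l y ^ 2)) ≤ N := fun l =>
    Finset.single_le_sum (f := fun l => Real.sqrt (nrm (fun y => F l y ^ 2)))
      (fun l _ => Real.sqrt_nonneg _) (Finset.mem_univ l)
  have hterm : ∀ (a b c l : Fin 2) (s : ℝ), 0 < s →
      |avg s (pd a (pd b (pd c gam))) (F l) x| ≤ S * N * Real.sqrt s⁻¹ := by
    intro a b c l s hs
    refine (abs_avg_le_four (((kg.pd c).pd b).pd a) (h.hF l) x hs).trans ?_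
    have e : (∫ z, |pd a (pd b (pd c gam)) z|) * (nrm (pd a (pd b (pd c gam)))
        * (s⁻¹ * nrm (fun y => F l y ^ 2)))
        = ((∫ z, |pd a (pd b (pd c gam)) z|) * nrm (pd a (pd b (pd c gam))))
          * (nrm (fun y => F l y ^ 2) * s⁻¹) := by ring
    have hi : 0 ≤ ∫ z, |pd a (pd b (pd c gam)) z| := integral_nonneg fun _ => abs_nonneg _
    rw [e, Real.sqrt_mul (mul_nonneg hi (nrm_nonneg _)), Real.sqrt_mul (nrm_nonneg _), ← mul_assoc]
    refine mul_le_mul_of_nonneg_right ?_ (Real.sqrt_nonneg _)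
    exact mul_le_mul (hAS a b c) (hNl l) (Real.sqrt_nonneg _) hS0
  have hd : ∀ s, HasDerivAt (fun s => avg s (fun z => gam z - lap gam z) (pd j (u k)) x)
      (-2 * (∑ l, avg s (pd j (pd k (pd l gam))) (F l) x
        - ∑ l, avg s (pd j (pd l (pd l gam))) (F k) x)) s := by
    intro s
    rw [← avg_stokes h j k s x]
    have := hasDerivAt_avg kk hw s x
    simp only [coord_mul_gam_sub_lap_gam, avg_const_mul_left, ← Finset.mul_sum] at this
    rw [neg_mul]
    exact this
  have hb : ∀ s, 0 < s → |-2 * (∑ l, avg s (pd j (pd k (pd l gam))) (F l) x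
        - ∑ l, avg s (pd j (pd l (pd l gam))) (F k) x)| ≤ (8 * S * N) * Real.sqrt s⁻¹ := by
    intro s hs
    rw [abs_mul, abs_neg, abs_two]
    simp only [Fin.sum_univ_two]
    have t1 := hterm j k 0 0 s hs
    have t2 := hterm j k 1 1 s hs
    have t3 := hterm j 0 0 k s hs
    have t4 := hterm j 1 1 k s hs
    rw [abs_le] at t1 t2 t3 t4
    have : |avg s (pd j (pd k (pd 0 gam))) (F 0) x + avg s (pd j (pd k (pd 1 gam))) (F 1) x
        - (avg s (pd j (pd 0 (pd 0 gam))) (F k) x + avg s (pd j (pd 1 (pd 1 gam))) (F k) x)|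
        ≤ 4 * (S * N * Real.sqrt s⁻¹) := by
      rw [abs_le]; constructor <;> linarith [t1.1, t1.2, t2.1, t2.2, t3.1, t3.2, t4.1, t4.2]
    nlinarith
  have hmain := abs_sub_le_of_deriv_le_inv_sqrt hr hd hb
  have h0 : avg 0 (fun z => gam z - lap gam z) (pd j (u k)) x = pd j (u k) x := by
    simp only [avg, zero_smul, sub_zero]
    rw [integral_mul_const, hint, one_mul]
  have h1 := abs_avg_le kk.memL2 hw x hr
  rw [h0] at hmain
  have h2 : |pd j (u k) x| ≤ nrm (fun z => gam z - lap gam z) * (r⁻¹ * nrm (pd j (u k)))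
      + 2 * (8 * S * N) * Real.sqrt r := by
    have := abs_sub_abs_le_abs_sub (pd j (u k) x) (avg r (fun z => gam z - lap gam z) (pd j (u k)) x)
    rw [abs_sub_comm] at this
    linarith
  have p1 : 0 ≤ r⁻¹ * nrm (pd j (u k)) := mul_nonneg (by positivity) (nrm_nonneg _)
  have p2 : 0 ≤ Real.sqrt r * N := mul_nonneg (Real.sqrt_nonneg _) hN0
  have p3 := nrm_nonneg (fun z => gam z - lap gam z)
  nlinarith [mul_nonneg hS0 p1, mul_nonneg hS0 p2, mul_nonneg p3 p2, mul_nonneg p3 p1]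

/-! ### Calculus on the half-line -/

lemma intervalIntegrable_of_continuousOn {a : ℝ → ℝ} (ha : ContinuousOn a (Ici 0)) {s t : ℝ}
    (hs : 0 ≤ s) (ht : 0 ≤ t) : IntervalIntegrable a volume s t :=
  (ha.mono fun _ hr => mem_Ici.2 ((le_min hs ht).trans hr.1)).intervalIntegrable

lemma hasDerivWithinAt_integral {a : ℝ → ℝ} (ha : ContinuousOn a (Ici 0)) {s t : ℝ}
    (hs : 0 ≤ s) (ht : 0 ≤ t) :
    HasDerivWithinAt (fun t => ∫ r in s..t, a r) (a t) (Ici 0) t := by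
  refine hasDerivWithinAt_of_integral_eq ha (fun t ht => ?_) ht
  exact (intervalIntegral.integral_add_adjacent_intervals
    (intervalIntegrable_of_continuousOn ha hs le_rfl)
    (intervalIntegrable_of_continuousOn ha le_rfl ht)).symm

lemma antitoneOn_of_hasDerivWithinAt_Ici {f f' : ℝ → ℝ}
    (hf : ∀ t, 0 ≤ t → HasDerivWithinAt f (f' t) (Ici 0) t) (h : ∀ t, 0 ≤ t → f' t ≤ 0) :
    AntitoneOn f (Ici 0) := by
  refine antitoneOn_of_hasDerivWithinAt_nonpos (f' := f') (convex_Ici 0)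
    (fun t ht => (hf t ht).continuousWithinAt) (fun t ht => ?_) (fun t ht => ?_)
  · exact (hf t (interior_subset ht)).mono interior_subset
  · exact h t (interior_subset ht)

/-- A version of Grönwall's inequality that keeps the dissipation. -/
lemma gronwall_dissipation {f f' a g d : ℝ → ℝ}
    (hf : ∀ t, 0 ≤ t → HasDerivWithinAt f (f' t) (Ici 0) t)
    (ha : ContinuousOn a (Ici 0)) (hg : ContinuousOn g (Ici 0)) (hd : ContinuousOn d (Ici 0))
    (ha0 : ∀ t, 0 ≤ t → 0 ≤ a t) (hg0 : ∀ t, 0 ≤ t → 0 ≤ g t) (hd0 : ∀ t, 0 ≤ t → 0 ≤ d t)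
    (h : ∀ t, 0 ≤ t → f' t + d t ≤ a t * f t + g t) {s t : ℝ} (hs : 0 ≤ s) (hst : s ≤ t) :
    f t + ∫ r in s..t, d r ≤ Real.exp (∫ r in s..t, a r) * (f s + ∫ r in s..t, g r) := by
  have ht : 0 ≤ t := hs.trans hst
  set A : ℝ → ℝ := fun t => ∫ r in s..t, a r with hA
  have hAd : ∀ t, 0 ≤ t → HasDerivWithinAt A (a t) (Ici 0) t := fun t ht =>
    hasDerivWithinAt_integral ha hs ht
  have hAc : ContinuousOn A (Ici 0) := fun t ht => (hAd t ht).continuousWithinAt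
  have hec : ContinuousOn (fun t => Real.exp (- A t)) (Ici 0) :=
    Real.continuous_exp.comp_continuousOn hAc.neg
  have h1c : ContinuousOn (fun t => Real.exp (- A t) * (d t - g t)) (Ici 0) := hec.mul (hd.sub hg)
  have hΦ : ∀ t, 0 ≤ t → HasDerivWithinAt
      (fun t => Real.exp (- A t) * f t + ∫ r in s..t, Real.exp (- A r) * (d r - g r))
      ((Real.exp (- A t) * (- a t) * f t + Real.exp (- A t) * f' t)
        + Real.exp (- A t) * (d t - g t)) (Ici 0) t := fun t ht =>
    (((hAd t ht).neg.exp).mul (hf t ht)).add (hasDerivWithinAt_integral h1c hs ht)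
  have hanti := antitoneOn_of_hasDerivWithinAt_Ici hΦ fun t ht => by
    have h1 := h t ht
    have h2 := Real.exp_pos (- A t)
    nlinarith
  have key := hanti (mem_Ici.2 hs) (mem_Ici.2 ht) hst
  have hAs : A s = 0 := intervalIntegral.integral_same
  simp only [hAs, neg_zero, Real.exp_zero, one_mul, intervalIntegral.integral_same,
    add_zero] at key
  have i1 : IntervalIntegrable (fun r => Real.exp (- A r) * d r) volume s t :=
    intervalIntegrable_of_continuousOn (hec.mul hd) hs ht
  have i2 : IntervalIntegrable (fun r => Real.exp (- A r) * g r) volume s t :=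
    intervalIntegrable_of_continuousOn (hec.mul hg) hs ht
  simp only [mul_sub] at key
  rw [intervalIntegral.integral_sub i1 i2] at key
  have hAnn : ∀ r ∈ Icc s t, 0 ≤ A r ∧ A r ≤ A t := by
    intro r hr
    have hr0 := hs.trans hr.1
    have e1 : 0 ≤ A r := intervalIntegral.integral_nonneg hr.1 fun x hx => ha0 x (hs.trans hx.1)
    have e2 : 0 ≤ ∫ x in r..t, a x :=
      intervalIntegral.integral_nonneg hr.2 fun x hx => ha0 x (hr0.trans hx.1)
    have e3 : A r + ∫ x in r..t, a x = A t := intervalIntegral.integral_add_adjacent_intervals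
      (intervalIntegrable_of_continuousOn ha hs hr0) (intervalIntegrable_of_continuousOn ha hr0 ht)
    exact ⟨e1, by linarith⟩
  have l1 : Real.exp (- A t) * ∫ r in s..t, d r ≤ ∫ r in s..t, Real.exp (- A r) * d r := by
    rw [← intervalIntegral.integral_const_mul]
    refine intervalIntegral.integral_mono_on hst
      ((intervalIntegrable_of_continuousOn hd hs ht).const_mul _) i1 fun r hr => ?_
    exact mul_le_mul_of_nonneg_right (Real.exp_le_exp.2 (neg_le_neg (hAnn r hr).2))
      (hd0 r (hs.trans hr.1))
  have l2 : ∫ r in s..t, Real.exp (- A r) * g r ≤ ∫ r in s..t, g r := by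
    refine intervalIntegral.integral_mono_on hst i2
      (intervalIntegrable_of_continuousOn hg hs ht) fun r hr => ?_
    have : Real.exp (- A r) ≤ 1 := Real.exp_le_one_iff.2 (neg_nonpos.2 (hAnn r hr).1)
    nlinarith [hg0 r (hs.trans hr.1)]
  have l3 : Real.exp (- A t) * (f t + ∫ r in s..t, d r) ≤ f s + ∫ r in s..t, g r := by
    rw [mul_add]; linarith
  have l4 : f t + ∫ r in s..t, d r
      = Real.exp (A t) * (Real.exp (- A t) * (f t + ∫ r in s..t, d r)) := by
    rw [← mul_assoc, ← Real.exp_add, add_neg_cancel, Real.exp_zero, one_mul]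
  rw [l4]
  exact mul_le_mul_of_nonneg_left l3 (Real.exp_pos _).le

/-! ### Transport by a divergence-free field -/

lemma le_of_integral_pow_le {h : Plane → ℝ} (hc : Continuous h) (h0 : ∀ x, 0 ≤ h x) {b K : ℝ}
    (hb : 0 ≤ b) (hi : ∀ n : ℕ, Integrable fun x => h x ^ (n + 2))
    (hK : ∀ n : ℕ, ∫ x, h x ^ (n + 2) ≤ K * b ^ n) (x : Plane) : h x ≤ b := by
  by_contra hlt
  push Not at hlt
  obtain ⟨b', hb1, hb2⟩ := exists_between hlt
  have hb' : 0 < b' := hb.trans_lt hb1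
  have hopen : IsOpen {y | b' < h y} := isOpen_lt continuous_const hc
  obtain ⟨ε, hε, hball⟩ := Metric.isOpen_iff.1 hopen x hb2
  set c := (volume (Metric.ball x ε)).toReal with hcdef
  have hcpos : 0 < c := ENNReal.toReal_pos (Metric.measure_ball_pos _ _ hε).ne' measure_ball_lt_top.ne
  have h1 : ∀ n : ℕ, c * b' ^ (n + 2) ≤ K * b ^ n := by
    intro n
    refine le_trans ?_ (hK n)
    have e1 : c * b' ^ (n + 2) = ∫ _ in Metric.ball x ε, b' ^ (n + 2) := by
      rw [setIntegral_const, smul_eq_mul, hcdef]; rfl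
    rw [e1]
    refine le_trans (setIntegral_mono_on (integrableOn_const measure_ball_lt_top.ne)
      (hi n).integrableOn measurableSet_ball fun y hy => ?_)
      (setIntegral_le_integral (hi n) (ae_of_all _ fun y => pow_nonneg (h0 y) _))
    exact pow_le_pow_left₀ hb'.le (hball hy).le _
  have h2 : ∀ n : ℕ, c * b' ^ 2 ≤ K * (b / b') ^ n := by
    intro n
    have := h1 n
    rw [div_pow, mul_div_assoc', le_div_iff₀ (by positivity)]
    calc c * b' ^ 2 * b' ^ n = c * b' ^ (n + 2) := by ring
      _ ≤ _ := this
  have hlim : Tendsto (fun n : ℕ => K * (b / b') ^ n) atTop (𝓝 (K * 0)) :=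
    (tendsto_pow_atTop_nhds_zero_of_lt_one (by positivity) ((div_lt_one hb').2 hb1)).const_mul K
  have := ge_of_tendsto' hlim h2
  have : 0 < c * b' ^ 2 := by positivity
  linarith

lemma xd_pow {f : Plane → ℝ} (hf : Differentiable ℝ f) (n : ℕ) (i : Fin 2) (x : Plane) :
    pd i (fun x => f x ^ (n + 1)) x = (n + 1) * (f x ^ n * pd i f x) := by
  simp only [pd]
  rw [fderiv_fun_pow _ (hf x)]
  simp
  ring

lemma SmoothOn.dt_pow {f : ℝ → Plane → ℝ} (hf : SmoothOn f) (n : ℕ) {t : ℝ} (ht : 0 ≤ t)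
    (x : Plane) :
    INS2D.dt (fun t x => f t x ^ (n + 1)) t x = (n + 1) * (f t x ^ n * INS2D.dt f t x) := by
  have := ((hf.hasDerivWithinAt ht x).pow (n + 1)).derivWithin (uniqueDiffOn_Ici 0 t ht)
  have e : INS2D.dt (fun t x => f t x ^ (n + 1)) t x
      = derivWithin ((fun s => f s x) ^ (n + 1)) (Ici 0) t := rfl
  rw [e, this, Nat.add_sub_cancel]
  push_cast
  ring

lemma integral_transport_eq_zero {u : Fin 2 → Plane → ℝ} (hu : ∀ i, Hs (u i))
    (hdiv : ∀ x, ∑ i, pd i (u i) x = 0) {f : Plane → ℝ} (hf : Hs f) :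
    ∑ i, ∫ x, u i x * pd i f x = 0 := by
  simp only [fun i => (hu i).integral_mul_pd hf i, Finset.sum_neg_distrib, neg_eq_zero]
  rw [← integral_finsetSum _ fun i _ => ((hu i).pd i).integrable_mul hf]
  simp only [← Finset.sum_mul, hdiv, zero_mul, integral_zero]

/-- Pointwise bounds for nonnegative quantities transported by a divergence-free field. -/
theorem le_of_transport {u : Fin 2 → ℝ → Plane → ℝ} (hu : ∀ i, Sm (u i))
    (hdiv : ∀ t, 0 ≤ t → ∀ x, ∑ i, xd i (u i) t x = 0) {h g : ℝ → Plane → ℝ} (hh : Sm h)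
    (hg : Sm g) (hpos : ∀ t, 0 ≤ t → ∀ x, 0 ≤ h t x)
    (heq : ∀ t, 0 ≤ t → ∀ x, dt h t x + ∑ i, u i t x * xd i h t x = g t x)
    {a : ℝ → ℝ} (ha : ContinuousOn a (Ici 0)) (ha0 : ∀ t, 0 ≤ t → 0 ≤ a t)
    (hga : ∀ t, 0 ≤ t → ∀ x, g t x ≤ a t * h t x) {H0 : ℝ} (hH0 : 0 ≤ H0) (hb : ∀ x, h 0 x ≤ H0)
    {t : ℝ} (ht : 0 ≤ t) (x : Plane) : h t x ≤ H0 * Real.exp (∫ r in (0 : ℝ)..t, a r) := by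
  have hpw : ∀ n : ℕ, Sm fun t x => h t x ^ (n + 1) := hh.pow
  have hM : ∀ n : ℕ, ∀ t, 0 ≤ t → HasDerivWithinAt (ip h fun t x => h t x ^ (n + 1))
      ((n + 2) * ∫ x, h t x ^ (n + 1) * g t x) (Ici 0) t := by
    intro n t ht
    have hd := hasDerivWithinAt_ip hh (hpw n) ht
    convert hd using 1
    have H := hh.hs ht
    have Hn := (hpw n).hs ht
    have Hn1 := (hpw (n + 1)).hs ht
    have Hg := hg.hs ht
    have Hu : ∀ i, Hs (u i t) := fun i => (hu i).hs ht
    have e1 : ip (dt h) (fun t x => h t x ^ (n + 1)) t + ip h (dt fun t x => h t x ^ (n + 1)) t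
        = ∫ x, (n + 2) * (h t x ^ (n + 1) * dt h t x) := by
      rw [ip, ip, ← integral_add ((hh.dt.hs ht).integrable_mul Hn)
        (H.integrable_mul ((hpw n).dt.hs ht))]
      congr 1
      funext x
      rw [hh.smooth.dt_pow n ht]
      ring
    have e2 : ∀ x, (n + 2 : ℝ) * (h t x ^ (n + 1) * dt h t x)
        = (n + 2) * (h t x ^ (n + 1) * g t x)
          - ∑ i, u i t x * pd i (fun x => h t x ^ (n + 1 + 1)) x := by
      intro x
      rw [← heq t ht x]
      simp only [xd_pow H.diff, Fin.sum_univ_two, xd]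
      push_cast
      ring
    rw [e1]
    simp only [e2]
    have i1 : Integrable fun x => h t x ^ (n + 1) * g t x := Hn.integrable_mul Hg
    rw [integral_sub (i1.const_mul _)
      (integrable_finsetSum _ fun i _ => (Hu i).integrable_mul (Hn1.pd i)),
      integral_finsetSum _ fun i _ => (Hu i).integrable_mul (Hn1.pd i),
      integral_transport_eq_zero Hu (hdiv t ht) Hn1, sub_zero, integral_const_mul]
  have hipe : ∀ (n : ℕ) t, ip h (fun t x => h t x ^ (n + 1)) t = ∫ x, h t x ^ (n + 2) := by
    intro n t
    simp only [ip]; congr 1; funext x; ring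
  have hi : ∀ (n : ℕ) t, 0 ≤ t → Integrable fun x => h t x ^ (n + 2) := by
    intro n t ht
    have := (hh.hs ht).integrable_mul ((hpw n).hs ht)
    refine this.congr (ae_of_all _ fun x => ?_)
    ring
  set A := ∫ r in (0 : ℝ)..t, a r with hAdef
  refine le_of_integral_pow_le (hh.hs ht).cont (hpos t ht) (K := Real.exp (2 * A) * sqn (h 0))
    (by positivity) (fun n => hi n t ht) (fun n => ?_) x
  have hgr := gronwall_dissipation (f := ip h fun t x => h t x ^ (n + 1))
    (f' := fun t => (n + 2) * ∫ x, h t x ^ (n + 1) * g t x) (a := fun t => (n + 2) * a t)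
    (g := fun _ => 0) (d := fun _ => 0) (hM n) (continuousOn_const.mul ha) continuousOn_const
    continuousOn_const (fun t ht => mul_nonneg (by positivity) (ha0 t ht)) (fun _ _ => le_rfl)
    (fun _ _ => le_rfl) (fun t ht => ?_) le_rfl ht
  · simp only [intervalIntegral.integral_zero, add_zero, hipe] at hgr
    rw [intervalIntegral.integral_const_mul, ← hAdef] at hgr
    refine hgr.trans ?_
    have h3 : ∫ x, h 0 x ^ (n + 2) ≤ H0 ^ n * sqn (h 0) := by
      rw [sqn, ← integral_const_mul]
      refine integral_mono (hi n 0 le_rfl) ((hh.hs le_rfl).integrable_sq.const_mul _) fun x => ?_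
      dsimp only
      rw [pow_add]
      exact mul_le_mul_of_nonneg_right (pow_le_pow_left₀ (hpos 0 le_rfl x) (hb x) n) (sq_nonneg _)
    have h4 : Real.exp ((n + 2) * A) = Real.exp (2 * A) * Real.exp A ^ n := by
      rw [← Real.exp_nat_mul, ← Real.exp_add]; congr 1; ring
    rw [h4, mul_pow]
    calc _ ≤ Real.exp (2 * A) * Real.exp A ^ n * (H0 ^ n * sqn (h 0)) := by gcongr
      _ = _ := by ring
  · simp only [add_zero]
    rw [hipe, mul_assoc]
    refine mul_le_mul_of_nonneg_left ?_ (by positivity)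
    rw [← integral_const_mul]
    refine integral_mono (((hpw n).hs ht).integrable_mul (hg.hs ht)) ((hi n t ht).const_mul _)
      fun x => ?_
    dsimp only
    have := mul_le_mul_of_nonneg_left (hga t ht x) (pow_nonneg (hpos t ht x) (n + 1))
    calc _ ≤ _ := this
      _ = _ := by ring

/-! ### The system in components -/

/-- A smooth solution of the system in components: `ϱ` is the density minus one, `u k` are the
components of the velocity and `P` is the pressure. -/
structure Sol (ϱ : ℝ → Plane → ℝ) (u : Fin 2 → ℝ → Plane → ℝ) (P : ℝ → Plane → ℝ) : Prop where
  hϱ : Sm ϱ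
  hu : ∀ k, Sm (u k)
  hP : SmoothOn P
  hp : ∀ k, Sm (xd k P)
  mass : ∀ t, 0 ≤ t → ∀ x, dt ϱ t x + ∑ i, u i t x * xd i ϱ t x = 0
  mom : ∀ k t, 0 ≤ t → ∀ x, (1 + ϱ t x) * (dt (u k) t x + ∑ i, u i t x * xd i (u k) t x)
    - lap (u k t) x + xd k P t x = 0
  div : ∀ t, 0 ≤ t → ∀ x, ∑ i, xd i (u i) t x = 0
  bd : ∀ x, |ϱ 0 x| ≤ 1 / 4

/-- The material derivative of the velocity. -/
def acc (u : Fin 2 → ℝ → Plane → ℝ) (k : Fin 2) (t : ℝ) (x : Plane) : ℝ :=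
  dt (u k) t x + ∑ i, u i t x * xd i (u k) t x

/-- The right-hand side of the Stokes system satisfied by the velocity. -/
def frc (ϱ : ℝ → Plane → ℝ) (u : Fin 2 → ℝ → Plane → ℝ) (k : Fin 2) (t : ℝ) (x : Plane) : ℝ :=
  -((1 + ϱ t x) * acc u k t x)

/-- The `k`-th coordinate as a continuous linear map. -/
def coordL (k : Fin 2) : Plane →L[ℝ] ℝ := EuclideanSpace.proj k

lemma pd_apply {f : Plane → Plane} (hf : Differentiable ℝ f) (i k : Fin 2) :
    pd i (fun y => f y k) = fun x => (fderiv ℝ f x (basisVec i)) k := by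
  funext x
  have h := (coordL k).hasFDerivAt.comp x
    (hf x).hasFDerivAt
  unfold pd
  rw [show (fun y => f y k) = (coordL k) ∘ f
    from rfl, h.fderiv]
  simp [coordL]

lemma laplacian_apply {f : Plane → Plane} (hf : ContDiff ℝ ∞ f) (k : Fin 2) (x : Plane) :
    Laplacian.laplacian f x k = lap (fun y => f y k) x := by
  have hd : ContDiff ℝ ∞ (fderiv ℝ f) := hf.fderiv_right (by simp)
  rw [InnerProductSpace.laplacian_eq_iteratedFDeriv_orthonormalBasis f
    (EuclideanSpace.basisFun (Fin 2) ℝ)]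
  simp only [lap, WithLp.ofLp_sum, Finset.sum_apply]
  refine Finset.sum_congr rfl fun i _ => ?_
  rw [pd_apply (hf.differentiable (by simp)),
    pd_apply (f := fun x => fderiv ℝ f x (basisVec i))
      ((hd.clm_apply contDiff_const).differentiable (by simp)), iteratedFDeriv_two_apply]
  beta_reduce
  rw [fderiv_clm_apply ((hd.differentiable (by simp)) x) (differentiableAt_const _)]
  simp [basisVec]

theorem IsSmoothSolution.sol {ρ : ℝ → Plane → ℝ} {u : ℝ → Plane → Plane} {P : ℝ → Plane → ℝ}
    (h : IsSmoothSolution ρ u P) (hd : GoodData ρ u) :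
    Sol (fun t x => ρ t x - 1) (fun k t x => u t x k) P := by
  have hus : SmoothOn u := h.smooth_velocity.contDiffOn
  have hrs : SmoothOn fun t x => ρ t x - 1 := h.smooth_density.contDiffOn
  have hu : ∀ k, Sm fun t x => u t x k := fun k =>
    h.smooth_velocity.sm (coordL k)
  have hdtu : ∀ k t, 0 ≤ t → dt (fun t x => u t x k) t = fun x => dt u t x k := fun k =>
    iter_dt_clm_comp (coordL k) hus 1
  have hxu : ∀ i k t, 0 ≤ t → xd i (fun t x => u t x k) t
      = fun x => (fderiv ℝ (u t) x (basisVec i)) k := fun i k t ht =>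
    pd_apply ((hus.slice ht).differentiable (by simp)) i k
  refine ⟨h.smooth_density.sm (ContinuousLinearMap.id ℝ ℝ), hu, h.smooth_pressure,
    fun k => h.smooth_pressure_grad.sm (coordL k),
    fun t ht x => ?_, fun k t ht x => ?_, fun t ht x => ?_, fun x => ?_⟩
  · have h1 := h.mass t ht x
    have e1 : dt (fun t x => ρ t x - 1) t x = dt ρ t x := derivWithin_sub_const ..
    have e2 : ∀ i, xd i (fun t x => ρ t x - 1) t x = pd i (ρ t) x := fun i => by
      simp only [xd, pd, fderiv_sub_const]
    rw [fderiv_apply_eq_sum] at h1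
    rw [e1]
    simp only [e2]
    exact h1
  · have h1 := congrArg (fun v : Plane => v k) (h.momentum t ht x)
    have h2 := laplacian_apply (hus.slice ht) k x
    have h3 : (fderiv ℝ (u t) x (u t x)) k = ∑ i, u t x i * xd i (fun t x => u t x k) t x := by
      have hv : u t x = ∑ i, u t x i • basisVec i := by
        ext j
        fin_cases j <;> simp [basisVec]
      conv_lhs => rw [hv, map_sum]
      simp [hxu _ k t ht]
    simp only [PiLp.add_apply, PiLp.sub_apply, PiLp.smul_apply, smul_eq_mul, PiLp.zero_apply] at h1
    rw [h2, h3] at h1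
    rw [hdtu k t ht]
    have e4 : xd k P t x = grad (P t) x k := rfl
    rw [e4]
    linear_combination h1
  · have h1 := h.incompressible t ht x
    rw [divergence] at h1
    rw [← h1]
    exact Finset.sum_congr rfl fun i _ => by rw [hxu i i t ht]
  · have := hd.density_bounds x
    rw [abs_le]
    constructor <;> linarith

namespace Sol

variable {ϱ P : ℝ → Plane → ℝ} {u : Fin 2 → ℝ → Plane → ℝ}

lemma hacc (h : Sol ϱ u P) (k : Fin 2) : Sm (acc u k) :=
  (h.hu k).dt.add (Sm.sum _ fun i _ => (h.hu i).mul ((h.hu k).xd i))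

lemma hfrc (h : Sol ϱ u P) (k : Fin 2) : Sm (frc ϱ u k) :=
  (((h.hacc k).add (h.hϱ.mul (h.hacc k))).neg).congr fun t _ => by
    funext x; simp only [frc]; ring

lemma stokes (h : Sol ϱ u P) {t : ℝ} (ht : 0 ≤ t) :
    IsStokes (fun k => u k t) (P t) (fun k => frc ϱ u k t) where
  hu k := (h.hu k).hs ht
  hP := h.hP.slice ht
  hp k := (h.hp k).hs ht
  hF k := (h.hfrc k).hs ht
  div := h.div t ht
  eq k x := by
    have := h.mom k t ht x
    simp only [frc, acc]
    have e : xd k P t x = pd k (P t) x := rfl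
    rw [e] at this
    linarith

lemma dt_lap (h : Sol ϱ u P) (k : Fin 2) {t : ℝ} (ht : 0 ≤ t) (x : Plane) :
    HasDerivWithinAt (fun s => lap (u k s) x) (lap (dt (u k) t) x) (Ici 0) t := by
  have hi : ∀ i, HasDerivWithinAt (fun s => xd i (xd i (u k)) s x)
      (pd i (pd i (dt (u k) t)) x) (Ici 0) t := by
    intro i
    have h1 := ((((h.hu k).xd i).xd i).smooth).hasDerivWithinAt ht x
    rw [((h.hu k).xd i).smooth.dt_xd i ht] at h1
    have e : dt (xd i (u k)) t = pd i (dt (u k) t) :=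
      funext fun y => (h.hu k).smooth.dt_xd i ht y
    change HasDerivWithinAt _ (pd i (dt (xd i (u k)) t) x) _ _ at h1
    rw [e] at h1
    exact h1
  have := HasDerivWithinAt.fun_sum fun i (_ : i ∈ Finset.univ) => hi i
  exact this

lemma stokes_dt (h : Sol ϱ u P) {t : ℝ} (ht : 0 ≤ t) :
    IsStokes (fun k => dt (u k) t) (dt P t) (fun k => dt (frc ϱ u k) t) where
  hu k := (h.hu k).dt.hs ht
  hP := h.hP.dt.slice ht
  hp k := by
    have e : pd k (dt P t) = dt (xd k P) t := funext fun x => (h.hP.dt_xd k ht x).symm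
    rw [e]
    exact (h.hp k).dt.hs ht
  hF k := (h.hfrc k).dt.hs ht
  div x := by
    have h1 : ∀ i, dt (xd i (u i)) t x = pd i (dt (u i) t) x := fun i =>
      (h.hu i).smooth.dt_xd i ht x
    simp only [← h1]
    have h2 := HasDerivWithinAt.fun_sum fun i (_ : i ∈ (Finset.univ : Finset (Fin 2))) =>
      ((h.hu i).xd i).smooth.hasDerivWithinAt ht x
    have h3 : HasDerivWithinAt (fun s => ∑ i, xd i (u i) s x) 0 (Ici 0) t :=
      (hasDerivWithinAt_const t (Ici 0) (0 : ℝ)).congr (fun s hs => h.div s hs x) (h.div t ht x)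
    exact (uniqueDiffOn_Ici (0 : ℝ) t ht).eq_deriv _ h2 h3
  eq k x := by
    have h1 := ((h.dt_lap k ht x).neg).add ((h.hp k).smooth.hasDerivWithinAt ht x)
    have h2 : HasDerivWithinAt (fun s => frc ϱ u k s x) (- lap (dt (u k) t) x + dt (xd k P) t x)
        (Ici 0) t := by
      refine h1.congr (fun s hs => ?_) ?_
      · exact ((h.stokes hs).eq k x).symm
      · exact ((h.stokes ht).eq k x).symm
    have h3 := (h.hfrc k).smooth.hasDerivWithinAt ht x
    have h4 := (uniqueDiffOn_Ici (0 : ℝ) t ht).eq_deriv _ h3 h2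
    rw [h4, h.hP.dt_xd k ht x]
    rfl

lemma abs_le (h : Sol ϱ u P) {t : ℝ} (ht : 0 ≤ t) (x : Plane) : |ϱ t x| ≤ 1 / 4 := by
  have h2 := le_of_transport h.hu h.div (h := fun t x => ϱ t x ^ 2) (g := fun _ _ => 0) h.hϱ.sq
    Sm.zero (fun _ _ _ => sq_nonneg _) (fun t ht x => ?_) (a := fun _ => 0) continuousOn_const
    (fun _ _ => le_rfl) (fun _ _ _ => by simp) (H0 := (1 / 4) ^ 2) (by norm_num)
    (fun x => by rw [← sq_abs]; exact pow_le_pow_left₀ (abs_nonneg _) (h.bd x) 2) ht x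
  · simp only [intervalIntegral.integral_zero, Real.exp_zero, mul_one] at h2
    exact abs_le_of_sq_le_sq h2 (by norm_num)
  · have e1 := h.hϱ.smooth.dt_pow 1 ht x
    have e2 : ∀ i, xd i (fun t x => ϱ t x ^ 2) t x = (1 + 1) * (ϱ t x ^ 1 * xd i ϱ t x) :=
      fun i => by
        have := xd_pow (h.hϱ.hs ht).diff 1 i x
        simpa [xd] using this
    have e3 : dt (fun t x => ϱ t x ^ 2) t x = (1 + 1) * (ϱ t x ^ 1 * dt ϱ t x) := by simpa using e1
    have h3 := h.mass t ht x
    simp only [e2, e3, Fin.sum_univ_two] at h3 ⊢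
    linear_combination 2 * ϱ t x * h3

lemma sqn_eq (h : Sol ϱ u P) {t : ℝ} (ht : 0 ≤ t) : sqn (ϱ t) = sqn (ϱ 0) := by
  have hd : ∀ t, 0 ≤ t → HasDerivWithinAt (ip ϱ ϱ) 0 (Ici 0) t := by
    intro t ht
    have h1 := hasDerivWithinAt_ip h.hϱ h.hϱ ht
    convert h1 using 1
    have H := h.hϱ.hs ht
    have hz := integral_transport_eq_zero (fun i => (h.hu i).hs ht) (h.div t ht) H.sq
    have e : ∀ i x, u i t x * pd i (fun x => ϱ t x ^ 2) x = 2 * (ϱ t x * (u i t x * xd i ϱ t x)) := by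
      intro i x
      have := xd_pow H.diff 1 i x
      simp only [Nat.cast_one, pow_one, one_add_one_eq_two] at this
      rw [this]
      simp only [xd]
      ring
    simp only [e] at hz
    have hint : ∀ i, Integrable fun x => 2 * (ϱ t x * (u i t x * xd i ϱ t x)) := fun i =>
      (H.integrable_mul (((h.hu i).hs ht).mul ((h.hϱ.xd i).hs ht))).const_mul 2
    rw [← integral_finsetSum _ fun i _ => hint i] at hz
    rw [ip_comm ϱ (dt ϱ), ← two_mul, ip, ← integral_const_mul, ← neg_eq_zero.2 hz, ← integral_neg]
    congr 1
    funext x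
    have h3 := h.mass t ht x
    simp only [Fin.sum_univ_two] at h3 ⊢
    linear_combination (-2) * ϱ t x * h3
  have e : ∀ t, sqn (ϱ t) = ip ϱ ϱ t := fun t => by simp only [sqn, ip, sq]
  rw [e, e]
  exact constant_of_derivWithin_zero (fun s hs => ((hd s hs.1).mono Icc_subset_Ici_self).differentiableWithinAt)
    (fun s hs => ((hd s hs.1).mono Icc_subset_Ici_self).derivWithin
      (uniqueDiffOn_Icc (hs.1.trans_lt hs.2) s ⟨hs.1, hs.2.le⟩)) t ⟨ht, le_rfl⟩

end Sol

/-! ### The `L⁴` norm and products -/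

/-- The `L⁴` norm. -/
def l4 (f : Plane → ℝ) : ℝ := Real.sqrt (nrm fun x => f x ^ 2)

lemma l4_nonneg (f : Plane → ℝ) : 0 ≤ l4 f := Real.sqrt_nonneg _

lemma l4_sq (f : Plane → ℝ) : l4 f ^ 2 = nrm fun x => f x ^ 2 := Real.sq_sqrt (nrm_nonneg _)

namespace Hs

variable {f g : Plane → ℝ}

lemma nrm_mul_le (hf : Hs f) (hg : Hs g) : nrm (fun x => f x * g x) ≤ l4 f * l4 g := by
  refine Real.sqrt_le_iff.2 ⟨mul_nonneg (l4_nonneg _) (l4_nonneg _), ?_⟩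
  rw [mul_pow, l4_sq, l4_sq, sqn]
  simp only [mul_pow]
  exact (le_abs_self _).trans (abs_integral_mul_le hf.sq.memL2 hg.sq.memL2)

lemma l4_mul_sq_le (hf : Hs f) (hg : Hs g) :
    l4 (fun x => f x * g x) ^ 2 ≤ l4 (fun x => f x ^ 2) * l4 (fun x => g x ^ 2) := by
  rw [l4_sq]
  simp only [mul_pow]
  exact hf.sq.nrm_mul_le hg.sq

lemma l4_add_le (hf : Hs f) (hg : Hs g) : l4 (fun x => f x + g x) ≤ l4 f + l4 g := by
  refine Real.sqrt_le_iff.2 ⟨add_nonneg (l4_nonneg _) (l4_nonneg _), ?_⟩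
  have h1 := hf.nrm_mul_le hg
  have e : (fun x => (f x + g x) ^ 2) = fun x => (f x ^ 2 + g x ^ 2) + 2 * (f x * g x) := by
    funext x; ring
  rw [e]
  have h2 := nrm_add_le (hf.sq.add hg.sq).memL2 ((hf.mul hg).const_mul 2).memL2
  have h3 := nrm_add_le hf.sq.memL2 hg.sq.memL2
  rw [nrm_const_mul, abs_of_pos (by norm_num : (0 : ℝ) < 2)] at h2
  rw [← l4_sq, ← l4_sq] at h3
  nlinarith

lemma l4_sq_le (hf : Hs f) {a b : ℝ} (ha : 0 ≤ a) (hb : 0 ≤ b) (h1 : nrm f ≤ a)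
    (h2 : gsq f ≤ b ^ 2) : l4 f ^ 2 ≤ 2 * (a * b) := by
  rw [l4_sq]
  refine Real.sqrt_le_iff.2 ⟨by positivity, ?_⟩
  have h3 : sqn f ≤ a ^ 2 := by
    rw [← nrm_sq]; exact pow_le_pow_left₀ (nrm_nonneg _) h1 2
  have h4 := mul_le_mul h3 h2 (gsq_nonneg _) (by positivity)
  have h5 := hf.sqn_sq_le
  nlinarith [mul_nonneg (sq_nonneg a) (sq_nonneg b)]

lemma l4_of_sq_le (hf : Hs f) {a b : ℝ} (ha : 0 ≤ a) (hb : 0 ≤ b) (h1 : nrm f ≤ a)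
    (h2 : gsq f ≤ b ^ 2) : l4 (fun x => f x ^ 2) ^ 2 ≤ 9 * (a * b ^ 3) := by
  rw [l4_sq]
  refine Real.sqrt_le_iff.2 ⟨by positivity, ?_⟩
  have h3 : sqn f ≤ a ^ 2 := by
    rw [← nrm_sq]; exact pow_le_pow_left₀ (nrm_nonneg _) h1 2
  have h4 := mul_le_mul h3 (pow_le_pow_left₀ (gsq_nonneg _) h2 3)
    (pow_nonneg (gsq_nonneg _) 3) (by positivity)
  have h5 := hf.sqn_pow_four_le
  have e : (fun x => (f x ^ 2) ^ 2) = fun x => f x ^ 4 := by funext x; ring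
  rw [e]
  nlinarith [mul_nonneg (sq_nonneg a) (sq_nonneg (b ^ 3))]

lemma abs_integral_weight_le (hf : Hs f) (hg : Hs g) {r : Plane → ℝ} {c : ℝ}
    (hr : ∀ x, |r x| ≤ c) : |∫ x, r x * (f x * g x)| ≤ c * (nrm f * nrm g) := by
  have hc : 0 ≤ c := (abs_nonneg _).trans (hr 0)
  refine abs_integral_le_integral_abs.trans ?_
  refine le_trans ?_ (mul_le_mul_of_nonneg_left (integral_abs_mul_le hf.memL2 hg.memL2) hc)
  rw [← integral_const_mul]
  refine integral_mono_of_nonneg (ae_of_all _ fun x => abs_nonneg _)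
    ((hf.integrable_mul hg).abs.const_mul c) (ae_of_all _ fun x => ?_)
  simp only [abs_mul]
  exact mul_le_mul_of_nonneg_right (hr x) (by positivity)

lemma integral_mul_lap (hf : Hs f) (hg : Hs g) :
    ∫ x, g x * INS2D.lap f x = - ∑ i, ∫ x, INS2D.pd i g x * INS2D.pd i f x := by
  have h1 : ∀ i, Integrable fun x => g x * INS2D.pd i (INS2D.pd i f) x := fun i =>
    hg.integrable_mul ((hf.pd i).pd i)
  simp only [INS2D.lap, Finset.mul_sum]
  rw [integral_finsetSum _ fun i _ => h1 i, ← Finset.sum_neg_distrib]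
  exact Finset.sum_congr rfl fun i _ => hg.integral_mul_pd (hf.pd i) i

end Hs

/-! ### Sums over components -/

/-- The square of the `L²` norm of a vector field. -/
def vsq (f : Fin 2 → Plane → ℝ) : ℝ := ∑ k, sqn (f k)

/-- The square of the `L²` norm of the gradient of a vector field. -/
def vgsq (f : Fin 2 → Plane → ℝ) : ℝ := ∑ k, gsq (f k)

/-- The square of the `L²` norm of the Hessian of a vector field. -/
def vhsq (f : Fin 2 → Plane → ℝ) : ℝ := ∑ k, hsq (f k)

lemma hsq_nonneg (f : Plane → ℝ) : 0 ≤ hsq f :=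
  Finset.sum_nonneg fun _ _ => Finset.sum_nonneg fun _ _ => sqn_nonneg _

lemma vsq_nonneg (f : Fin 2 → Plane → ℝ) : 0 ≤ vsq f := Finset.sum_nonneg fun _ _ => sqn_nonneg _

lemma vgsq_nonneg (f : Fin 2 → Plane → ℝ) : 0 ≤ vgsq f :=
  Finset.sum_nonneg fun _ _ => gsq_nonneg _

lemma vhsq_nonneg (f : Fin 2 → Plane → ℝ) : 0 ≤ vhsq f :=
  Finset.sum_nonneg fun _ _ => hsq_nonneg _

lemma nrm_le_vsq (f : Fin 2 → Plane → ℝ) (k : Fin 2) : nrm (f k) ≤ Real.sqrt (vsq f) :=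
  Real.sqrt_le_sqrt (Finset.single_le_sum (f := fun k => sqn (f k)) (fun _ _ => sqn_nonneg _)
    (Finset.mem_univ k))

lemma gsq_le_vgsq (f : Fin 2 → Plane → ℝ) (k : Fin 2) : gsq (f k) ≤ Real.sqrt (vgsq f) ^ 2 := by
  rw [Real.sq_sqrt (vgsq_nonneg f)]
  exact Finset.single_le_sum (f := fun k => gsq (f k)) (fun _ _ => gsq_nonneg _)
    (Finset.mem_univ k)

lemma nrm_pd_le_vgsq (f : Fin 2 → Plane → ℝ) (i k : Fin 2) :
    nrm (pd i (f k)) ≤ Real.sqrt (vgsq f) := by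
  refine Real.sqrt_le_sqrt (le_trans ?_ (Finset.single_le_sum (f := fun k => gsq (f k))
    (fun _ _ => gsq_nonneg _) (Finset.mem_univ k)))
  exact Finset.single_le_sum (f := fun i => sqn (pd i (f k))) (fun _ _ => sqn_nonneg _)
    (Finset.mem_univ i)

lemma gsq_pd_le_vhsq {f : Fin 2 → Plane → ℝ} (hf : ∀ k, Hs (f k)) (i k : Fin 2) :
    gsq (pd i (f k)) ≤ Real.sqrt (vhsq f) ^ 2 := by
  rw [Real.sq_sqrt (vhsq_nonneg f)]
  refine le_trans ?_ (Finset.single_le_sum (f := fun k => hsq (f k)) (fun _ _ => hsq_nonneg _)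
    (Finset.mem_univ k))
  have e : gsq (pd i (f k)) = ∑ j, sqn (pd i (pd j (f k))) :=
    Finset.sum_congr rfl fun j _ => by rw [pd_comm (hf k).smooth j i]
  rw [e]
  exact Finset.single_le_sum (f := fun i => ∑ j, sqn (pd i (pd j (f k))))
    (fun _ _ => Finset.sum_nonneg fun _ _ => sqn_nonneg _) (Finset.mem_univ i)

lemma nrm_pd_pd_le_vhsq {f : Fin 2 → Plane → ℝ} (hf : ∀ k, Hs (f k)) (i j k : Fin 2) :
    nrm (pd j (pd i (f k))) ≤ Real.sqrt (vhsq f) := by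
  refine Real.sqrt_le_iff.2 ⟨Real.sqrt_nonneg _, le_trans ?_ (gsq_pd_le_vhsq hf i k)⟩
  exact Finset.single_le_sum (f := fun j => sqn (pd j (pd i (f k)))) (fun _ _ => sqn_nonneg _)
    (Finset.mem_univ j)

/-- The `L⁴` estimates for a vector field in terms of its `L²` norms. -/
lemma l4_le_vsq {f : Fin 2 → Plane → ℝ} (hf : ∀ k, Hs (f k)) (k : Fin 2) :
    l4 (f k) ≤ Real.sqrt (2 * (Real.sqrt (vsq f) * Real.sqrt (vgsq f))) :=
  Real.le_sqrt_of_sq_le ((hf k).l4_sq_le (Real.sqrt_nonneg _) (Real.sqrt_nonneg _)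
    (nrm_le_vsq f k) (gsq_le_vgsq f k))

lemma l4_pd_le_vgsq {f : Fin 2 → Plane → ℝ} (hf : ∀ k, Hs (f k)) (i k : Fin 2) :
    l4 (pd i (f k)) ≤ Real.sqrt (2 * (Real.sqrt (vgsq f) * Real.sqrt (vhsq f))) :=
  Real.le_sqrt_of_sq_le (((hf k).pd i).l4_sq_le (Real.sqrt_nonneg _) (Real.sqrt_nonneg _)
    (nrm_pd_le_vgsq f i k) (gsq_pd_le_vhsq hf i k))

lemma l4_of_sq_le_vsq {f : Fin 2 → Plane → ℝ} (hf : ∀ k, Hs (f k)) (k : Fin 2) :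
    l4 (fun x => f k x ^ 2) ≤ Real.sqrt (9 * (Real.sqrt (vsq f) * Real.sqrt (vgsq f) ^ 3)) :=
  Real.le_sqrt_of_sq_le ((hf k).l4_of_sq_le (Real.sqrt_nonneg _) (Real.sqrt_nonneg _)
    (nrm_le_vsq f k) (gsq_le_vgsq f k))

lemma l4_of_pd_sq_le_vgsq {f : Fin 2 → Plane → ℝ} (hf : ∀ k, Hs (f k)) (i k : Fin 2) :
    l4 (fun x => pd i (f k) x ^ 2)
      ≤ Real.sqrt (9 * (Real.sqrt (vgsq f) * Real.sqrt (vhsq f) ^ 3)) :=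
  Real.le_sqrt_of_sq_le (((hf k).pd i).l4_of_sq_le (Real.sqrt_nonneg _) (Real.sqrt_nonneg _)
    (nrm_pd_le_vgsq f i k) (gsq_pd_le_vhsq hf i k))

/-! ### Weak forms of the Stokes system -/

namespace IsStokes

variable {u F : Fin 2 → Plane → ℝ} {P : Plane → ℝ}

lemma sum_integral_mul_lap (h : IsStokes u P F) {w : Fin 2 → Plane → ℝ} (hw : ∀ k, Hs (w k))
    (hdiv : ∀ x, ∑ i, pd i (w i) x = 0) :
    ∑ k, ∫ x, w k x * lap (u k) x = - ∑ k, ∫ x, w k x * F k x := by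
  have h0 := sum_integral_mul_pd_eq_zero hw hdiv h.hP h.hp
  rw [← sub_eq_zero, sub_neg_eq_add, ← Finset.sum_add_distrib, ← h0]
  refine Finset.sum_congr rfl fun k _ => ?_
  rw [← integral_add ((hw k).integrable_mul (h.hu k).lap) ((hw k).integrable_mul (h.hF k))]
  congr 1
  funext x
  rw [← h.eq k x]
  ring

lemma sum_integral_mul (h : IsStokes u P F) : ∑ k, ∫ x, u k x * F k x = vgsq u := by
  have h1 := h.sum_integral_mul_lap h.hu h.div
  rw [← neg_eq_iff_eq_neg] at h1
  rw [← h1, vgsq, ← Finset.sum_neg_distrib]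
  refine Finset.sum_congr rfl fun k _ => ?_
  rw [(h.hu k).integral_mul_lap (h.hu k), neg_neg, gsq]
  simp only [sqn, sq]

end IsStokes

/-! ### Time derivatives of quadratic quantities -/

lemma hasDerivWithinAt_sqn {f : ℝ → Plane → ℝ} (hf : Sm f) {t : ℝ} (ht : 0 ≤ t) :
    HasDerivWithinAt (fun t => sqn (f t)) (2 * ∫ x, dt f t x * f t x) (Ici 0) t := by
  have h := hasDerivWithinAt_ip hf hf ht
  rw [ip_comm f (dt f), ← two_mul] at h
  refine h.congr_of_mem (fun s _ => ?_) ht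
  simp only [sqn, ip, sq]

lemma hasDerivWithinAt_gsq {f : ℝ → Plane → ℝ} (hf : Sm f) {t : ℝ} (ht : 0 ≤ t) :
    HasDerivWithinAt (fun t => gsq (f t)) (-2 * ∫ x, dt f t x * lap (f t) x) (Ici 0) t := by
  have h := HasDerivWithinAt.fun_sum fun i (_ : i ∈ (Finset.univ : Finset (Fin 2))) =>
    hasDerivWithinAt_sqn (hf.xd i) ht
  refine HasDerivWithinAt.congr_deriv (f := fun t => gsq (f t)) h (Eq.symm ?_)
  rw [(hf.hs ht).integral_mul_lap (hf.dt.hs ht), neg_mul_neg, Finset.mul_sum]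
  refine Finset.sum_congr rfl fun i _ => ?_
  congr 2
  funext x
  rw [hf.smooth.dt_xd i ht]
  rfl

lemma continuousOn_sqn {f : ℝ → Plane → ℝ} (hf : Sm f) :
    ContinuousOn (fun t => sqn (f t)) (Ici 0) := fun _ ht =>
  (hasDerivWithinAt_sqn hf ht).continuousWithinAt

lemma sum_xd_dt_eq_zero {f : Fin 2 → ℝ → Plane → ℝ} (hf : ∀ i, Sm (f i))
    (hdiv : ∀ t, 0 ≤ t → ∀ x, ∑ i, xd i (f i) t x = 0) {t : ℝ} (ht : 0 ≤ t) (x : Plane) :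
    ∑ i, xd i (dt (f i)) t x = 0 := by
  simp only [← fun i => (hf i).smooth.dt_xd i ht x]
  have h2 := HasDerivWithinAt.fun_sum fun i (_ : i ∈ (Finset.univ : Finset (Fin 2))) =>
    ((hf i).xd i).smooth.hasDerivWithinAt ht x
  have h3 : HasDerivWithinAt (fun s => ∑ i, xd i (f i) s x) 0 (Ici 0) t :=
    (hasDerivWithinAt_const t (Ici 0) (0 : ℝ)).congr (fun s hs => hdiv s hs x) (hdiv t ht x)
  exact (uniqueDiffOn_Ici (0 : ℝ) t ht).eq_deriv _ h2 h3

/-- The weighted square norm `∫ ρ f²`. -/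
def wsq (ϱ : ℝ → Plane → ℝ) (f : ℝ → Plane → ℝ) (t : ℝ) : ℝ := ∫ x, (1 + ϱ t x) * f t x ^ 2

namespace Sol

variable {ϱ P : ℝ → Plane → ℝ} {u : Fin 2 → ℝ → Plane → ℝ}

/-- Transport by the flow: the weighted square norm evolves by the material derivative. -/
lemma hasDerivWithinAt_wsq (h : Sol ϱ u P) {f : ℝ → Plane → ℝ} (hf : Sm f) {t : ℝ} (ht : 0 ≤ t) :
    HasDerivWithinAt (wsq ϱ f)
      (2 * ∫ x, (1 + ϱ t x) * (f t x * (dt f t x + ∑ i, u i t x * xd i f t x))) (Ici 0) t := by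
  have hs := hf.hs ht
  have hr := h.hϱ.hs ht
  have hrf := h.hϱ.mul hf
  have h1 := (hasDerivWithinAt_ip hf hf ht).add (hasDerivWithinAt_ip hrf hf ht)
  have h2 : HasDerivWithinAt (wsq ϱ f) _ (Ici 0) t := h1.congr_of_mem (fun s hs => by
    simp only [wsq, ip, Pi.add_apply]
    rw [← integral_add ((hf.hs hs).integrable_mul (hf.hs hs))
      ((hrf.hs hs).integrable_mul (hf.hs hs))]
    congr 1; funext x; ring) ht
  convert h2 using 1
  have hH : Hs fun x => f t x * f t x + ϱ t x * (f t x * f t x) :=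
    (hs.mul hs).add (hr.mul (hs.mul hs))
  have hz := integral_transport_eq_zero (fun i => (h.hu i).hs ht) (h.div t ht) hH
  have hui : ∀ i, Integrable fun x => u i t x *
      pd i (fun x => f t x * f t x + ϱ t x * (f t x * f t x)) x := fun i =>
    ((h.hu i).hs ht).integrable_mul (hH.pd i)
  rw [← integral_finsetSum _ fun i _ => hui i] at hz
  simp only [ip]
  have i1 : Integrable fun x => dt f t x * f t x := (hf.dt.hs ht).integrable_mul hs
  have i2 : Integrable fun x => f t x * dt f t x := hs.integrable_mul (hf.dt.hs ht)
  have i3 : Integrable fun x => dt (fun t x => ϱ t x * f t x) t x * f t x :=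
    (hrf.dt.hs ht).integrable_mul hs
  have i4 : Integrable fun x => (ϱ t x * f t x) * dt f t x :=
    (hrf.hs ht).integrable_mul (hf.dt.hs ht)
  have i5 := integrable_finsetSum Finset.univ fun i _ => hui i
  rw [← integral_add i1 i2, ← integral_add i3 i4, ← integral_add (i1.fun_add i2) (i3.fun_add i4),
    ← add_zero (∫ x, _ + _), ← hz, ← integral_add ((i1.fun_add i2).fun_add (i3.fun_add i4)) i5,
    ← integral_const_mul]
  congr 1
  funext x
  have e : ∀ i, pd i (fun x => f t x * f t x + ϱ t x * (f t x * f t x)) x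
      = 2 * (1 + ϱ t x) * (f t x * xd i f t x) + xd i ϱ t x * f t x ^ 2 := by
    intro i
    rw [pd_add (hs.mul hs).diff (hr.mul (hs.mul hs)).diff, pd_mul hr.diff (hs.mul hs).diff,
      pd_mul hs.diff hs.diff]
    simp only [xd]
    ring
  have h3 := h.mass t ht x
  rw [h.hϱ.smooth.dt_mul hf.smooth ht]
  simp only [e, Fin.sum_univ_two] at h3 ⊢
  linear_combination (- f t x ^ 2) * h3

end Sol

/-! ### Norms of time dependent vector fields -/

/-- `‖v(t)‖_{L²}`. -/
def n0 (v : Fin 2 → ℝ → Plane → ℝ) (t : ℝ) : ℝ := Real.sqrt (vsq fun k => v k t)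

/-- `‖∇v(t)‖_{L²}`. -/
def n1 (v : Fin 2 → ℝ → Plane → ℝ) (t : ℝ) : ℝ := Real.sqrt (vgsq fun k => v k t)

/-- `‖∇²v(t)‖_{L²}`. -/
def n2 (v : Fin 2 → ℝ → Plane → ℝ) (t : ℝ) : ℝ := Real.sqrt (vhsq fun k => v k t)

/-- The bound for the `L⁴` norm of `v`. -/
def b0 (v : Fin 2 → ℝ → Plane → ℝ) (t : ℝ) : ℝ := Real.sqrt (2 * (n0 v t * n1 v t))

/-- The bound for the `L⁴` norm of `∇v`. -/
def b1 (v : Fin 2 → ℝ → Plane → ℝ) (t : ℝ) : ℝ := Real.sqrt (2 * (n1 v t * n2 v t))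

/-- The bound for the square of the `L⁸` norm of `v`. -/
def e0 (v : Fin 2 → ℝ → Plane → ℝ) (t : ℝ) : ℝ := Real.sqrt (9 * (n0 v t * n1 v t ^ 3))

/-- The bound for the square of the `L⁸` norm of `∇v`. -/
def e1 (v : Fin 2 → ℝ → Plane → ℝ) (t : ℝ) : ℝ := Real.sqrt (9 * (n1 v t * n2 v t ^ 3))

section Norms

variable (v : Fin 2 → ℝ → Plane → ℝ) (t : ℝ)

lemma n0_nonneg : 0 ≤ n0 v t := Real.sqrt_nonneg _
lemma n1_nonneg : 0 ≤ n1 v t := Real.sqrt_nonneg _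
lemma n2_nonneg : 0 ≤ n2 v t := Real.sqrt_nonneg _
lemma b0_nonneg : 0 ≤ b0 v t := Real.sqrt_nonneg _
lemma b1_nonneg : 0 ≤ b1 v t := Real.sqrt_nonneg _
lemma e0_nonneg : 0 ≤ e0 v t := Real.sqrt_nonneg _
lemma e1_nonneg : 0 ≤ e1 v t := Real.sqrt_nonneg _

lemma n0_sq : n0 v t ^ 2 = vsq fun k => v k t := Real.sq_sqrt (vsq_nonneg _)
lemma n1_sq : n1 v t ^ 2 = vgsq fun k => v k t := Real.sq_sqrt (vgsq_nonneg _)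
lemma n2_sq : n2 v t ^ 2 = vhsq fun k => v k t := Real.sq_sqrt (vhsq_nonneg _)

lemma b0_sq : b0 v t ^ 2 = 2 * (n0 v t * n1 v t) :=
  Real.sq_sqrt (by have := n0_nonneg v t; have := n1_nonneg v t; positivity)

lemma b1_sq : b1 v t ^ 2 = 2 * (n1 v t * n2 v t) :=
  Real.sq_sqrt (by have := n1_nonneg v t; have := n2_nonneg v t; positivity)

lemma e0_sq : e0 v t ^ 2 = 9 * (n0 v t * n1 v t ^ 3) :=
  Real.sq_sqrt (by have := n0_nonneg v t; have := n1_nonneg v t; positivity)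

lemma e1_sq : e1 v t ^ 2 = 9 * (n1 v t * n2 v t ^ 3) :=
  Real.sq_sqrt (by have := n1_nonneg v t; have := n2_nonneg v t; positivity)

end Norms

section Components

variable {v : Fin 2 → ℝ → Plane → ℝ} {t : ℝ}

lemma nrm_le_n0 (k : Fin 2) : nrm (v k t) ≤ n0 v t := nrm_le_vsq (fun k => v k t) k

lemma nrm_le_n1 (i k : Fin 2) : nrm (pd i (v k t)) ≤ n1 v t := nrm_pd_le_vgsq (fun k => v k t) i k

lemma nrm_le_n2 (hv : ∀ k, Hs (v k t)) (i j k : Fin 2) : nrm (pd i (pd j (v k t))) ≤ n2 v t :=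
  nrm_pd_pd_le_vhsq hv j i k

lemma l4_le_b0 (hv : ∀ k, Hs (v k t)) (k : Fin 2) : l4 (v k t) ≤ b0 v t := l4_le_vsq hv k

lemma l4_le_b1 (hv : ∀ k, Hs (v k t)) (i k : Fin 2) : l4 (pd i (v k t)) ≤ b1 v t :=
  l4_pd_le_vgsq hv i k

lemma l4_le_e0 (hv : ∀ k, Hs (v k t)) (k l : Fin 2) :
    l4 (fun x => v k t x * v l t x) ≤ e0 v t := by
  refine abs_le_of_sq_le_sq' ?_ (e0_nonneg v t) |>.2
  refine ((hv k).l4_mul_sq_le (hv l)).trans ?_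
  rw [sq]
  exact mul_le_mul (l4_of_sq_le_vsq hv k) (l4_of_sq_le_vsq hv l) (l4_nonneg _) (e0_nonneg v t)

lemma l4_sq_le_e0_mul_e1 (hv : ∀ k, Hs (v k t)) (i k l : Fin 2) :
    l4 (fun x => v k t x * pd i (v l t) x) ^ 2 ≤ e0 v t * e1 v t :=
  ((hv k).l4_mul_sq_le ((hv l).pd i)).trans
    (mul_le_mul (l4_of_sq_le_vsq hv k) (l4_of_pd_sq_le_vgsq hv i l) (l4_nonneg _) (e0_nonneg v t))

end Components

lemma Hs.nrm_mul_le_of_le {f g : Plane → ℝ} (hf : Hs f) (hg : Hs g) {a b : ℝ} (h1 : l4 f ≤ a)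
    (h2 : l4 g ≤ b) : nrm (fun x => f x * g x) ≤ a * b :=
  (hf.nrm_mul_le hg).trans (mul_le_mul h1 h2 (l4_nonneg _) ((l4_nonneg _).trans h1))

lemma Hs.abs_integral_weight_le_of_le {f g : Plane → ℝ} (hf : Hs f) (hg : Hs g) {r : Plane → ℝ}
    {c a b : ℝ} (hr : ∀ x, |r x| ≤ c) (h1 : nrm f ≤ a) (h2 : nrm g ≤ b) :
    |∫ x, r x * (f x * g x)| ≤ c * (a * b) :=
  (hf.abs_integral_weight_le hg hr).trans (mul_le_mul_of_nonneg_left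
    (mul_le_mul h1 h2 (nrm_nonneg _) ((nrm_nonneg _).trans h1)) ((abs_nonneg _).trans (hr 0)))

/-! ### Young inequalities -/

lemma le_add_of_sq_le_mul {T A B : ℝ} (hA : 0 ≤ A) (hB : 0 ≤ B) (h : T ^ 2 ≤ A * B) :
    T ≤ A + B := by
  refine (abs_le_of_sq_le_sq' (h.trans ?_) (by positivity)).2
  nlinarith

lemma le_add_of_pow_four_le {T A B : ℝ} (hA : 0 ≤ A) (hB : 0 ≤ B) (h : T ^ 4 ≤ A ^ 3 * B) :
    T ≤ A + B := by
  by_contra hlt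
  push Not at hlt
  have h1 : (A + B) ^ 4 < T ^ 4 := pow_lt_pow_left₀ hlt (by positivity) (by norm_num)
  have h2 : A ^ 3 * B ≤ (A + B) ^ 4 := by
    have : A ^ 3 * B ≤ (A + B) ^ 3 * (A + B) := by gcongr <;> linarith
    linarith [pow_succ (A + B) 3]
  linarith

/-! ### Derivatives along the solution -/

namespace Sol

variable {ϱ P : ℝ → Plane → ℝ} {u : Fin 2 → ℝ → Plane → ℝ} {t : ℝ}

lemma dt_acc (h : Sol ϱ u P) (k : Fin 2) (ht : 0 ≤ t) (x : Plane) :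
    dt (acc u k) t x = dt (dt (u k)) t x
      + ∑ i, (dt (u i) t x * xd i (u k) t x + u i t x * xd i (dt (u k)) t x) := by
  have h1 : HasDerivWithinAt (fun s => acc u k s x) (dt (dt (u k)) t x
      + ∑ i, (dt (u i) t x * xd i (u k) t x + u i t x * xd i (dt (u k)) t x)) (Ici 0) t := by
    refine ((h.hu k).dt.smooth.hasDerivWithinAt ht x).add
      (HasDerivWithinAt.fun_sum fun i _ => ?_)
    have := ((h.hu i).smooth.hasDerivWithinAt ht x).mul
      (((h.hu k).xd i).smooth.hasDerivWithinAt ht x)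
    rw [(h.hu k).smooth.dt_xd i ht] at this
    exact this
  exact h1.derivWithin (uniqueDiffOn_Ici 0 t ht)

lemma dt_frc (h : Sol ϱ u P) (k : Fin 2) (ht : 0 ≤ t) (x : Plane) :
    dt (frc ϱ u k) t x = -(dt ϱ t x * acc u k t x + (1 + ϱ t x) * dt (acc u k) t x) := by
  have h1 := (((h.hϱ.smooth.hasDerivWithinAt ht x).const_add 1).mul
    ((h.hacc k).smooth.hasDerivWithinAt ht x)).neg
  exact h1.derivWithin (uniqueDiffOn_Ici 0 t ht)

lemma pd_acc (h : Sol ϱ u P) (i k : Fin 2) (ht : 0 ≤ t) (x : Plane) :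
    pd i (acc u k t) x = pd i (dt (u k) t) x
      + ∑ j, (pd i (u j t) x * pd j (u k t) x + u j t x * pd i (pd j (u k t)) x) := by
  have hs : ∀ j, Hs fun x => u j t x * pd j (u k t) x := fun j =>
    ((h.hu j).hs ht).mul (((h.hu k).hs ht).pd j)
  have e : acc u k t = fun x => dt (u k) t x + ∑ j, u j t x * pd j (u k t) x := rfl
  rw [e, pd_add ((h.hu k).dt.hs ht).diff (Hs.sum _ fun j _ => hs j).diff,
    pd_sum _ fun j _ => (hs j).diff]
  simp only [fun j => pd_mul ((h.hu j).hs ht).diff (((h.hu k).hs ht).pd j).diff i]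

/-- Integration by parts against `∂ₜρ`. -/
lemma integral_dt_mul (h : Sol ϱ u P) (ht : 0 ≤ t) {g : Plane → ℝ} (hg : Hs g) :
    ∫ x, dt ϱ t x * g x = ∑ i, ∫ x, ϱ t x * (u i t x * pd i g x) := by
  have hr := h.hϱ.hs ht
  have hu := fun i => (h.hu i).hs ht
  have hz := integral_transport_eq_zero hu (h.div t ht) (hr.mul hg)
  have i1 : ∀ i, Integrable fun x => u i t x * pd i (fun x => ϱ t x * g x) x := fun i =>
    (hu i).integrable_mul ((hr.mul hg).pd i)
  have i2 : ∀ i, Integrable fun x => ϱ t x * (u i t x * pd i g x) := fun i =>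
    hr.integrable_mul ((hu i).mul (hg.pd i))
  rw [← integral_finsetSum _ fun i _ => i1 i] at hz
  rw [← integral_finsetSum _ fun i _ => i2 i, ← sub_eq_zero, ← neg_eq_zero.2 hz, ← integral_neg,
    ← integral_sub ((h.hϱ.dt.hs ht).integrable_mul hg) (integrable_finsetSum _ fun i _ => i2 i)]
  congr 1
  funext x
  have h3 := h.mass t ht x
  simp only [pd_mul hr.diff hg.diff, Fin.sum_univ_two, xd] at h3 ⊢
  linear_combination g x * h3

lemma abs_one_add_le (h : Sol ϱ u P) (ht : 0 ≤ t) (x : Plane) : |1 + ϱ t x| ≤ 5 / 4 := by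
  have := _root_.abs_le.1 (h.abs_le ht x)
  rw [_root_.abs_le]
  constructor <;> linarith

lemma wsq_bounds (h : Sol ϱ u P) (ht : 0 ≤ t) {f : ℝ → Plane → ℝ} (hf : Hs (f t)) :
    3 / 4 * sqn (f t) ≤ wsq ϱ f t ∧ wsq ϱ f t ≤ 5 / 4 * sqn (f t) := by
  have hi : Integrable fun x => (1 + ϱ t x) * f t x ^ 2 := by
    have := hf.integrable_sq.fun_add ((h.hϱ.hs ht).integrable_mul hf.sq)
    refine this.congr (ae_of_all _ fun x => ?_)
    simp only
    ring
  constructor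
  · rw [sqn, wsq, ← integral_const_mul]
    refine integral_mono (hf.integrable_sq.const_mul _) hi fun x => ?_
    have := _root_.abs_le.1 (h.abs_le ht x)
    exact mul_le_mul_of_nonneg_right (by linarith) (sq_nonneg _)
  · rw [sqn, wsq, ← integral_const_mul]
    refine integral_mono hi (hf.integrable_sq.const_mul _) fun x => ?_
    have := _root_.abs_le.1 (h.abs_le ht x)
    exact mul_le_mul_of_nonneg_right (by linarith) (sq_nonneg _)

/-- The kinetic energy `∫ ρ|u|²`. -/
def kin (ϱ : ℝ → Plane → ℝ) (u : Fin 2 → ℝ → Plane → ℝ) (t : ℝ) : ℝ := ∑ k, wsq ϱ (u k) t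

lemma kin_bounds (h : Sol ϱ u P) (ht : 0 ≤ t) {v : Fin 2 → ℝ → Plane → ℝ} (hv : ∀ k, Sm (v k)) :
    3 / 4 * n0 v t ^ 2 ≤ kin ϱ v t ∧ kin ϱ v t ≤ 5 / 4 * n0 v t ^ 2 := by
  have := fun k => h.wsq_bounds ht ((hv k).hs ht)
  rw [n0_sq, kin, vsq, Finset.mul_sum, Finset.mul_sum]
  exact ⟨Finset.sum_le_sum fun k _ => (this k).1, Finset.sum_le_sum fun k _ => (this k).2⟩

/-- The energy identity. -/
lemma hasDerivWithinAt_kin (h : Sol ϱ u P) (ht : 0 ≤ t) :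
    HasDerivWithinAt (kin ϱ u) (-2 * n1 u t ^ 2) (Ici 0) t := by
  have h1 := HasDerivWithinAt.fun_sum fun k (_ : k ∈ (Finset.univ : Finset (Fin 2))) =>
    h.hasDerivWithinAt_wsq (h.hu k) ht
  refine HasDerivWithinAt.congr_deriv (f := kin ϱ u) h1 ?_
  have h2 := (h.stokes ht).sum_integral_mul
  rw [n1_sq, ← h2, ← Finset.mul_sum, neg_mul, ← mul_neg, ← Finset.sum_neg_distrib]
  congr 1
  refine Finset.sum_congr rfl fun k _ => ?_
  rw [← integral_neg]
  congr 1
  funext x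
  simp only [frc, acc]
  ring

end Sol

lemma Hs.nrm_sum_le {F : Fin 2 → Plane → ℝ} (hF : ∀ i, Hs (F i)) {a : ℝ} (h : ∀ i, nrm (F i) ≤ a) :
    nrm (fun x => ∑ i, F i x) ≤ 2 * a := by
  simp only [Fin.sum_univ_two]
  linarith [nrm_add_le (hF 0).memL2 (hF 1).memL2, h 0, h 1]

lemma vsq_le_of_nrm_le {F : Fin 2 → Plane → ℝ} {a : ℝ} (h : ∀ k, nrm (F k) ≤ a) :
    vsq F ≤ 2 * a ^ 2 := by
  have h1 : ∀ k, sqn (F k) ≤ a ^ 2 := fun k => by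
    rw [← nrm_sq]; exact pow_le_pow_left₀ (nrm_nonneg _) (h k) 2
  simp only [vsq, Fin.sum_univ_two]
  linarith [h1 0, h1 1]

namespace Sol

variable {ϱ P : ℝ → Plane → ℝ} {u : Fin 2 → ℝ → Plane → ℝ} {t : ℝ}

/-- The time derivative of a vector field, component by component. -/
def vdt (v : Fin 2 → ℝ → Plane → ℝ) : Fin 2 → ℝ → Plane → ℝ := fun k => dt (v k)

/-- The quantity `∫ ρ|∂ₜu|² + ‖∇u‖⁴`. -/
def eX (ϱ : ℝ → Plane → ℝ) (u : Fin 2 → ℝ → Plane → ℝ) (t : ℝ) : ℝ :=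
  kin ϱ (vdt u) t + n1 u t ^ 4

lemma n0_vdt_sq_le (h : Sol ϱ u P) (ht : 0 ≤ t) : n0 (vdt u) t ^ 2 ≤ 2 * eX ϱ u t := by
  have := (h.kin_bounds ht fun k => (h.hu k).dt).1
  have h2 : 0 ≤ n1 u t ^ 4 := by positivity
  change 3 / 4 * n0 (vdt u) t ^ 2 ≤ kin ϱ (vdt u) t at this
  unfold eX
  nlinarith [sq_nonneg (n0 (vdt u) t)]

lemma eX_nonneg (h : Sol ϱ u P) (ht : 0 ≤ t) : 0 ≤ eX ϱ u t := by
  have := h.n0_vdt_sq_le ht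
  nlinarith [sq_nonneg (n0 (vdt u) t)]

lemma n1_pow_four_le (h : Sol ϱ u P) (ht : 0 ≤ t) : n1 u t ^ 4 ≤ eX ϱ u t := by
  have := (h.kin_bounds ht fun k => (h.hu k).dt).1
  change 3 / 4 * n0 (vdt u) t ^ 2 ≤ kin ϱ (vdt u) t at this
  unfold eX
  nlinarith [sq_nonneg (n0 (vdt u) t)]

lemma nrm_convection_le (h : Sol ϱ u P) (ht : 0 ≤ t) (k : Fin 2) :
    nrm (fun x => ∑ i, u i t x * pd i (u k t) x) ≤ 2 * (b0 u t * b1 u t) := by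
  have hs := fun k => (h.hu k).hs ht
  exact Hs.nrm_sum_le (fun i => (hs i).mul ((hs k).pd i)) fun i =>
    (hs i).nrm_mul_le_of_le ((hs k).pd i) (l4_le_b0 hs i) (l4_le_b1 hs i k)

/-- The Stokes estimate for the velocity. -/
lemma n2_sq_le (h : Sol ϱ u P) (ht : 0 ≤ t) : n2 u t ^ 2 ≤ 25 / 16 * n0 (acc u) t ^ 2 := by
  have h1 := (h.stokes ht).energy
  have h2 : ∀ k, sqn (frc ϱ u k t) ≤ 25 / 16 * sqn (acc u k t) := fun k => by
    have := sqn_mul_le_of_bound (f := fun x => -(1 + ϱ t x)) (C := 5 / 4)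
      (fun x => by rw [abs_neg]; exact h.abs_one_add_le ht x) ((h.hacc k).hs ht).memL2
    norm_num at this
    refine le_trans (le_of_eq ?_) this
    congr 1
    funext x
    simp only [frc]
    ring
  have h3 : 0 ≤ ∑ k, sqn (pd k (P t)) := Finset.sum_nonneg fun _ _ => sqn_nonneg _
  rw [n2_sq, n0_sq, vhsq, vsq, Finset.mul_sum]
  have h4 := Finset.sum_le_sum fun k (_ : k ∈ (Finset.univ : Finset (Fin 2))) => h2 k
  linarith

lemma n2_le (h : Sol ϱ u P) (ht : 0 ≤ t) : n2 u t ≤ 5 / 4 * n0 (acc u) t := by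
  refine (abs_le_of_sq_le_sq' ?_ (by have := n0_nonneg (acc u) t; positivity)).2
  have := h.n2_sq_le ht
  nlinarith

lemma convection_sq_le (h : Sol ϱ u P) (ht : 0 ≤ t) :
    (b0 u t * b1 u t) ^ 2 ≤ 5 * (n0 u t * n1 u t ^ 2 * n0 (acc u) t) := by
  have h0 := n0_nonneg u t
  have h1 := n1_nonneg u t
  have h3 := mul_le_mul_of_nonneg_left (h.n2_le ht) (by positivity : 0 ≤ n0 u t * n1 u t ^ 2)
  rw [mul_pow, b0_sq, b1_sq]
  nlinarith

lemma n0_acc_sq_le (h : Sol ϱ u P) (ht : 0 ≤ t) {B : ℝ} (hB1 : 1 ≤ B) (hB : n0 u t ^ 2 ≤ B) :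
    n0 (acc u) t ^ 2 ≤ 12800 * (B * eX ϱ u t) := by
  have hw : ∀ k, nrm (acc u k t) ≤ n0 (vdt u) t + 2 * (b0 u t * b1 u t) := fun k => by
    have h1 := h.nrm_convection_le ht k
    have h2 := nrm_add_le ((h.hu k).dt.hs ht).memL2
      (Hs.sum Finset.univ fun i _ => ((h.hu i).hs ht).mul (((h.hu k).hs ht).pd i)).memL2
    have h3 : nrm (dt (u k) t) ≤ n0 (vdt u) t := nrm_le_n0 (v := vdt u) k
    exact h2.trans (add_le_add h3 h1)
  have h1 := vsq_le_of_nrm_le hw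
  rw [← n0_sq] at h1
  have h2 := h.convection_sq_le ht
  have h3 := h.n0_vdt_sq_le ht
  have h4 := h.n1_pow_four_le ht
  have h5 := h.eX_nonneg ht
  have h6 : n0 u t ^ 2 * n1 u t ^ 4 ≤ B * eX ϱ u t :=
    mul_le_mul hB h4 (by positivity) (by linarith)
  have h7 : eX ϱ u t ≤ B * eX ϱ u t := le_mul_of_one_le_left h5 hB1
  have h8 : 80 * (n0 u t * n1 u t ^ 2 * n0 (acc u) t)
      ≤ 1 / 2 * n0 (acc u) t ^ 2 + 3200 * (n0 u t ^ 2 * n1 u t ^ 4) := by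
    nlinarith [sq_nonneg (n0 (acc u) t - 80 * (n0 u t * n1 u t ^ 2))]
  nlinarith [sq_nonneg (n0 (vdt u) t - 2 * (b0 u t * b1 u t))]

lemma n2_sq_le_eX (h : Sol ϱ u P) (ht : 0 ≤ t) {B : ℝ} (hB1 : 1 ≤ B) (hB : n0 u t ^ 2 ≤ B) :
    n2 u t ^ 2 ≤ 20000 * (B * eX ϱ u t) := by
  have h1 := h.n2_sq_le ht
  have h2 := h.n0_acc_sq_le ht hB1 hB
  linarith

/-- The derivative of `‖∇u‖²`. -/
def dN1 (ϱ : ℝ → Plane → ℝ) (u : Fin 2 → ℝ → Plane → ℝ) (t : ℝ) : ℝ :=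
  2 * ∑ k, ∫ x, dt (u k) t x * frc ϱ u k t x

lemma hasDerivWithinAt_vgsq_of_stokes {v F : Fin 2 → ℝ → Plane → ℝ} {Q : Plane → ℝ}
    (hv : ∀ k, Sm (v k)) (hdiv : ∀ t, 0 ≤ t → ∀ x, ∑ i, xd i (v i) t x = 0) (ht : 0 ≤ t)
    (hS : IsStokes (fun k => v k t) Q (fun k => F k t)) :
    HasDerivWithinAt (fun t => n1 v t ^ 2) (2 * ∑ k, ∫ x, dt (v k) t x * F k t x) (Ici 0) t := by
  have h1 := HasDerivWithinAt.fun_sum fun k (_ : k ∈ (Finset.univ : Finset (Fin 2))) =>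
    hasDerivWithinAt_gsq (hv k) ht
  have e : (fun t => n1 v t ^ 2) = fun t => ∑ k, gsq (v k t) := funext fun t => n1_sq v t
  rw [e]
  refine HasDerivWithinAt.congr_deriv h1 ?_
  have h2 := hS.sum_integral_mul_lap (fun k => (hv k).dt.hs ht) (fun x => sum_xd_dt_eq_zero hv hdiv ht x)
  rw [← Finset.mul_sum, h2]
  ring

lemma hasDerivWithinAt_n1_sq (h : Sol ϱ u P) (ht : 0 ≤ t) :
    HasDerivWithinAt (fun t => n1 u t ^ 2) (dN1 ϱ u t) (Ici 0) t :=
  hasDerivWithinAt_vgsq_of_stokes h.hu h.div ht (h.stokes ht)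

lemma dN1_add_le (h : Sol ϱ u P) (ht : 0 ≤ t) :
    dN1 ϱ u t + n0 (acc u) t ^ 2 ≤ 2000000 * (n0 u t ^ 2 * n1 u t ^ 4) := by
  set μ := n0 (acc u) t with hμ
  have hμ0 : 0 ≤ μ := n0_nonneg _ _
  have hc0 : 0 ≤ b0 u t * b1 u t := mul_nonneg (b0_nonneg _ _) (b1_nonneg _ _)
  let c : Fin 2 → Plane → ℝ := fun k x => ∑ i, u i t x * pd i (u k t) x
  have hc : ∀ k, Hs (c k) := fun k =>
    Hs.sum _ fun i _ => ((h.hu i).hs ht).mul (((h.hu k).hs ht).pd i)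
  have ha : ∀ k, Hs (acc u k t) := fun k => (h.hacc k).hs ht
  have hk : ∀ k, ∫ x, dt (u k) t x * frc ϱ u k t x
      ≤ -(3 / 4) * sqn (acc u k t) + 5 / 4 * (μ * (2 * (b0 u t * b1 u t))) := by
    intro k
    have h1 : |∫ x, (1 + ϱ t x) * (acc u k t x * c k x)| ≤ 5 / 4 * (μ * (2 * (b0 u t * b1 u t))) :=
      (ha k).abs_integral_weight_le_of_le (hc k) (h.abs_one_add_le ht) (nrm_le_n0 k)
      (h.nrm_convection_le ht k)
    have h2 := (h.wsq_bounds ht (f := acc u k) (ha k)).1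
    have i1 : Integrable fun x => (1 + ϱ t x) * (acc u k t x * c k x) :=
      (((ha k).integrable_mul (hc k)).fun_add
        ((h.hϱ.hs ht).integrable_mul ((ha k).mul (hc k)))).congr
        (ae_of_all _ fun x => by simp only; ring)
    have i2 : Integrable fun x => (1 + ϱ t x) * acc u k t x ^ 2 :=
      ((ha k).integrable_sq.fun_add ((h.hϱ.hs ht).integrable_mul (ha k).sq)).congr
        (ae_of_all _ fun x => by simp only; ring)
    have e : ∫ x, dt (u k) t x * frc ϱ u k t x
        = (∫ x, (1 + ϱ t x) * (acc u k t x * c k x)) - wsq ϱ (acc u k) t := by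
      rw [wsq, ← integral_sub i1 i2]
      congr 1
      funext x
      simp only [frc, acc, c, xd]
      ring
    rw [e]
    linarith [le_abs_self (∫ x, (1 + ϱ t x) * (acc u k t x * c k x))]
  have h1 : dN1 ϱ u t ≤ -(3 / 2) * μ ^ 2 + 10 * (μ * (b0 u t * b1 u t)) := by
    have e : μ ^ 2 = sqn (acc u 0 t) + sqn (acc u 1 t) := by
      rw [hμ, n0_sq, vsq, Fin.sum_univ_two]
    simp only [dN1, Fin.sum_univ_two]
    linarith [hk 0, hk 1]
  have h2 : 10 * (μ * (b0 u t * b1 u t)) ≤ 1 / 2 * μ ^ 2 + 2000000 * (n0 u t ^ 2 * n1 u t ^ 4) := by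
    refine le_add_of_pow_four_le (by positivity) (by positivity) ?_
    have h3 := pow_le_pow_left₀ (sq_nonneg _) (h.convection_sq_le ht) 2
    rw [← hμ] at h3
    calc (10 * (μ * (b0 u t * b1 u t))) ^ 4
        = 10000 * μ ^ 4 * ((b0 u t * b1 u t) ^ 2) ^ 2 := by ring
      _ ≤ 10000 * μ ^ 4 * (5 * (n0 u t * n1 u t ^ 2 * μ)) ^ 2 := by gcongr
      _ = (1 / 2 * μ ^ 2) ^ 3 * (2000000 * (n0 u t ^ 2 * n1 u t ^ 4)) := by ring
  linarith

/-- The derivative of `∫ ρ|∂ₜu|²`. -/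
def dW (ϱ : ℝ → Plane → ℝ) (u : Fin 2 → ℝ → Plane → ℝ) (t : ℝ) : ℝ :=
  ∑ k, 2 * ∫ x, (1 + ϱ t x) * (dt (u k) t x * (dt (dt (u k)) t x
    + ∑ i, u i t x * xd i (dt (u k)) t x))

lemma hasDerivWithinAt_kin_vdt (h : Sol ϱ u P) (ht : 0 ≤ t) :
    HasDerivWithinAt (kin ϱ (vdt u)) (dW ϱ u t) (Ici 0) t :=
  HasDerivWithinAt.fun_sum fun k (_ : k ∈ (Finset.univ : Finset (Fin 2))) =>
    h.hasDerivWithinAt_wsq (h.hu k).dt ht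

lemma abs_integral_dt_mul_le (h : Sol ϱ u P) (ht : 0 ≤ t) (k : Fin 2) :
    |∫ x, dt ϱ t x * (dt (u k) t x * acc u k t x)|
      ≤ n1 (vdt u) t * (b0 u t * b0 (vdt u) t) + n1 (vdt u) t * (e0 u t * b1 u t)
        + b0 u t * b0 (vdt u) t * b1 u t ^ 2 + e0 u t * b0 (vdt u) t * n2 u t := by
  have hu := fun k => (h.hu k).hs ht
  have hw : ∀ k, Hs (dt (u k) t) := fun k => (h.hu k).dt.hs ht
  have ha : ∀ k, Hs (acc u k t) := fun k => (h.hacc k).hs ht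
  have hr := h.abs_le ht
  have hrs := h.hϱ.hs ht
  have lw : l4 (dt (u k) t) ≤ b0 (vdt u) t := l4_le_b0 (v := vdt u) hw k
  have hi : ∀ i, |∫ x, ϱ t x * (u i t x * pd i (fun x => dt (u k) t x * acc u k t x) x)|
      ≤ 1 / 4 * (n1 (vdt u) t * (b0 u t * b0 (vdt u) t) + 2 * (n1 (vdt u) t * (e0 u t * b1 u t)))
        + 1 / 4 * (b0 u t * b0 (vdt u) t * n1 (vdt u) t)
        + 2 * (1 / 4 * (b0 u t * b0 (vdt u) t * b1 u t ^ 2))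
        + 2 * (1 / 4 * (e0 u t * b0 (vdt u) t * n2 u t)) := by
    intro i
    have nw : nrm (pd i (dt (u k) t)) ≤ n1 (vdt u) t := nrm_le_n1 (v := vdt u) i k
    have huw : nrm (fun x => u i t x * dt (u k) t x) ≤ b0 u t * b0 (vdt u) t :=
      (hu i).nrm_mul_le_of_le (hw k) (l4_le_b0 hu i) lw
    have hua : nrm (fun x => u i t x * acc u k t x)
        ≤ b0 u t * b0 (vdt u) t + 2 * (e0 u t * b1 u t) := by
      have e : (fun x => u i t x * acc u k t x) = fun x => u i t x * dt (u k) t x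
          + ∑ j, u i t x * u j t x * pd j (u k t) x := by
        funext x
        simp only [acc, mul_add, Finset.mul_sum, xd, mul_assoc]
      rw [e]
      have hs : ∀ j, Hs fun x => u i t x * u j t x * pd j (u k t) x := fun j =>
        ((hu i).mul (hu j)).mul ((hu k).pd j)
      refine (nrm_add_le ((hu i).mul (hw k)).memL2 (Hs.sum _ fun j _ => hs j).memL2).trans
        (add_le_add huw (Hs.nrm_sum_le hs fun j => ?_))
      exact ((hu i).mul (hu j)).nrm_mul_le_of_le ((hu k).pd j) (l4_le_e0 hu i j)
        (l4_le_b1 hu j k)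
    have t1 : |∫ x, ϱ t x * (pd i (dt (u k) t) x * (u i t x * acc u k t x))|
        ≤ 1 / 4 * (n1 (vdt u) t * (b0 u t * b0 (vdt u) t + 2 * (e0 u t * b1 u t))) :=
      ((hw k).pd i).abs_integral_weight_le_of_le ((hu i).mul (ha k)) hr nw hua
    have t2 : |∫ x, ϱ t x * (u i t x * dt (u k) t x * pd i (dt (u k) t) x)|
        ≤ 1 / 4 * (b0 u t * b0 (vdt u) t * n1 (vdt u) t) :=
      ((hu i).mul (hw k)).abs_integral_weight_le_of_le ((hw k).pd i) hr huw nw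
    have t3 : ∀ j, |∫ x, ϱ t x * (u i t x * dt (u k) t x * (pd i (u j t) x * pd j (u k t) x))|
        ≤ 1 / 4 * (b0 u t * b0 (vdt u) t * b1 u t ^ 2) := fun j => by
      refine ((hu i).mul (hw k)).abs_integral_weight_le_of_le (((hu j).pd i).mul ((hu k).pd j))
        hr huw ?_
      rw [sq]
      exact ((hu j).pd i).nrm_mul_le_of_le ((hu k).pd j) (l4_le_b1 hu i j) (l4_le_b1 hu j k)
    have t4 : ∀ j, |∫ x, ϱ t x * (u i t x * u j t x * dt (u k) t x * pd i (pd j (u k t)) x)|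
        ≤ 1 / 4 * (e0 u t * b0 (vdt u) t * n2 u t) := fun j =>
      (((hu i).mul (hu j)).mul (hw k)).abs_integral_weight_le_of_le (((hu k).pd j).pd i) hr
        (((hu i).mul (hu j)).nrm_mul_le_of_le (hw k) (l4_le_e0 hu i j) lw) (nrm_le_n2 hu i j k)
    have i1 : Integrable fun x => ϱ t x * (pd i (dt (u k) t) x * (u i t x * acc u k t x)) :=
      hrs.integrable_mul (((hw k).pd i).mul ((hu i).mul (ha k)))
    have i2 : Integrable fun x => ϱ t x * (u i t x * dt (u k) t x * pd i (dt (u k) t) x) :=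
      hrs.integrable_mul (((hu i).mul (hw k)).mul ((hw k).pd i))
    have i3 : ∀ j, Integrable fun x =>
        ϱ t x * (u i t x * dt (u k) t x * (pd i (u j t) x * pd j (u k t) x)) := fun j =>
      hrs.integrable_mul (((hu i).mul (hw k)).mul (((hu j).pd i).mul ((hu k).pd j)))
    have i4 : ∀ j, Integrable fun x =>
        ϱ t x * (u i t x * u j t x * dt (u k) t x * pd i (pd j (u k t)) x) := fun j =>
      hrs.integrable_mul ((((hu i).mul (hu j)).mul (hw k)).mul (((hu k).pd j).pd i))
    have e : ∫ x, ϱ t x * (u i t x * pd i (fun x => dt (u k) t x * acc u k t x) x)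
        = (∫ x, ϱ t x * (pd i (dt (u k) t) x * (u i t x * acc u k t x)))
        + (∫ x, ϱ t x * (u i t x * dt (u k) t x * pd i (dt (u k) t) x))
        + (∫ x, ϱ t x * (u i t x * dt (u k) t x * (pd i (u 0 t) x * pd 0 (u k t) x)))
        + (∫ x, ϱ t x * (u i t x * dt (u k) t x * (pd i (u 1 t) x * pd 1 (u k t) x)))
        + (∫ x, ϱ t x * (u i t x * u 0 t x * dt (u k) t x * pd i (pd 0 (u k t)) x))
        + ∫ x, ϱ t x * (u i t x * u 1 t x * dt (u k) t x * pd i (pd 1 (u k t)) x) := by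
      rw [← integral_add i1 i2, ← integral_add (i1.fun_add i2) (i3 0),
        ← integral_add ((i1.fun_add i2).fun_add (i3 0)) (i3 1),
        ← integral_add (((i1.fun_add i2).fun_add (i3 0)).fun_add (i3 1)) (i4 0),
        ← integral_add ((((i1.fun_add i2).fun_add (i3 0)).fun_add (i3 1)).fun_add (i4 0)) (i4 1)]
      congr 1
      funext x
      rw [pd_mul (hw k).diff (ha k).diff]
      simp only [h.pd_acc i k ht, Fin.sum_univ_two]
      ring
    rw [e]
    have s1 := _root_.abs_le.1 t1
    have s2 := _root_.abs_le.1 t2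
    have s3 := fun j => _root_.abs_le.1 (t3 j)
    have s4 := fun j => _root_.abs_le.1 (t4 j)
    rw [_root_.abs_le]
    constructor
    · linarith [s1.1, s2.1, (s3 0).1, (s3 1).1, (s4 0).1, (s4 1).1]
    · linarith [s1.2, s2.2, (s3 0).2, (s3 1).2, (s4 0).2, (s4 1).2]
  rw [h.integral_dt_mul ht ((hw k).mul (ha k)), Fin.sum_univ_two]
  refine (abs_add_le _ _).trans ?_
  linarith [hi 0, hi 1]

lemma dW_add_le (h : Sol ϱ u P) (ht : 0 ≤ t) :
    dW ϱ u t + 2 * n1 (vdt u) t ^ 2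
      ≤ 4 * (n1 (vdt u) t * (b0 u t * b0 (vdt u) t) + n1 (vdt u) t * (e0 u t * b1 u t)
        + b0 u t * b0 (vdt u) t * b1 u t ^ 2 + e0 u t * b0 (vdt u) t * n2 u t)
        + 10 * (b0 (vdt u) t ^ 2 * n1 u t) := by
  have hu := fun k => (h.hu k).hs ht
  have hw : ∀ k, Hs (dt (u k) t) := fun k => (h.hu k).dt.hs ht
  have ha : ∀ k, Hs (acc u k t) := fun k => (h.hacc k).hs ht
  have lw : ∀ k, l4 (dt (u k) t) ≤ b0 (vdt u) t := fun k => l4_le_b0 (v := vdt u) hw k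
  have t5 : ∀ i k, |∫ x, (1 + ϱ t x) * (dt (u k) t x * dt (u i) t x * pd i (u k t) x)|
      ≤ 5 / 4 * (b0 (vdt u) t ^ 2 * n1 u t) := fun i k => by
    refine ((hw k).mul (hw i)).abs_integral_weight_le_of_le ((hu k).pd i) (h.abs_one_add_le ht) ?_
      (nrm_le_n1 i k)
    rw [sq]
    exact (hw k).nrm_mul_le_of_le (hw i) (lw k) (lw i)
  have i5 : ∀ i k, Integrable fun x =>
      (1 + ϱ t x) * (dt (u k) t x * dt (u i) t x * pd i (u k t) x) := fun i k =>
    ((((hw k).mul (hw i)).integrable_mul ((hu k).pd i)).fun_add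
      ((h.hϱ.hs ht).integrable_mul (((hw k).mul (hw i)).mul ((hu k).pd i)))).congr
      (ae_of_all _ fun x => by simp only; ring)
  have e : ∀ k, ∫ x, (1 + ϱ t x) * (dt (u k) t x * (dt (dt (u k)) t x
      + ∑ i, u i t x * xd i (dt (u k)) t x))
      = - (∫ x, dt (u k) t x * dt (frc ϱ u k) t x)
        - (∫ x, dt ϱ t x * (dt (u k) t x * acc u k t x))
        - (∫ x, (1 + ϱ t x) * (dt (u k) t x * dt (u 0) t x * pd 0 (u k t) x))
        - ∫ x, (1 + ϱ t x) * (dt (u k) t x * dt (u 1) t x * pd 1 (u k t) x) := by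
    intro k
    have i1 : Integrable fun x => -(dt (u k) t x * dt (frc ϱ u k) t x) :=
      ((hw k).integrable_mul ((h.hfrc k).dt.hs ht)).neg
    have i2 : Integrable fun x => dt ϱ t x * (dt (u k) t x * acc u k t x) :=
      (h.hϱ.dt.hs ht).integrable_mul ((hw k).mul (ha k))
    have i12 : Integrable fun x => -(dt (u k) t x * dt (frc ϱ u k) t x)
        - dt ϱ t x * (dt (u k) t x * acc u k t x) := i1.sub i2
    have i123 : Integrable fun x => -(dt (u k) t x * dt (frc ϱ u k) t x)
        - dt ϱ t x * (dt (u k) t x * acc u k t x)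
        - (1 + ϱ t x) * (dt (u k) t x * dt (u 0) t x * pd 0 (u k t) x) := i12.sub (i5 0 k)
    rw [← integral_neg, ← integral_sub i1 i2]
    rw [← integral_sub i12 (i5 0 k), ← integral_sub i123 (i5 1 k)]
    congr 1
    funext x
    rw [h.dt_frc k ht, h.dt_acc k ht]
    simp only [Fin.sum_univ_two, xd]
    ring
  have hst : (∫ x, dt (u 0) t x * dt (frc ϱ u 0) t x) + ∫ x, dt (u 1) t x * dt (frc ϱ u 1) t x
      = n1 (vdt u) t ^ 2 := by
    rw [n1_sq, ← Fin.sum_univ_two (f := fun k => ∫ x, dt (u k) t x * dt (frc ϱ u k) t x)]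
    exact (h.stokes_dt ht).sum_integral_mul
  have s1 := fun k => (_root_.abs_le.1 (h.abs_integral_dt_mul_le ht k)).1
  have s5 := fun i k => (_root_.abs_le.1 (t5 i k)).1
  simp only [dW, e]
  rw [Fin.sum_univ_two]
  linarith [s1 0, s1 1, s5 0 0, s5 0 1, s5 1 0, s5 1 1]

end Sol

/-- Optimization over the scale `r`. -/
lemma pow_three_le_of_forall_scale {L C a b : ℝ} (hL : 0 ≤ L) (hC : 0 ≤ C) (ha : 0 ≤ a)
    (hb : 0 ≤ b) (h : ∀ r, 0 < r → L ≤ C * (r⁻¹ * a + Real.sqrt r * b)) :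
    L ^ 3 ≤ 8 * C ^ 3 * (a * b ^ 2) := by
  have key : ∀ ε, 0 < ε → L ^ 3 ≤ 8 * C ^ 3 * ((a + ε) * (b + ε) ^ 2) := by
    intro ε hε
    have ha' : 0 < a + ε := by linarith
    have hb' : 0 < b + ε := by linarith
    set s : ℝ := ((a + ε) / (b + ε)) ^ ((1 : ℝ) / 3) with hs
    have hs0 : 0 < s := Real.rpow_pos_of_pos (by positivity) _
    have hs3 : s ^ 3 = (a + ε) / (b + ε) := by
      rw [hs, ← Real.rpow_natCast, ← Real.rpow_mul (by positivity)]
      norm_num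
    have e : a + ε = (b + ε) * s ^ 3 := by rw [hs3]; field_simp
    have h1 := h (s ^ 2) (by positivity)
    rw [Real.sqrt_sq hs0.le] at h1
    have h2 : L ≤ 2 * C * ((b + ε) * s) := by
      refine h1.trans ?_
      have h3 : (s ^ 2)⁻¹ * a ≤ (b + ε) * s := by
        rw [inv_mul_le_iff₀ (by positivity)]
        nlinarith
      have h4 : s * b ≤ (b + ε) * s := by nlinarith
      nlinarith
    calc L ^ 3 ≤ (2 * C * ((b + ε) * s)) ^ 3 := pow_le_pow_left₀ hL h2 3
      _ = 8 * C ^ 3 * (((b + ε) * s ^ 3) * (b + ε) ^ 2) := by ring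
      _ = _ := by rw [← e]
  have hc : Continuous fun ε : ℝ => 8 * C ^ 3 * ((a + ε) * (b + ε) ^ 2) := by fun_prop
  have hlim := (hc.tendsto 0).mono_left (nhdsWithin_le_nhds (s := Ioi 0))
  simp only [add_zero] at hlim
  exact ge_of_tendsto hlim (eventually_mem_nhdsWithin.mono fun ε hε => key ε hε)

lemma sq_three_le (a b c : ℝ) :
    (5 / 2 * (a + b) + 2 * c) ^ 2 ≤ 75 / 4 * (a ^ 2 + b ^ 2) + 12 * c ^ 2 := by
  nlinarith [sq_nonneg (5 / 2 * a - 5 / 2 * b), sq_nonneg (5 / 2 * a - 2 * c),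
    sq_nonneg (5 / 2 * b - 2 * c)]

namespace Sol

variable {ϱ P : ℝ → Plane → ℝ} {u : Fin 2 → ℝ → Plane → ℝ} {t B : ℝ}

/-- The derivative of `eX`. -/
def dX (ϱ : ℝ → Plane → ℝ) (u : Fin 2 → ℝ → Plane → ℝ) (t : ℝ) : ℝ :=
  dW ϱ u t + 2 * (n1 u t ^ 2 * dN1 ϱ u t)

lemma hasDerivWithinAt_eX (h : Sol ϱ u P) (ht : 0 ≤ t) :
    HasDerivWithinAt (eX ϱ u) (dX ϱ u t) (Ici 0) t := by
  have h1 := (h.hasDerivWithinAt_kin_vdt ht).add ((h.hasDerivWithinAt_n1_sq ht).pow 2)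
  have e : eX ϱ u = kin ϱ (vdt u) + (fun t => n1 u t ^ 2) ^ 2 := by
    funext s
    simp only [eX, Pi.add_apply, Pi.pow_apply]
    ring
  rw [e]
  refine h1.congr_deriv ?_
  simp only [dX]
  norm_num
  ring

lemma interpolation_le (h : Sol ϱ u P) (ht : 0 ≤ t) (hB1 : 1 ≤ B) (hB : n0 u t ^ 2 ≤ B) :
    n0 u t * n1 u t ^ 2 * n2 u t ≤ 150 * (B * eX ϱ u t) := by
  have h0 := h.eX_nonneg ht
  refine (abs_le_of_sq_le_sq' ?_ (by positivity)).2
  have h1 := h.n2_sq_le_eX ht hB1 hB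
  have h2 := h.n1_pow_four_le ht
  calc (n0 u t * n1 u t ^ 2 * n2 u t) ^ 2 = n0 u t ^ 2 * n1 u t ^ 4 * n2 u t ^ 2 := by ring
    _ ≤ B * eX ϱ u t * (20000 * (B * eX ϱ u t)) := by gcongr
    _ ≤ _ := by nlinarith [sq_nonneg (B * eX ϱ u t)]

/-- The differential inequality for `∫ ρ|∂ₜu|² + ‖∇u‖⁴`. -/
lemma dX_add_le (h : Sol ϱ u P) (ht : 0 ≤ t) (hB1 : 1 ≤ B) (hB : n0 u t ^ 2 ≤ B) :
    dX ϱ u t + n1 (vdt u) t ^ 2 ≤ 6000000 * (B * (n1 u t ^ 2 * eX ϱ u t)) := by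
  have hw := h.dW_add_le ht
  have hn := h.dN1_add_le ht
  have hX := h.eX_nonneg ht
  have hm0 := h.n0_vdt_sq_le ht
  have hn2 := h.n2_sq_le_eX ht hB1 hB
  have hn1 := h.n1_pow_four_le ht
  have hint := h.interpolation_le ht hB1 hB
  have sα := b0_sq u t
  have sβ := b1_sq u t
  have sγ := b0_sq (vdt u) t
  have sδ := e0_sq u t
  have pa := n0_nonneg u t
  have pb := n1_nonneg u t
  have pc := n2_nonneg u t
  have pd := n0_nonneg (vdt u) t
  have pe := n1_nonneg (vdt u) t
  set X := eX ϱ u t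
  set a := n0 u t
  set b := n1 u t
  set c := n2 u t
  set d := n0 (vdt u) t
  set m := n1 (vdt u) t
  set α := b0 u t
  set β := b1 u t
  set γ := b0 (vdt u) t
  set δ := e0 u t
  have hBX : 0 ≤ B * (b ^ 2 * X) := by positivity
  have hle : b ^ 2 * X ≤ B * (b ^ 2 * X) := le_mul_of_one_le_left (by positivity) hB1
  have E1 : 4 * (m * (α * γ)) ≤ m ^ 2 / 5 + 1024000 * (B * (b ^ 2 * X)) := by
    refine le_add_of_pow_four_le (by positivity) (by positivity) ?_
    calc (4 * (m * (α * γ))) ^ 4 = 256 * m ^ 4 * (α ^ 2) ^ 2 * (γ ^ 2) ^ 2 := by ring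
      _ = 4096 * m ^ 6 * b ^ 2 * (a ^ 2 * d ^ 2) := by rw [sα, sγ]; ring
      _ ≤ 4096 * m ^ 6 * b ^ 2 * (B * (2 * X)) := by gcongr
      _ = _ := by ring
  have E2 : 4 * (m * (δ * β)) ≤ m ^ 2 / 5 + 216000 * (B * (b ^ 2 * X)) := by
    refine le_add_of_sq_le_mul (by positivity) (by positivity) ?_
    calc (4 * (m * (δ * β))) ^ 2 = 16 * m ^ 2 * δ ^ 2 * β ^ 2 := by ring
      _ = 288 * m ^ 2 * b ^ 2 * (a * b ^ 2 * c) := by rw [sδ, sβ]; ring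
      _ ≤ 288 * m ^ 2 * b ^ 2 * (150 * (B * X)) := by gcongr
      _ = _ := by ring
  have hc4 : a ^ 2 * d ^ 2 * (c ^ 2) ^ 2 ≤ B * (2 * X) * (20000 * (B * X)) ^ 2 := by gcongr
  have E3 : 4 * (α * γ * β ^ 2) ≤ 70000 * (B * (b ^ 2 * X)) + m ^ 2 / 5 := by
    refine le_add_of_pow_four_le (by positivity) (by positivity) ?_
    calc (4 * (α * γ * β ^ 2)) ^ 4 = 256 * (α ^ 2) ^ 2 * (γ ^ 2) ^ 2 * (β ^ 2) ^ 4 := by ring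
      _ = 65536 * b ^ 6 * m ^ 2 * (a ^ 2 * d ^ 2 * (c ^ 2) ^ 2) := by rw [sα, sβ, sγ]; ring
      _ ≤ 65536 * b ^ 6 * m ^ 2 * (B * (2 * X) * (20000 * (B * X)) ^ 2) := by gcongr
      _ = 262144000000000 * ((B * (b ^ 2 * X)) ^ 3 * (m ^ 2 / 5)) := by ring
      _ ≤ 343000000000000 * ((B * (b ^ 2 * X)) ^ 3 * (m ^ 2 / 5)) :=
        mul_le_mul_of_nonneg_right (by norm_num) (by positivity)
      _ = _ := by ring
  have E4 : 4 * (δ * γ * c) ≤ 70000 * (B * (b ^ 2 * X)) + m ^ 2 / 5 := by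
    refine le_add_of_pow_four_le (by positivity) (by positivity) ?_
    calc (4 * (δ * γ * c)) ^ 4 = 256 * (δ ^ 2) ^ 2 * (γ ^ 2) ^ 2 * c ^ 4 := by ring
      _ = 82944 * b ^ 6 * m ^ 2 * (a ^ 2 * d ^ 2 * (c ^ 2) ^ 2) := by rw [sδ, sγ]; ring
      _ ≤ 82944 * b ^ 6 * m ^ 2 * (B * (2 * X) * (20000 * (B * X)) ^ 2) := by gcongr
      _ = 331776000000000 * ((B * (b ^ 2 * X)) ^ 3 * (m ^ 2 / 5)) := by ring
      _ ≤ 343000000000000 * ((B * (b ^ 2 * X)) ^ 3 * (m ^ 2 / 5)) :=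
        mul_le_mul_of_nonneg_right (by norm_num) (by positivity)
      _ = _ := by ring
  have E5 : 10 * (γ ^ 2 * b) ≤ m ^ 2 / 5 + 4000 * (b ^ 2 * X) := by
    refine le_add_of_sq_le_mul (by positivity) (by positivity) ?_
    rw [sγ]
    calc (10 * (2 * (d * m) * b)) ^ 2 = 400 * m ^ 2 * b ^ 2 * d ^ 2 := by ring
      _ ≤ 400 * m ^ 2 * b ^ 2 * (2 * X) := by gcongr
      _ = _ := by ring
  have E6 : 2 * (b ^ 2 * dN1 ϱ u t) ≤ 4000000 * (B * (b ^ 2 * X)) := by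
    have h1 : dN1 ϱ u t ≤ 2000000 * (a ^ 2 * b ^ 4) := by nlinarith [sq_nonneg (n0 (acc u) t)]
    calc 2 * (b ^ 2 * dN1 ϱ u t) ≤ 2 * (b ^ 2 * (2000000 * (a ^ 2 * b ^ 4))) := by gcongr
      _ ≤ 2 * (b ^ 2 * (2000000 * (B * X))) := by gcongr
      _ = _ := by ring
  unfold dX
  linarith

/-- The square root of `‖∇∂ₜu‖² + ‖∇u‖² eX`. -/
def kap (ϱ : ℝ → Plane → ℝ) (u : Fin 2 → ℝ → Plane → ℝ) (t : ℝ) : ℝ :=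
  Real.sqrt (n1 (vdt u) t ^ 2 + n1 u t ^ 2 * eX ϱ u t)

lemma kap_nonneg : 0 ≤ kap ϱ u t := Real.sqrt_nonneg _

lemma kap_sq (h : Sol ϱ u P) (ht : 0 ≤ t) :
    kap ϱ u t ^ 2 = n1 (vdt u) t ^ 2 + n1 u t ^ 2 * eX ϱ u t :=
  Real.sq_sqrt (by have := h.eX_nonneg ht; positivity)

lemma l4_acc_sq_le (h : Sol ϱ u P) (ht : 0 ≤ t) (hB1 : 1 ≤ B) (hB : n0 u t ^ 2 ≤ B) (k : Fin 2) :
    l4 (acc u k t) ^ 2 ≤ 125000 * (B * (Real.sqrt (eX ϱ u t) * kap ϱ u t)) := by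
  have hu := fun k => (h.hu k).hs ht
  have hw : ∀ k, Hs (dt (u k) t) := fun k => (h.hu k).dt.hs ht
  have hX := h.eX_nonneg ht
  have hk := h.kap_sq ht
  have hk0 := kap_nonneg (ϱ := ϱ) (u := u) (t := t)
  have hsX := Real.sq_sqrt hX
  have hsX0 := Real.sqrt_nonneg (eX ϱ u t)
  have hm0 := h.n0_vdt_sq_le ht
  have hn2 := h.n2_sq_le_eX ht hB1 hB
  have hint := h.interpolation_le ht hB1 hB
  have hs : ∀ i, Hs fun x => u i t x * pd i (u k t) x := fun i => (hu i).mul ((hu k).pd i)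
  have hle : l4 (acc u k t) ≤ b0 (vdt u) t + 2 * Real.sqrt (e0 u t * e1 u t) := by
    have e : acc u k t = fun x => dt (u k) t x
        + (u 0 t x * pd 0 (u k t) x + u 1 t x * pd 1 (u k t) x) := by
      funext x; simp only [acc, Fin.sum_univ_two, xd]
    have h1 := (hw k).l4_add_le ((hs 0).add (hs 1))
    have h2 := (hs 0).l4_add_le (hs 1)
    have h3 : l4 (dt (u k) t) ≤ b0 (vdt u) t := l4_le_b0 (v := vdt u) hw k
    have h4 := fun i => Real.le_sqrt_of_sq_le (l4_sq_le_e0_mul_e1 hu i i k)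
    rw [e]
    linarith [h4 0, h4 1]
  have hE : 0 ≤ e0 u t * e1 u t := mul_nonneg (e0_nonneg _ _) (e1_nonneg _ _)
  have h1 : n0 (vdt u) t * n1 (vdt u) t ≤ 2 * (Real.sqrt (eX ϱ u t) * kap ϱ u t) := by
    refine (abs_le_of_sq_le_sq' ?_ (by positivity)).2
    have h2 : n1 (vdt u) t ^ 2 ≤ kap ϱ u t ^ 2 := by
      rw [hk]; linarith [mul_nonneg (sq_nonneg (n1 u t)) hX]
    calc (n0 (vdt u) t * n1 (vdt u) t) ^ 2 = n0 (vdt u) t ^ 2 * n1 (vdt u) t ^ 2 := by ring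
      _ ≤ 2 * eX ϱ u t * kap ϱ u t ^ 2 := by gcongr
      _ = 2 * (Real.sqrt (eX ϱ u t) ^ 2 * kap ϱ u t ^ 2) := by rw [hsX]; ring
      _ ≤ _ := by nlinarith [mul_nonneg (sq_nonneg (Real.sqrt (eX ϱ u t))) (sq_nonneg (kap ϱ u t))]
  have h2 : e0 u t * e1 u t ≤ 15600 * (B * (Real.sqrt (eX ϱ u t) * kap ϱ u t)) := by
    refine (abs_le_of_sq_le_sq' ?_ (by positivity)).2
    have h3 : n1 u t ^ 2 * eX ϱ u t ≤ kap ϱ u t ^ 2 := by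
      rw [hk]; linarith [sq_nonneg (n1 (vdt u) t)]
    have p0 := n0_nonneg u t
    have p1 := n1_nonneg u t
    have p2 := n2_nonneg u t
    calc (e0 u t * e1 u t) ^ 2 = e0 u t ^ 2 * e1 u t ^ 2 := by ring
      _ = 81 * n1 u t ^ 2 * ((n0 u t * n1 u t ^ 2 * n2 u t) * n2 u t ^ 2) := by
        rw [e0_sq, e1_sq]; ring
      _ ≤ 81 * n1 u t ^ 2 * ((150 * (B * eX ϱ u t)) * (20000 * (B * eX ϱ u t))) := by gcongr
      _ = 243000000 * B ^ 2 * eX ϱ u t * (n1 u t ^ 2 * eX ϱ u t) := by ring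
      _ ≤ 243000000 * B ^ 2 * eX ϱ u t * kap ϱ u t ^ 2 := by gcongr
      _ = 243000000 * (B ^ 2 * Real.sqrt (eX ϱ u t) ^ 2 * kap ϱ u t ^ 2) := by rw [hsX]; ring
      _ ≤ 243360000 * (B ^ 2 * Real.sqrt (eX ϱ u t) ^ 2 * kap ϱ u t ^ 2) :=
        mul_le_mul_of_nonneg_right (by norm_num) (by positivity)
      _ = _ := by ring
  have h4 := b0_sq (vdt u) t
  have h5 := Real.sq_sqrt hE
  have h6 : Real.sqrt (eX ϱ u t) * kap ϱ u t ≤ B * (Real.sqrt (eX ϱ u t) * kap ϱ u t) :=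
    le_mul_of_one_le_left (by positivity) hB1
  have h7 := pow_le_pow_left₀ (l4_nonneg _) hle 2
  nlinarith [sq_nonneg (b0 (vdt u) t - 2 * Real.sqrt (e0 u t * e1 u t))]

/-- The supremum bound for the velocity gradient. -/
lemma exists_abs_pd_pow_three_le : ∃ C : ℝ, 0 < C ∧
    ∀ {ϱ P : ℝ → Plane → ℝ} {u : Fin 2 → ℝ → Plane → ℝ}, Sol ϱ u P → ∀ {t B : ℝ}, 0 ≤ t → 1 ≤ B →
      n0 u t ^ 2 ≤ B → ∀ (j k : Fin 2) (x : Plane),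
      |pd j (u k t) x| ^ 3 ≤ C * (B * (n1 u t * (Real.sqrt (eX ϱ u t) * kap ϱ u t))) := by
  obtain ⟨C, hC, hst⟩ := exists_abs_pd_le_of_stokes
  refine ⟨8 * C ^ 3 * 781250, by positivity, fun {ϱ P u} h {t B} ht hB1 hB j k x => ?_⟩
  set Z := B * (Real.sqrt (eX ϱ u t) * kap ϱ u t) with hZ
  have hZ0 : 0 ≤ Z :=
    mul_nonneg (by linarith) (mul_nonneg (Real.sqrt_nonneg _) kap_nonneg)
  have hF : ∀ l, l4 (frc ϱ u l t) ≤ 5 / 4 * Real.sqrt (125000 * Z) := by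
    intro l
    have h1 : l4 (acc u l t) ≤ Real.sqrt (125000 * Z) :=
      Real.le_sqrt_of_sq_le (h.l4_acc_sq_le ht hB1 hB l)
    have h2 : l4 (frc ϱ u l t) ≤ 5 / 4 * l4 (acc u l t) := by
      refine Real.sqrt_le_iff.2 ⟨mul_nonneg (by norm_num) (l4_nonneg _), ?_⟩
      rw [mul_pow, l4_sq]
      have h3 := nrm_mul_le_of_bound (f := fun x => (1 + ϱ t x) ^ 2) (C := (5 / 4) ^ 2)
        (by norm_num) (fun x => by
          rw [abs_pow]; exact pow_le_pow_left₀ (abs_nonneg _) (h.abs_one_add_le ht x) 2)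
        ((h.hacc l).hs ht).sq.memL2
      refine le_trans (le_of_eq ?_) h3
      congr 1
      funext x
      simp only [frc]
      ring
    linarith
  have h1 : ∀ r, 0 < r → |pd j (u k t) x| ≤ C * (r⁻¹ * n1 u t
      + Real.sqrt r * (2 * (5 / 4 * Real.sqrt (125000 * Z)))) := by
    intro r hr
    refine (hst _ _ _ (h.stokes ht) j k x r hr).trans ?_
    have h2 : ∑ l, Real.sqrt (nrm (fun y => frc ϱ u l t y ^ 2))
        ≤ 2 * (5 / 4 * Real.sqrt (125000 * Z)) := by
      rw [Fin.sum_univ_two]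
      exact (add_le_add (hF 0) (hF 1)).trans (by linarith)
    have h3 : nrm (pd j (u k t)) ≤ n1 u t := nrm_le_n1 j k
    gcongr
  have h2 := pow_three_le_of_forall_scale (abs_nonneg _) hC.le (n1_nonneg u t) (by positivity) h1
  refine h2.trans (le_of_eq ?_)
  rw [mul_pow, mul_pow, Real.sq_sqrt (by positivity), hZ]
  ring

/-- `‖∂ₜ²u‖² + ‖∇²∂ₜu‖² + ‖∇∂ₜP‖²`. -/
def dis (u : Fin 2 → ℝ → Plane → ℝ) (P : ℝ → Plane → ℝ) (t : ℝ) : ℝ :=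
  n0 (vdt (vdt u)) t ^ 2 + n2 (vdt u) t ^ 2 + ∑ k, sqn (pd k (dt P t))

lemma dis_nonneg : 0 ≤ dis u P t := by
  have : 0 ≤ ∑ k, sqn (pd k (dt P t)) := Finset.sum_nonneg fun _ _ => sqn_nonneg _
  unfold dis
  positivity

/-- The derivative of `‖∇∂ₜu‖²`. -/
def dM1 (ϱ : ℝ → Plane → ℝ) (u : Fin 2 → ℝ → Plane → ℝ) (t : ℝ) : ℝ :=
  2 * ∑ k, ∫ x, dt (dt (u k)) t x * dt (frc ϱ u k) t x

lemma hasDerivWithinAt_n1_vdt_sq (h : Sol ϱ u P) (ht : 0 ≤ t) :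
    HasDerivWithinAt (fun t => n1 (vdt u) t ^ 2) (dM1 ϱ u t) (Ici 0) t :=
  hasDerivWithinAt_vgsq_of_stokes (v := vdt u) (F := fun k => dt (frc ϱ u k))
    (fun k => (h.hu k).dt) (fun _ ht x => sum_xd_dt_eq_zero h.hu h.div ht x) ht (h.stokes_dt ht)

lemma dM1_add_le_sq (h : Sol ϱ u P) (ht : 0 ≤ t) {R lam S : ℝ} (hR0 : 0 ≤ R)
    (hR : ∀ i x, |pd i (ϱ t) x| ≤ R) (hlam0 : 0 ≤ lam) (hla : ∀ k, l4 (acc u k t) ≤ lam)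
    (hS : S = 5 / 2 * (b0 (vdt u) t * b1 u t + b0 u t * b1 (vdt u) t) + 2 * (R * (b0 u t * lam))) :
    dM1 ϱ u t + 1 / 2 * n0 (vdt (vdt u)) t ^ 2
      + 1 / 8 * (n2 (vdt u) t ^ 2 + ∑ k, sqn (pd k (dt P t))) ≤ 9 / 2 * S ^ 2 := by
  have hu := fun k => (h.hu k).hs ht
  have hw : ∀ k, Hs (dt (u k) t) := fun k => (h.hu k).dt.hs ht
  have hz : ∀ k, Hs (dt (dt (u k)) t) := fun k => (h.hu k).dt.dt.hs ht
  have ha : ∀ k, Hs (acc u k t) := fun k => (h.hacc k).hs ht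
  have hf : ∀ k, Hs (dt (frc ϱ u k) t) := fun k => (h.hfrc k).dt.hs ht
  have hr := h.hϱ.hs ht
  have hS0 : 0 ≤ S := by
    have := b0_nonneg u t; have := b1_nonneg u t; have := b0_nonneg (vdt u) t
    have := b1_nonneg (vdt u) t
    rw [hS]
    positivity
  let g : Fin 2 → Plane → ℝ := fun k x => dt (frc ϱ u k) t x
    + (dt (dt (u k)) t x + ϱ t x * dt (dt (u k)) t x)
  have hg : ∀ k, Hs (g k) := fun k => (hf k).add ((hz k).add (hr.mul (hz k)))
  have hgS : ∀ k, nrm (g k) ≤ S := by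
    intro k
    let e : Plane → ℝ := fun x => ∑ i, (dt (u i) t x * pd i (u k t) x
      + u i t x * pd i (dt (u k) t) x)
    have he' : ∀ i, Hs fun x => dt (u i) t x * pd i (u k t) x
      + u i t x * pd i (dt (u k) t) x := fun i =>
      ((hw i).mul ((hu k).pd i)).add ((hu i).mul ((hw k).pd i))
    have he : Hs e := Hs.sum _ fun i _ => he' i
    have hen : nrm e ≤ 2 * (b0 (vdt u) t * b1 u t + b0 u t * b1 (vdt u) t) := by
      refine Hs.nrm_sum_le he' fun i => ?_
      refine (nrm_add_le ((hw i).mul ((hu k).pd i)).memL2 ((hu i).mul ((hw k).pd i)).memL2).trans ?_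
      exact add_le_add ((hw i).nrm_mul_le_of_le ((hu k).pd i) (l4_le_b0 (v := vdt u) hw i)
        (l4_le_b1 hu i k)) ((hu i).nrm_mul_le_of_le ((hw k).pd i) (l4_le_b0 hu i)
        (l4_le_b1 (v := vdt u) hw i k))
    let c : Plane → ℝ := fun x => ∑ i, pd i (ϱ t) x * (u i t x * acc u k t x)
    have hc' : ∀ i, Hs fun x => pd i (ϱ t) x * (u i t x * acc u k t x) := fun i =>
      (hr.pd i).mul ((hu i).mul (ha k))
    have hc : Hs c := Hs.sum _ fun i _ => hc' i
    have hcn : nrm c ≤ 2 * (R * (b0 u t * lam)) := by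
      refine Hs.nrm_sum_le hc' fun i => ?_
      refine (nrm_mul_le_of_bound hR0 (hR i) ((hu i).mul (ha k)).memL2).trans ?_
      exact mul_le_mul_of_nonneg_left ((hu i).nrm_mul_le_of_le (ha k) (l4_le_b0 hu i) (hla k)) hR0
    have hen2 := nrm_mul_le_of_bound (f := fun x => -(1 + ϱ t x)) (C := 5 / 4) (by norm_num)
      (fun x => by rw [abs_neg]; exact h.abs_one_add_le ht x) he.memL2
    have h1 : Hs fun x => -(1 + ϱ t x) * e x := by
      have : (fun x => -(1 + ϱ t x) * e x) = fun x => -(e x + ϱ t x * e x) := by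
        funext x; ring
      rw [this]
      exact (he.add (hr.mul he)).neg
    have eg : g k = fun x => c x + -(1 + ϱ t x) * e x := by
      funext x
      simp only [g, c, e]
      rw [h.dt_frc k ht, h.dt_acc k ht]
      have h3 := h.mass t ht x
      simp only [Fin.sum_univ_two, xd] at h3 ⊢
      linear_combination (- acc u k t x) * h3
    rw [eg]
    refine (nrm_add_le hc.memL2 h1.memL2).trans ?_
    rw [hS]
    linarith
  have hzf : ∀ k, ∫ x, dt (dt (u k)) t x * dt (frc ϱ u k) t x
      ≤ -(1 / 2) * sqn (dt (dt (u k)) t) + S ^ 2 := by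
    intro k
    have h1 := (h.wsq_bounds ht (f := dt (dt (u k))) (hz k)).1
    have i2 : Integrable fun x => (1 + ϱ t x) * dt (dt (u k)) t x ^ 2 :=
      ((hz k).integrable_sq.fun_add ((h.hϱ.hs ht).integrable_mul (hz k).sq)).congr
        (ae_of_all _ fun x => by simp only; ring)
    have e : ∫ x, dt (dt (u k)) t x * dt (frc ϱ u k) t x
        = (∫ x, dt (dt (u k)) t x * g k x) - wsq ϱ (dt (dt (u k))) t := by
      rw [wsq, ← integral_sub ((hz k).integrable_mul (hg k)) i2]
      congr 1
      funext x
      simp only [g]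
      ring
    have h2 := (le_abs_self _).trans (abs_integral_mul_le (hz k).memL2 (hg k).memL2)
    have h3 := mul_le_mul_of_nonneg_left (hgS k) (nrm_nonneg (dt (dt (u k)) t))
    have h4 := nrm_sq (dt (dt (u k)) t)
    rw [e]
    nlinarith [sq_nonneg (nrm (dt (dt (u k)) t) - 2 * S)]
  have hff : ∀ k, sqn (dt (frc ϱ u k) t) ≤ 25 / 8 * sqn (dt (dt (u k)) t) + 2 * S ^ 2 := by
    intro k
    have h1 : nrm (dt (frc ϱ u k) t) ≤ S + 5 / 4 * nrm (dt (dt (u k)) t) := by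
      have h2 := nrm_mul_le_of_bound (f := fun x => -(1 + ϱ t x)) (C := 5 / 4) (by norm_num)
        (fun x => by rw [abs_neg]; exact h.abs_one_add_le ht x) (hz k).memL2
      have e : dt (frc ϱ u k) t = fun x => g k x + -(1 + ϱ t x) * dt (dt (u k)) t x := by
        funext x; simp only [g]; ring
      have h3 : Hs fun x => -(1 + ϱ t x) * dt (dt (u k)) t x := by
        have : (fun x => -(1 + ϱ t x) * dt (dt (u k)) t x)
            = fun x => -(dt (dt (u k)) t x + ϱ t x * dt (dt (u k)) t x) := by
          funext x; ring
        rw [this]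
        exact ((hz k).add (hr.mul (hz k))).neg
      rw [e]
      exact (nrm_add_le (hg k).memL2 h3.memL2).trans (add_le_add (hgS k) h2)
    have h4 := pow_le_pow_left₀ (nrm_nonneg _) h1 2
    rw [nrm_sq] at h4
    have h5 := nrm_sq (dt (dt (u k)) t)
    nlinarith [sq_nonneg (S - 5 / 4 * nrm (dt (dt (u k)) t))]
  have hen := (h.stokes_dt ht).energy
  have hK : n0 (vdt (vdt u)) t ^ 2 = sqn (dt (dt (u 0)) t) + sqn (dt (dt (u 1)) t) := by
    rw [n0_sq, vsq, Fin.sum_univ_two]; rfl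
  have hM2 : n2 (vdt u) t ^ 2 + ∑ k, sqn (pd k (dt P t))
      ≤ 25 / 8 * n0 (vdt (vdt u)) t ^ 2 + 4 * S ^ 2 := by
    have e : n2 (vdt u) t ^ 2 = ∑ k, hsq (dt (u k) t) := by rw [n2_sq]; rfl
    rw [e, hen, Fin.sum_univ_two, hK]
    linarith [hff 0, hff 1]
  simp only [dM1]
  rw [Fin.sum_univ_two]
  have hK0 : 0 ≤ n0 (vdt (vdt u)) t ^ 2 := sq_nonneg _
  linarith [hzf 0, hzf 1]

/-- The differential inequality for `‖∇∂ₜu‖²`. -/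
lemma dM1_add_le (h : Sol ϱ u P) (ht : 0 ≤ t) (hB1 : 1 ≤ B) (hB : n0 u t ^ 2 ≤ B) {R : ℝ}
    (hR0 : 0 ≤ R) (hR : ∀ i x, |pd i (ϱ t) x| ≤ R) :
    dM1 ϱ u t + dis u P t / 16 ≤ 20000000 * B * (n1 u t ^ 2 * n1 (vdt u) t ^ 2 + eX ϱ u t ^ 2
      + R ^ 2 * (n0 u t * n1 u t * (Real.sqrt (eX ϱ u t) * kap ϱ u t))) := by
  set lam := Real.sqrt (125000 * (B * (Real.sqrt (eX ϱ u t) * kap ϱ u t))) with hlam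
  obtain ⟨S, hS⟩ : ∃ S, S = 5 / 2 * (b0 (vdt u) t * b1 u t + b0 u t * b1 (vdt u) t)
    + 2 * (R * (b0 u t * lam)) := ⟨_, rfl⟩
  have hmain := h.dM1_add_le_sq ht hR0 hR (Real.sqrt_nonneg _)
    (fun k => Real.le_sqrt_of_sq_le (h.l4_acc_sq_le ht hB1 hB k)) hS
  have hQ : 0 ≤ ∑ k, sqn (pd k (dt P t)) := Finset.sum_nonneg fun _ _ => sqn_nonneg _
  have hX := h.eX_nonneg ht
  have hk0 := kap_nonneg (ϱ := ϱ) (u := u) (t := t)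
  have hlsq : lam ^ 2 = 125000 * (B * (Real.sqrt (eX ϱ u t) * kap ϱ u t)) :=
    Real.sq_sqrt (by positivity)
  have hm0 := h.n0_vdt_sq_le ht
  have hn2 := h.n2_sq_le_eX ht hB1 hB
  have sα := b0_sq u t
  have sβ := b1_sq u t
  have sγ := b0_sq (vdt u) t
  have sη := b1_sq (vdt u) t
  have pa := n0_nonneg u t
  have pb := n1_nonneg u t
  have hS2 : S ^ 2 ≤ 75 / 4 * ((b0 (vdt u) t * b1 u t) ^ 2 + (b0 u t * b1 (vdt u) t) ^ 2)
      + 12 * (R * (b0 u t * lam)) ^ 2 := by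
    rw [hS]
    exact sq_three_le _ _ _
  have e1 : (b0 (vdt u) t * b1 u t) ^ 2
      = 4 * ((n1 u t * n1 (vdt u) t) * (n0 (vdt u) t * n2 u t)) := by
    rw [mul_pow, sγ, sβ]; ring
  have e2 : (b0 u t * b1 (vdt u) t) ^ 2
      = 4 * ((n0 u t * n1 u t * n1 (vdt u) t) * n2 (vdt u) t) := by
    rw [mul_pow, sα, sη]; ring
  have e3 : (R * (b0 u t * lam)) ^ 2
      = 250000 * B * (R ^ 2 * (n0 u t * n1 u t * (Real.sqrt (eX ϱ u t) * kap ϱ u t))) := by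
    rw [mul_pow, mul_pow, sα, hlsq]; ring
  rw [e1, e2, e3] at hS2
  have f1 : (n0 (vdt u) t * n2 u t) ^ 2 ≤ 40000 * B * eX ϱ u t ^ 2 := by
    calc (n0 (vdt u) t * n2 u t) ^ 2 = n0 (vdt u) t ^ 2 * n2 u t ^ 2 := by ring
      _ ≤ 2 * eX ϱ u t * (20000 * (B * eX ϱ u t)) := by gcongr
      _ = _ := by ring
  have f2 : (n0 u t * n1 u t * n1 (vdt u) t) ^ 2 ≤ B * (n1 u t ^ 2 * n1 (vdt u) t ^ 2) := by
    calc (n0 u t * n1 u t * n1 (vdt u) t) ^ 2 = n0 u t ^ 2 * (n1 u t ^ 2 * n1 (vdt u) t ^ 2) := by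
          ring
      _ ≤ _ := by gcongr
  have f3 : n1 u t ^ 2 * n1 (vdt u) t ^ 2 ≤ B * (n1 u t ^ 2 * n1 (vdt u) t ^ 2) :=
    le_mul_of_one_le_left (by positivity) hB1
  have f4 : 0 ≤ B * (R ^ 2 * (n0 u t * n1 u t * (Real.sqrt (eX ϱ u t) * kap ϱ u t))) := by
    positivity
  have f5 : 0 ≤ B * eX ϱ u t ^ 2 := by positivity
  have f6 : 0 ≤ B * (n1 u t ^ 2 * n1 (vdt u) t ^ 2) := by positivity
  have g1 : (n1 u t * n1 (vdt u) t) * (n0 (vdt u) t * n2 u t)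
      ≤ (n1 u t ^ 2 * n1 (vdt u) t ^ 2 + (n0 (vdt u) t * n2 u t) ^ 2) / 2 := by
    rw [← mul_pow]
    linarith [two_mul_le_add_sq (n1 u t * n1 (vdt u) t) (n0 (vdt u) t * n2 u t)]
  have g2 : (n0 u t * n1 u t * n1 (vdt u) t) * n2 (vdt u) t
      ≤ 1400 * (n0 u t * n1 u t * n1 (vdt u) t) ^ 2 + n2 (vdt u) t ^ 2 / 5600 := by
    linarith [two_mul_le_add_sq (2800 * (n0 u t * n1 u t * n1 (vdt u) t)) (n2 (vdt u) t),
      mul_pow 2800 (n0 u t * n1 u t * n1 (vdt u) t) 2]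
  unfold dis
  have hK0 : 0 ≤ n0 (vdt (vdt u)) t ^ 2 := sq_nonneg _
  have hM0 : 0 ≤ n2 (vdt u) t ^ 2 := sq_nonneg _
  linarith

/-- Propagation of the density gradient. -/
lemma sum_pd_sq_le (h : Sol ϱ u P) {a : ℝ → ℝ} (ha : ContinuousOn a (Ici 0))
    (ha0 : ∀ t, 0 ≤ t → 0 ≤ a t) (hau : ∀ t, 0 ≤ t → ∀ j k x, |pd j (u k t) x| ≤ a t) {H : ℝ}
    (hH0 : 0 ≤ H) (hH : ∀ x, ∑ i, pd i (ϱ 0) x ^ 2 ≤ H) (ht : 0 ≤ t) (x : Plane) :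
    ∑ i, pd i (ϱ t) x ^ 2 ≤ H * Real.exp (∫ s in (0 : ℝ)..t, 4 * a s) := by
  have hx : ∀ i, Sm (xd i ϱ) := fun i => h.hϱ.xd i
  have key : ∀ i t, 0 ≤ t → ∀ x, xd i (dt ϱ) t x
      + ∑ j, (xd i (u j) t x * xd j ϱ t x + u j t x * pd i (pd j (ϱ t)) x) = 0 := by
    intro i t ht x
    have e : (fun y => dt ϱ t y + ∑ j, u j t y * pd j (ϱ t) y) = fun _ => 0 :=
      funext fun y => h.mass t ht y
    have h1 := congrFun (congrArg (pd i) e) x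
    have hs : ∀ j, Hs fun x => u j t x * pd j (ϱ t) x := fun j =>
      ((h.hu j).hs ht).mul ((h.hϱ.hs ht).pd j)
    rw [pd_const, pd_add (h.hϱ.dt.hs ht).diff (Hs.sum _ fun j _ => hs j).diff,
      pd_sum _ fun j _ => (hs j).diff] at h1
    simp only [fun j => pd_mul ((h.hu j).hs ht).diff ((h.hϱ.hs ht).pd j).diff i] at h1
    exact h1
  have h2 := le_of_transport h.hu h.div (h := fun t x => ∑ i, xd i ϱ t x ^ 2)
    (g := fun t x => -2 * ∑ i, xd i ϱ t x * ∑ j, xd i (u j) t x * xd j ϱ t x)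
    (Sm.sum _ fun i _ => (hx i).sq)
    ((Sm.sum _ fun i _ => (hx i).mul (Sm.sum _ fun j _ => ((h.hu j).xd i).mul (hx j))).const_mul _)
    (fun _ _ _ => Finset.sum_nonneg fun _ _ => sq_nonneg _) (fun t ht x => ?_)
    (a := fun t => 4 * a t) (ha.const_mul 4 |>.congr fun _ _ => rfl)
    (fun t ht => by have := ha0 t ht; positivity) (fun t ht x => ?_) hH0 hH ht x
  · exact h2
  · have e1 : dt (fun t x => ∑ i, xd i ϱ t x ^ 2) t x = ∑ i, 2 * (xd i ϱ t x * xd i (dt ϱ) t x) := by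
      have h3 : HasDerivWithinAt (fun s => ∑ i, xd i ϱ s x ^ 2)
          (∑ i, 2 * (xd i ϱ t x * xd i (dt ϱ) t x)) (Ici 0) t := by
        refine HasDerivWithinAt.fun_sum fun i _ => ?_
        have := ((hx i).smooth.hasDerivWithinAt ht x).pow 2
        rw [h.hϱ.smooth.dt_xd i ht] at this
        refine this.congr_deriv ?_
        norm_num
        ring
      exact h3.derivWithin (uniqueDiffOn_Ici 0 t ht)
    have e2 : ∀ j, xd j (fun t x => ∑ i, xd i ϱ t x ^ 2) t x
        = ∑ i, 2 * (xd i ϱ t x * pd i (pd j (ϱ t)) x) := by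
      intro j
      have hs := fun i => ((h.hϱ.xd i).hs ht)
      have h3 := congrFun (pd_sum Finset.univ (F := fun i x => xd i ϱ t x ^ 2)
        (fun i _ => (hs i).sq.diff) j) x
      refine h3.trans (Finset.sum_congr rfl fun i _ => ?_)
      have h4 := xd_pow (hs i).diff 1 j x
      norm_num at h4
      rw [h4, pd_comm (h.hϱ.hs ht).smooth i j]
      rfl
    have k0 := key 0 t ht x
    have k1 := key 1 t ht x
    rw [e1]
    simp only [e2]
    simp only [Fin.sum_univ_two] at k0 k1 ⊢
    linear_combination 2 * xd 0 ϱ t x * k0 + 2 * xd 1 ϱ t x * k1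
  · have hb := fun j k => _root_.abs_le.1 (hau t ht j k x)
    have ha := ha0 t ht
    have hab : ∀ i j, -2 * (xd i ϱ t x * (xd i (u j) t x * xd j ϱ t x))
        ≤ a t * (xd i ϱ t x ^ 2 + xd j ϱ t x ^ 2) := by
      intro i j
      have h1 : |xd i (u j) t x| ≤ a t := hau t ht i j x
      have h2 : |2 * (xd i ϱ t x * xd j ϱ t x)| ≤ xd i ϱ t x ^ 2 + xd j ϱ t x ^ 2 := by
        rw [_root_.abs_le]
        constructor <;>
          nlinarith [sq_nonneg (xd i ϱ t x - xd j ϱ t x), sq_nonneg (xd i ϱ t x + xd j ϱ t x)]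
      calc -2 * (xd i ϱ t x * (xd i (u j) t x * xd j ϱ t x))
          ≤ |xd i (u j) t x * (2 * (xd i ϱ t x * xd j ϱ t x))| := by
            refine le_trans (le_of_eq ?_) (neg_le_abs _); ring
        _ ≤ a t * (xd i ϱ t x ^ 2 + xd j ϱ t x ^ 2) := by
            rw [abs_mul]; gcongr
    simp only [Fin.sum_univ_two]
    linarith [hab 0 0, hab 0 1, hab 1 0, hab 1 1]

end Sol

/-! ### Heat averages of Sobolev functions -/

lemma fderiv_eq_sum_coordL (f : Plane → ℝ) (x : Plane) :
    fderiv ℝ f x = ∑ i, pd i f x • coordL i := by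
  ext v
  rw [fderiv_apply_eq_sum]
  simp [coordL, mul_comm]

lemma norm_coordL_le (i : Fin 2) : ‖coordL i‖ ≤ 1 :=
  ContinuousLinearMap.opNorm_le_bound _ zero_le_one fun v => by
    rw [one_mul]; exact PiLp.norm_apply_le v i

lemma continuous_avg {f : Plane → ℝ} (hf : Hs f) :
    Continuous fun q : ℝ × Plane => avg q.1 gam f q.2 := by
  obtain ⟨C, hC0, hC⟩ := hf.bounded
  have hc := hf.cont
  have hg := Ker.gam.cont
  refine continuous_of_dominated (bound := fun z => C * gam z)
    (fun q => Continuous.aestronglyMeasurable (by fun_prop)) (fun q => ae_of_all _ fun z => ?_)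
    (Ker.gam.integrable.const_mul C) (ae_of_all _ fun z => by fun_prop)
  rw [norm_mul, Real.norm_of_nonneg (gam_nonneg z), mul_comm]
  exact mul_le_mul_of_nonneg_right (hC _) (gam_nonneg z)

lemma hasFDerivAt_avg_space {f : Plane → ℝ} (hf : Hs f) (r : ℝ) (x : Plane) :
    HasFDerivAt (avg r gam f) (∑ i, avg r gam (pd i f) x • coordL i) x := by
  have hb := fun i => (hf.pd i).bounded
  choose C hC0 hC using hb
  have hc := hf.cont
  have hpc := fun i => (hf.pd i).cont
  have hg := Ker.gam.cont
  have h := hasFDerivAt_integral_of_dominated_of_fderiv_le (μ := (volume : Measure Plane))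
    (𝕜 := ℝ) (F := fun x z => gam z * f (x - r • z)) (s := univ)
    (F' := fun x z => ∑ i, (gam z * pd i f (x - r • z)) • coordL i)
    (bound := fun z => gam z * ∑ i, C i) (x₀ := x) univ_mem
    (Eventually.of_forall fun y => Continuous.aestronglyMeasurable (by fun_prop))
    (integrable_avg Ker.gam hf r x)
    (Continuous.aestronglyMeasurable (by
      refine continuous_finsetSum _ fun i _ => ?_
      have := hpc i
      fun_prop)) (ae_of_all _ fun z y _ => ?_) (Ker.gam.integrable.mul_const _)
    (ae_of_all _ fun z y _ => ?_)
  · have e : ∫ z, ∑ i, (gam z * pd i f (x - r • z)) • coordL i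
        = ∑ i, avg r gam (pd i f) x • coordL i := by
      rw [integral_finsetSum _ fun i _ =>
        (integrable_avg Ker.gam (hf.pd i) r x).smul_const (coordL i)]
      exact Finset.sum_congr rfl fun i _ => integral_smul_const _ _
    rw [e] at h
    exact h
  · rw [Finset.mul_sum]
    refine norm_sum_le_of_le _ fun i _ => ?_
    rw [norm_smul, norm_mul, Real.norm_of_nonneg (gam_nonneg z)]
    calc gam z * ‖pd i f (y - r • z)‖ * ‖coordL i‖ ≤ gam z * C i * 1 := by
          gcongr
          · exact mul_nonneg (gam_nonneg z) (hC0 i)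
          · exact gam_nonneg z
          · exact hC i _
          · exact norm_coordL_le i
      _ = gam z * C i := mul_one _
  · have h1 : HasFDerivAt (fun y : Plane => y - r • z) (ContinuousLinearMap.id ℝ Plane) y :=
      (hasFDerivAt_id y).sub_const _
    have h2 := ((hf.diff (y - r • z)).hasFDerivAt.comp y h1).const_mul (gam z)
    rw [fderiv_eq_sum_coordL] at h2
    refine h2.congr_fderiv ?_
    ext v
    simp [mul_assoc]

lemma pd_avg {f : Plane → ℝ} (hf : Hs f) (r : ℝ) (i : Fin 2) :
    pd i (avg r gam f) = avg r gam (pd i f) := by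
  funext x
  rw [pd, (hasFDerivAt_avg_space hf r x).fderiv]
  fin_cases i <;> simp [coordL, basisVec]

lemma contDiff_avg {f : Plane → ℝ} (hf : Hs f) (r : ℝ) : ContDiff ℝ ∞ (avg r gam f) := by
  rw [contDiff_infty]
  intro n
  induction n generalizing f with
  | zero =>
    rw [Nat.cast_zero, contDiff_zero]
    exact (continuous_avg hf).comp (Continuous.prodMk_right r)
  | succ n ih =>
    rw [Nat.cast_add, Nat.cast_one, contDiff_succ_iff_hasFDerivAt]
    exact ⟨_, ContDiff.sum fun i _ => (ih (hf.pd i)).smul contDiff_const,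
      hasFDerivAt_avg_space hf r⟩

lemma sq_avg_le {f : Plane → ℝ} (hf : Hs f) (r : ℝ) (x : Plane) :
    avg r gam f x ^ 2 ≤ avg r gam (fun y => f y ^ 2) x := by
  set a := avg r gam f x with ha
  have i1 := integrable_avg Ker.gam hf r x
  have i2 := integrable_avg Ker.gam hf.sq r x
  have i3 := Ker.gam.integrable
  have h1 : 0 ≤ ∫ z, gam z * (f (x - r • z) - a) ^ 2 :=
    integral_nonneg fun z => mul_nonneg (gam_nonneg z) (sq_nonneg _)
  have e : (fun z => gam z * (f (x - r • z) - a) ^ 2) = fun z =>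
      gam z * f (x - r • z) ^ 2 - 2 * a * (gam z * f (x - r • z)) + a ^ 2 * gam z := by
    funext z; ring
  have i12 : Integrable fun z => gam z * f (x - r • z) ^ 2 - 2 * a * (gam z * f (x - r • z)) :=
    i2.sub (i1.const_mul (2 * a))
  rw [e, integral_add i12 (i3.const_mul _), integral_sub i2 (i1.const_mul _), integral_const_mul,
    integral_const_mul, integral_gam] at h1
  change 0 ≤ avg r gam (fun y => f y ^ 2) x - 2 * a * a + a ^ 2 * 1 at h1
  nlinarith

lemma integrable_prod_avg {f : Plane → ℝ} (hf : Hs f) (r : ℝ) :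
    Integrable (fun q : Plane × Plane => gam q.2 * f (q.1 - r • q.2) ^ 2)
      (volume.prod volume) := by
  have hc := hf.cont
  have hg := Ker.gam.cont
  have hm : AEStronglyMeasurable (fun q : Plane × Plane => gam q.2 * f (q.1 - r • q.2) ^ 2)
      (volume.prod volume) := Continuous.aestronglyMeasurable (by fun_prop)
  rw [integrable_prod_iff' hm]
  refine ⟨ae_of_all _ fun z => ?_, ?_⟩
  · exact (hf.integrable_sq.comp_sub_right (r • z)).const_mul (gam z)
  · have e : (fun z => ∫ x, ‖gam z * f (x - r • z) ^ 2‖) = fun z => gam z * sqn f := by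
      funext z
      have : (fun x => ‖gam z * f (x - r • z) ^ 2‖) = fun x => gam z * f (x - r • z) ^ 2 := by
        funext x
        rw [Real.norm_of_nonneg (mul_nonneg (gam_nonneg z) (sq_nonneg _))]
      rw [this, integral_const_mul, integral_sub_right_eq_self (fun y => f y ^ 2)]
      rfl
    simp only [e]
    exact Ker.gam.integrable.mul_const _

lemma memLp_avg {f : Plane → ℝ} (hf : Hs f) (r : ℝ) : MemLp (avg r gam f) 2 volume := by
  have hc := (contDiff_avg hf r).continuous
  rw [memLp_two_iff_integrable_sq hc.aestronglyMeasurable]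
  refine (integrable_prod_avg hf r).integral_prod_left.mono' (hc.pow 2).aestronglyMeasurable
    (ae_of_all _ fun x => ?_)
  rw [Real.norm_of_nonneg (sq_nonneg _)]
  exact sq_avg_le hf r x

lemma nrm_avg_le {f : Plane → ℝ} (hf : Hs f) (r : ℝ) : nrm (avg r gam f) ≤ nrm f := by
  refine Real.sqrt_le_sqrt ?_
  have h1 : sqn (avg r gam f) ≤ ∫ x, ∫ z, gam z * f (x - r • z) ^ 2 :=
    integral_mono (memLp_avg hf r).integrable_sq (integrable_prod_avg hf r).integral_prod_left
      fun x => sq_avg_le hf r x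
  refine h1.trans (le_of_eq ?_)
  rw [integral_integral_swap (integrable_prod_avg hf r)]
  have e : (fun z => ∫ x, gam z * f (x - r • z) ^ 2) = fun z => gam z * sqn f := by
    funext z
    rw [integral_const_mul, integral_sub_right_eq_self (fun y => f y ^ 2)]
    rfl
  rw [e, integral_mul_const, integral_gam, one_mul]

lemma Hs.avg {f : Plane → ℝ} (hf : Hs f) (r : ℝ) : Hs (avg r INS2D.gam f) := by
  refine ⟨contDiff_avg hf r, fun l => ?_⟩
  have h : ∀ l : List (Fin 2), pdl l (INS2D.avg r INS2D.gam f)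
      = INS2D.avg r INS2D.gam (pdl l f) ∧ Hs (pdl l f) := by
    intro l
    induction l with
    | nil => exact ⟨rfl, hf⟩
    | cons i l ih =>
      refine ⟨?_, ih.2.pd i⟩
      change INS2D.pd i (pdl l _) = INS2D.avg r INS2D.gam (INS2D.pd i (pdl l f))
      rw [ih.1, pd_avg ih.2]
  rw [(h l).1]
  exact memLp_avg (h l).2 r

lemma avg_lap {f : Plane → ℝ} (hf : Hs f) (r : ℝ) (x : Plane) :
    avg r gam (lap f) x = ∑ i, avg r gam (pd i (pd i f)) x :=
  avg_sum_right Ker.gam (fun i => (hf.pd i).pd i) r x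

lemma lap_avg {f : Plane → ℝ} (hf : Hs f) (r : ℝ) : lap (avg r gam f) = avg r gam (lap f) := by
  funext x
  rw [avg_lap hf]
  refine Finset.sum_congr rfl fun i _ => ?_
  rw [pd_avg hf, pd_avg (hf.pd i)]

lemma hasDerivAt_avg_gam {f : Plane → ℝ} (hf : Hs f) (r : ℝ) (x : Plane) :
    HasDerivAt (fun r => avg r gam f x) (2 * r * avg r gam (lap f) x) r := by
  refine (hasDerivAt_avg Ker.gam hf r x).congr_deriv ?_
  have e : ∀ i : Fin 2, (fun z : Plane => z i * gam z) = fun z => -2 * pd i gam z := by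
    intro i; funext z; rw [pd_gam]; ring
  have h1 : ∀ i, avg r (fun z => z i * gam z) (pd i f) x
      = -(2 * r * avg r gam (pd i (pd i f)) x) := by
    intro i
    rw [e, avg_const_mul_left, avg_pd Ker.gam (hf.pd i)]
    ring
  simp only [h1]
  rw [avg_lap hf, Finset.mul_sum]
  simp

/-- The supremum bound for `∂ᵢ` of a heat average. -/
lemma abs_avg_pd_le {f : Plane → ℝ} (hf : Hs f) (i : Fin 2) (x : Plane) {r : ℝ} (hr : 0 < r) :
    |avg r gam (pd i f) x| ≤ nrm (pd i gam) * ((r ^ 2)⁻¹ * nrm f) := by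
  have h1 := abs_avg_le (Ker.gam.pd i).memL2 hf x hr
  rw [avg_pd Ker.gam hf, abs_mul, abs_of_pos hr] at h1
  have : |avg r gam (pd i f) x| = r⁻¹ * (r * |avg r gam (pd i f) x|) := by field_simp
  rw [this]
  calc r⁻¹ * (r * |avg r gam (pd i f) x|) ≤ r⁻¹ * (nrm (pd i gam) * (r⁻¹ * nrm f)) := by gcongr
    _ = _ := by rw [sq, mul_inv]; ring

/-- The supremum bound for the Laplacian of a heat average. -/
lemma abs_avg_lap_le {f : Plane → ℝ} (hf : Hs f) (x : Plane) {r : ℝ} (hr : 0 < r) :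
    |avg r gam (lap f) x| ≤ (∑ i, nrm (pd i (pd i gam))) * ((r ^ 3)⁻¹ * nrm f) := by
  have h0 : ∀ i, |avg r gam (pd i (pd i f)) x| ≤ nrm (pd i (pd i gam)) * ((r ^ 3)⁻¹ * nrm f) := by
    intro i
    have h1 := abs_avg_le ((Ker.gam.pd i).pd i).memL2 hf x hr
    rw [avg_pd (Ker.gam.pd i) hf, avg_pd Ker.gam (hf.pd i), abs_mul, abs_mul, abs_of_pos hr] at h1
    have : |avg r gam (pd i (pd i f)) x|
        = (r ^ 2)⁻¹ * (r * (r * |avg r gam (pd i (pd i f)) x|)) := by field_simp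
    rw [this]
    calc _ ≤ (r ^ 2)⁻¹ * (nrm (pd i (pd i gam)) * (r⁻¹ * nrm f)) := by gcongr
      _ = _ := by rw [pow_succ r 2, mul_inv]; ring
  rw [avg_lap hf, Finset.sum_mul]
  exact (Finset.abs_sum_le_sum_abs _ _).trans (Finset.sum_le_sum fun i _ => h0 i)

/-- Evolution of the pairing of a smooth function of time with a heat average. -/
lemma integral_pairing_avg {f : ℝ → Plane → ℝ} (hf : Sm f) {w : Plane → ℝ} (hw : Hs w)
    {r r' : ℝ → ℝ} {b : ℝ} (hb : 0 ≤ b) (hr : ContinuousOn r (Icc 0 b))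
    (hr' : ContinuousOn r' (Icc 0 b)) (hd : ∀ s ∈ Ioo 0 b, HasDerivAt r (r' s) s) :
    IntervalIntegrable (fun s => ∫ x, (dt f s x * avg (r s) gam w x
          + f s x * (2 * r s * r' s * avg (r s) gam (lap w) x))) volume 0 b ∧
    (∫ x, f b x * avg (r b) gam w x) - ∫ x, f 0 x * avg (r 0) gam w x
      = ∫ s in (0 : ℝ)..b, ∫ x, (dt f s x * avg (r s) gam w x
          + f s x * (2 * r s * r' s * avg (r s) gam (lap w) x)) := by
  have hcont : ∀ {g : Plane → ℝ}, Hs g →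
      ContinuousOn (fun q : ℝ × Plane => avg (r q.1) gam g q.2) (Icc 0 b ×ˢ univ) := by
    intro g hg
    have h1 : ContinuousOn (fun q : ℝ × Plane => r q.1) (Icc 0 b ×ˢ univ) :=
      hr.comp continuousOn_fst fun q hq => hq.1
    exact (continuous_avg hg).comp_continuousOn
      (f := fun q : ℝ × Plane => (r q.1, q.2)) (h1.prodMk continuousOn_snd)
  have hsm : ∀ {F : ℝ → Plane → ℝ}, Sm F →
      ContinuousOn (fun q : ℝ × Plane => F q.1 q.2) (Icc 0 b ×ˢ univ) := fun hF =>
    hF.smooth.continuousOn.mono (prod_mono Icc_subset_Ici_self subset_rfl)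
  have hx : ∀ x : Plane, MapsTo (fun s : ℝ => (s, x)) (Icc 0 b) (Icc 0 b ×ˢ univ) :=
    fun x s hs => ⟨hs, mem_univ _⟩
  have hG : ContinuousOn (fun q : ℝ × Plane => dt f q.1 q.2 * avg (r q.1) gam w q.2
      + f q.1 q.2 * (2 * r q.1 * r' q.1 * avg (r q.1) gam (lap w) q.2)) (Icc 0 b ×ˢ univ) := by
    have h1 : ContinuousOn (fun q : ℝ × Plane => r q.1) (Icc 0 b ×ˢ univ) :=
      hr.comp continuousOn_fst fun q hq => hq.1
    have h2 : ContinuousOn (fun q : ℝ × Plane => r' q.1) (Icc 0 b ×ˢ univ) :=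
      hr'.comp continuousOn_fst fun q hq => hq.1
    exact ((hsm hf.dt).mul (hcont hw)).add ((hsm hf).mul
      (((continuousOn_const.mul h1).mul h2).mul (hcont hw.lap)))
  have hpt : ∀ x, ∫ s in (0 : ℝ)..b, (dt f s x * avg (r s) gam w x
      + f s x * (2 * r s * r' s * avg (r s) gam (lap w) x))
      = f b x * avg (r b) gam w x - f 0 x * avg (r 0) gam w x := by
    intro x
    have hpair : Continuous fun s : ℝ => (s, x) := by fun_prop
    refine intervalIntegral.integral_eq_sub_of_hasDerivAt_of_le
      (f := fun s => f s x * avg (r s) gam w x) hb ?_ (fun s hs => ?_) ?_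
    · exact ((hsm hf).mul (hcont hw)).comp hpair.continuousOn (hx x)
    · have h1 := (hf.smooth.hasDerivAt hs.1 x).mul
        ((hasDerivAt_avg_gam hw (r s) x).comp s (hd s hs))
      refine h1.congr_deriv ?_
      simp only [Function.comp]
      ring
    · refine ContinuousOn.intervalIntegrable ?_
      rw [uIcc_of_le hb]
      exact hG.comp hpair.continuousOn (hx x)
  have hmem : ∀ s, 0 ≤ s → Integrable fun x => dt f s x * avg (r s) gam w x
      + f s x * (2 * r s * r' s * avg (r s) gam (lap w) x) := fun s hs =>
    ((hf.dt.hs hs).integrable_mul (hw.avg _)).fun_add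
      ((hf.hs hs).integrable_mul ((hw.lap.avg _).const_mul _))
  have hm : AEStronglyMeasurable (fun q : ℝ × Plane => dt f q.1 q.2 * avg (r q.1) gam w q.2
      + f q.1 q.2 * (2 * r q.1 * r' q.1 * avg (r q.1) gam (lap w) q.2))
      ((volume.restrict (Ioc 0 b)).prod volume) := by
    have e : (volume.restrict (Ioc 0 b)).prod (volume : Measure Plane)
        = (volume.prod volume).restrict (Ioc 0 b ×ˢ univ) := by
      rw [← Measure.prod_restrict, Measure.restrict_univ]
    rw [e]
    exact ContinuousOn.aestronglyMeasurable
      (hG.mono (prod_mono Ioc_subset_Icc_self subset_rfl)) (measurableSet_Ioc.prod MeasurableSet.univ)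
  have hint : Integrable (fun q : ℝ × Plane => dt f q.1 q.2 * avg (r q.1) gam w q.2
      + f q.1 q.2 * (2 * r q.1 * r' q.1 * avg (r q.1) gam (lap w) q.2))
      ((volume.restrict (Ioc 0 b)).prod volume) := by
    rw [integrable_prod_iff hm]
    refine ⟨?_, ?_⟩
    · filter_upwards [ae_restrict_mem measurableSet_Ioc] with s hs
      exact hmem s hs.1.le
    · have hc : ContinuousOn (fun s => nrm (dt f s) * nrm w
          + nrm (f s) * (|2 * r s * r' s| * nrm (lap w))) (Icc 0 b) :=
        ((hf.dt.toCL2.continuousOn_nrm.mono Icc_subset_Ici_self).mul continuousOn_const).add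
          ((hf.toCL2.continuousOn_nrm.mono Icc_subset_Ici_self).mul
            ((((continuousOn_const.mul hr).mul hr').abs).mul continuousOn_const))
      have hi := (hc.integrableOn_compact isCompact_Icc (μ := volume)).mono_set
        (Ioc_subset_Icc_self (a := (0 : ℝ)) (b := b))
      refine Integrable.mono' hi hm.norm.integral_prod_right' ?_
      filter_upwards [ae_restrict_mem measurableSet_Ioc] with s hs
      rw [Real.norm_of_nonneg (integral_nonneg fun _ => norm_nonneg _)]
      have a1 := integral_abs_mul_le (hf.dt.hs hs.1.le).memL2 (hw.avg (r s)).memL2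
      have a2 := integral_abs_mul_le (hf.hs hs.1.le).memL2
        ((hw.lap.avg (r s)).const_mul (2 * r s * r' s)).memL2
      have i1 := ((hf.dt.hs hs.1.le).integrable_mul (hw.avg (r s))).abs
      have i2 := ((hf.hs hs.1.le).integrable_mul
        ((hw.lap.avg (r s)).const_mul (2 * r s * r' s))).abs
      have a3 : ∫ x, ‖dt f s x * avg (r s) gam w x
          + f s x * (2 * r s * r' s * avg (r s) gam (lap w) x)‖
          ≤ (∫ x, |dt f s x * avg (r s) gam w x|)
            + ∫ x, |f s x * (2 * r s * r' s * avg (r s) gam (lap w) x)| := by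
        rw [← integral_add i1 i2]
        exact integral_mono (hmem s hs.1.le).norm (i1.fun_add i2) fun x => norm_add_le _ _
      have a4 := mul_le_mul_of_nonneg_left (nrm_avg_le hw (r s)) (nrm_nonneg (dt f s))
      have a5 := mul_le_mul_of_nonneg_left (mul_le_mul_of_nonneg_left (nrm_avg_le hw.lap (r s))
        (abs_nonneg (2 * r s * r' s))) (nrm_nonneg (f s))
      rw [nrm_const_mul] at a2
      linarith
  refine ⟨(intervalIntegrable_iff_integrableOn_Ioc_of_le hb).2 hint.integral_prod_left, ?_⟩
  have hswap := intervalIntegral_integral_swap (μ := (volume : Measure Plane)) (a := 0) (b := b)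
    (f := fun s x => dt f s x * avg (r s) gam w x
      + f s x * (2 * r s * r' s * avg (r s) gam (lap w) x)) (by rw [uIoc_of_le hb]; exact hint)
  rw [hswap]
  simp only [hpt]
  rw [integral_sub ((hf.hs hb).integrable_mul (hw.avg _))
    ((hf.hs le_rfl).integrable_mul (hw.avg _))]

/-! ### The low frequency estimate -/

lemma dt_const (w : Plane → ℝ) : dt (fun _ : ℝ => w) = fun _ _ => 0 := by
  funext t x
  simp [dt]

lemma Sm.of_const {w : Plane → ℝ} (hw : Hs w) : Sm fun _ => w := by
  refine ⟨hw.smooth.comp_contDiffOn contDiffOn_snd, fun j l => ?_⟩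
  cases j with
  | zero =>
    refine ⟨fun t _ => hw.memLp l, fun t _ => ?_⟩
    simpa [nrm, sqn] using tendsto_const_nhds
  | succ j =>
    rw [Function.iterate_succ_apply, dt_const]
    exact Sm.zero.cl2 j l

lemma avg_zero (f : Plane → ℝ) (x : Plane) : avg 0 gam f x = f x := by
  simp [avg, integral_mul_const, integral_gam]

lemma sqn_sub_pairing_avg_le {w : Plane → ℝ} (hw : Hs w) {r : ℝ} (hr : 0 ≤ r) :
    sqn w - ∫ x, w x * avg r gam w x ≤ r ^ 2 * gsq w := by
  have h := integral_pairing_avg (Sm.of_const hw) hw (r := fun s => s) (r' := fun _ => 1) hr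
    continuousOn_id continuousOn_const fun s _ => hasDerivAt_id s
  replace h := h.2
  simp only [dt_const, zero_mul, zero_add, avg_zero, mul_one] at h
  have e : ∀ s, ∫ x, w x * (2 * s * avg s gam (lap w) x)
      = -(2 * s * ∑ i, ∫ x, pd i w x * avg s gam (pd i w) x) := by
    intro s
    have h1 : ∀ x, w x * (2 * s * avg s gam (lap w) x) = 2 * s * (w x * lap (avg s gam w) x) := by
      intro x; rw [lap_avg hw]; ring
    simp only [h1]
    rw [integral_const_mul, (hw.avg s).integral_mul_lap hw]
    simp only [pd_avg hw]
    ring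
  have hle : ∀ s, ∑ i, ∫ x, pd i w x * avg s gam (pd i w) x ≤ gsq w := by
    intro s
    refine Finset.sum_le_sum fun i _ => ?_
    have h1 := (le_abs_self _).trans (abs_integral_mul_le (hw.pd i).memL2 ((hw.pd i).avg s).memL2)
    have h2 := mul_le_mul_of_nonneg_left (nrm_avg_le (hw.pd i) s) (nrm_nonneg (pd i w))
    rw [← nrm_sq, sq]
    linarith
  have hI : -∫ s in (0 : ℝ)..r, ∫ x, w x * (2 * s * avg s gam (lap w) x) ≤ r ^ 2 * gsq w := by
    have h2 : ‖∫ s in (0 : ℝ)..r, ∫ x, w x * (2 * s * avg s gam (lap w) x)‖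
        ≤ ∫ s in (0 : ℝ)..r, 2 * s * gsq w := by
      refine intervalIntegral.norm_integral_le_of_norm_le hr (ae_of_all _ fun s hs => ?_)
        (Continuous.intervalIntegrable (by fun_prop) _ _)
      rw [e, norm_neg, Real.norm_eq_abs, abs_mul, abs_of_nonneg (by linarith [hs.1] : 0 ≤ 2 * s)]
      refine mul_le_mul_of_nonneg_left ?_ (by linarith [hs.1])
      refine (Finset.abs_sum_le_sum_abs _ _).trans (Finset.sum_le_sum fun i _ => ?_)
      refine (abs_integral_mul_le (hw.pd i).memL2 ((hw.pd i).avg s).memL2).trans ?_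
      rw [← nrm_sq, sq]
      exact mul_le_mul_of_nonneg_left (nrm_avg_le (hw.pd i) s) (nrm_nonneg (pd i w))
    have h3 : ∫ s in (0 : ℝ)..r, 2 * s * gsq w = r ^ 2 * gsq w := by
      rw [intervalIntegral.integral_mul_const, intervalIntegral.integral_const_mul, integral_id]
      ring
    rw [h3, Real.norm_eq_abs] at h2
    exact (neg_le_abs _).trans h2
  have e2 : sqn w = ∫ x, w x * w x := by simp only [sqn, sq]
  rw [e2]
  linarith

lemma integrable_of_first_moment {f : Plane → ℝ} (hc : Continuous f)
    (h : Integrable fun x => ‖x‖ * |f x|) : Integrable f := by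
  have h1 : IntegrableOn f (Metric.closedBall 0 1) :=
    hc.continuousOn.integrableOn_compact (isCompact_closedBall 0 1)
  have h2 : IntegrableOn f (Metric.closedBall 0 1)ᶜ := by
    refine Integrable.mono' h.integrableOn hc.aestronglyMeasurable ?_
    filter_upwards [ae_restrict_mem Metric.isClosed_closedBall.measurableSet.compl] with x hx
    rw [mem_compl_iff, Metric.mem_closedBall, dist_zero_right, not_le] at hx
    rw [Real.norm_eq_abs]
    exact le_mul_of_one_le_left (abs_nonneg _) hx.le
  have := h1.union h2
  rwa [union_compl_self, integrableOn_univ] at this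

lemma abs_sub_le_of_pd_le {f : Plane → ℝ} (hf : Differentiable ℝ f) {G : ℝ}
    (hG : ∀ i x, |pd i f x| ≤ G) (x : Plane) : |f x - f 0| ≤ 2 * G * ‖x‖ := by
  have hb : ∀ y ∈ (univ : Set Plane), ‖fderiv ℝ f y‖ ≤ 2 * G := by
    intro y _
    rw [fderiv_eq_sum_coordL, Fin.sum_univ_two]
    have h1 : ∀ i, ‖pd i f y • coordL i‖ ≤ G := fun i => by
      rw [norm_smul, Real.norm_eq_abs]
      have := mul_le_mul (hG i y) (norm_coordL_le i) (norm_nonneg _)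
        ((abs_nonneg _).trans (hG i y))
      linarith
    linarith [norm_add_le (pd 0 f y • coordL 0) (pd 1 f y • coordL 1), h1 0, h1 1]
  have := convex_univ.norm_image_sub_le_of_norm_fderiv_le (fun y _ => hf y) hb (mem_univ 0)
    (mem_univ x)
  simpa using this

namespace Sol

variable {ϱ P : ℝ → Plane → ℝ} {u : Fin 2 → ℝ → Plane → ℝ} {t : ℝ}

/-- The momentum density. -/
def mmt (ϱ : ℝ → Plane → ℝ) (u : Fin 2 → ℝ → Plane → ℝ) (k : Fin 2) (t : ℝ) (x : Plane) : ℝ :=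
  u k t x + ϱ t x * u k t x

lemma hmmt (h : Sol ϱ u P) (k : Fin 2) : Sm (mmt ϱ u k) := (h.hu k).add (h.hϱ.mul (h.hu k))

lemma dt_mmt (h : Sol ϱ u P) (k : Fin 2) (ht : 0 ≤ t) (x : Plane) :
    dt (mmt ϱ u k) t x = lap (u k t) x - pd k (P t) x - ∑ i, u i t x * pd i (mmt ϱ u k t) x := by
  have h1 : HasDerivWithinAt (fun s => mmt ϱ u k s x)
      (dt (u k) t x + (dt ϱ t x * u k t x + ϱ t x * dt (u k) t x)) (Ici 0) t :=
    ((h.hu k).smooth.hasDerivWithinAt ht x).add ((h.hϱ.smooth.hasDerivWithinAt ht x).mul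
      ((h.hu k).smooth.hasDerivWithinAt ht x))
  have e1 : dt (mmt ϱ u k) t x = _ := h1.derivWithin (uniqueDiffOn_Ici 0 t ht)
  have hr := h.hϱ.hs ht
  have hu := (h.hu k).hs ht
  have e2 : ∀ i, pd i (mmt ϱ u k t) x
      = pd i (u k t) x + (pd i (ϱ t) x * u k t x + ϱ t x * pd i (u k t) x) := by
    intro i
    have : mmt ϱ u k t = fun x => u k t x + ϱ t x * u k t x := rfl
    rw [this, pd_add hu.diff (hr.mul hu).diff, pd_mul hr.diff hu.diff]
  have h3 := h.mass t ht x
  have h4 := h.mom k t ht x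
  rw [e1]
  simp only [e2, Fin.sum_univ_two, xd] at h3 h4 ⊢
  linear_combination u k t x * h3 + h4

/-- The weak form of the momentum equation, tested with a divergence free field. -/
lemma sum_integral_dt_mmt (h : Sol ϱ u P) (ht : 0 ≤ t) {φ : Fin 2 → Plane → ℝ}
    (hφ : ∀ k, Hs (φ k)) (hdiv : ∀ x, ∑ k, pd k (φ k) x = 0) :
    ∑ k, ∫ x, (dt (mmt ϱ u k) t x * φ k x - mmt ϱ u k t x * lap (φ k) x)
      = ∑ k, ∑ i, (∫ x, (1 + ϱ t x) * pd i (φ k) x * (u i t x * u k t x))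
        - ∑ k, ∫ x, lap (φ k) x * (ϱ t x * u k t x) := by
  have hu := fun k => (h.hu k).hs ht
  have hr := h.hϱ.hs ht
  have hm := fun k => (h.hmmt k).hs ht
  have hz := sum_integral_mul_pd_eq_zero hφ hdiv (h.hP.slice ht) fun k => (h.hp k).hs ht
  have hk : ∀ k, ∫ x, (dt (mmt ϱ u k) t x * φ k x - mmt ϱ u k t x * lap (φ k) x)
      = (∑ i, ∫ x, (1 + ϱ t x) * pd i (φ k) x * (u i t x * u k t x))
        - (∫ x, lap (φ k) x * (ϱ t x * u k t x)) - ∫ x, φ k x * pd k (P t) x := by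
    intro k
    have z1 : (∫ x, φ k x * lap (u k t) x) - ∫ x, u k t x * lap (φ k) x = 0 := by
      rw [(hu k).integral_mul_lap (hφ k), (hφ k).integral_mul_lap (hu k)]
      simp only [mul_comm, sub_self]
    have z2 := integral_transport_eq_zero hu (h.div t ht) ((hm k).mul (hφ k))
    have i1 : Integrable fun x => φ k x * lap (u k t) x := (hφ k).integrable_mul (hu k).lap
    have i2 : Integrable fun x => u k t x * lap (φ k) x := (hu k).integrable_mul (hφ k).lap
    have i3 : ∀ i, Integrable fun x => u i t x * pd i (fun x => mmt ϱ u k t x * φ k x) x :=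
      fun i => (hu i).integrable_mul (((hm k).mul (hφ k)).pd i)
    have i4 : ∀ i, Integrable fun x => (1 + ϱ t x) * pd i (φ k) x * (u i t x * u k t x) :=
      fun i => (((hu i).integrable_mul ((hu k).mul ((hφ k).pd i))).fun_add
        (hr.integrable_mul ((hu i).mul ((hu k).mul ((hφ k).pd i))))).congr
        (ae_of_all _ fun x => by simp only; ring)
    have i5 : Integrable fun x => lap (φ k) x * (ϱ t x * u k t x) :=
      (hφ k).lap.integrable_mul (hr.mul (hu k))
    have i6 : Integrable fun x => φ k x * pd k (P t) x :=
      (hφ k).integrable_mul ((h.hp k).hs ht)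
    have i7 : Integrable fun x => dt (mmt ϱ u k) t x * φ k x - mmt ϱ u k t x * lap (φ k) x :=
      (((h.hmmt k).dt.hs ht).integrable_mul (hφ k)).sub ((hm k).integrable_mul (hφ k).lap)
    rw [← sub_eq_zero]
    rw [Fin.sum_univ_two] at z2 ⊢
    have e : ∀ i x, pd i (fun x => mmt ϱ u k t x * φ k x) x
        = pd i (mmt ϱ u k t) x * φ k x + mmt ϱ u k t x * pd i (φ k) x := fun i x => by
      rw [pd_mul (hm k).diff (hφ k).diff]
    have key : ∫ x, ((dt (mmt ϱ u k) t x * φ k x - mmt ϱ u k t x * lap (φ k) x)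
        - (φ k x * lap (u k t) x - u k t x * lap (φ k) x)
        + (u 0 t x * pd 0 (fun x => mmt ϱ u k t x * φ k x) x
          + u 1 t x * pd 1 (fun x => mmt ϱ u k t x * φ k x) x)
        - ((1 + ϱ t x) * pd 0 (φ k) x * (u 0 t x * u k t x)
          + (1 + ϱ t x) * pd 1 (φ k) x * (u 1 t x * u k t x))
        + lap (φ k) x * (ϱ t x * u k t x) + φ k x * pd k (P t) x) = 0 := by
      rw [← integral_zero Plane ℝ]
      congr 1
      funext x
      rw [h.dt_mmt k ht, Fin.sum_univ_two, e, e]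
      simp only [mmt]
      ring
    have j1 : Integrable fun x => φ k x * lap (u k t) x - u k t x * lap (φ k) x := i1.sub i2
    have j2 := (i3 0).fun_add (i3 1)
    have j3 := (i4 0).fun_add (i4 1)
    have q1 : Integrable fun x => (dt (mmt ϱ u k) t x * φ k x - mmt ϱ u k t x * lap (φ k) x)
        - (φ k x * lap (u k t) x - u k t x * lap (φ k) x) := i7.sub j1
    have q2 := q1.fun_add j2
    have q3 : Integrable fun x => (dt (mmt ϱ u k) t x * φ k x - mmt ϱ u k t x * lap (φ k) x)
        - (φ k x * lap (u k t) x - u k t x * lap (φ k) x)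
        + (u 0 t x * pd 0 (fun x => mmt ϱ u k t x * φ k x) x
          + u 1 t x * pd 1 (fun x => mmt ϱ u k t x * φ k x) x)
        - ((1 + ϱ t x) * pd 0 (φ k) x * (u 0 t x * u k t x)
          + (1 + ϱ t x) * pd 1 (φ k) x * (u 1 t x * u k t x)) := q2.sub j3
    rw [integral_add (q3.fun_add i5) i6, integral_add q3 i5, integral_sub q2 j3,
      integral_add q1 j2, integral_sub i7 j1, integral_sub i1 i2, integral_add (i3 0) (i3 1),
      integral_add (i4 0) (i4 1)] at key
    linarith
  simp only [hk, Finset.sum_sub_distrib]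
  rw [hz, sub_zero]

lemma nrm_density_eq (h : Sol ϱ u P) (ht : 0 ≤ t) : nrm (ϱ t) = nrm (ϱ 0) := by
  rw [nrm, nrm, h.sqn_eq ht]

lemma continuousOn_n0 {v : Fin 2 → ℝ → Plane → ℝ} (hv : ∀ k, Sm (v k)) :
    ContinuousOn (n0 v) (Ici 0) :=
  ContinuousOn.sqrt (continuousOn_finsetSum _ fun k _ => continuousOn_sqn (hv k))

/-- The low frequency estimate. -/
theorem exists_low_frequency : ∃ c : ℝ, 0 < c ∧
    ∀ {ϱ P : ℝ → Plane → ℝ} {u : Fin 2 → ℝ → Plane → ℝ}, Sol ϱ u P →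
    ∀ {U : ℝ}, (∀ k, Integrable fun x => ‖x‖ * |u k 0 x|) →
      (∀ k, ∫ x, ‖x‖ * |u k 0 x| ≤ U) → (∀ k, ∫ x, mmt ϱ u k 0 x = 0) →
    ∀ {t r : ℝ}, 0 ≤ t → 0 < r →
      n0 u t ^ 2 ≤ r ^ 2 * n1 u t ^ 2 + c * n0 u t * ((r ^ 2)⁻¹ * (U + ∫ s in (0 : ℝ)..t, n0 u s ^ 2)
        + (r ^ 3)⁻¹ * (nrm (ϱ 0) * ∫ s in (0 : ℝ)..t, n0 u s) + r⁻¹ * (nrm (ϱ 0) * n0 u t)) := by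
  set g0 := nrm gam
  set g1 := ∑ i, nrm (pd i gam) with hg1
  set g2 := ∑ i, nrm (pd i (pd i gam)) with hg2
  have hg0' : 0 ≤ g0 := nrm_nonneg _
  have hg1' : 0 ≤ g1 := Finset.sum_nonneg fun _ _ => nrm_nonneg _
  have hg2' : 0 ≤ g2 := Finset.sum_nonneg fun _ _ => nrm_nonneg _
  have hg1i : ∀ i, nrm (pd i gam) ≤ g1 := fun i =>
    Finset.single_le_sum (f := fun i => nrm (pd i gam)) (fun _ _ => nrm_nonneg _)
      (Finset.mem_univ i)
  refine ⟨1 + 2 * g0 + 5 * g1 + 2 * g2, by positivity,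
    fun {ϱ P u} h {U} hU1 hU2 hmz {t r} ht hr => ?_⟩
  have hw := fun k => (h.hu k).hs ht
  set a := n0 u t with ha
  have ha0 : 0 ≤ a := n0_nonneg _ _
  have hwa : ∀ k, nrm (u k t) ≤ a := fun k => nrm_le_n0 k
  let R : ℝ → ℝ := fun s => Real.sqrt (r ^ 2 + t - s)
  have hRr : ∀ s, s ≤ t → r ≤ R s := fun s hs =>
    Real.le_sqrt_of_sq_le (by linarith)
  have hR0 : ∀ s, s ≤ t → 0 < R s := fun s hs => hr.trans_le (hRr s hs)
  have hRt : R t = r := by simp [R, Real.sqrt_sq hr.le]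
  have hRc : Continuous R := by fun_prop
  have hRd : ∀ s, s < t → HasDerivAt R (-(2 * R s)⁻¹) s := by
    intro s hs
    have h1 : HasDerivAt (fun s => r ^ 2 + t - s) (-1) s := by
      simpa using (hasDerivAt_id s).const_sub (r ^ 2 + t)
    have h2 := h1.sqrt (by nlinarith : r ^ 2 + t - s ≠ 0)
    refine h2.congr_deriv ?_
    simp only [R]
    ring
  have hR' : ContinuousOn (fun s => -(2 * R s)⁻¹) (Icc 0 t) :=
    ((continuous_const.mul hRc).continuousOn.inv₀ fun s hs =>
      (mul_pos two_pos (hR0 s hs.2)).ne').neg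
  let φ : ℝ → Fin 2 → Plane → ℝ := fun s k => avg (R s) gam (u k t)
  have hφ : ∀ s k, Hs (φ s k) := fun s k => (hw k).avg _
  have hφdiv : ∀ s x, ∑ k, pd k (φ s k) x = 0 := by
    intro s x
    simp only [φ, pd_avg (hw _)]
    rw [← avg_sum_right Ker.gam fun k => (hw k).pd k]
    have : (fun y => ∑ i, pd i (u i t) y) = fun _ => 0 := funext fun y => h.div t ht y
    rw [this]
    simp [avg]
  have hφ1 : ∀ s, s ≤ t → ∀ i k x, |pd i (φ s k) x| ≤ g1 * ((r ^ 2)⁻¹ * a) := by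
    intro s hs i k x
    rw [pd_avg (hw k)]
    refine (abs_avg_pd_le (hw k) i x (hR0 s hs)).trans ?_
    have := hRr s hs
    have := hwa k
    have := hg1i i
    have := nrm_nonneg (u k t)
    gcongr
  have hφ2 : ∀ s, s ≤ t → ∀ k x, |lap (φ s k) x| ≤ g2 * ((r ^ 3)⁻¹ * a) := by
    intro s hs k x
    rw [lap_avg (hw k)]
    refine (abs_avg_lap_le (hw k) x (hR0 s hs)).trans ?_
    have := hRr s hs
    have := hwa k
    have := nrm_nonneg (u k t)
    gcongr
  have hpair : ∑ k, ((∫ x, mmt ϱ u k t x * φ t k x) - ∫ x, mmt ϱ u k 0 x * φ 0 k x)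
      = ∫ s in (0 : ℝ)..t, ∑ k, ∫ x, (dt (mmt ϱ u k) s x * φ s k x
        - mmt ϱ u k s x * lap (φ s k) x) := by
    have h1 := fun k => integral_pairing_avg (h.hmmt k) (hw k) ht hRc.continuousOn hR'
      fun s hs => hRd s hs.2
    have e : ∀ k, EqOn (fun s => ∫ x, (dt (mmt ϱ u k) s x * avg (R s) gam (u k t) x
        + mmt ϱ u k s x * (2 * R s * -(2 * R s)⁻¹ * avg (R s) gam (lap (u k t)) x)))
        (fun s => ∫ x, (dt (mmt ϱ u k) s x * φ s k x
        - mmt ϱ u k s x * lap (φ s k) x)) (uIcc 0 t) := by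
      intro k s hs
      rw [uIcc_of_le ht] at hs
      have hs' : 2 * R s ≠ 0 := by have := hR0 s hs.2; positivity
      simp only [φ, lap_avg (hw k)]
      congr 1
      funext x
      rw [mul_neg, mul_inv_cancel₀ hs']
      ring
    have i1 := fun k => (h1 k).1.congr ((e k).mono uIoc_subset_uIcc)
    rw [Fin.sum_univ_two, (h1 0).2, (h1 1).2, intervalIntegral.integral_congr (e 0),
      intervalIntegral.integral_congr (e 1), ← intervalIntegral.integral_add (i1 0) (i1 1)]
    simp only [Fin.sum_univ_two]
  have hbd : ∀ s, 0 ≤ s → s ≤ t → |∑ k, ∫ x, (dt (mmt ϱ u k) s x * φ s k x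
      - mmt ϱ u k s x * lap (φ s k) x)|
      ≤ 5 * g1 * ((r ^ 2)⁻¹ * a) * n0 u s ^ 2
        + 2 * g2 * ((r ^ 3)⁻¹ * a) * (nrm (ϱ 0) * n0 u s) := by
    intro s hs hst
    have hus := fun k => (h.hu k).hs hs
    rw [h.sum_integral_dt_mmt hs (hφ s) (hφdiv s)]
    have b1 : ∀ k i, |∫ x, (1 + ϱ s x) * pd i (φ s k) x * (u i s x * u k s x)|
        ≤ 5 / 4 * (g1 * ((r ^ 2)⁻¹ * a)) * (n0 u s * n0 u s) := fun k i => by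
      refine (hus i).abs_integral_weight_le_of_le (hus k) (fun x => ?_) (nrm_le_n0 i) (nrm_le_n0 k)
      rw [abs_mul]
      exact mul_le_mul (h.abs_one_add_le hs x) (hφ1 s hst i k x) (abs_nonneg _) (by norm_num)
    have b2 : ∀ k, |∫ x, lap (φ s k) x * (ϱ s x * u k s x)|
        ≤ g2 * ((r ^ 3)⁻¹ * a) * (nrm (ϱ 0) * n0 u s) := fun k =>
      (h.hϱ.hs hs).abs_integral_weight_le_of_le (hus k) (hφ2 s hst k)
        (h.nrm_density_eq hs).le (nrm_le_n0 k)
    simp only [Fin.sum_univ_two]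
    have c1 := fun k i => _root_.abs_le.1 (b1 k i)
    have c2 := fun k => _root_.abs_le.1 (b2 k)
    rw [_root_.abs_le]
    constructor
    · linarith [(c1 0 0).1, (c1 0 1).1, (c1 1 0).1, (c1 1 1).1, (c2 0).2, (c2 1).2]
    · linarith [(c1 0 0).2, (c1 0 1).2, (c1 1 0).2, (c1 1 1).2, (c2 0).1, (c2 1).1]
  have hcont := continuousOn_n0 h.hu
  have k1 : IntervalIntegrable (fun s => n0 u s ^ 2) volume 0 t :=
    intervalIntegrable_of_continuousOn (hcont.pow 2) le_rfl ht
  have k2 : IntervalIntegrable (fun s => n0 u s) volume 0 t :=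
    intervalIntegrable_of_continuousOn hcont le_rfl ht
  have hI : |∑ k, ((∫ x, mmt ϱ u k t x * φ t k x) - ∫ x, mmt ϱ u k 0 x * φ 0 k x)|
      ≤ 5 * g1 * ((r ^ 2)⁻¹ * a) * (∫ s in (0 : ℝ)..t, n0 u s ^ 2)
        + 2 * g2 * ((r ^ 3)⁻¹ * a) * (nrm (ϱ 0) * ∫ s in (0 : ℝ)..t, n0 u s) := by
    rw [hpair]
    have i1 := k1.const_mul (5 * g1 * ((r ^ 2)⁻¹ * a))
    have i2 := (k2.const_mul (nrm (ϱ 0))).const_mul (2 * g2 * ((r ^ 3)⁻¹ * a))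
    have h1 := intervalIntegral.norm_integral_le_of_norm_le ht (μ := volume)
      (f := fun s => ∑ k, ∫ x, (dt (mmt ϱ u k) s x * φ s k x - mmt ϱ u k s x * lap (φ s k) x))
      (ae_of_all _ fun s hs => hbd s hs.1.le hs.2) (i1.add i2)
    rw [intervalIntegral.integral_add i1 i2, intervalIntegral.integral_const_mul,
      intervalIntegral.integral_const_mul, intervalIntegral.integral_const_mul] at h1
    exact h1
  have hinit : ∀ k, |∫ x, mmt ϱ u k 0 x * φ 0 k x| ≤ 5 / 2 * (g1 * ((r ^ 2)⁻¹ * a)) * U := by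
    intro k
    have hu0 := (h.hu k).hs le_rfl
    have hm0 := (h.hmmt k).hs le_rfl
    have hG0 : 0 ≤ g1 * ((r ^ 2)⁻¹ * a) := by positivity
    have hmabs : ∀ x, |mmt ϱ u k 0 x| ≤ 5 / 4 * |u k 0 x| := fun x => by
      have : mmt ϱ u k 0 x = (1 + ϱ 0 x) * u k 0 x := by simp only [mmt]; ring
      rw [this, abs_mul]
      exact mul_le_mul_of_nonneg_right (h.abs_one_add_le le_rfl x) (abs_nonneg _)
    have hmi : Integrable (mmt ϱ u k 0) :=
      ((integrable_of_first_moment hu0.cont (hU1 k)).abs.const_mul (5 / 4)).mono'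
        hm0.cont.aestronglyMeasurable (ae_of_all _ hmabs)
    have e : ∫ x, mmt ϱ u k 0 x * φ 0 k x = ∫ x, mmt ϱ u k 0 x * (φ 0 k x - φ 0 k 0) := by
      simp only [mul_sub]
      rw [integral_sub (hm0.integrable_mul (hφ 0 k)) (hmi.mul_const _), integral_mul_const, hmz k,
        zero_mul, sub_zero]
    rw [e]
    refine abs_integral_le_integral_abs.trans ?_
    have h1 : ∫ x, |mmt ϱ u k 0 x * (φ 0 k x - φ 0 k 0)|
        ≤ ∫ x, 5 / 2 * (g1 * ((r ^ 2)⁻¹ * a)) * (‖x‖ * |u k 0 x|) := by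
      refine integral_mono_of_nonneg (ae_of_all _ fun x => abs_nonneg _) ((hU1 k).const_mul _)
        (ae_of_all _ fun x => ?_)
      simp only [abs_mul]
      have h2 := abs_sub_le_of_pd_le (hφ 0 k).diff (fun i x => hφ1 0 ht i k x) x
      calc |mmt ϱ u k 0 x| * |φ 0 k x - φ 0 k 0|
          ≤ 5 / 4 * |u k 0 x| * (2 * (g1 * ((r ^ 2)⁻¹ * a)) * ‖x‖) :=
            mul_le_mul (hmabs x) h2 (abs_nonneg _) (by positivity)
        _ = _ := by ring
    rw [integral_const_mul] at h1
    exact h1.trans (mul_le_mul_of_nonneg_left (hU2 k) (by positivity))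
  have hfin : ∀ k, sqn (u k t) ≤ r ^ 2 * gsq (u k t) + (∫ x, mmt ϱ u k t x * φ t k x)
      + g0 * (r⁻¹ * a) * (nrm (ϱ 0) * a) := by
    intro k
    have h1 := sqn_sub_pairing_avg_le (hw k) hr.le
    have hφt : φ t k = avg r gam (u k t) := by simp only [φ, hRt]
    have h2 : |∫ x, φ t k x * (ϱ t x * u k t x)| ≤ g0 * (r⁻¹ * a) * (nrm (ϱ 0) * a) := by
      refine (h.hϱ.hs ht).abs_integral_weight_le_of_le (hw k) (fun x => ?_)
        (h.nrm_density_eq ht).le (hwa k)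
      rw [hφt]
      refine (abs_avg_le Ker.gam.memL2 (hw k) x hr).trans ?_
      have := hwa k
      gcongr
    have e : ∫ x, mmt ϱ u k t x * φ t k x
        = (∫ x, u k t x * φ t k x) + ∫ x, φ t k x * (ϱ t x * u k t x) := by
      rw [← integral_add ((hw k).integrable_mul (hφ t k))
        ((hφ t k).integrable_mul ((h.hϱ.hs ht).mul (hw k)))]
      congr 1
      funext x
      simp only [mmt]
      ring
    rw [← hφt] at h1
    rw [e]
    linarith [(_root_.abs_le.1 h2).1]
  have e1 : a ^ 2 = sqn (u 0 t) + sqn (u 1 t) := by rw [ha, n0_sq, vsq, Fin.sum_univ_two]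
  have e2 : n1 u t ^ 2 = gsq (u 0 t) + gsq (u 1 t) := by rw [n1_sq, vgsq, Fin.sum_univ_two]
  have hU0 : 0 ≤ U := (integral_nonneg fun x => by positivity).trans (hU2 0)
  have hA : 0 ≤ ∫ s in (0 : ℝ)..t, n0 u s ^ 2 :=
    intervalIntegral.integral_nonneg ht fun s _ => sq_nonneg _
  have hA1 : 0 ≤ ∫ s in (0 : ℝ)..t, n0 u s :=
    intervalIntegral.integral_nonneg ht fun s _ => n0_nonneg _ _
  have hn := nrm_nonneg (ϱ 0)
  rw [Fin.sum_univ_two] at hI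
  have f1 := hfin 0
  have f2 := hfin 1
  have f3 := (_root_.abs_le.1 hI).2
  have f4 := (_root_.abs_le.1 (hinit 0)).2
  have f5 := (_root_.abs_le.1 (hinit 1)).2
  set A := ∫ s in (0 : ℝ)..t, n0 u s ^ 2
  set A1 := ∫ s in (0 : ℝ)..t, n0 u s
  set N := nrm (ϱ 0)
  have T1 : 0 ≤ a * ((r ^ 2)⁻¹ * (U + A)) := by positivity
  have T2 : 0 ≤ a * ((r ^ 3)⁻¹ * (N * A1)) := by positivity
  have T3 : 0 ≤ a * (r⁻¹ * (N * a)) := by positivity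
  have T : 5 * g1 * ((r ^ 2)⁻¹ * a) * (U + A) + 2 * g2 * ((r ^ 3)⁻¹ * a) * (N * A1)
      + 2 * (g0 * (r⁻¹ * a) * (N * a)) ≤ (1 + 2 * g0 + 5 * g1 + 2 * g2) * a
        * ((r ^ 2)⁻¹ * (U + A) + (r ^ 3)⁻¹ * (N * A1) + r⁻¹ * (N * a)) := by
    have q1 := mul_nonneg (by positivity : 0 ≤ 1 + 2 * g0 + 2 * g2) T1
    have q2 := mul_nonneg (by positivity : 0 ≤ 1 + 2 * g0 + 5 * g1) T2
    have q3 := mul_nonneg (by positivity : 0 ≤ 1 + 5 * g1 + 2 * g2) T3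
    linarith
  rw [e1, e2]
  linarith

end Sol

/-! ### Decay from the low frequency estimate -/

lemma hasDerivAt_lam {σ : ℝ} (hσ : 0 ≤ σ) :
    HasDerivAt (fun σ => 3 + Real.log (Real.exp 1 + σ)) (Real.exp 1 + σ)⁻¹ σ := by
  have h0 : 0 < Real.exp 1 + σ := by positivity
  simpa using (((hasDerivAt_id σ).const_add (Real.exp 1)).log h0.ne').const_add 3

lemma four_le_lam {σ : ℝ} (hσ : 0 ≤ σ) : 4 ≤ 3 + Real.log (Real.exp 1 + σ) := by
  have : Real.log (Real.exp 1) ≤ Real.log (Real.exp 1 + σ) :=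
    Real.log_le_log (Real.exp_pos 1) (by linarith)
  rw [Real.log_exp] at this
  linarith

lemma lam_sq_le {σ : ℝ} (hσ : 0 ≤ σ) :
    (3 + Real.log (Real.exp 1 + σ)) ^ 2 ≤ 8 * (Real.exp 1 + σ) := by
  have h0 : 0 < Real.exp 1 + σ := by positivity
  set l := Real.log (Real.exp 1 + σ) with hl
  have h1 : 1 ≤ l := by linarith [four_le_lam hσ]
  have h2 : 1 + l + l ^ 2 / 2 ≤ Real.exp l := Real.quadratic_le_exp_of_nonneg (by linarith)
  rw [hl, Real.exp_log h0, ← hl] at h2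
  nlinarith

lemma le_of_deriv_le {f g f' g' : ℝ → ℝ}
    (hf : ∀ t, 0 ≤ t → HasDerivWithinAt f (f' t) (Ici 0) t)
    (hg : ∀ t, 0 ≤ t → HasDerivWithinAt g (g' t) (Ici 0) t) (h : ∀ t, 0 ≤ t → f' t ≤ g' t)
    {t : ℝ} (ht : 0 ≤ t) : f t ≤ f 0 + (g t - g 0) := by
  have := antitoneOn_of_hasDerivWithinAt_Ici (fun t ht => (hf t ht).sub (hg t ht))
    (fun t ht => by linarith [h t ht]) self_mem_Ici ht ht
  simp only [Pi.sub_apply] at this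
  linarith

section Splitting

variable {c B E : ℝ} {y y' a n : ℝ → ℝ}

/-- The system of inequalities produced by the Fourier splitting method. -/
structure Splitting (c B E : ℝ) (y y' a n : ℝ → ℝ) : Prop where
  hc : 0 ≤ c
  hE : 0 ≤ E
  hEB : E ≤ B
  hy : ∀ σ, 0 ≤ σ → HasDerivWithinAt y (y' σ) (Ici 0) σ
  ha : ∀ σ, 0 ≤ σ → HasDerivWithinAt a (n σ) (Ici 0) σ
  ha0 : a 0 = 0
  hn : ∀ σ, 0 ≤ σ → 0 ≤ n σ ∧ n σ ≤ 4 / 3 * y σ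
  hy0 : ∀ σ, 0 ≤ σ → 0 ≤ y σ ∧ y σ ≤ E
  main : ∀ σ, 0 ≤ σ → ∀ q, 1 / 5 ≤ q →
    y' σ ≤ -(4 / (5 * q)) * y σ + c / q * ((E + a σ) ^ 2 / q ^ 2 + σ * a σ / q ^ 3)

namespace Splitting

lemma a_nonneg (h : Splitting c B E y y' a n) {σ : ℝ} (hσ : 0 ≤ σ) : 0 ≤ a σ := by
  have := le_of_deriv_le (fun t _ => (hasDerivWithinAt_const t (Ici 0) (0 : ℝ))) h.ha
    (fun t ht => (h.hn t ht).1) hσ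
  rw [h.ha0] at this
  linarith

lemma a_le (h : Splitting c B E y y' a n) {σ : ℝ} (hσ : 0 ≤ σ) : a σ ≤ 4 / 3 * E * σ := by
  have := le_of_deriv_le h.ha
    (fun t _ => ((hasDerivAt_id t).const_mul (4 / 3 * E)).hasDerivWithinAt)
    (fun t ht => by linarith [(h.hn t ht).2, (h.hy0 t ht).2]) hσ
  rw [h.ha0] at this
  simpa using this

/-- Logarithmic decay. -/
lemma log_decay (h : Splitting c B E y y' a n) {σ : ℝ} (hσ : 0 ≤ σ) :
    y σ * (3 + Real.log (Real.exp 1 + σ)) ^ 2 ≤ (16 + 250 * c * (B + 5)) * E := by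
  have hE := h.hE
  have hc := h.hc
  have hB : 0 ≤ B := hE.trans h.hEB
  have key := le_of_deriv_le (f := fun σ => (3 + Real.log (Real.exp 1 + σ)) ^ 3 * y σ)
    (g := fun σ => 250 * c * (B + 5) * E * (3 + Real.log (Real.exp 1 + σ)))
    (fun t ht => ((hasDerivAt_lam ht).pow 3).hasDerivWithinAt.mul (h.hy t ht))
    (fun t ht => ((hasDerivAt_lam ht).const_mul _).hasDerivWithinAt) (fun t ht => ?_) hσ
  · simp only [add_zero, Real.log_exp] at key
    have h0 := (h.hy0 0 le_rfl).2
    have hl := four_le_lam hσ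
    set l := 3 + Real.log (Real.exp 1 + σ)
    have hC : 0 ≤ 250 * c * (B + 5) * E := by positivity
    have h1 : l * (y σ * l ^ 2) ≤ l * ((16 + 250 * c * (B + 5)) * E) := by
      have : 16 * (4 * E) ≤ 16 * (l * E) := by gcongr
      nlinarith
    exact le_of_mul_le_mul_left h1 (by linarith)
  · have ht0 : 0 < Real.exp 1 + t := by positivity
    have hl := four_le_lam ht
    have he : 1 ≤ Real.exp 1 + t := by linarith [Real.add_one_le_exp (1 : ℝ)]
    have het : t ≤ Real.exp 1 + t := by linarith [Real.exp_pos 1]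
    set τ := Real.exp 1 + t
    set l := 3 + Real.log τ
    have hl0 : 0 < l := by linarith
    have hm := h.main t ht (τ * l / 5) (by nlinarith)
    have ha := h.a_le ht
    have ha0 := h.a_nonneg ht
    have hy := (h.hy0 t ht).1
    have hG : E + a t ≤ 4 / 3 * E * τ := by
      have : 1 ≤ Real.exp 1 := by linarith [Real.add_one_le_exp (1 : ℝ)]
      have e : 4 / 3 * E * τ = 4 / 3 * E * Real.exp 1 + 4 / 3 * E * t := by simp only [τ]; ring
      have : E * 1 ≤ E * Real.exp 1 := by gcongr
      rw [e]
      linarith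
    have hG2 : (E + a t) ^ 2 ≤ 2 * B * E * τ ^ 2 := by
      calc (E + a t) ^ 2 ≤ (4 / 3 * E * τ) ^ 2 := pow_le_pow_left₀ (by linarith) hG 2
        _ = 16 / 9 * E * E * τ ^ 2 := by ring
        _ ≤ 2 * B * E * τ ^ 2 := by
          have := h.hEB
          gcongr
          norm_num
    have hta : t * a t ≤ 2 * E * τ ^ 2 := by
      calc t * a t ≤ τ * (4 / 3 * E * τ) := by
            refine mul_le_mul het (ha.trans ?_) ha0 ht0.le
            gcongr
        _ ≤ 2 * E * τ ^ 2 := by nlinarith [mul_nonneg hE (sq_nonneg τ)]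
    have hF : (E + a t) ^ 2 / (τ * l / 5) ^ 2 + t * a t / (τ * l / 5) ^ 3
        ≤ (50 * B * E + 250 * E) / l ^ 2 := by
      have e1 : (E + a t) ^ 2 / (τ * l / 5) ^ 2 = 25 * ((E + a t) ^ 2 / τ ^ 2) / l ^ 2 := by
        field_simp
        norm_num
      have e2 : t * a t / (τ * l / 5) ^ 3 = 125 * (t * a t / τ ^ 2) / (τ * l) / l ^ 2 := by
        field_simp
        norm_num
      have f1 : (E + a t) ^ 2 / τ ^ 2 ≤ 2 * B * E := by
        rw [div_le_iff₀ (by positivity)]; exact hG2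
      have f2 : t * a t / τ ^ 2 ≤ 2 * E := by
        rw [div_le_iff₀ (by positivity)]; exact hta
      have f3 : 125 * (t * a t / τ ^ 2) / (τ * l) ≤ 250 * E := by
        rw [div_le_iff₀ (by positivity)]
        have : 1 ≤ τ * l := by nlinarith
        nlinarith [mul_nonneg hE (by linarith : 0 ≤ τ * l - 1)]
      rw [e1, e2, ← add_div]
      exact div_le_div_of_nonneg_right (by linarith) (by positivity)
    have hy' : l ^ 3 * y' t ≤ -(4 * l ^ 2 * τ⁻¹) * y t + 250 * c * (B + 5) * E * τ⁻¹ := by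
      calc l ^ 3 * y' t ≤ l ^ 3 * (-(4 / (5 * (τ * l / 5))) * y t
            + c / (τ * l / 5) * ((50 * B * E + 250 * E) / l ^ 2)) := by
            refine mul_le_mul_of_nonneg_left (hm.trans ?_) (by positivity)
            gcongr
        _ = _ := by field_simp; ring
    have : 0 ≤ l ^ 2 * τ⁻¹ * y t := by positivity
    have e : ((3 : ℕ) : ℝ) * l ^ (3 - 1) * τ⁻¹ = 3 * l ^ 2 * τ⁻¹ := by norm_num
    change ((3 : ℕ) : ℝ) * l ^ (3 - 1) * τ⁻¹ * y t + l ^ 3 * y' t ≤ _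
    rw [e]
    linarith

/-- A first bound for the time integral. -/
lemma a_le_of_log_decay (h : Splitting c B E y y' a n) {σ : ℝ} (hσ : 0 ≤ σ) :
    E + a σ ≤ (8 + 3 * (16 + 250 * c * (B + 5))) * E
      * ((Real.exp 1 + σ) / (3 + Real.log (Real.exp 1 + σ)) ^ 2) := by
  have hE := h.hE
  have hc := h.hc
  have hB : 0 ≤ B := hE.trans h.hEB
  set K := 16 + 250 * c * (B + 5) with hK
  have hK0 : 0 ≤ K := by positivity
  have key := le_of_deriv_le (g := fun σ => 8 / 3 * K * E
      * ((Real.exp 1 + σ) / (3 + Real.log (Real.exp 1 + σ)) ^ 2)) h.ha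
    (fun t ht => (((((hasDerivAt_id t).const_add (Real.exp 1)).div ((hasDerivAt_lam ht).pow 2)
      (pow_ne_zero 2 (by linarith [four_le_lam ht]))).const_mul (8 / 3 * K * E)).hasDerivWithinAt))
    (fun t ht => ?_) hσ
  · rw [h.ha0] at key
    have hl := four_le_lam hσ
    have h8 := lam_sq_le hσ
    set l := 3 + Real.log (Real.exp 1 + σ)
    have h1 : 1 / 8 ≤ (Real.exp 1 + σ) / l ^ 2 := by
      rw [div_le_div_iff₀ (by norm_num) (by positivity)]; linarith
    have h2 : 0 ≤ 8 / 3 * K * E * ((Real.exp 1 + 0) / (3 + Real.log (Real.exp 1 + 0)) ^ 2) := by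
      have := four_le_lam (le_refl (0 : ℝ)); positivity
    have h3 : 8 * E * (1 / 8) ≤ 8 * E * ((Real.exp 1 + σ) / l ^ 2) := by gcongr
    have h4 : 8 / 3 * K * E * ((Real.exp 1 + σ) / l ^ 2) ≤ 3 * K * E * ((Real.exp 1 + σ) / l ^ 2) := by
      gcongr; norm_num
    linarith
  · have ht0 : 0 < Real.exp 1 + t := by positivity
    have hl := four_le_lam ht
    have hld := h.log_decay ht
    rw [← hK] at hld
    have hn := (h.hn t ht).2
    simp only [id, Pi.pow_apply]
    set τ := Real.exp 1 + t
    set l := 3 + Real.log τ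
    have hl0 : 0 < l := by linarith
    have h1 : y t ≤ K * E / l ^ 2 := by rw [le_div_iff₀ (by positivity)]; exact hld
    have e : 8 / 3 * K * E * ((1 * l ^ 2 - τ * (((2 : ℕ) : ℝ) * l ^ (2 - 1) * τ⁻¹)) / (l ^ 2) ^ 2)
        = 8 / 3 * (K * E / l ^ 2) * (1 - 2 / l) := by
      norm_num
      field_simp
    have h2 : 1 / 2 ≤ 1 - 2 / l := by
      have : 2 / l ≤ 1 / 2 := by rw [div_le_div_iff₀ hl0 (by norm_num)]; linarith
      linarith
    have h3 : 0 ≤ K * E / l ^ 2 := by positivity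
    rw [e]
    nlinarith

/-- The derivative of `τ³ y`. -/
lemma deriv_cube_le (h : Splitting c B E y y' a n) {t : ℝ} (ht : 0 ≤ t) :
    3 * (Real.exp 1 + t) ^ 2 * y t + (Real.exp 1 + t) ^ 3 * y' t
      ≤ 125 * c * ((E + a t) ^ 2 + 5 * (E + a t)) := by
  have hE := h.hE
  have hc := h.hc
  have ht0 : 0 < Real.exp 1 + t := by positivity
  have he : 1 ≤ Real.exp 1 + t := by linarith [Real.add_one_le_exp (1 : ℝ)]
  have het : t ≤ Real.exp 1 + t := by linarith [Real.exp_pos 1]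
  set τ := Real.exp 1 + t
  have hm := h.main t ht (τ / 5) (by linarith)
  have ha0 := h.a_nonneg ht
  have hy := (h.hy0 t ht).1
  have h1 : t * a t / τ ≤ E + a t := by
    rw [div_le_iff₀ ht0]
    nlinarith
  have h2 : τ ^ 3 * y' t ≤ -(4 * τ ^ 2) * y t + 125 * c * ((E + a t) ^ 2 + 5 * (t * a t / τ)) := by
    calc τ ^ 3 * y' t ≤ τ ^ 3 * (-(4 / (5 * (τ / 5))) * y t
        + c / (τ / 5) * ((E + a t) ^ 2 / (τ / 5) ^ 2 + t * a t / (τ / 5) ^ 3)) := by gcongr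
      _ = _ := by field_simp; ring
  have h3 : 125 * c * ((E + a t) ^ 2 + 5 * (t * a t / τ))
      ≤ 125 * c * ((E + a t) ^ 2 + 5 * (E + a t)) := by gcongr
  have h4 : 0 ≤ τ ^ 2 * y t := by positivity
  linarith

lemma hasDerivWithinAt_cube (h : Splitting c B E y y' a n) {t : ℝ} (ht : 0 ≤ t) :
    HasDerivWithinAt (fun σ => (Real.exp 1 + σ) ^ 3 * y σ)
      (3 * (Real.exp 1 + t) ^ 2 * y t + (Real.exp 1 + t) ^ 3 * y' t) (Ici 0) t := by
  have := ((((hasDerivAt_id t).const_add (Real.exp 1)).pow 3).hasDerivWithinAt).mul (h.hy t ht)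
  refine this.congr_deriv ?_
  norm_num

lemma exists_a_le (c B : ℝ) : ∃ K, 0 < K ∧ ∀ {E : ℝ} {y y' a n : ℝ → ℝ},
    Splitting c B E y y' a n → ∀ {σ : ℝ}, 0 ≤ σ → E + a σ ≤ K * E := by
  set K2 := 8 + 3 * (16 + 250 * c * (B + 5)) with hK2
  set K3 := 125 * c * (K2 * B + 40) with hK3
  set K4 := 36 + 2 * K3 with hK4
  refine ⟨Real.exp K4, Real.exp_pos _, fun {E y y' a n} h {σ} hσ => ?_⟩
  have hE := h.hE
  have hc := h.hc
  have hB : 0 ≤ B := hE.trans h.hEB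
  have hK2' : 0 ≤ K2 := by positivity
  have hK3' : 0 ≤ K3 := by positivity
  have hK4' : 0 ≤ K4 := by positivity
  have hGd : ∀ t, 0 ≤ t → HasDerivWithinAt (fun s => E + a s) (n t) (Ici 0) t := fun t ht =>
    (h.ha t ht).const_add E
  have hy : ∀ t, 0 ≤ t → y t ≤ 27 * E / (Real.exp 1 + t) ^ 3
      + K3 * (E + a t) / ((Real.exp 1 + t) * (3 + Real.log (Real.exp 1 + t)) ^ 2) := by
    intro t ht
    have key := le_of_deriv_le (f := fun σ => (Real.exp 1 + σ) ^ 3 * y σ)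
      (g := fun σ => K3 * ((Real.exp 1 + σ) ^ 2 / (3 + Real.log (Real.exp 1 + σ)) ^ 2 * (E + a σ)))
      (fun t ht => h.hasDerivWithinAt_cube ht)
      (fun t ht => (((((((hasDerivAt_id t).const_add (Real.exp 1)).pow 2).div
        ((hasDerivAt_lam ht).pow 2)
        (pow_ne_zero 2 (by linarith [four_le_lam ht]))).hasDerivWithinAt).mul (hGd t ht)).const_mul K3))
      (fun t ht => ?_) ht
    · have ht0 : 0 < Real.exp 1 + t := by positivity
      have hl := four_le_lam ht
      have h0 := (h.hy0 0 le_rfl).2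
      have h00 := (h.hy0 0 le_rfl).1
      have he : Real.exp 1 ^ 3 ≤ 27 := by
        calc Real.exp 1 ^ 3 ≤ 3 ^ 3 := by
              have := Real.exp_one_lt_d9
              gcongr
              linarith
          _ = 27 := by norm_num
      have h1 : 0 ≤ K3 * ((Real.exp 1 + 0) ^ 2 / (3 + Real.log (Real.exp 1 + 0)) ^ 2 * (E + a 0)) := by
        have := four_le_lam (le_refl (0 : ℝ))
        rw [h.ha0]
        positivity
      have h2 : (Real.exp 1 + 0) ^ 3 * y 0 ≤ 27 * E := by
        rw [add_zero]
        exact mul_le_mul he h0 h00 (by norm_num)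
      set τ := Real.exp 1 + t
      set l := 3 + Real.log τ
      have hl0 : 0 < l := by linarith
      have h3 : τ ^ 3 * y t ≤ 27 * E + K3 * (τ ^ 2 / l ^ 2 * (E + a t)) := by linarith
      have e : 27 * E / τ ^ 3 + K3 * (E + a t) / (τ * l ^ 2)
          = (27 * E + K3 * (τ ^ 2 / l ^ 2 * (E + a t))) / τ ^ 3 := by field_simp
      rw [e, le_div_iff₀ (by positivity), mul_comm]
      exact h3
    · have ht0 : 0 < Real.exp 1 + t := by positivity
      have hl := four_le_lam ht
      have h8 := lam_sq_le ht
      have hG := h.a_le_of_log_decay ht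
      have hcube := h.deriv_cube_le ht
      have hn := (h.hn t ht).1
      have ha0 := h.a_nonneg ht
      rw [← hK2] at hG
      simp only [id, Pi.pow_apply, Pi.div_apply]
      set τ := Real.exp 1 + t
      set l := 3 + Real.log τ
      have hl0 : 0 < l := by linarith
      have hG0 : 0 ≤ E + a t := by linarith
      refine hcube.trans ?_
      have h1 : (E + a t) ^ 2 ≤ K2 * B * (τ / l ^ 2) * (E + a t) := by
        have : E + a t ≤ K2 * B * (τ / l ^ 2) := hG.trans (by have := h.hEB; gcongr)
        nlinarith
      have h2 : E + a t ≤ 8 * (τ / l ^ 2) * (E + a t) := by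
        have : 1 ≤ 8 * (τ / l ^ 2) := by
          rw [← mul_div_assoc, le_div_iff₀ (by positivity)]; linarith
        nlinarith
      have e : (((2 : ℕ) : ℝ) * τ ^ (2 - 1) * 1 * l ^ 2 - τ ^ 2 * (((2 : ℕ) : ℝ) * l ^ (2 - 1) * τ⁻¹)) / (l ^ 2) ^ 2
          = 2 * (τ / l ^ 2) * (1 - 1 / l) := by
        norm_num
        field_simp
      have h3 : 1 / 2 ≤ 1 - 1 / l := by
        have : 1 / l ≤ 1 / 2 := by rw [div_le_div_iff₀ hl0 (by norm_num)]; linarith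
        linarith
      have h4 : 0 ≤ τ / l ^ 2 * (E + a t) := by positivity
      calc 125 * c * ((E + a t) ^ 2 + 5 * (E + a t))
          ≤ 125 * c * (K2 * B * (τ / l ^ 2) * (E + a t) + 5 * (8 * (τ / l ^ 2) * (E + a t))) := by
            gcongr
        _ = K3 * (τ / l ^ 2 * (E + a t)) := by rw [hK3]; ring
        _ ≤ K3 * (2 * (τ / l ^ 2) * (1 - 1 / l) * (E + a t) + τ ^ 2 / l ^ 2 * n t) := by
            gcongr
            have : 0 ≤ τ ^ 2 / l ^ 2 * n t := by positivity
            nlinarith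
        _ = _ := by rw [← e]
  have hanti := le_of_deriv_le
    (f := fun s => (E + a s) * Real.exp (K4 * ((Real.exp 1 + s)⁻¹ + (3 + Real.log (Real.exp 1 + s))⁻¹)))
    (g := fun _ => 0)
    (fun t ht => (hGd t ht).mul ((((((hasDerivAt_id t).const_add (Real.exp 1)).inv
      (by simp only [id]; positivity)).add ((hasDerivAt_lam ht).inv
        (by have := four_le_lam ht; positivity))).const_mul K4).exp).hasDerivWithinAt)
    (fun t _ => hasDerivWithinAt_const t _ 0) (fun t ht => ?_) hσ
  · simp only [add_zero, Real.log_exp, h.ha0, sub_self] at hanti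
    have hl := four_le_lam hσ
    have hτ : 0 < Real.exp 1 + σ := by positivity
    have ha0 := h.a_nonneg hσ
    have h1 : 1 ≤ Real.exp (K4 * ((Real.exp 1 + σ)⁻¹ + (3 + Real.log (Real.exp 1 + σ))⁻¹)) :=
      Real.one_le_exp (by positivity)
    have h2 : Real.exp (K4 * ((Real.exp 1)⁻¹ + (3 + 1)⁻¹)) ≤ Real.exp K4 := by
      refine Real.exp_le_exp.2 ?_
      have : (Real.exp 1)⁻¹ ≤ 2⁻¹ := by
        have := Real.add_one_le_exp (1 : ℝ)
        gcongr
        linarith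
      nlinarith
    calc E + a σ ≤ (E + a σ) * Real.exp (K4 * ((Real.exp 1 + σ)⁻¹
          + (3 + Real.log (Real.exp 1 + σ))⁻¹)) := le_mul_of_one_le_right (by linarith) h1
      _ ≤ E * Real.exp (K4 * ((Real.exp 1)⁻¹ + (3 + 1)⁻¹)) := hanti
      _ ≤ E * Real.exp K4 := by gcongr
      _ = _ := mul_comm _ _
  · have ht0 : 0 < Real.exp 1 + t := by positivity
    have he : 1 ≤ Real.exp 1 + t := by linarith [Real.add_one_le_exp (1 : ℝ)]
    have hl := four_le_lam ht
    have hyt := hy t ht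
    have hn := (h.hn t ht).2
    have ha0 := h.a_nonneg ht
    simp only [id, Pi.add_apply, Pi.inv_apply]
    set τ := Real.exp 1 + t
    set l := 3 + Real.log τ
    have hl0 : 0 < l := by linarith
    have h1 : n t ≤ K4 * (E + a t) * (1 / τ ^ 2 + 1 / (τ * l ^ 2)) := by
      have h2 : 27 * E / τ ^ 3 ≤ 27 * (E + a t) * (1 / τ ^ 2) := by
        rw [mul_one_div]
        have : τ ^ 2 ≤ τ ^ 3 := pow_le_pow_right₀ he (by norm_num)
        gcongr
        linarith
      have h3 : K3 * (E + a t) / (τ * l ^ 2) = K3 * (E + a t) * (1 / (τ * l ^ 2)) := by ring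
      have p1 : 0 ≤ (E + a t) * (1 / τ ^ 2) := by positivity
      have p2 : 0 ≤ (E + a t) * (1 / (τ * l ^ 2)) := by positivity
      have p3 := mul_nonneg hK3' p1
      have p4 := mul_nonneg hK3' p2
      rw [hK4]
      linarith
    set X := Real.exp (K4 * (τ⁻¹ + l⁻¹))
    have hX : 0 < X := Real.exp_pos _
    have e : n t * X + (E + a t) * (X * (K4 * (-1 / τ ^ 2 + -τ⁻¹ / l ^ 2)))
        = X * (n t - K4 * (E + a t) * (1 / τ ^ 2 + 1 / (τ * l ^ 2))) := by
      field_simp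
      ring
    rw [e]
    exact mul_nonpos_of_nonneg_of_nonpos hX.le (by linarith)

/-- Quadratic decay. -/
theorem exists_decay (c B : ℝ) : ∃ K, 0 < K ∧ ∀ {E : ℝ} {y y' a n : ℝ → ℝ},
    Splitting c B E y y' a n → ∀ {σ : ℝ}, 0 ≤ σ → y σ * (Real.exp 1 + σ) ^ 2 ≤ K * E := by
  obtain ⟨K, hK, hG⟩ := exists_a_le c B
  refine ⟨27 + 125 * |c| * (K ^ 2 * |B| + 5 * K), by positivity, fun {E y y' a n} h {σ} hσ => ?_⟩
  have hE := h.hE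
  have hc := h.hc
  have hB : 0 ≤ B := hE.trans h.hEB
  rw [abs_of_nonneg hc, abs_of_nonneg hB]
  set K5 := 125 * c * (K ^ 2 * B + 5 * K) with hK5
  have hK5' : 0 ≤ K5 := by positivity
  have key := le_of_deriv_le (f := fun σ => (Real.exp 1 + σ) ^ 3 * y σ)
      (g := fun σ => K5 * E * σ) (fun t ht => h.hasDerivWithinAt_cube ht)
      (fun t _ => ((hasDerivAt_id t).const_mul (K5 * E)).hasDerivWithinAt) (fun t ht => ?_) hσ
  · have he : Real.exp 1 ^ 3 ≤ 27 := by
      calc Real.exp 1 ^ 3 ≤ 3 ^ 3 := by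
            have := Real.exp_one_lt_d9
            gcongr
            linarith
        _ = 27 := by norm_num
    have h0 := h.hy0 0 le_rfl
    have h2 : (Real.exp 1 + 0) ^ 3 * y 0 ≤ 27 * E := by
      rw [add_zero]
      exact mul_le_mul he h0.2 h0.1 (by norm_num)
    have ht0 : 0 < Real.exp 1 + σ := by positivity
    have h1 : 1 ≤ Real.exp 1 + σ := by linarith [Real.add_one_le_exp (1 : ℝ)]
    have h3 : σ ≤ Real.exp 1 + σ := by linarith [Real.exp_pos 1]
    set τ := Real.exp 1 + σ
    have h4 : τ * (y σ * τ ^ 2) ≤ τ * ((27 + K5) * E) := by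
      have : K5 * E * σ ≤ K5 * E * τ := by gcongr
      have : 27 * E * 1 ≤ 27 * E * τ := by gcongr
      nlinarith
    exact le_of_mul_le_mul_left h4 ht0
  · refine (h.deriv_cube_le ht).trans ?_
    have hGt := hG h ht
    have ha0 := h.a_nonneg ht
    have h1 : (E + a t) ^ 2 ≤ K ^ 2 * B * E := by
      calc (E + a t) ^ 2 ≤ (K * E) ^ 2 := pow_le_pow_left₀ (by linarith) hGt 2
        _ = K ^ 2 * E * E := by ring
        _ ≤ K ^ 2 * B * E := by have := h.hEB; gcongr
    calc 125 * c * ((E + a t) ^ 2 + 5 * (E + a t)) ≤ 125 * c * (K ^ 2 * B * E + 5 * (K * E)) := by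
          gcongr
      _ = K5 * E * 1 := by rw [hK5]; ring

end Splitting

end Splitting

/-! ### The time weight -/

lemma one_le_bracket {T t : ℝ} (hT : 0 ≤ T) (ht : 0 ≤ t) : 1 ≤ bracket T t := by
  have : 0 ≤ t / T := by positivity
  have := Real.add_one_le_exp (1 : ℝ)
  simp only [bracket]
  linarith

lemma bracket_mono {T s t : ℝ} (hT : 0 ≤ T) (hst : s ≤ t) : bracket T s ≤ bracket T t := by
  simp only [bracket]
  gcongr

lemma bracket_le_two_mul {T t : ℝ} : bracket T t ≤ 2 * bracket T (t / 2) := by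
  have := Real.exp_pos 1
  have e : t / 2 / T = t / T / 2 := by ring
  simp only [bracket, e]
  linarith

lemma bracket_le_four {T t : ℝ} (hT : 0 < T) (htT : t ≤ T) : bracket T t ≤ 4 := by
  have h1 : t / T ≤ 1 := (div_le_one hT).2 htT
  have := Real.exp_one_lt_d9
  simp only [bracket]
  linarith

lemma bracket_mul_le {T t : ℝ} (hT : 0 < T) (htT : T ≤ t) : bracket T t * T ≤ 4 * t := by
  have := Real.exp_one_lt_d9
  have e : bracket T t * T = Real.exp 1 * T + t := by
    simp only [bracket]; field_simp
  rw [e]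
  nlinarith

/-- A bound near zero and decay of `t f` give one more power of decay for `f`. -/
lemma decay_step {T t f K₁ K : ℝ} {j : ℕ} (hT : 0 < T) (ht : 0 ≤ t) (hf : 0 ≤ f) (h1 : f ≤ K₁)
    (hK : 0 ≤ K) (h2 : t * f * bracket T t ^ j ≤ T * K) :
    f * bracket T t ^ (j + 1) ≤ 4 ^ (j + 1) * K₁ + 4 * K := by
  have hb := one_le_bracket hT.le ht
  rcases le_total t T with h | h
  · have h4 := bracket_le_four hT h
    have hK₁ := hf.trans h1
    calc f * bracket T t ^ (j + 1) ≤ K₁ * 4 ^ (j + 1) := by gcongr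
      _ ≤ _ := by linarith
  · have h4 := bracket_mul_le hT h
    have h5 : T * (f * bracket T t ^ (j + 1)) ≤ T * (4 * K) := by
      calc T * (f * bracket T t ^ (j + 1)) = f * bracket T t ^ j * (bracket T t * T) := by ring
        _ ≤ f * bracket T t ^ j * (4 * t) := by gcongr
        _ ≤ _ := by linarith
    have h6 := le_of_mul_le_mul_left h5 hT
    have : 0 ≤ (4 : ℝ) ^ (j + 1) * K₁ := mul_nonneg (by positivity) (hf.trans h1)
    linarith

lemma integral_mono_of_continuousOn {a b : ℝ → ℝ} (ha : ContinuousOn a (Ici 0))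
    (hb : ContinuousOn b (Ici 0)) {s t : ℝ} (hs : 0 ≤ s) (hst : s ≤ t)
    (h : ∀ r, s ≤ r → r ≤ t → a r ≤ b r) : ∫ r in s..t, a r ≤ ∫ r in s..t, b r :=
  intervalIntegral.integral_mono_on hst (intervalIntegrable_of_continuousOn ha hs (hs.trans hst))
    (intervalIntegrable_of_continuousOn hb hs (hs.trans hst)) fun r hr => h r hr.1 hr.2

lemma integral_nonneg_of_nonneg {a : ℝ → ℝ} (ha : ∀ t, 0 ≤ t → 0 ≤ a t) {s t : ℝ} (hs : 0 ≤ s)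
    (hst : s ≤ t) : 0 ≤ ∫ r in s..t, a r :=
  intervalIntegral.integral_nonneg hst fun r hr => ha r (hs.trans hr.1)

/-- Averaging over the second half of the time interval. -/
lemma mul_le_of_average {f : ℝ → ℝ} (hf : ContinuousOn f (Ici 0)) {K G H t : ℝ} (ht : 0 ≤ t)
    (hK : 0 ≤ K) (h : ∀ s, t / 2 ≤ s → s ≤ t → f t ≤ K * f s + H)
    (hG : ∫ s in (t / 2)..t, f s ≤ G) : t * f t ≤ 2 * K * G + t * H := by
  have hfK : ContinuousOn (fun s => K * f s + H) (Ici 0) := (hf.const_smul K).add continuousOn_const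
  have h1 := integral_mono_of_continuousOn (continuousOn_const (c := f t)) hfK
    (by linarith : 0 ≤ t / 2) (by linarith : t / 2 ≤ t) h
  rw [intervalIntegral.integral_const, intervalIntegral.integral_add
    ((intervalIntegrable_of_continuousOn hf (by linarith) ht).const_mul K) (by simp),
    intervalIntegral.integral_const_mul, intervalIntegral.integral_const, smul_eq_mul,
    smul_eq_mul] at h1
  have := mul_le_mul_of_nonneg_left hG hK
  linarith

/-! ### The system of energy inequalities -/

/-- The energy inequalities for `y = ∫ρ|u|²`, `N = ‖∇u‖²`, `X`, `M = ‖∇∂ₜu‖²` and the dissipation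
`A` of `N`. -/
structure EnergySystem (C T : ℝ) (y N X M A dN dX : ℝ → ℝ) : Prop where
  hC : 1 ≤ C
  hT : 0 < T
  hy : ∀ t, 0 ≤ t → HasDerivWithinAt y (-2 * N t) (Ici 0) t
  hN : ∀ t, 0 ≤ t → HasDerivWithinAt N (dN t) (Ici 0) t
  hX : ∀ t, 0 ≤ t → HasDerivWithinAt X (dX t) (Ici 0) t
  cM : ContinuousOn M (Ici 0)
  cA : ContinuousOn A (Ici 0)
  y0 : ∀ t, 0 ≤ t → 0 ≤ y t
  N0 : ∀ t, 0 ≤ t → 0 ≤ N t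
  M0 : ∀ t, 0 ≤ t → 0 ≤ M t
  A0 : ∀ t, 0 ≤ t → 0 ≤ A t
  yC : ∀ t, 0 ≤ t → y t ≤ C
  y_decay : ∀ t, 0 ≤ t → y t * bracket T t ^ 2 ≤ C * y 0
  N_le : ∀ t, 0 ≤ t → dN t + A t ≤ C * N t * N t
  X_le : ∀ t, 0 ≤ t → dX t + M t ≤ C * N t * X t
  N_sq_le : ∀ t, 0 ≤ t → N t ^ 2 ≤ X t
  X_le_A : ∀ t, 0 ≤ t → X t ≤ C * (A t + N t * N t)
  N_zero : N 0 ^ 2 ≤ C * (y 0 * X 0)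
  y_zero : y 0 ≤ T * N 0

namespace EnergySystem

variable {C T : ℝ} {y N X M A dN dX : ℝ → ℝ}

lemma X0 (h : EnergySystem C T y N X M A dN dX) {t : ℝ} (ht : 0 ≤ t) : 0 ≤ X t := (sq_nonneg _).trans (h.N_sq_le t ht)

lemma cy (h : EnergySystem C T y N X M A dN dX) : ContinuousOn y (Ici 0) := fun t ht => (h.hy t ht).continuousWithinAt
lemma cN (h : EnergySystem C T y N X M A dN dX) : ContinuousOn N (Ici 0) := fun t ht => (h.hN t ht).continuousWithinAt
lemma cX (h : EnergySystem C T y N X M A dN dX) : ContinuousOn X (Ici 0) := fun t ht => (h.hX t ht).continuousWithinAt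

lemma integral_N_le (h : EnergySystem C T y N X M A dN dX) {s t : ℝ} (hs : 0 ≤ s) (hst : s ≤ t) : ∫ r in s..t, N r ≤ y s := by
  have hd : ∀ t, 0 ≤ t → HasDerivWithinAt (fun t => y t + 2 * ∫ r in s..t, N r)
      (-2 * N t + 2 * N t) (Ici 0) t := fun t ht =>
    (h.hy t ht).add ((hasDerivWithinAt_integral h.cN hs ht).const_mul 2)
  have := antitoneOn_of_hasDerivWithinAt_Ici hd (fun t _ => by linarith) (mem_Ici.2 hs)
    (mem_Ici.2 (hs.trans hst)) hst
  simp only [intervalIntegral.integral_same, mul_zero, add_zero] at this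
  have h1 := h.y0 t (hs.trans hst)
  have h2 := integral_nonneg_of_nonneg h.N0 hs hst
  linarith

lemma exp_integral_N_le (h : EnergySystem C T y N X M A dN dX) {s t : ℝ} (hs : 0 ≤ s) (hst : s ≤ t) :
    Real.exp (∫ r in s..t, C * N r) ≤ Real.exp (C * C) := by
  rw [intervalIntegral.integral_const_mul]
  have h1 := h.integral_N_le hs hst
  have h2 := h.yC s hs
  have h3 := h.hC
  gcongr
  linarith

variable (C) in
/-- The constant of Grönwall's inequality. -/
def gr : ℝ := Real.exp (C * C)

lemma one_le_gr : 1 ≤ gr C := Real.one_le_exp (mul_self_nonneg C)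

lemma gronwall_N (h : EnergySystem C T y N X M A dN dX) {f f' d g : ℝ → ℝ}
    (hf : ∀ t, 0 ≤ t → HasDerivWithinAt f (f' t) (Ici 0) t)
    (hg : ContinuousOn g (Ici 0)) (hd : ContinuousOn d (Ici 0)) (hg0 : ∀ t, 0 ≤ t → 0 ≤ g t)
    (hd0 : ∀ t, 0 ≤ t → 0 ≤ d t) (hf0 : ∀ t, 0 ≤ t → 0 ≤ f t)
    (hle : ∀ t, 0 ≤ t → f' t + d t ≤ C * N t * f t + g t) {s t : ℝ} (hs : 0 ≤ s) (hst : s ≤ t) :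
    f t + ∫ r in s..t, d r ≤ gr C * (f s + ∫ r in s..t, g r) := by
  have hC := h.hC
  refine (gronwall_dissipation hf (h.cN.const_smul C) hg hd
    (fun t ht => mul_nonneg (by linarith) (h.N0 t ht)) hg0 hd0 hle hs hst).trans ?_
  have h1 := h.exp_integral_N_le hs hst
  have h2 := integral_nonneg_of_nonneg hg0 hs hst
  have h3 := hf0 s hs
  exact mul_le_mul_of_nonneg_right h1 (by linarith)

lemma N_add_le (h : EnergySystem C T y N X M A dN dX) {s t : ℝ} (hs : 0 ≤ s) (hst : s ≤ t) : N t + ∫ r in s..t, A r ≤ gr C * N s := by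
  have := h.gronwall_N (g := fun _ => 0) h.hN continuousOn_const h.cA (fun _ _ => le_rfl) h.A0 h.N0
    (fun t ht => by linarith [h.N_le t ht]) hs hst
  simpa using this

lemma N_le_mul (h : EnergySystem C T y N X M A dN dX) {s t : ℝ} (hs : 0 ≤ s) (hst : s ≤ t) : N t ≤ gr C * N s := by
  linarith [h.N_add_le hs hst, integral_nonneg_of_nonneg h.A0 hs hst]

lemma X_add_le (h : EnergySystem C T y N X M A dN dX) {s t : ℝ} (hs : 0 ≤ s) (hst : s ≤ t) : X t + ∫ r in s..t, M r ≤ gr C * X s := by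
  have := h.gronwall_N (g := fun _ => 0) h.hX continuousOn_const h.cM (fun _ _ => le_rfl) h.M0
    (fun t ht => h.X0 ht) (fun t ht => by linarith [h.X_le t ht]) hs hst
  simpa using this

lemma X_le_mul (h : EnergySystem C T y N X M A dN dX) {s t : ℝ} (hs : 0 ≤ s) (hst : s ≤ t) : X t ≤ gr C * X s := by
  linarith [h.X_add_le hs hst, integral_nonneg_of_nonneg h.M0 hs hst]

lemma integral_N_sq_le (h : EnergySystem C T y N X M A dN dX) {s t : ℝ} (hs : 0 ≤ s) (hst : s ≤ t) :
    ∫ r in s..t, N r * N r ≤ gr C * C * N s := by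
  have hg := one_le_gr (C := C)
  have h1 : ∫ r in s..t, N r * N r ≤ ∫ r in s..t, gr C * N s * N r :=
    integral_mono_of_continuousOn (h.cN.mul h.cN) (h.cN.const_smul (gr C * N s)) hs hst
      fun r h1 _ => mul_le_mul_of_nonneg_right (h.N_le_mul hs h1) (h.N0 r (hs.trans h1))
  rw [intervalIntegral.integral_const_mul] at h1
  have h2 := (h.integral_N_le hs hst).trans (h.yC s hs)
  have h3 := mul_le_mul_of_nonneg_left h2 (mul_nonneg (by linarith) (h.N0 s hs) : 0 ≤ gr C * N s)
  linarith

lemma integral_X_le (h : EnergySystem C T y N X M A dN dX) {s t : ℝ} (hs : 0 ≤ s) (hst : s ≤ t) :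
    ∫ r in s..t, X r ≤ C * (gr C + gr C * C) * N s := by
  have hC := h.hC
  have ht := hs.trans hst
  have iA := intervalIntegrable_of_continuousOn h.cA hs ht
  have iN : IntervalIntegrable (fun r => N r * N r) volume s t :=
    intervalIntegrable_of_continuousOn (h.cN.mul h.cN) hs ht
  have h1 : ∫ r in s..t, X r ≤ ∫ r in s..t, C * (A r + N r * N r) :=
    integral_mono_of_continuousOn h.cX ((h.cA.add (h.cN.mul h.cN)).const_smul C) hs hst
      fun r h1 _ => h.X_le_A r (hs.trans h1)
  rw [intervalIntegral.integral_const_mul, intervalIntegral.integral_add iA iN] at h1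
  have h2 := h.integral_N_sq_le hs hst
  have h3 := h.N_add_le hs hst
  have h4 := h.N0 t ht
  have h5 : C * ((∫ r in s..t, A r) + ∫ r in s..t, N r * N r) ≤ C * (gr C * N s + gr C * C * N s) := by
    gcongr
    linarith
  linarith

lemma exists_N_decay (C : ℝ) : ∃ K, 1 ≤ K ∧ ∀ {T : ℝ} {y N X M A dN dX : ℝ → ℝ},
    EnergySystem C T y N X M A dN dX → ∀ {t : ℝ}, 0 ≤ t →
      t * N t * bracket T t ^ 2 ≤ K * y 0 ∧ N t * bracket T t ^ 3 ≤ K * N 0 := by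
  have hg := one_le_gr (C := C)
  refine ⟨1 + 64 * gr C + 4 * (8 * gr C * |C|), by nlinarith [abs_nonneg C],
    fun {T y N X M A dN dX} h {t} ht => ?_⟩
  have hC := h.hC
  have hT := h.hT
  rw [abs_of_nonneg (by linarith : 0 ≤ C)]
  have h0 := h.N0 t ht
  have hy0 := h.y0 0 le_rfl
  have hN0 := h.N0 0 le_rfl
  have hb := one_le_bracket hT.le ht
  have h1 : t * N t ≤ 2 * gr C * y (t / 2) + t * 0 := mul_le_of_average h.cN ht (by linarith)
    (fun s h1 h2 => by linarith [h.N_le_mul (by linarith) h2])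
    (h.integral_N_le (by linarith) (by linarith))
  have h2 := h.y_decay (t / 2) (by linarith)
  have h3 := bracket_le_two_mul (T := T) (t := t)
  have hy2 := h.y0 (t / 2) (by linarith)
  have h4 : t * N t * bracket T t ^ 2 ≤ 8 * gr C * C * y 0 := by
    calc t * N t * bracket T t ^ 2 ≤ (2 * gr C * y (t / 2)) * (2 * bracket T (t / 2)) ^ 2 :=
          mul_le_mul (by linarith) (pow_le_pow_left₀ (by linarith) h3 2) (by positivity)
            (by positivity)
      _ = 8 * gr C * (y (t / 2) * bracket T (t / 2) ^ 2) := by ring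
      _ ≤ 8 * gr C * (C * y 0) := by gcongr
      _ = _ := by ring
  have hgc : 0 ≤ gr C * C := mul_nonneg (by linarith) (by linarith)
  refine ⟨h4.trans ?_, ?_⟩
  · nlinarith [mul_nonneg hgc hy0]
  · have h5 : t * N t * bracket T t ^ 2 ≤ T * (8 * gr C * C * N 0) := by
      refine h4.trans ?_
      calc 8 * gr C * C * y 0 ≤ 8 * gr C * C * (T * N 0) := by
            have := h.y_zero
            gcongr
        _ = _ := by ring
    have h6 := decay_step hT ht h0 (h.N_le_mul le_rfl ht) (by positivity) h5
    refine h6.trans (le_of_sub_nonneg ?_)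
    ring_nf
    positivity

lemma exists_weighted_integral_le (C : ℝ) : ∃ K, 1 ≤ K ∧ ∀ {T : ℝ} {y N X M A dN dX : ℝ → ℝ},
    EnergySystem C T y N X M A dN dX → ∀ {t : ℝ}, 0 ≤ t →
      ∫ r in (0 : ℝ)..t, r ^ 2 * (M r + N r * X r) ≤ K := by
  have hg := one_le_gr (C := C)
  set c := |C|
  set K1 := gr C * c
  set K2 := gr C * (2 * c * (K1 + K1 * c))
  have hc0 : 0 ≤ c := abs_nonneg C
  have hK1 : 0 ≤ K1 := by positivity
  have hK2 : 0 ≤ K2 := by positivity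
  refine ⟨1 + K2 + K2 * c, by nlinarith [mul_nonneg hK2 hc0], fun {T y N X M A dN dX} h {t} ht => ?_⟩
  have hC := h.hC
  have ec : c = C := abs_of_nonneg (by linarith)
  have cid : ContinuousOn (fun t : ℝ => t) (Ici 0) := continuous_id.continuousOn
  have cid2 : ContinuousOn (fun t : ℝ => t ^ 2) (Ici 0) := (continuous_pow 2).continuousOn
  have hyc : ∀ {t : ℝ}, 0 ≤ t → ∫ r in (0 : ℝ)..t, N r ≤ c := fun ht =>
    (h.integral_N_le le_rfl ht).trans (ec ▸ h.yC 0 le_rfl)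
  have a1 : ∀ {t : ℝ}, 0 ≤ t → t * N t + ∫ r in (0 : ℝ)..t, r * A r ≤ K1 := by
    intro t ht
    have hgr := h.gronwall_N (f := fun t => t * N t) (f' := fun t => 1 * N t + t * dN t) (g := N)
      (d := fun t => t * A t) (fun t ht => (hasDerivWithinAt_id t _).mul (h.hN t ht)) h.cN
      (cid.mul h.cA) h.N0 (fun t ht => mul_nonneg ht (h.A0 t ht))
      (fun t ht => mul_nonneg ht (h.N0 t ht)) (fun t ht => ?_) le_rfl ht
    · simp only [zero_mul, zero_add] at hgr
      exact hgr.trans (mul_le_mul_of_nonneg_left (hyc ht) (by linarith))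
    · have := mul_le_mul_of_nonneg_left (h.N_le t ht) ht
      linarith
  have a1N : ∀ {t : ℝ}, 0 ≤ t → t * N t ≤ K1 := fun {t} ht => by
    have := integral_nonneg_of_nonneg (fun t ht => mul_nonneg ht (h.A0 t ht)) le_rfl ht
    linarith [a1 ht]
  have a1A : ∀ {t : ℝ}, 0 ≤ t → ∫ r in (0 : ℝ)..t, r * A r ≤ K1 := fun {t} ht => by
    linarith [a1 ht, mul_nonneg ht (h.N0 t ht)]
  have a2 : ∀ {t : ℝ}, 0 ≤ t → ∫ r in (0 : ℝ)..t, 2 * (r * X r) ≤ 2 * c * (K1 + K1 * c) := by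
    intro t ht
    have h1 : ∫ r in (0 : ℝ)..t, 2 * (r * X r)
        ≤ ∫ r in (0 : ℝ)..t, (2 * c * (r * A r) + 2 * c * K1 * N r) := by
      have := h.cX
      have := h.cA
      have := h.cN
      refine integral_mono_of_continuousOn (by fun_prop) (by fun_prop) le_rfl ht fun r hr _ => ?_
      have e1 := mul_le_mul_of_nonneg_left (h.X_le_A r hr) hr
      have e2 := mul_le_mul_of_nonneg_right (a1N hr) (h.N0 r hr)
      have e3 := mul_le_mul_of_nonneg_left e2 hc0
      rw [← ec] at e1
      linarith
    have iA : IntervalIntegrable (fun r => r * A r) volume 0 t :=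
      intervalIntegrable_of_continuousOn (cid.mul h.cA) le_rfl ht
    rw [intervalIntegral.integral_add (iA.const_mul _)
      ((intervalIntegrable_of_continuousOn h.cN le_rfl ht).const_mul _)] at h1
    simp only [intervalIntegral.integral_const_mul] at h1 ⊢
    have e1 := mul_le_mul_of_nonneg_left (a1A ht) hc0
    have e2 := mul_le_mul_of_nonneg_left (hyc ht) (mul_nonneg hc0 hK1)
    linarith
  have a3 : ∀ {t : ℝ}, 0 ≤ t → t ^ 2 * X t + ∫ r in (0 : ℝ)..t, r ^ 2 * M r ≤ K2 := by
    intro t ht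
    have hgr := h.gronwall_N (f := fun t => t ^ 2 * X t) (f' := fun t => 2 * t * X t + t ^ 2 * dX t)
      (g := fun t => 2 * (t * X t)) (d := fun t => t ^ 2 * M t)
      (fun t ht => HasDerivWithinAt.mul (by simpa using (hasDerivAt_pow 2 t).hasDerivWithinAt)
        (h.hX t ht)) ((cid.mul h.cX).const_smul (2 : ℝ))
      (cid2.mul h.cM) (fun t ht => mul_nonneg (by norm_num) (mul_nonneg ht (h.X0 ht)))
      (fun t ht => mul_nonneg (sq_nonneg t) (h.M0 t ht))
      (fun t ht => mul_nonneg (sq_nonneg t) (h.X0 ht)) (fun t ht => ?_) le_rfl ht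
    · simp only [ne_eq, OfNat.ofNat_ne_zero, not_false_eq_true, zero_pow, zero_mul, zero_add] at hgr
      exact hgr.trans (mul_le_mul_of_nonneg_left (a2 ht) (by linarith))
    · have := mul_le_mul_of_nonneg_left (h.X_le t ht) (sq_nonneg t)
      linarith
  have a3X : ∀ {t : ℝ}, 0 ≤ t → t ^ 2 * X t ≤ K2 := fun {t} ht => by
    have := integral_nonneg_of_nonneg (fun t ht => mul_nonneg (sq_nonneg t) (h.M0 t ht)) le_rfl ht
    linarith [a3 ht]
  have h1 : ∫ r in (0 : ℝ)..t, r ^ 2 * (M r + N r * X r)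
      ≤ ∫ r in (0 : ℝ)..t, (r ^ 2 * M r + K2 * N r) := by
    have := h.cX
    have := h.cM
    have := h.cN
    refine integral_mono_of_continuousOn (by fun_prop) (by fun_prop) le_rfl ht fun r hr _ => ?_
    have := mul_le_mul_of_nonneg_right (a3X hr) (h.N0 r hr)
    linarith
  have iM : IntervalIntegrable (fun r => r ^ 2 * M r) volume 0 t :=
    intervalIntegrable_of_continuousOn (cid2.mul h.cM) le_rfl ht
  rw [intervalIntegral.integral_add iM
      ((intervalIntegrable_of_continuousOn h.cN le_rfl ht).const_mul _),
      intervalIntegral.integral_const_mul] at h1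
  have e1 := mul_le_mul_of_nonneg_left (hyc ht) hK2
  have e2 := a3 ht
  have e3 := mul_nonneg (sq_nonneg t) (h.X0 ht)
  linarith

lemma integral_kappa_le (h : EnergySystem C T y N X M A dN dX) {s t : ℝ} (hs : 0 ≤ s)
    (hst : s ≤ t) : ∫ r in s..t, (M r + N r * X r) ≤ (gr C + gr C * C) * X s := by
  have ht := hs.trans hst
  have hg := one_le_gr (C := C)
  have h1 : ∫ r in s..t, (M r + N r * X r) ≤ ∫ r in s..t, (M r + gr C * X s * N r) := by
    have := h.cX
    have := h.cM
    have := h.cN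
    refine integral_mono_of_continuousOn (by fun_prop) (by fun_prop) hs hst fun r h1 _ => ?_
    have := mul_le_mul_of_nonneg_left (h.X_le_mul hs h1) (h.N0 r (hs.trans h1))
    linarith
  rw [intervalIntegral.integral_add (intervalIntegrable_of_continuousOn h.cM hs ht)
    ((intervalIntegrable_of_continuousOn h.cN hs ht).const_mul _),
    intervalIntegral.integral_const_mul] at h1
  have h2 := (h.integral_N_le hs hst).trans (h.yC s hs)
  have h3 := mul_le_mul_of_nonneg_left h2 (mul_nonneg (by linarith) (h.X0 hs) : 0 ≤ gr C * X s)
  have h4 := h.X_add_le hs hst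
  have h5 := h.X0 ht
  linarith

lemma exists_X_decay (C : ℝ) : ∃ K, 1 ≤ K ∧ ∀ {T : ℝ} {y N X M A dN dX : ℝ → ℝ},
    EnergySystem C T y N X M A dN dX → ∀ {t : ℝ}, 0 ≤ t →
      X t * bracket T t ^ 4 ≤ K * X 0 ∧ t ^ 2 * X t * bracket T t ^ 2 ≤ K := by
  obtain ⟨K, hK, hN⟩ := exists_N_decay C
  have hg := one_le_gr (C := C)
  set c := |C|
  have hc0 : 0 ≤ c := abs_nonneg C
  set G := 2 * gr C * (c * (gr C + gr C * c)) with hGdef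
  have hG : 0 ≤ G := by positivity
  refine ⟨1 + 256 * gr C + 4 * (8 * G * K * c) + 8 * G * K * c, ?_,
    fun {T y N X M A dN dX} h {t} ht => ?_⟩
  · have : 0 ≤ G * K * c := by positivity
    linarith
  have hC := h.hC
  have ec : c = C := abs_of_nonneg (by linarith)
  have hT := h.hT
  have ht2 : 0 ≤ t / 2 := by linarith
  have hb2 := one_le_bracket hT.le ht2
  have hb := one_le_bracket hT.le ht
  have h3 := bracket_le_two_mul (T := T) (t := t)
  have hN2 := h.N0 (t / 2) ht2
  have hX := h.X0 ht
  have hX0 := h.X0 le_rfl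
  have hN0 := h.N0 0 le_rfl
  have hy0 := h.y0 0 le_rfl
  have h1 : t * X t ≤ G * N (t / 2) := by
    have := mul_le_of_average (K := gr C) (H := 0) h.cX ht (by linarith)
      (fun s h1 h2 => by linarith [h.X_le_mul (by linarith) h2])
      (h.integral_X_le ht2 (by linarith))
    rw [hGdef, ec]
    linarith
  obtain ⟨hNa, hNb⟩ := hN h ht2
  have hNT : N 0 ≤ T * (c * X 0) := by
    rcases hN0.eq_or_lt with e | e
    · rw [← e]; positivity
    · have h5 := h.N_zero
      have h6 := mul_le_mul_of_nonneg_right h.y_zero hX0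
      have h7 := mul_le_mul_of_nonneg_left h6 hc0
      rw [← ec] at h5
      refine le_of_mul_le_mul_left ?_ e
      linarith
  have hsum : 0 ≤ G * K * c := by positivity
  constructor
  · have h4 : t * X t * bracket T t ^ 3 ≤ T * (8 * G * K * c * X 0) := by
      calc t * X t * bracket T t ^ 3 ≤ (G * N (t / 2)) * (2 * bracket T (t / 2)) ^ 3 := by gcongr
        _ = 8 * G * (N (t / 2) * bracket T (t / 2) ^ 3) := by ring
        _ ≤ 8 * G * (K * N 0) := by gcongr
        _ ≤ 8 * G * (K * (T * (c * X 0))) := by gcongr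
        _ = _ := by ring
    have h6 := decay_step hT ht hX (h.X_le_mul le_rfl ht) (by positivity) h4
    refine h6.trans (le_of_sub_nonneg ?_)
    ring_nf
    positivity
  · calc t ^ 2 * X t * bracket T t ^ 2 = t * (t * X t) * bracket T t ^ 2 := by ring
      _ ≤ t * (G * N (t / 2)) * (2 * bracket T (t / 2)) ^ 2 := by gcongr
      _ = 8 * G * (t / 2 * N (t / 2) * bracket T (t / 2) ^ 2) := by ring
      _ ≤ 8 * G * (K * y 0) := by gcongr
      _ ≤ 8 * G * (K * c) := by
        have := h.yC 0 le_rfl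
        rw [← ec] at this
        gcongr
      _ ≤ _ := by linarith

end EnergySystem

lemma le_of_pow_three_le {L q θ : ℝ} (hL : 0 ≤ L) (hθ : 0 < θ) (h : L ^ 3 ≤ q) :
    L ≤ θ / 4 + 16 * q / θ ^ 2 := by
  have hq : 0 ≤ q := (by positivity : (0 : ℝ) ≤ L ^ 3).trans h
  rcases le_total L (θ / 4) with h1 | h1
  · have : 0 ≤ 16 * q / θ ^ 2 := by positivity
    linarith
  · have h2 : L ≤ 16 * q / θ ^ 2 := by
      rw [le_div_iff₀ (by positivity)]
      have : L * (θ / 4) ^ 2 ≤ L * L ^ 2 := by gcongr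
      nlinarith
    linarith

lemma sqrt_mul_le_of_mul_sq_le {a p K : ℝ} (ha : 0 ≤ a) (hp : 0 ≤ p) (hK : 0 ≤ K)
    (h : a * p ^ 2 ≤ K ^ 2) : √a * p ≤ K := by
  refine (sq_le_sq₀ (by positivity) hK).1 ?_
  rw [mul_pow, Real.sq_sqrt ha]
  exact h

namespace EnergySystem

variable {C T : ℝ} {y N X M A dN dX : ℝ → ℝ}

/-- A bound for `‖∇u‖_∞` adapted to the energy system. -/
def velBound (c : ℝ) (N X M : ℝ → ℝ) (t : ℝ) : ℝ :=
  √(X 0) / (1 + t * √(X 0)) / 4 + 32 * c * ((t ^ 2 + (X 0)⁻¹) * (M t + N t * X t))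

lemma kappa_nonneg (h : EnergySystem C T y N X M A dN dX) {t : ℝ} (ht : 0 ≤ t) :
    0 ≤ M t + N t * X t :=
  add_nonneg (h.M0 t ht) (mul_nonneg (h.N0 t ht) (h.X0 ht))

lemma velBound_nonneg (h : EnergySystem C T y N X M A dN dX) {c : ℝ} (hc : 0 ≤ c) {t : ℝ}
    (ht : 0 ≤ t) : 0 ≤ velBound c N X M t := by
  have := h.kappa_nonneg ht
  have := h.X0 le_rfl
  simp only [velBound]
  positivity

lemma le_velBound (h : EnergySystem C T y N X M A dN dX) (hX : 0 < X 0) {c L t : ℝ} (hL : 0 ≤ L)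
    (hc : 0 ≤ c) (ht : 0 ≤ t) (hle : L ^ 3 ≤ c * (M t + N t * X t)) : L ≤ velBound c N X M t := by
  have hσ : 0 < √(X 0) := Real.sqrt_pos.2 hX
  have hk := h.kappa_nonneg ht
  refine (le_of_pow_three_le hL (by positivity : 0 < √(X 0) / (1 + t * √(X 0))) hle).trans ?_
  simp only [velBound]
  gcongr
  have e : 16 * (c * (M t + N t * X t)) / (√(X 0) / (1 + t * √(X 0))) ^ 2
      = 16 * c * ((t + (√(X 0))⁻¹) ^ 2 * (M t + N t * X t)) := by
    field_simp
    ring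
  have e2 : (X 0)⁻¹ = (√(X 0))⁻¹ ^ 2 := by rw [inv_pow, Real.sq_sqrt hX.le]
  have e3 : (t + (√(X 0))⁻¹) ^ 2 ≤ 2 * (t ^ 2 + (√(X 0))⁻¹ ^ 2) := by
    nlinarith [sq_nonneg (t - (√(X 0))⁻¹)]
  rw [e, e2]
  calc _ ≤ 16 * c * (2 * (t ^ 2 + (√(X 0))⁻¹ ^ 2) * (M t + N t * X t)) := by gcongr
    _ = _ := by ring

lemma continuousOn_velBound (h : EnergySystem C T y N X M A dN dX) (c : ℝ) :
    ContinuousOn (velBound c N X M) (Ici 0) := by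
  have := h.cN
  have := h.cX
  have := h.cM
  have h1 : ContinuousOn (fun t : ℝ => √(X 0) / (1 + t * √(X 0)) / 4) (Ici 0) := by
    refine ContinuousOn.div_const (ContinuousOn.div continuousOn_const (by fun_prop) ?_) _
    intro t (ht : 0 ≤ t)
    have := Real.sqrt_nonneg (X 0)
    positivity
  exact h1.add (by fun_prop)

lemma exists_exp_integral_velBound_le (C c : ℝ) (hc : 0 ≤ c) : ∃ K, 1 ≤ K ∧
    ∀ {T : ℝ} {y N X M A dN dX : ℝ → ℝ}, EnergySystem C T y N X M A dN dX → 0 < X 0 →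
      ∀ {t : ℝ}, 0 ≤ t →
        Real.exp (∫ r in (0 : ℝ)..t, 4 * velBound c N X M r) ≤ K * (1 + t * √(X 0)) := by
  obtain ⟨K, hK, hw⟩ := exists_weighted_integral_le C
  have hg := one_le_gr (C := C)
  refine ⟨Real.exp (128 * c * (K + (gr C + gr C * |C|))), Real.one_le_exp (by positivity),
    fun {T y N X M A dN dX} h hX {t} ht => ?_⟩
  have hC := h.hC
  rw [abs_of_nonneg (by linarith : 0 ≤ C)]
  set σ := √(X 0) with hσdef
  have hσ : 0 < σ := Real.sqrt_pos.2 hX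
  have c1 : ContinuousOn (fun t : ℝ => σ / (1 + t * σ)) (Ici 0) := by
    refine ContinuousOn.div continuousOn_const (by fun_prop) ?_
    intro t (ht : 0 ≤ t)
    positivity
  have cκ : ContinuousOn (fun t => M t + N t * X t) (Ici 0) := h.cM.add (h.cN.mul h.cX)
  have c2 : ContinuousOn (fun t => t ^ 2 * (M t + N t * X t)) (Ici 0) :=
    (continuous_pow 2).continuousOn.mul cκ
  have i1 := intervalIntegrable_of_continuousOn c1 le_rfl ht
  have i2 := intervalIntegrable_of_continuousOn c2 le_rfl ht
  have i3 := intervalIntegrable_of_continuousOn cκ le_rfl ht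
  have e : ∀ r, 4 * velBound c N X M r = σ / (1 + r * σ) + (128 * c * (r ^ 2 * (M r + N r * X r))
      + 128 * c * (X 0)⁻¹ * (M r + N r * X r)) := fun r => by
    simp only [velBound]
    ring
  have hlog : ∫ r in (0 : ℝ)..t, σ / (1 + r * σ) ≤ Real.log (1 + t * σ) := by
    have hd : ∀ t, 0 ≤ t → HasDerivWithinAt (fun t => Real.log (1 + t * σ)) (σ / (1 + t * σ))
        (Ici 0) t := fun t ht => by
      have := (((hasDerivAt_id t).mul_const σ).const_add 1).log
        (by simp only [id]; positivity : 1 + id t * σ ≠ 0)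
      simpa using this.hasDerivWithinAt
    have := le_of_deriv_le (fun t ht => hasDerivWithinAt_integral c1 le_rfl ht) hd
      (fun t _ => le_rfl) ht
    simpa using this
  simp only [e]
  rw [intervalIntegral.integral_add i1 ((i2.const_mul _).add (i3.const_mul _)),
    intervalIntegral.integral_add (i2.const_mul _) (i3.const_mul _),
    intervalIntegral.integral_const_mul, intervalIntegral.integral_const_mul]
  have h1 := mul_le_mul_of_nonneg_left (hw h ht) (by positivity : 0 ≤ 128 * c)
  have h2 := mul_le_mul_of_nonneg_left (h.integral_kappa_le le_rfl ht)
    (by positivity : 0 ≤ 128 * c * (X 0)⁻¹)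
  have e3 : 128 * c * (X 0)⁻¹ * ((gr C + gr C * C) * X 0) = 128 * c * (gr C + gr C * C) := by
    field_simp
  have ht1 : 0 < 1 + t * σ := by positivity
  calc _ ≤ Real.exp (128 * c * (K + (gr C + gr C * C)) + Real.log (1 + t * σ)) := by
        refine Real.exp_le_exp.2 ?_
        linarith
    _ = _ := by rw [Real.exp_add, Real.exp_log ht1]

lemma exists_integral_X_sq_le (C : ℝ) : ∃ K, 1 ≤ K ∧ ∀ {T : ℝ} {y N X M A dN dX : ℝ → ℝ},
    EnergySystem C T y N X M A dN dX → ∀ {s t : ℝ}, 0 ≤ s → s ≤ t →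
      (∫ r in s..t, X r ^ 2) * bracket T s ^ 5 ≤ K * (X 0 * √(X 0)) := by
  obtain ⟨K1, hK1, hN⟩ := exists_N_decay C
  obtain ⟨K2, hK2, hX⟩ := exists_X_decay C
  have hg := one_le_gr (C := C)
  set G := gr C * (|C| * (gr C + gr C * |C|)) with hG
  have hG0 : 0 ≤ G := by positivity
  refine ⟨1 + G * (K2 * K1), by nlinarith [mul_nonneg hG0 (by positivity : 0 ≤ K2 * K1)],
    fun {T y N X M A dN dX} h {s t} hs hst => ?_⟩
  have hC := h.hC
  rw [abs_of_nonneg (by linarith : 0 ≤ C)] at hG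
  have hb := one_le_bracket h.hT.le hs
  have hXs := h.X0 hs
  have hNs := h.N0 s hs
  have hX0 := h.X0 le_rfl
  have h1 : ∫ r in s..t, X r ^ 2 ≤ ∫ r in s..t, gr C * X s * X r := by
    have := h.cX
    refine integral_mono_of_continuousOn (by fun_prop) (by fun_prop) hs hst fun r h1 _ => ?_
    rw [_root_.sq]
    exact mul_le_mul_of_nonneg_right (h.X_le_mul hs h1) (h.X0 (hs.trans h1))
  rw [intervalIntegral.integral_const_mul] at h1
  have h2 := mul_le_mul_of_nonneg_left (h.integral_X_le hs hst)
    (by positivity : 0 ≤ gr C * X s)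
  have hN0 : N 0 ≤ √(X 0) := Real.le_sqrt_of_sq_le (h.N_sq_le 0 le_rfl)
  calc (∫ r in s..t, X r ^ 2) * bracket T s ^ 5
      ≤ (gr C * X s * (C * (gr C + gr C * C) * N s)) * bracket T s ^ 5 := by
        gcongr
        linarith
    _ = G * (X s * N s * bracket T s ^ 5) := by rw [hG]; ring
    _ ≤ G * (X s * N s * bracket T s ^ 7) := by
        gcongr
        norm_num
    _ = G * ((X s * bracket T s ^ 4) * (N s * bracket T s ^ 3)) := by ring
    _ ≤ G * ((K2 * X 0) * (K1 * √(X 0))) := by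
        have := (hX h hs).1
        have := (hN h hs).2.trans (mul_le_mul_of_nonneg_left hN0 (by linarith : 0 ≤ K1))
        gcongr
    _ = G * (K2 * K1) * (X 0 * √(X 0)) := by ring
    _ ≤ _ := by
        have : 0 ≤ X 0 * √(X 0) := by positivity
        linarith

/-- The weight multiplying `‖∇ρ₀‖²_∞` in the equation for `‖∇∂ₜu‖²`. -/
def mixed (y N X M : ℝ → ℝ) (t : ℝ) : ℝ :=
  (1 + t * √(X 0)) * (√(y t) * √(N t) * (√(X t) * √(M t + N t * X t)))

lemma mixed_nonneg {t : ℝ} (ht : 0 ≤ t) : 0 ≤ mixed y N X M t := by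
  simp only [mixed]; positivity

lemma continuousOn_mixed (h : EnergySystem C T y N X M A dN dX) :
    ContinuousOn (mixed y N X M) (Ici 0) := by
  have := h.cy
  have := h.cN
  have := h.cX
  have := h.cM
  unfold mixed
  fun_prop

lemma exists_mixed_le (C : ℝ) : ∃ K, 1 ≤ K ∧ ∀ {T : ℝ} {y N X M A dN dX : ℝ → ℝ},
    EnergySystem C T y N X M A dN dX → ∀ {t : ℝ}, 0 ≤ t →
      mixed y N X M t * bracket T t ^ 2 ≤ K * √(X 0) * (√(N t) * √(M t + N t * X t)) := by
  obtain ⟨K, hK, hX⟩ := exists_X_decay C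
  refine ⟨1 + 2 * |C| * K, by nlinarith [abs_nonneg C], fun {T y N X M A dN dX} h {t} ht => ?_⟩
  have hC := h.hC
  rw [abs_of_nonneg (by linarith : 0 ≤ C)]
  have hb := one_le_bracket h.hT.le ht
  have hX0 := h.X0 le_rfl
  have hXt := h.X0 ht
  set p := bracket T t
  have a1 : √(y t) * p ≤ C := by
    refine sqrt_mul_le_of_mul_sq_le (h.y0 t ht) (by linarith) (by linarith) ?_
    refine (h.y_decay t ht).trans ?_
    have := h.yC 0 le_rfl
    nlinarith
  have a2 : √(X t) * p ^ 2 ≤ K * √(X 0) := by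
    refine sqrt_mul_le_of_mul_sq_le hXt (by positivity) (by positivity) ?_
    rw [mul_pow, Real.sq_sqrt hX0, ← pow_mul]
    refine ((hX h ht).1).trans ?_
    nlinarith [mul_nonneg hX0 (by linarith : 0 ≤ K - 1)]
  have a3 : t * √(X t) * p ≤ K := by
    have : √(X t) * (t * p) ≤ K := by
      refine sqrt_mul_le_of_mul_sq_le hXt (by positivity) (by positivity) ?_
      have h1 := (hX h ht).2
      nlinarith
    linarith
  have a4 : (1 + t * √(X 0)) * (√(y t) * √(X t)) * p ^ 2 ≤ 2 * C * K * √(X 0) := by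
    have b1 : √(y t) * √(X t) * p ^ 2 ≤ C * (K * √(X 0)) := by
      calc √(y t) * √(X t) * p ^ 2 = √(y t) * 1 * (√(X t) * p ^ 2) := by ring
        _ ≤ √(y t) * p * (√(X t) * p ^ 2) := by gcongr
        _ ≤ C * (K * √(X 0)) := by gcongr
    have b2 : (√(y t) * p) * (t * √(X t) * p) ≤ C * K := by gcongr
    have b3 := mul_le_mul_of_nonneg_right b2 (Real.sqrt_nonneg (X 0))
    linarith
  have h5 : 0 ≤ √(N t) * √(M t + N t * X t) := by positivity
  calc mixed y N X M t * p ^ 2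
      = ((1 + t * √(X 0)) * (√(y t) * √(X t)) * p ^ 2) * (√(N t) * √(M t + N t * X t)) := by
        simp only [mixed]; ring
    _ ≤ (2 * C * K * √(X 0)) * (√(N t) * √(M t + N t * X t)) := by gcongr
    _ ≤ _ := by
      gcongr
      linarith

lemma exists_integral_mixed_le (C : ℝ) : ∃ K, 1 ≤ K ∧ ∀ {T : ℝ} {y N X M A dN dX : ℝ → ℝ},
    EnergySystem C T y N X M A dN dX → 0 < X 0 → ∀ {s t : ℝ}, 0 ≤ s → s ≤ t →
      (∫ r in s..t, mixed y N X M r) * bracket T s ^ 5 ≤ K * X 0 := by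
  obtain ⟨K1, hK1, hm⟩ := exists_mixed_le C
  obtain ⟨K2, hK2, hX⟩ := exists_X_decay C
  have hg := one_le_gr (C := C)
  set G := gr C + gr C * |C| with hG
  have hG0 : 0 ≤ G := by positivity
  refine ⟨1 + K1 * (C ^ 2 + G * K2), le_add_of_nonneg_right (by positivity),
    fun {T y N X M A dN dX} h hX0 {s t} hs hst => ?_⟩
  have hC := h.hC
  have ht := hs.trans hst
  rw [abs_of_nonneg (by linarith : 0 ≤ C)] at hG
  have hb := one_le_bracket h.hT.le hs
  have hσ : 0 < √(X 0) := Real.sqrt_pos.2 hX0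
  have hσ2 : √(X 0) ^ 2 = X 0 := Real.sq_sqrt hX0.le
  set σ := √(X 0)
  have hys := h.y0 s hs
  have hXs := h.X0 hs
  set p := bracket T s with hp
  have hp0 : 0 < p := by linarith
  have cκ : ContinuousOn (fun t => M t + N t * X t) (Ici 0) := h.cM.add (h.cN.mul h.cX)
  have h1 : ∫ r in s..t, mixed y N X M r * p ^ 2
      ≤ ∫ r in s..t, (K1 * σ * (σ / p) * N r + K1 * σ * (p / σ) * (M r + N r * X r)) := by
    have := h.cN
    have := h.continuousOn_mixed
    refine integral_mono_of_continuousOn (by fun_prop) (by fun_prop) hs hst fun r h1 _ => ?_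
    have hr := hs.trans h1
    have hN := h.N0 r hr
    have hκ := h.kappa_nonneg hr
    have hpr : p ≤ bracket T r := bracket_mono h.hT.le h1
    have hm0 := mixed_nonneg (y := y) (N := N) (X := X) (M := M) hr
    have e1 : √(N r) * √(M r + N r * X r) ≤ σ / p * N r + p / σ * (M r + N r * X r) := by
      refine le_add_of_sq_le_mul (by positivity) (by positivity) ?_
      rw [mul_pow, Real.sq_sqrt hN, Real.sq_sqrt hκ]
      refine le_of_eq ?_
      field_simp
    calc mixed y N X M r * p ^ 2 ≤ mixed y N X M r * bracket T r ^ 2 := by gcongr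
      _ ≤ K1 * σ * (√(N r) * √(M r + N r * X r)) := hm h hr
      _ ≤ K1 * σ * (σ / p * N r + p / σ * (M r + N r * X r)) := by gcongr
      _ = _ := by ring
  rw [intervalIntegral.integral_mul_const, intervalIntegral.integral_add
    ((intervalIntegrable_of_continuousOn h.cN hs ht).const_mul _)
    ((intervalIntegrable_of_continuousOn cκ hs ht).const_mul _),
    intervalIntegral.integral_const_mul, intervalIntegral.integral_const_mul] at h1
  have h2 := mul_le_mul_of_nonneg_left (h.integral_N_le hs hst)
    (by positivity : 0 ≤ K1 * σ * (σ / p))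
  have h3 := mul_le_mul_of_nonneg_left (h.integral_kappa_le hs hst)
    (by positivity : 0 ≤ K1 * σ * (p / σ))
  rw [← hG] at h3
  have h4 : y s * p ^ 2 ≤ C * C := (h.y_decay s hs).trans
    (mul_le_mul_of_nonneg_left (h.yC 0 le_rfl) (by linarith))
  have h5 := (hX h hs).1
  rw [← hp] at h5
  calc (∫ r in s..t, mixed y N X M r) * p ^ 5 = ((∫ r in s..t, mixed y N X M r) * p ^ 2) * p ^ 3 := by
        ring
    _ ≤ (K1 * σ * (σ / p) * y s + K1 * σ * (p / σ) * (G * X s)) * p ^ 3 := by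
        gcongr
        linarith
    _ = K1 * (σ ^ 2 * (y s * p ^ 2) + G * (X s * p ^ 4)) := by
        field_simp
    _ ≤ K1 * (σ ^ 2 * (C * C) + G * (K2 * X 0)) := by gcongr
    _ = K1 * (C ^ 2 + G * K2) * X 0 := by rw [hσ2]; ring
    _ ≤ _ := by linarith

/-- Decay of `‖∇∂ₜu‖²` and of its dissipation. -/
theorem exists_M_decay (C : ℝ) : ∃ K, 1 ≤ K ∧ ∀ {T : ℝ} {y N X M A dN dX : ℝ → ℝ},
    EnergySystem C T y N X M A dN dX → 0 < X 0 → ∀ {dM D : ℝ → ℝ} {H E : ℝ},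
      (∀ t, 0 ≤ t → HasDerivWithinAt M (dM t) (Ici 0) t) → ContinuousOn D (Ici 0) →
      (∀ t, 0 ≤ t → 0 ≤ D t) → 0 ≤ H →
      (∀ t, 0 ≤ t → dM t + D t ≤ C * (N t * M t + X t ^ 2 + H * mixed y N X M t)) →
      M 0 ≤ E → X 0 * √(X 0) ≤ E → X 0 * H ≤ E → X 0 ≤ T * E → ∀ {t : ℝ}, 0 ≤ t →
        M t * bracket T t ^ 5 ≤ K * E ∧
          ∀ {t' : ℝ}, t ≤ t' → (∫ r in t..t', D r) * bracket T t ^ 5 ≤ K * E := by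
  obtain ⟨K1, hK1, h1⟩ := exists_integral_X_sq_le C
  obtain ⟨K2, hK2, h2⟩ := exists_integral_mixed_le C
  obtain ⟨K3, hK3, h3⟩ := exists_X_decay C
  have hg := one_le_gr (C := C)
  set K4 := gr C * (|C| * (K1 + K2)) with hK4
  have hK4' : 0 ≤ K4 := by positivity
  set K5 := 1024 * (gr C + K4) + 128 * gr C * gr C * K3 + 32 * K4 with hK5
  have hK5' : 1 ≤ K5 := by
    have : 0 ≤ 128 * gr C * gr C * K3 := by positivity
    linarith
  refine ⟨gr C * K5 + K4, by nlinarith, fun {T y N X M A dN dX} h hX0 {dM D H E} hM cD D0 hH hle hE1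
    hE2 hE3 hE4 {t} ht => ?_⟩
  have hC := h.hC
  rw [abs_of_nonneg (by linarith : 0 ≤ C)] at hK4
  have hE : 0 ≤ E := (h.M0 0 le_rfl).trans hE1
  have hT := h.hT
  have cX := h.cX
  have cm := h.continuousOn_mixed
  have hgr : ∀ {s t : ℝ}, 0 ≤ s → s ≤ t → M t + ∫ r in s..t, D r ≤ gr C * M s
      + K4 * E / bracket T s ^ 5 := by
    intro s t hs hst
    have hb := one_le_bracket hT.le hs
    have ht := hs.trans hst
    have hG := h.gronwall_N (f := M) (f' := dM) (d := D)
      (g := fun t => C * (X t ^ 2 + H * mixed y N X M t)) hM (by fun_prop) cD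
      (fun t ht => by
        have := mixed_nonneg (y := y) (N := N) (X := X) (M := M) ht
        positivity) D0 h.M0 (fun t ht => by linarith [hle t ht]) hs hst
    have i1 : IntervalIntegrable (fun r => X r ^ 2) volume s t :=
      intervalIntegrable_of_continuousOn (by fun_prop) hs ht
    rw [intervalIntegral.integral_const_mul, intervalIntegral.integral_add i1
      ((intervalIntegrable_of_continuousOn cm hs ht).const_mul _),
      intervalIntegral.integral_const_mul] at hG
    have g1 := h1 h hs hst
    have g2 := h2 h hX0 hs hst
    have g3 : C * ((∫ r in s..t, X r ^ 2) + H * ∫ r in s..t, mixed y N X M r)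
        ≤ C * (K1 + K2) * E / bracket T s ^ 5 := by
      rw [le_div_iff₀ (by positivity)]
      have g4 := mul_le_mul_of_nonneg_left g2 hH
      have g5 := mul_le_mul_of_nonneg_left hE2 (by linarith : 0 ≤ K1)
      have g6 := mul_le_mul_of_nonneg_left hE3 (by linarith : 0 ≤ K2)
      calc C * ((∫ r in s..t, X r ^ 2) + H * ∫ r in s..t, mixed y N X M r) * bracket T s ^ 5
          = C * ((∫ r in s..t, X r ^ 2) * bracket T s ^ 5
            + H * ((∫ r in s..t, mixed y N X M r) * bracket T s ^ 5)) := by ring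
        _ ≤ C * (K1 * E + K2 * E) := mul_le_mul_of_nonneg_left (by linarith) (by linarith)
        _ = _ := by ring
    calc _ ≤ _ := hG
      _ ≤ gr C * (M s + C * (K1 + K2) * E / bracket T s ^ 5) := by gcongr
      _ = _ := by rw [hK4]; ring
  have hgrM : ∀ {s t : ℝ}, 0 ≤ s → s ≤ t → M t ≤ gr C * M s + K4 * E / bracket T s ^ 5 :=
    fun {s t} hs hst => by linarith [hgr hs hst, integral_nonneg_of_nonneg D0 hs hst]
  have hb := one_le_bracket hT.le ht
  have hMt : M t * bracket T t ^ 5 ≤ K5 * E := by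
    have hM0 := h.M0 t ht
    rcases le_total t T with htT | htT
    · have h4 := bracket_le_four hT htT
      have h5 : M t ≤ (gr C + K4) * E := by
        have h6 := hgrM le_rfl ht
        have h7 : K4 * E / bracket T 0 ^ 5 ≤ K4 * E :=
          div_le_self (by positivity) (one_le_pow₀ (one_le_bracket hT.le le_rfl))
        have h8 := mul_le_mul_of_nonneg_left hE1 (by linarith : 0 ≤ gr C)
        linarith
      calc M t * bracket T t ^ 5 ≤ (gr C + K4) * E * 4 ^ 5 := by gcongr
        _ = 1024 * (gr C + K4) * E := by ring
        _ ≤ K5 * E := by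
          have : 0 ≤ 128 * gr C * gr C * K3 := by positivity
          gcongr
          linarith
    · have ht0 : 0 < t := hT.trans_le htT
      have ht2 : 0 ≤ t / 2 := by linarith
      have hb2 := one_le_bracket hT.le ht2
      have h4 := bracket_mul_le hT htT
      have h5 := bracket_le_two_mul (T := T) (t := t)
      have h6 : t * M t ≤ 2 * gr C * (gr C * X (t / 2)) + t * (K4 * E / bracket T (t / 2) ^ 5) := by
        refine mul_le_of_average h.cM ht (by linarith) (fun s s1 s2 => ?_) ?_
        · refine (hgrM (ht2.trans s1) s2).trans ?_
          have := bracket_mono hT.le s1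
          gcongr
        · linarith [h.X_add_le ht2 (by linarith : t / 2 ≤ t), h.X0 ht]
      have hXs := h.X0 ht2
      have h7 : X (t / 2) * bracket T t ^ 5 ≤ 64 * K3 * E * t := by
        calc X (t / 2) * bracket T t ^ 5 = X (t / 2) * bracket T t ^ 4 * bracket T t := by ring
          _ ≤ X (t / 2) * (2 * bracket T (t / 2)) ^ 4 * bracket T t := by gcongr
          _ = 16 * (X (t / 2) * bracket T (t / 2) ^ 4) * bracket T t := by ring
          _ ≤ 16 * (K3 * (T * E)) * bracket T t := by
            have := (h3 h ht2).1.trans (mul_le_mul_of_nonneg_left hE4 (by linarith : 0 ≤ K3))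
            gcongr
          _ = 16 * K3 * E * (bracket T t * T) := by ring
          _ ≤ 16 * K3 * E * (4 * t) := by gcongr
          _ = _ := by ring
      have h8 : K4 * E / bracket T (t / 2) ^ 5 * bracket T t ^ 5 ≤ 32 * K4 * E := by
        calc K4 * E / bracket T (t / 2) ^ 5 * bracket T t ^ 5
            ≤ K4 * E / bracket T (t / 2) ^ 5 * (2 * bracket T (t / 2)) ^ 5 := by gcongr
          _ = _ := by field_simp; norm_num
      have h9 : t * (M t * bracket T t ^ 5) ≤ t * ((128 * gr C * gr C * K3 + 32 * K4) * E) := by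
        have e1 := mul_le_mul_of_nonneg_left h7 (by positivity : 0 ≤ 2 * gr C * gr C)
        have e2 := mul_le_mul_of_nonneg_left h8 ht
        have e3 := mul_le_mul_of_nonneg_right h6 (by positivity : 0 ≤ bracket T t ^ 5)
        linarith
      have h10 := le_of_mul_le_mul_left h9 ht0
      have : 0 ≤ 1024 * (gr C + K4) * E := by positivity
      rw [hK5]
      linarith
  have hKE : K5 * E ≤ gr C * (K5 * E) := le_mul_of_one_le_left (by positivity) hg
  have hKE4 : 0 ≤ K4 * E := by positivity
  refine ⟨by linarith, fun {t'} htt => ?_⟩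
  have h4 := hgr ht htt
  have h5 := h.M0 t' (ht.trans htt)
  calc (∫ r in t..t', D r) * bracket T t ^ 5
      ≤ (gr C * M t + K4 * E / bracket T t ^ 5) * bracket T t ^ 5 := by
        gcongr
        linarith
    _ = gr C * (M t * bracket T t ^ 5) + K4 * E := by field_simp
    _ ≤ gr C * (K5 * E) + K4 * E := by gcongr
    _ = _ := by ring

end EnergySystem

lemma sq_integral_le {f : ℝ → ℝ} (hf : ContinuousOn f (Ici 0)) {t : ℝ} (ht : 0 ≤ t) :
    (∫ s in (0 : ℝ)..t, f s) ^ 2 ≤ t * ∫ s in (0 : ℝ)..t, f s ^ 2 := by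
  rcases ht.eq_or_lt with rfl | ht0
  · simp
  set I := ∫ s in (0 : ℝ)..t, f s with hI
  have i1 := intervalIntegrable_of_continuousOn hf le_rfl ht
  have i2 : IntervalIntegrable (fun s => f s ^ 2) volume 0 t :=
    intervalIntegrable_of_continuousOn (hf.pow 2) le_rfl ht
  have h1 : 0 ≤ ∫ s in (0 : ℝ)..t, (f s - I / t) ^ 2 :=
    intervalIntegral.integral_nonneg ht fun _ _ => sq_nonneg _
  have e : ∀ s, (f s - I / t) ^ 2 = f s ^ 2 - (2 * (I / t) * f s - (I / t) ^ 2) := fun s => by ring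
  simp only [e] at h1
  rw [intervalIntegral.integral_sub i2 ((i1.const_mul _).sub (by simp)),
    intervalIntegral.integral_sub (i1.const_mul _) (by simp), intervalIntegral.integral_const_mul,
    ← hI, intervalIntegral.integral_const, smul_eq_mul, sub_zero] at h1
  have e2 : 2 * (I / t) * I - t * (I / t) ^ 2 = I ^ 2 / t := by field_simp; ring
  rw [e2, sub_nonneg, div_le_iff₀ ht0] at h1
  linarith

namespace Sol

lemma splitting_term_le {n F c q a : ℝ} (hF : F ^ 2 ≤ c ^ 2 * n ^ 2 * (a / q)) (ha : 0 ≤ a / q) :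
    F ≤ n ^ 2 / 8 + 8 * c ^ 2 * (a / q) :=
  le_add_of_sq_le_mul (by positivity) (by positivity) (by linarith)

/-- The low frequency estimate in the rescaled variables of the splitting method. -/
lemma low_frequency_rescaled {c N n U J I E T T' q σ ν a : ℝ} (hc : 0 < c) (hT : 0 < T)
    (hTT : T ≤ T') (hcT : 80 * c ^ 2 * T ≤ T') (hq : 1 / 5 ≤ q) (hU : U ≤ T * E)
    (hU0 : 0 ≤ U) (hE : 0 ≤ E) (hν : ν ^ 2 ≤ T) (hJ : J = T' * a) (ha : 0 ≤ a) (hσ : 0 ≤ σ)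
    (hI : I ^ 2 ≤ T' * σ * J)
    (h : n ^ 2 ≤ √(T' * q) ^ 2 * N + c * n * ((√(T' * q) ^ 2)⁻¹ * (U + J)
      + (√(T' * q) ^ 3)⁻¹ * (ν * I) + (√(T' * q))⁻¹ * (ν * n))) :
    n ^ 2 ≤ 2 * (T' * q) * N + 16 * c ^ 2 * ((E + a) ^ 2 / q ^ 2 + σ * a / q ^ 3) := by
  have hT' : 0 < T' := hT.trans_le hTT
  have hq0 : 0 < q := by linarith
  set r := √(T' * q) with hr
  have hr2 : r ^ 2 = T' * q := Real.sq_sqrt (by positivity)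
  have hr0 : 0 < r := Real.sqrt_pos.2 (by positivity)
  have h1 : c * n * ((r ^ 2)⁻¹ * (U + J)) ≤ n ^ 2 / 8 + 8 * c ^ 2 * ((E + a) ^ 2 / q ^ 2) := by
    refine splitting_term_le ?_ (by positivity)
    have e1 : (r ^ 2)⁻¹ * (U + J) ≤ (E + a) / q := by
      rw [hr2, inv_mul_le_iff₀ (by positivity), hJ]
      have : T * E ≤ T' * E := by gcongr
      have e : T' * q * ((E + a) / q) = T' * E + T' * a := by field_simp
      linarith
    have e0 : 0 ≤ (r ^ 2)⁻¹ * (U + J) := by rw [hJ]; positivity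
    calc (c * n * ((r ^ 2)⁻¹ * (U + J))) ^ 2 = c ^ 2 * n ^ 2 * ((r ^ 2)⁻¹ * (U + J)) ^ 2 := by ring
      _ ≤ c ^ 2 * n ^ 2 * ((E + a) / q) ^ 2 := by gcongr
      _ = _ := by rw [div_pow]
  have h2 : c * n * ((r ^ 3)⁻¹ * (ν * I)) ≤ n ^ 2 / 8 + 8 * c ^ 2 * (σ * a / q ^ 3) := by
    refine splitting_term_le ?_ (by positivity)
    have e : ((r ^ 3)⁻¹ * (ν * I)) ^ 2 = ν ^ 2 * I ^ 2 / (T' * q) ^ 3 := by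
      rw [← hr2]; field_simp
    have e1 : ν ^ 2 * I ^ 2 ≤ T' * (T' * σ * (T' * a)) := by
      rw [← hJ]
      exact mul_le_mul (hν.trans hTT) hI (sq_nonneg _) hT'.le
    calc (c * n * ((r ^ 3)⁻¹ * (ν * I))) ^ 2 = c ^ 2 * n ^ 2 * ((r ^ 3)⁻¹ * (ν * I)) ^ 2 := by ring
      _ ≤ c ^ 2 * n ^ 2 * (T' * (T' * σ * (T' * a)) / (T' * q) ^ 3) := by rw [e]; gcongr
      _ = _ := by field_simp
  have h3 : c * n * (r⁻¹ * (ν * n)) ≤ n ^ 2 / 4 := by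
    refine (abs_le_of_sq_le_sq' ?_ (by positivity)).2
    have e : (c * n * (r⁻¹ * (ν * n))) ^ 2 = c ^ 2 * n ^ 4 * ν ^ 2 / (T' * q) := by
      rw [← hr2]; field_simp
    rw [e, div_le_iff₀ (by positivity)]
    have e1 : 16 * c ^ 2 * ν ^ 2 ≤ T' * q := by
      have : 16 * c ^ 2 * ν ^ 2 ≤ 16 * c ^ 2 * T := by gcongr
      nlinarith
    have e2 := mul_le_mul_of_nonneg_left e1 (by positivity : 0 ≤ n ^ 4 / 16)
    linarith
  rw [hr2] at h h1
  linarith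

variable {ϱ P : ℝ → Plane → ℝ} {u : Fin 2 → ℝ → Plane → ℝ} {t : ℝ}

lemma kin_nonneg (h : Sol ϱ u P) (ht : 0 ≤ t) : 0 ≤ kin ϱ u t := by
  have := (h.kin_bounds ht h.hu).1
  nlinarith [sq_nonneg (n0 u t)]

lemma kin_le_kin_zero (h : Sol ϱ u P) (ht : 0 ≤ t) : kin ϱ u t ≤ kin ϱ u 0 :=
  antitoneOn_of_hasDerivWithinAt_Ici (fun _ ht => h.hasDerivWithinAt_kin ht)
    (fun t _ => by nlinarith [sq_nonneg (n1 u t)]) self_mem_Ici ht ht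

/-- Quadratic decay of the kinetic energy. -/
theorem exists_kin_decay (B : ℝ) : ∃ K : ℝ, 1 ≤ K ∧
    ∀ {ϱ P : ℝ → Plane → ℝ} {u : Fin 2 → ℝ → Plane → ℝ}, Sol ϱ u P → kin ϱ u 0 ≤ B →
    ∀ {U T : ℝ}, (∀ k, Integrable fun x => ‖x‖ * |u k 0 x|) →
      (∀ k, ∫ x, ‖x‖ * |u k 0 x| ≤ U) → (∀ k, ∫ x, mmt ϱ u k 0 x = 0) →
      0 < T → U ≤ T * kin ϱ u 0 → nrm (ϱ 0) ^ 2 ≤ T → ∀ {t : ℝ}, 0 ≤ t →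
      kin ϱ u t * bracket T t ^ 2 ≤ K * kin ϱ u 0 := by
  obtain ⟨c, hc, hlow⟩ := exists_low_frequency
  obtain ⟨K, hK, hdec⟩ := Splitting.exists_decay (16 * c ^ 2) B
  set m := 1 + 80 * c ^ 2 with hm
  have hm1 : 1 ≤ m := le_add_of_nonneg_right (by positivity)
  refine ⟨1 + m ^ 2 * K, le_add_of_nonneg_right (by positivity),
    fun {ϱ P u} h hB {U T} hi hU hmom hT hUT hν {t} ht => ?_⟩
  have hE := h.kin_nonneg le_rfl
  set E := kin ϱ u 0
  set T' := m * T with hT'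
  have hT'0 : 0 < T' := by positivity
  have hU0 : 0 ≤ U := le_trans (integral_nonneg fun x => by positivity) (hU 0)
  have hcont := continuousOn_n0 h.hu
  have hcont2 : ContinuousOn (fun s => n0 u s ^ 2) (Ici 0) := hcont.pow 2
  have hscale : ∀ σ : ℝ, HasDerivWithinAt (fun σ : ℝ => T' * σ) (T' * 1) (Ici 0) σ := fun σ =>
    ((hasDerivAt_id σ).const_mul T').hasDerivWithinAt
  have hmaps : MapsTo (fun σ : ℝ => T' * σ) (Ici 0) (Ici 0) := fun σ (hσ : 0 ≤ σ) =>
    mem_Ici.2 (by positivity)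
  have hS : Splitting (16 * c ^ 2) B E (fun σ => kin ϱ u (T' * σ))
      (fun σ => -2 * n1 u (T' * σ) ^ 2 * (T' * 1))
      (fun σ => T'⁻¹ * ∫ s in (0 : ℝ)..(T' * σ), n0 u s ^ 2) (fun σ => n0 u (T' * σ) ^ 2) := by
    refine ⟨by positivity, hE, hB, fun σ hσ => ?_, fun σ hσ => ?_, by simp, fun σ hσ => ?_,
      fun σ hσ => ?_, fun σ hσ q hq => ?_⟩
    · exact HasDerivWithinAt.comp σ (h.hasDerivWithinAt_kin (by positivity)) (hscale σ) hmaps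
    · have := (HasDerivWithinAt.comp σ (hasDerivWithinAt_integral hcont2 le_rfl
        (by positivity : 0 ≤ T' * σ)) (hscale σ) hmaps).const_mul T'⁻¹
      refine this.congr_deriv ?_
      field_simp
    · exact ⟨sq_nonneg _, by linarith [(h.kin_bounds (by positivity : 0 ≤ T' * σ) h.hu).1]⟩
    · exact ⟨h.kin_nonneg (by positivity), h.kin_le_kin_zero (by positivity)⟩
    · have hσ' : 0 ≤ T' * σ := by positivity
      have hq0 : 0 < q := by linarith
      have hl := hlow h hi hU hmom hσ' (Real.sqrt_pos.2 (by positivity : 0 < T' * q))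
      have hres := low_frequency_rescaled (T := T) (E := E)
        (a := T'⁻¹ * ∫ s in (0 : ℝ)..(T' * σ), n0 u s ^ 2) hc hT (by nlinarith)
        (by rw [hT', hm]; nlinarith) hq hUT hU0 hE hν (by field_simp)
        (mul_nonneg (by positivity) (intervalIntegral.integral_nonneg hσ' fun _ _ => sq_nonneg _)) hσ
        (sq_integral_le hcont hσ') hl
      have hk := (h.kin_bounds hσ' h.hu).2
      set F := (E + T'⁻¹ * ∫ s in (0 : ℝ)..(T' * σ), n0 u s ^ 2) ^ 2 / q ^ 2
        + σ * (T'⁻¹ * ∫ s in (0 : ℝ)..(T' * σ), n0 u s ^ 2) / q ^ 3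
      have e : -(4 / (5 * q)) * kin ϱ u (T' * σ) + 16 * c ^ 2 / q * F
          = (-(4 / 5) * kin ϱ u (T' * σ) + 16 * c ^ 2 * F) / q := by field_simp
      rw [e, le_div_iff₀ hq0]
      linarith
  have h1 := hdec hS (σ := t / T') (by positivity)
  have e : T' * (t / T') = t := by field_simp
  simp only [e] at h1
  have h2 : bracket T t ≤ m * (Real.exp 1 + t / T') := by
    have e1 : m * (t / T') = t / T := by rw [hT']; field_simp
    have := Real.exp_pos 1
    rw [mul_add, e1, bracket]
    gcongr
    nlinarith
  have hb := one_le_bracket hT.le ht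
  have hk := h.kin_nonneg ht
  calc kin ϱ u t * bracket T t ^ 2 ≤ kin ϱ u t * (m * (Real.exp 1 + t / T')) ^ 2 := by gcongr
    _ = m ^ 2 * (kin ϱ u t * (Real.exp 1 + t / T') ^ 2) := by ring
    _ ≤ m ^ 2 * (K * E) := by gcongr
    _ ≤ _ := by linarith

lemma eX_le (h : Sol ϱ u P) (ht : 0 ≤ t) {B : ℝ} (hB1 : 1 ≤ B) (hB : n0 u t ^ 2 ≤ B) :
    eX ϱ u t ≤ 500 * B * (n0 (acc u) t ^ 2 + n1 u t ^ 2 * n1 u t ^ 2) := by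
  have hw : ∀ k, nrm (vdt u k t) ≤ n0 (acc u) t + 2 * (b0 u t * b1 u t) := fun k => by
    have hc : Hs fun x => ∑ i, u i t x * pd i (u k t) x :=
      Hs.sum Finset.univ fun i _ => ((h.hu i).hs ht).mul (((h.hu k).hs ht).pd i)
    have h2 := nrm_add_le ((h.hacc k).hs ht).memL2 (hc.const_mul (-1)).memL2
    have e : (fun x => acc u k t x + -1 * ∑ i, u i t x * pd i (u k t) x) = vdt u k t := by
      funext x
      simp only [acc, vdt, xd]
      ring
    have e2 : nrm (fun x => -1 * ∑ i, u i t x * pd i (u k t) x)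
        = nrm fun x => ∑ i, u i t x * pd i (u k t) x := by
      simp only [nrm, sqn]
      congr 2
      funext x
      ring
    rw [e, e2] at h2
    have h3 : nrm (acc u k t) ≤ n0 (acc u) t := nrm_le_n0 (v := acc u) k
    linarith [h.nrm_convection_le ht k]
  have h1 := vsq_le_of_nrm_le hw
  have e : vsq (fun k => vdt u k t) = n0 (vdt u) t ^ 2 := (n0_sq _ _).symm
  rw [e] at h1
  have h2 := h.convection_sq_le ht
  have h3 : kin ϱ (vdt u) t ≤ 5 / 4 * n0 (vdt u) t ^ 2 := (h.kin_bounds ht fun k => (h.hu k).dt).2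
  have h4 : n0 u t ^ 2 * n1 u t ^ 4 ≤ B * n1 u t ^ 4 := by gcongr
  have h8 : n0 u t * n1 u t ^ 2 * n0 (acc u) t ≤ n0 (acc u) t ^ 2 + n0 u t ^ 2 * n1 u t ^ 4 := by
    nlinarith [sq_nonneg (n0 (acc u) t - n0 u t * n1 u t ^ 2)]
  have h5 : n0 (acc u) t ^ 2 ≤ B * n0 (acc u) t ^ 2 := le_mul_of_one_le_left (sq_nonneg _) hB1
  have h6 : n1 u t ^ 4 ≤ B * n1 u t ^ 4 := le_mul_of_one_le_left (by positivity) hB1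
  have h7 : (n0 (acc u) t + 2 * (b0 u t * b1 u t)) ^ 2
      ≤ 2 * n0 (acc u) t ^ 2 + 8 * (b0 u t * b1 u t) ^ 2 := by
    nlinarith [sq_nonneg (n0 (acc u) t - 2 * (b0 u t * b1 u t))]
  have e4 : n1 u t ^ 2 * n1 u t ^ 2 = n1 u t ^ 4 := by ring
  have p1 : 0 ≤ n0 (acc u) t ^ 2 := sq_nonneg _
  have p2 : 0 ≤ n1 u t ^ 4 := by positivity
  rw [e4, eX]
  linarith

lemma n1_sq_le (h : Sol ϱ u P) (ht : 0 ≤ t) :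
    n1 u t ^ 2 ≤ 5 / 2 * (n0 u t * n0 (acc u) t) := by
  have h1 := (h.stokes ht).sum_integral_mul
  rw [n1_sq, ← h1]
  have h2 : ∀ k, ∫ x, u k t x * frc ϱ u k t x ≤ 5 / 4 * (n0 u t * n0 (acc u) t) := fun k => by
    have := ((h.hu k).hs ht).abs_integral_weight_le_of_le ((h.hacc k).hs ht)
      (r := fun x => -(1 + ϱ t x)) (c := 5 / 4)
      (fun x => by rw [abs_neg]; exact h.abs_one_add_le ht x) (nrm_le_n0 k) (nrm_le_n0 k)
    refine le_trans (le_of_eq ?_) ((le_abs_self _).trans this)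
    congr 1
    funext x
    simp only [frc]
    ring
  rw [Fin.sum_univ_two]
  linarith [h2 0, h2 1]

/-- The energy quantities of a solution form an `EnergySystem`. -/
theorem exists_energySystem (B : ℝ) : ∃ C : ℝ, 1 ≤ C ∧
    ∀ {ϱ P : ℝ → Plane → ℝ} {u : Fin 2 → ℝ → Plane → ℝ}, Sol ϱ u P → kin ϱ u 0 ≤ B →
    ∀ {U T : ℝ}, (∀ k, Integrable fun x => ‖x‖ * |u k 0 x|) →
      (∀ k, ∫ x, ‖x‖ * |u k 0 x| ≤ U) → (∀ k, ∫ x, mmt ϱ u k 0 x = 0) →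
      0 < T → U ≤ T * kin ϱ u 0 → nrm (ϱ 0) ^ 2 ≤ T → kin ϱ u 0 ≤ T * n1 u 0 ^ 2 →
      EnergySystem C T (kin ϱ u) (fun t => n1 u t ^ 2) (eX ϱ u) (fun t => n1 (vdt u) t ^ 2)
        (fun t => n0 (acc u) t ^ 2) (dN1 ϱ u) (dX ϱ u) ∧ (∀ t, 0 ≤ t → n0 u t ^ 2 ≤ C) := by
  obtain ⟨K, hK, hdec⟩ := exists_kin_decay B
  set b := 1 + 2 * |B| with hb
  have hb1 : 1 ≤ b := le_add_of_nonneg_right (by positivity)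
  refine ⟨6000000 * b + K, by linarith,
    fun {ϱ P u} h hB {U T} hi hU hmom hT hUT hν hET => ?_⟩
  have hkb : ∀ t, 0 ≤ t → kin ϱ u t ≤ b := fun t ht => by
    linarith [h.kin_le_kin_zero ht, le_abs_self B, abs_nonneg B]
  have hnb : ∀ t, 0 ≤ t → n0 u t ^ 2 ≤ b := fun t ht => by
    linarith [h.kin_le_kin_zero ht, le_abs_self B, abs_nonneg B, (h.kin_bounds ht h.hu).1]
  have hE := h.kin_nonneg le_rfl
  have hX0 := h.eX_nonneg le_rfl
  refine ⟨⟨by linarith, hT, fun t ht => h.hasDerivWithinAt_kin ht,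
    fun t ht => h.hasDerivWithinAt_n1_sq ht, fun t ht => h.hasDerivWithinAt_eX ht,
    fun t ht => (h.hasDerivWithinAt_n1_vdt_sq ht).continuousWithinAt,
    (continuousOn_n0 h.hacc).pow 2, fun t ht => h.kin_nonneg ht, fun _ _ => sq_nonneg _,
    fun _ _ => sq_nonneg _, fun _ _ => sq_nonneg _, fun t ht => ?_, fun t ht => ?_, fun t ht => ?_,
    fun t ht => ?_, fun t ht => ?_, fun t ht => ?_, ?_, hET⟩, fun t ht => ?_⟩
  · linarith [hkb t ht]
  · refine (hdec h hB hi hU hmom hT hUT hν ht).trans ?_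
    gcongr
    linarith
  · refine (h.dN1_add_le ht).trans ?_
    have e : n1 u t ^ 4 = n1 u t ^ 2 * n1 u t ^ 2 := by ring
    have h1 := hnb t ht
    calc 2000000 * (n0 u t ^ 2 * n1 u t ^ 4) ≤ 2000000 * (b * n1 u t ^ 4) := by gcongr
      _ = 2000000 * b * (n1 u t ^ 4) := by ring
      _ ≤ (6000000 * b + K) * n1 u t ^ 4 := by gcongr; linarith
      _ = _ := by ring
  · refine (h.dX_add_le ht hb1 (hnb t ht)).trans ?_
    have := h.eX_nonneg ht
    calc 6000000 * (b * (n1 u t ^ 2 * eX ϱ u t)) = 6000000 * b * n1 u t ^ 2 * eX ϱ u t := by ring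
      _ ≤ _ := by gcongr; linarith
  · refine le_trans (le_of_eq ?_) (h.n1_pow_four_le ht)
    ring
  · refine (h.eX_le ht hb1 (hnb t ht)).trans ?_
    gcongr
    linarith
  · have h1 := h.n1_sq_le le_rfl
    have h2 := h.n0_acc_sq_le le_rfl hb1 (hnb 0 le_rfl)
    have h3 := (h.kin_bounds le_rfl h.hu).1
    have h4 := n0_nonneg u 0
    have h5 := n0_nonneg (acc u) 0
    calc (n1 u 0 ^ 2) ^ 2 ≤ (5 / 2 * (n0 u 0 * n0 (acc u) 0)) ^ 2 := by gcongr
      _ = 25 / 4 * (n0 u 0 ^ 2 * n0 (acc u) 0 ^ 2) := by ring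
      _ ≤ 25 / 4 * ((4 / 3 * kin ϱ u 0) * (12800 * (b * eX ϱ u 0))) := by
        gcongr
        linarith
      _ = 320000 / 3 * b * (kin ϱ u 0 * eX ϱ u 0) := by ring
      _ ≤ _ := by
        gcongr
        linarith
  · linarith [hnb t ht]

end Sol

lemma EnergySystem.mono {C C' T : ℝ} {y N X M A dN dX : ℝ → ℝ}
    (h : EnergySystem C T y N X M A dN dX) (hCC : C ≤ C') :
    EnergySystem C' T y N X M A dN dX where
  __ := h
  hC := h.hC.trans hCC
  yC t ht := (h.yC t ht).trans hCC
  y_decay t ht := (h.y_decay t ht).trans (mul_le_mul_of_nonneg_right hCC (h.y0 0 le_rfl))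
  N_le t ht := (h.N_le t ht).trans (by have := h.N0 t ht; gcongr)
  X_le t ht := (h.X_le t ht).trans (by have := h.N0 t ht; have := h.X0 ht; gcongr)
  X_le_A t ht := (h.X_le_A t ht).trans
    (mul_le_mul_of_nonneg_right hCC (add_nonneg (h.A0 t ht) (mul_self_nonneg _)))
  N_zero := h.N_zero.trans
    (mul_le_mul_of_nonneg_right hCC (mul_nonneg (h.y0 0 le_rfl) (h.X0 le_rfl)))

/-- Weighted time integrability from decay of the tails. -/
lemma integral_rpow_bracket_mul_le {D : ℝ → ℝ} (cD : ContinuousOn D (Ici 0))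
    (D0 : ∀ t, 0 ≤ t → 0 ≤ D t) {T E s : ℝ} (hT : 0 < T)
    (h : ∀ t, 0 ≤ t → ∀ t', t ≤ t' → (∫ r in t..t', D r) * bracket T t ^ 5 ≤ E) (hs : 0 ≤ s)
    (hs5 : s < 5) {t₀ b : ℝ} (ht₀ : 0 ≤ t₀) (hb : t₀ ≤ b) :
    ∫ r in t₀..b, bracket T r ^ s * D r ≤ 5 / (5 - s) * E := by
  have hE : 0 ≤ E := by simpa using h 0 le_rfl 0 le_rfl
  have hb0 := ht₀.trans hb
  have hpos : ∀ t, 0 ≤ t → 0 < bracket T t := fun t ht => by linarith [one_le_bracket hT.le ht]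
  have hd : ∀ t, HasDerivAt (bracket T) (1 / T) t := fun t =>
    ((hasDerivAt_id t).div_const T).const_add (Real.exp 1)
  have hdp : ∀ p t, 0 ≤ t → HasDerivWithinAt (fun t => bracket T t ^ p)
      (1 / T * p * bracket T t ^ (p - 1)) (Ici 0) t := fun p t ht =>
    ((hd t).rpow_const (Or.inl (hpos t ht).ne')).hasDerivWithinAt
  have cw : ContinuousOn (fun t => bracket T t ^ s * D t) (Ici 0) :=
    ContinuousOn.mul (fun t ht => (hdp s t ht).continuousWithinAt) cD
  have htail : ∀ t, 0 ≤ t → -(∫ r in b..t, D r) * bracket T t ^ 5 ≤ E := fun t ht => by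
    rcases le_total t b with htb | htb
    · rw [← intervalIntegral.integral_symm]
      exact h t ht b htb
    · have h1 := integral_nonneg_of_nonneg D0 hb0 htb
      have h2 : 0 < bracket T t ^ 5 := pow_pos (hpos t ht) 5
      nlinarith
  have hsplit : ∀ p t : ℝ, 0 ≤ t → bracket T t ^ p = bracket T t ^ (p - 5) * bracket T t ^ 5 :=
    fun p t ht => by
      rw [← Real.rpow_natCast, ← Real.rpow_add (hpos t ht)]
      norm_num
  have hanti := antitoneOn_of_hasDerivWithinAt_Ici (f := fun t =>
      (∫ r in t₀..t, bracket T r ^ s * D r) + bracket T t ^ s * -(∫ r in b..t, D r)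
        + E * (s / (5 - s)) * bracket T t ^ (s - 5))
    (fun t ht => ((hasDerivWithinAt_integral cw ht₀ ht).add
      ((hdp s t ht).mul (hasDerivWithinAt_integral cD hb0 ht).neg)).add
        ((hdp (s - 5) t ht).const_mul (E * (s / (5 - s))))) (fun t ht => ?_)
  · have h1 := hanti (mem_Ici.2 ht₀) (mem_Ici.2 hb0) hb
    simp only [intervalIntegral.integral_same, neg_zero, mul_zero, add_zero, zero_add] at h1
    have h2 := mul_le_mul_of_nonneg_left (htail t₀ ht₀)
      (Real.rpow_nonneg (hpos t₀ ht₀).le (s - 5))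
    have h3 : bracket T t₀ ^ (s - 5) ≤ 1 :=
      Real.rpow_le_one_of_one_le_of_nonpos (one_le_bracket hT.le ht₀) (by linarith)
    have h4 : 0 ≤ E * (s / (5 - s)) * bracket T b ^ (s - 5) :=
      mul_nonneg (mul_nonneg hE (div_nonneg hs (by linarith))) (Real.rpow_nonneg (hpos b hb0).le _)
    have h5 : 0 ≤ E * (s / (5 - s)) := mul_nonneg hE (div_nonneg hs (by linarith))
    have h6 := mul_le_mul_of_nonneg_left h3 h5
    have h7 := mul_le_mul_of_nonneg_left h3 hE
    have e : 5 / (5 - s) * E = E + E * (s / (5 - s)) := by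
      have : 5 - s ≠ 0 := by linarith
      field_simp
      ring
    rw [hsplit s t₀ ht₀] at h1
    rw [e]
    linarith
  · have h1 := htail t ht
    have e1 := hsplit (s - 1) t ht
    have e2 : s - 5 - 1 = s - 1 - 5 := by ring
    rw [e1, e2]
    have hw : 0 ≤ bracket T t ^ (s - 1 - 5) := Real.rpow_nonneg (hpos t ht).le _
    set w := bracket T t ^ (s - 1 - 5)
    have h2 := mul_le_mul_of_nonneg_left h1 (by positivity : 0 ≤ s / T * w)
    have e3 : E * (s / (5 - s)) * (1 / T * (s - 5) * w) = -(s / T * w * E) := by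
      have : 5 - s ≠ 0 := by linarith
      field_simp
      ring
    have e4 : 1 / T * s * (w * bracket T t ^ 5) * -(∫ r in b..t, D r)
        = s / T * w * (-(∫ r in b..t, D r) * bracket T t ^ 5) := by ring
    rw [e3]
    simp only [Pi.neg_apply]
    linarith

namespace Sol

variable {ϱ P : ℝ → Plane → ℝ} {u : Fin 2 → ℝ → Plane → ℝ} {t : ℝ}

lemma continuousOn_dis (h : Sol ϱ u P) : ContinuousOn (dis u P) (Ici 0) := by
  have h1 : ContinuousOn (fun t => n2 (vdt u) t ^ 2) (Ici 0) := by
    simp only [n2_sq, vhsq, hsq]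
    exact continuousOn_finsetSum _ fun k _ => continuousOn_finsetSum _ fun i _ =>
      continuousOn_finsetSum _ fun j _ => continuousOn_sqn (((h.hu k).dt.xd j).xd i)
  have h2 : ContinuousOn (fun t => ∑ k, sqn (pd k (dt P t))) (Ici 0) := by
    refine continuousOn_finsetSum _ fun k _ => (continuousOn_sqn (h.hp k).dt).congr fun t ht => ?_
    exact congrArg sqn (funext fun x => (h.hP.dt_xd k ht x).symm)
  exact (((continuousOn_n0 fun k => (h.hu k).dt.dt).pow 2).add h1).add h2

/-- Decay of `‖∇∂ₜu‖²` and of its dissipation for solutions in components. -/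
theorem exists_decay (B : ℝ) : ∃ K : ℝ, 1 ≤ K ∧
    ∀ {ϱ P : ℝ → Plane → ℝ} {u : Fin 2 → ℝ → Plane → ℝ}, Sol ϱ u P → kin ϱ u 0 ≤ B →
    ∀ {U T : ℝ}, (∀ k, Integrable fun x => ‖x‖ * |u k 0 x|) →
      (∀ k, ∫ x, ‖x‖ * |u k 0 x| ≤ U) → (∀ k, ∫ x, mmt ϱ u k 0 x = 0) →
      0 < T → U ≤ T * kin ϱ u 0 → nrm (ϱ 0) ^ 2 ≤ T → kin ϱ u 0 ≤ T * n1 u 0 ^ 2 →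
      0 < eX ϱ u 0 → ∀ {H E : ℝ}, 0 ≤ H → (∀ x, ∑ i, pd i (ϱ 0) x ^ 2 ≤ H) →
      n1 (vdt u) 0 ^ 2 ≤ E → eX ϱ u 0 * √(eX ϱ u 0) ≤ E → eX ϱ u 0 * H ≤ E →
      eX ϱ u 0 ≤ T * E → ∀ {t : ℝ}, 0 ≤ t →
        n1 (vdt u) t ^ 2 * bracket T t ^ 5 ≤ K * E ∧
          ∀ {t' : ℝ}, t ≤ t' → (∫ r in t..t', dis u P r) * bracket T t ^ 5 ≤ K * E := by
  obtain ⟨C, hC, hsys⟩ := exists_energySystem B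
  obtain ⟨c, hc, hgrad⟩ := exists_abs_pd_pow_three_le
  obtain ⟨K₁, hK₁, hexp⟩ := EnergySystem.exists_exp_integral_velBound_le C (c * C) (by positivity)
  have hCC : C ≤ 40000000 * C * K₁ := by nlinarith
  obtain ⟨K, hK, hdec⟩ := EnergySystem.exists_M_decay (40000000 * C * K₁)
  refine ⟨16 * K, by linarith, fun {ϱ P u} h hB {U T} hi hU hmom hT hUT hν hET hX0 {H E} hH hR hE1
    hE2 hE3 hE4 {t} ht => ?_⟩
  obtain ⟨hS, hn0⟩ := hsys h hB hi hU hmom hT hUT hν hET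
  have hvel : ∀ t, 0 ≤ t → ∀ (j k : Fin 2) (x : Plane), |pd j (u k t) x|
      ≤ EnergySystem.velBound (c * C) (fun t => n1 u t ^ 2) (eX ϱ u) (fun t => n1 (vdt u) t ^ 2) t := by
    intro t ht j k x
    refine hS.le_velBound hX0 (abs_nonneg _) (by positivity) ht
      ((hgrad h ht hC (hn0 t ht) j k x).trans ?_)
    have hXt := h.eX_nonneg ht
    have h1 := kap_nonneg (ϱ := ϱ) (u := u) (t := t)
    have h2 := h.kap_sq ht
    have h3 : n1 u t * √(eX ϱ u t) ≤ kap ϱ u t := by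
      refine (abs_le_of_sq_le_sq' ?_ h1).2
      rw [mul_pow, Real.sq_sqrt hXt, h2]
      nlinarith [sq_nonneg (n1 (vdt u) t)]
    have h4 := mul_le_mul_of_nonneg_right h3 h1
    calc c * (C * (n1 u t * (√(eX ϱ u t) * kap ϱ u t)))
        = c * C * (n1 u t * √(eX ϱ u t) * kap ϱ u t) := by ring
      _ ≤ c * C * (kap ϱ u t * kap ϱ u t) := by gcongr
      _ = c * C * kap ϱ u t ^ 2 := by ring
      _ = _ := by rw [h2]
  have hdens : ∀ t, 0 ≤ t → ∀ x, ∑ i, pd i (ϱ t) x ^ 2 ≤ H * (K₁ * (1 + t * √(eX ϱ u 0))) :=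
    fun t ht x => (h.sum_pd_sq_le (hS.continuousOn_velBound (c * C))
      (fun t ht => hS.velBound_nonneg (by positivity) ht) hvel hH hR ht x).trans
        (mul_le_mul_of_nonneg_left (hexp hS hX0 ht) hH)
  have hmain : ∀ t, 0 ≤ t → dM1 ϱ u t + dis u P t / 16 ≤ 40000000 * C * K₁
      * (n1 u t ^ 2 * n1 (vdt u) t ^ 2 + eX ϱ u t ^ 2 + H * EnergySystem.mixed (kin ϱ u)
        (fun t => n1 u t ^ 2) (eX ϱ u) (fun t => n1 (vdt u) t ^ 2) t) := by
    intro t ht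
    have hQ : 0 ≤ H * (K₁ * (1 + t * √(eX ϱ u 0))) := by positivity
    have h1 := h.dM1_add_le ht hC (hn0 t ht) (Real.sqrt_nonneg (H * (K₁ * (1 + t * √(eX ϱ u 0)))))
      fun i x => by
        rw [← Real.sqrt_sq_eq_abs]
        refine Real.sqrt_le_sqrt (le_trans ?_ (hdens t ht x))
        exact Finset.single_le_sum (f := fun i => pd i (ϱ t) x ^ 2) (fun _ _ => sq_nonneg _)
          (Finset.mem_univ i)
    rw [Real.sq_sqrt hQ] at h1
    refine h1.trans ?_
    have hy := h.kin_nonneg ht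
    have h2 : n0 u t ≤ 2 * √(kin ϱ u t) := by
      refine (abs_le_of_sq_le_sq' ?_ (by positivity)).2
      rw [mul_pow, Real.sq_sqrt hy]
      linarith [(h.kin_bounds ht h.hu).1]
    have h3 : √(n1 u t ^ 2) = n1 u t := Real.sqrt_sq (n1_nonneg u t)
    have h4 := n1_nonneg u t
    have h5 := kap_nonneg (ϱ := ϱ) (u := u) (t := t)
    have e : EnergySystem.mixed (kin ϱ u) (fun t => n1 u t ^ 2) (eX ϱ u)
        (fun t => n1 (vdt u) t ^ 2) t
        = (1 + t * √(eX ϱ u 0)) * (√(kin ϱ u t) * n1 u t * (√(eX ϱ u t) * kap ϱ u t)) := by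
      simp only [EnergySystem.mixed, h3, kap]
    have h6 : n0 u t * n1 u t * (√(eX ϱ u t) * kap ϱ u t)
        ≤ 2 * (√(kin ϱ u t) * n1 u t * (√(eX ϱ u t) * kap ϱ u t)) := by
      have := mul_le_mul_of_nonneg_right h2
        (by positivity : 0 ≤ n1 u t * (√(eX ϱ u t) * kap ϱ u t))
      linarith
    rw [e]
    set Y := √(kin ϱ u t) * n1 u t * (√(eX ϱ u t) * kap ϱ u t) with hY
    have hY0 : 0 ≤ Y := by positivity
    set W := n1 u t ^ 2 * n1 (vdt u) t ^ 2 + eX ϱ u t ^ 2 with hW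
    have hW0 : 0 ≤ W := by positivity
    have h7 := mul_le_mul_of_nonneg_left h6 hQ
    have h8 : W ≤ K₁ * W := le_mul_of_one_le_left hW0 hK₁
    have h9 : W + H * (K₁ * (1 + t * √(eX ϱ u 0))) * (n0 u t * n1 u t * (√(eX ϱ u t) * kap ϱ u t))
        ≤ 2 * K₁ * (W + H * ((1 + t * √(eX ϱ u 0)) * Y)) := by linarith
    calc _ ≤ 20000000 * C * (2 * K₁ * (W + H * ((1 + t * √(eX ϱ u 0)) * Y))) := by gcongr
      _ = _ := by ring
  have cD : ContinuousOn (fun t => dis u P t / 16) (Ici 0) := h.continuousOn_dis.div_const 16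
  obtain ⟨hM, hD⟩ := hdec (hS.mono hCC) hX0 (fun t ht => h.hasDerivWithinAt_n1_vdt_sq ht) cD
    (fun t _ => div_nonneg dis_nonneg (by norm_num)) hH hmain hE1 hE2 hE3 hE4 ht
  have hE : 0 ≤ E := (sq_nonneg _).trans hE1
  refine ⟨hM.trans (by nlinarith [mul_nonneg (by linarith : 0 ≤ K) hE]), fun {t'} htt => ?_⟩
  have h1 := hD htt
  rw [intervalIntegral.integral_div] at h1
  linarith

end Sol

/-! ### Norms of vector fields in components -/

section Norms

variable {F : Type*} [NormedAddCommGroup F]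

lemma LpN_sq_eq_sum {ι : Type*} [Fintype ι] {f : Plane → F} (g : ι → Plane → ℝ) (hf : Continuous f)
    (hg : ∀ i, MemLp (g i) 2 volume) (h : ∀ x, ‖f x‖ ^ 2 = ∑ i, g i x ^ 2) :
    LpN 2 f ^ 2 = ∑ i, sqn (g i) := by
  have e : (fun x => ‖f x‖ ^ 2) = fun x => ∑ i, g i x ^ 2 := funext h
  have hm : MemLp (fun x => ‖f x‖) 2 volume := by
    rw [memLp_two_iff_integrable_sq hf.norm.aestronglyMeasurable, e]
    exact integrable_finsetSum _ fun i _ => (hg i).integrable_sq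
  have h1 := nrm_eq_toReal hm
  rw [eLpNorm_norm] at h1
  rw [LpN, ← h1, nrm_sq, sqn, e, integral_finsetSum _ fun i _ => (hg i).integrable_sq]
  rfl

variable [NormedSpace ℝ F]

lemma contDiff_grad {f : Plane → F} (hf : ContDiff ℝ ∞ f) : ContDiff ℝ ∞ (grad f) :=
  contDiff_piLp' 2 fun _ => (hf.fderiv_right (by simp)).clm_apply contDiff_const

lemma fderiv_grad_apply {f : Plane → F} (hf : ContDiff ℝ ∞ f) (x v : Plane) (j : Fin 2) :
    (fderiv ℝ (grad f) x v) j = fderiv ℝ (fun y => fderiv ℝ f y (basisVec j)) x v := by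
  have h := (PiLp.proj 2 (𝕜 := ℝ) (fun _ : Fin 2 => F) j).hasFDerivAt.comp x
    ((contDiff_grad hf).differentiable (by simp) x).hasFDerivAt
  have e : (fun y => fderiv ℝ f y (basisVec j)) = (PiLp.proj 2 (𝕜 := ℝ) (fun _ : Fin 2 => F) j) ∘ grad f :=
    rfl
  rw [e, h.fderiv]
  rfl

end Norms

section Plane

variable {f : Plane → Plane}

lemma LpN_eq_vsq (hf : Continuous f) (hk : ∀ k, Hs fun x => f x k) :
    LpN 2 f ^ 2 = vsq fun k x => f x k :=
  LpN_sq_eq_sum (fun k x => f x k) hf (fun k => (hk k).memL2) fun x => by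
    rw [EuclideanSpace.norm_sq_eq]
    simp only [Real.norm_eq_abs, sq_abs]

lemma LpN_grad_eq_vgsq (hf : ContDiff ℝ ∞ f) (hk : ∀ k, Hs fun x => f x k) :
    LpN 2 (grad f) ^ 2 = vgsq fun k x => f x k := by
  rw [LpN_sq_eq_sum (fun (p : Fin 2 × Fin 2) => pd p.2 fun x => f x p.1)
    (contDiff_grad hf).continuous (fun p => ((hk p.1).pd p.2).memL2) fun x => ?_,
    Fintype.sum_prod_type]
  · rfl
  · rw [PiLp.norm_sq_eq_of_L2, Fintype.sum_prod_type, Finset.sum_comm]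
    refine Finset.sum_congr rfl fun i _ => ?_
    rw [EuclideanSpace.norm_sq_eq]
    refine Finset.sum_congr rfl fun k _ => ?_
    rw [pd_apply (hf.differentiable (by simp)), Real.norm_eq_abs, sq_abs]
    rfl

lemma LpN_grad_grad_eq_vhsq (hf : ContDiff ℝ ∞ f) (hk : ∀ k, Hs fun x => f x k) :
    LpN 2 (grad (grad f)) ^ 2 = vhsq fun k x => f x k := by
  rw [LpN_sq_eq_sum (fun (p : Fin 2 × Fin 2 × Fin 2) => pd p.2.1 (pd p.2.2 fun x => f x p.1))
    (contDiff_grad (contDiff_grad hf)).continuous (fun p => (((hk p.1).pd p.2.2).pd p.2.1).memL2)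
    fun x => ?_]
  · simp only [Fintype.sum_prod_type]
    rfl
  · rw [PiLp.norm_sq_eq_of_L2]
    simp only [Fintype.sum_prod_type]
    rw [Finset.sum_comm]
    refine Finset.sum_congr rfl fun i _ => ?_
    rw [PiLp.norm_sq_eq_of_L2, Finset.sum_comm]
    refine Finset.sum_congr rfl fun j _ => ?_
    rw [EuclideanSpace.norm_sq_eq]
    refine Finset.sum_congr rfl fun k _ => ?_
    have hj : ContDiff ℝ ∞ fun y => fderiv ℝ f y (basisVec j) :=
      (hf.fderiv_right (by simp)).clm_apply contDiff_const
    have e : grad (grad f) x i j = fderiv ℝ (fun y => fderiv ℝ f y (basisVec j)) x (basisVec i) :=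
      fderiv_grad_apply hf x (basisVec i) j
    rw [e, pd_apply (hf.differentiable (by simp)), pd_apply (hj.differentiable (by simp)),
      Real.norm_eq_abs, sq_abs]

end Plane

lemma norm_grad_sq (f : Plane → ℝ) (x : Plane) : ‖grad f x‖ ^ 2 = ∑ i, pd i f x ^ 2 := by
  rw [PiLp.norm_sq_eq_of_L2]
  exact Finset.sum_congr rfl fun i _ => by rw [Real.norm_eq_abs, sq_abs]; rfl

lemma LpN_grad_eq_sum {f : Plane → ℝ} (hf : ContDiff ℝ ∞ f) (hk : ∀ k, Hs (pd k f)) :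
    LpN 2 (grad f) ^ 2 = ∑ k, sqn (pd k f) :=
  LpN_sq_eq_sum (fun k => pd k f) (contDiff_grad hf).continuous (fun k => (hk k).memL2)
    (norm_grad_sq f)

/-- A bounded continuous field is bounded pointwise by its `L^∞` norm. -/
lemma norm_le_LpN_top {F : Type*} [NormedAddCommGroup F] [NormedSpace ℝ F] {f : Plane → F}
    (hf : Continuous f) {K : ℝ} (hK : ∀ x, ‖f x‖ ≤ K) (x : Plane) : ‖f x‖ ≤ LpN ⊤ f := by
  have hm : MemLp f ⊤ volume := memLp_top_of_bound hf.aestronglyMeasurable K (ae_of_all _ hK)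
  have h1 : ∀ᵐ y, ‖f y‖ ≤ LpN ⊤ f := by
    have h2 : ∀ᵐ y, ‖f y‖ₑ ≤ eLpNorm f ⊤ volume := by
      rw [eLpNorm_exponent_top]; exact ae_le_eLpNormEssSup
    filter_upwards [h2] with y hy
    have := ENNReal.toReal_mono hm.2.ne hy
    simpa [LpN] using this
  have h3 : (fun y => max ‖f y‖ (LpN ⊤ f)) =ᵐ[volume] fun _ => LpN ⊤ f := by
    filter_upwards [h1] with y hy using max_eq_right hy
  have h4 := (Continuous.ae_eq_iff_eq volume (hf.norm.max continuous_const) continuous_const).1 h3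
  exact (le_max_left _ _).trans_eq (congrFun h4 x)

lemma Hs.eq_zero_of_sqn_eq_zero {f : Plane → ℝ} (hf : Hs f) (h : sqn f = 0) (x : Plane) : f x = 0 := by
  have h1 : (fun x => f x ^ 2) =ᵐ[volume] 0 :=
    (integral_eq_zero_iff_of_nonneg (fun x => sq_nonneg _) hf.memL2.integrable_sq).1 h
  have h2 := (Continuous.ae_eq_iff_eq volume (hf.smooth.continuous.pow 2) continuous_const).1 h1
  exact pow_eq_zero_iff two_ne_zero |>.1 (congrFun h2 x)

lemma Hs.eq_zero_of_gsq_eq_zero {f : Plane → ℝ} (hf : Hs f) (h : gsq f = 0) (x : Plane) : f x = 0 := by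
  have h1 := hf.sqn_sq_le
  rw [h, mul_zero, mul_zero] at h1
  have := hf.sq.eq_zero_of_sqn_eq_zero (le_antisymm h1 (sqn_nonneg _)) x
  simpa using this

namespace Sol

variable {ϱ P : ℝ → Plane → ℝ} {u : Fin 2 → ℝ → Plane → ℝ} {t : ℝ}

lemma kin_zero_of_n1_zero (h : Sol ϱ u P) (h0 : n1 u 0 ^ 2 = 0) : kin ϱ u 0 = 0 := by
  rw [n1_sq, vgsq, Finset.sum_eq_zero_iff_of_nonneg fun k _ => gsq_nonneg _] at h0
  refine Finset.sum_eq_zero fun k _ => ?_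
  have := ((h.hu k).hs le_rfl).eq_zero_of_gsq_eq_zero (h0 k (Finset.mem_univ k))
  simp [wsq, this]

lemma eq_zero_of_kin_zero (h : Sol ϱ u P) (h0 : kin ϱ u 0 = 0) (ht : 0 ≤ t) (k : Fin 2) :
    u k t = fun _ => 0 := by
  have h1 := h.kin_le_kin_zero ht
  have h2 := (h.kin_bounds ht h.hu).1
  have h3 : vsq (fun k => u k t) = 0 := by
    rw [← n0_sq]
    nlinarith [sq_nonneg (n0 u t)]
  rw [vsq, Finset.sum_eq_zero_iff_of_nonneg fun k _ => sqn_nonneg _] at h3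
  exact funext (((h.hu k).hs ht).eq_zero_of_sqn_eq_zero (h3 k (Finset.mem_univ k)))

lemma vdt_eq_zero {v : Fin 2 → ℝ → Plane → ℝ} (hv : ∀ k t, 0 ≤ t → v k t = fun _ => 0) (k : Fin 2)
    (t : ℝ) (ht : 0 ≤ t) : vdt v k t = fun _ => 0 := by
  have h1 := dt_congr (g := fun _ _ => 0) (hv k) ht
  rw [vdt, h1]
  funext x
  simp [dt]

/-- The trivial solution. -/
lemma trivial_of_kin_zero (h : Sol ϱ u P) (h0 : kin ϱ u 0 = 0) (ht : 0 ≤ t) :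
    n1 (vdt u) t ^ 2 = 0 ∧ dis u P t = 0 := by
  have hu : ∀ k t, 0 ≤ t → u k t = fun _ => 0 := fun k t ht => h.eq_zero_of_kin_zero h0 ht k
  have hv := vdt_eq_zero hu
  have hw := vdt_eq_zero hv
  have hP : ∀ k t, 0 ≤ t → xd k P t = fun _ => 0 := fun k t ht => by
    funext x
    have h1 := h.mom k t ht x
    have h2 : dt (u k) t = fun _ => 0 := hv k t ht
    simp only [h2, hu _ t ht, zero_mul, Finset.sum_const_zero, add_zero, mul_zero, lap, pd_const,
      sub_zero, zero_add] at h1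
    simpa using h1
  have hP' : ∀ k, pd k (dt P t) = fun _ => 0 := fun k => by
    have e : pd k (dt P t) = dt (xd k P) t := funext fun x => (h.hP.dt_xd k ht x).symm
    rw [e]
    exact vdt_eq_zero hP k t ht
  constructor
  · rw [n1_sq]
    simp [vgsq, gsq, hv _ t ht, pd_const, sqn]
  · rw [dis, n0_sq, n2_sq]
    simp [vsq, vhsq, hsq, hv _ t ht, hw _ t ht, hP', pd_const, sqn]

end Sol

/-! ### The energy quantities in components -/

namespace IsSmoothSolution

variable {ρ : ℝ → Plane → ℝ} {u : ℝ → Plane → Plane} {P : ℝ → Plane → ℝ} {t : ℝ}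

lemma smoothOn_velocity (h : IsSmoothSolution ρ u P) : SmoothOn u := h.smooth_velocity.contDiffOn

lemma sm_velocity (h : IsSmoothSolution ρ u P) (k : Fin 2) : Sm fun t x => u t x k := h.smooth_velocity.sm (coordL k)

lemma hs_velocity (h : IsSmoothSolution ρ u P) (k : Fin 2) : Hs fun x => u 0 x k := (h.sm_velocity k).hs le_rfl

lemma dt_apply (h : IsSmoothSolution ρ u P) (ht : 0 ≤ t) (k : Fin 2) : dt (fun t x => u t x k) t = fun x => dt u t x k :=
  iter_dt_clm_comp (coordL k) h.smoothOn_velocity 1 t ht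

lemma dt_dt_apply (h : IsSmoothSolution ρ u P) (ht : 0 ≤ t) (k : Fin 2) :
    dt (dt fun t x => u t x k) t = fun x => dt (dt u) t x k :=
  iter_dt_clm_comp (coordL k) h.smoothOn_velocity 2 t ht

lemma hs_dt (h : IsSmoothSolution ρ u P) (ht : 0 ≤ t) (k : Fin 2) : Hs fun x => dt u t x k := by
  rw [← h.dt_apply ht]; exact (h.sm_velocity k).dt.hs ht

lemma LpN_grad_dt (h : IsSmoothSolution ρ u P) (ht : 0 ≤ t) :
    LpN 2 (grad (dt u t)) ^ 2 = n1 (Sol.vdt fun k t x => u t x k) t ^ 2 := by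
  rw [LpN_grad_eq_vgsq (h.smoothOn_velocity.dt.slice ht) (h.hs_dt ht), n1_sq]
  congr 1
  funext k
  exact (h.dt_apply ht k).symm

lemma dissipation_eq (h : IsSmoothSolution ρ u P) (hS : Sol (fun t x => ρ t x - 1) (fun k t x => u t x k) P) (ht : 0 ≤ t) :
    dissipation u P t = Sol.dis (fun k t x => u t x k) P t := by
  have hk : ∀ k, Hs fun x => dt (dt u) t x k := fun k => by
    rw [← h.dt_dt_apply ht]; exact (h.sm_velocity k).dt.dt.hs ht
  rw [dissipation, Sol.dis, LpN_eq_vsq (h.smoothOn_velocity.dt.dt.slice ht).continuous hk,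
    LpN_grad_grad_eq_vhsq (h.smoothOn_velocity.dt.slice ht) (h.hs_dt ht),
    LpN_grad_eq_sum (hS.hP.dt.slice ht) (hS.stokes_dt ht).hp, n0_sq, n2_sq]
  congr 3
  · funext k
    exact (h.dt_dt_apply ht k).symm
  · funext k
    exact (h.dt_apply ht k).symm

lemma E1_eq (h : IsSmoothSolution ρ u P) : E1 u = n1 (fun k t x => u t x k) 0 ^ 2 := by
  rw [E1, LpN_grad_eq_vgsq (h.smoothOn_velocity.slice le_rfl) h.hs_velocity, n1_sq]

lemma E0_eq (h : IsSmoothSolution ρ u P) (hd : GoodData ρ u) : E0 ρ u = Sol.kin (fun t x => ρ t x - 1) (fun k t x => u t x k) 0 := by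
  have hS := h.sol hd
  have e : ∀ x, ρ 0 x * ‖u 0 x‖ ^ 2 = ∑ k, (1 + (ρ 0 x - 1)) * u 0 x k ^ 2 := fun x => by
    rw [EuclideanSpace.norm_sq_eq, Finset.mul_sum]
    refine Finset.sum_congr rfl fun k _ => ?_
    rw [Real.norm_eq_abs, sq_abs]
    ring
  simp only [E0, e, Sol.kin, wsq]
  refine integral_finsetSum _ fun k _ => ?_
  have h1 := (hS.hu k).hs le_rfl
  have h3 := h1.integrable_mul (h1.add ((hS.hϱ.hs le_rfl).mul h1))
  refine h3.congr (ae_of_all _ fun x => ?_)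
  ring

lemma continuous_density (h : IsSmoothSolution ρ u P) (hd : GoodData ρ u) : Continuous (ρ 0) := by
  have := ((h.sol hd).hϱ.hs le_rfl).smooth.continuous.add (continuous_const (y := (1 : ℝ)))
  exact this.congr fun x => sub_add_cancel (ρ 0 x) 1

lemma E2_eq (h : IsSmoothSolution ρ u P) (hd : GoodData ρ u) : E2 ρ u = Sol.eX (fun t x => ρ t x - 1) (fun k t x => u t x k) 0 := by
  have hρ : ∀ x, 0 ≤ ρ 0 x := fun x => by linarith [(hd.density_bounds x).1]
  have hc := h.continuous_density hd
  have h1 : LpN 2 (fun x => √(ρ 0 x) • dt u 0 x) ^ 2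
      = ∑ k, sqn fun x => √(ρ 0 x) * dt u 0 x k := by
    refine LpN_sq_eq_sum (fun (k : Fin 2) x => √(ρ 0 x) * dt u 0 x k)
      (hc.sqrt.smul (h.smoothOn_velocity.dt.slice le_rfl).continuous) (fun k => ?_) fun x => ?_
    · refine MemLp.of_le_mul (c := 2) (h.hs_dt le_rfl k).memL2
        (hc.sqrt.mul (h.hs_dt le_rfl k).smooth.continuous).aestronglyMeasurable
        (ae_of_all _ fun x => ?_)
      rw [norm_mul]
      gcongr
      rw [Real.norm_eq_abs, abs_of_nonneg (Real.sqrt_nonneg _), Real.sqrt_le_left (by norm_num)]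
      linarith [(hd.density_bounds x).2]
    · rw [EuclideanSpace.norm_sq_eq]
      refine Finset.sum_congr rfl fun k _ => ?_
      rw [Real.norm_eq_abs, sq_abs]
      rfl
  have e4 : LpN 2 (grad (u 0)) ^ 4 = (LpN 2 (grad (u 0)) ^ 2) ^ 2 := by ring
  have e5 := h.E1_eq
  rw [E1] at e5
  rw [E2, h1, e4, e5, Sol.eX, Sol.kin]
  congr 1
  · refine Finset.sum_congr rfl fun k _ => ?_
    simp only [sqn, wsq, Sol.vdt, h.dt_apply le_rfl k]
    congr 1
    funext x
    rw [mul_pow, Real.sq_sqrt (hρ x)]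
    ring
  · ring

lemma E3_eq (h : IsSmoothSolution ρ u P) (hd : GoodData ρ u) : E3 ρ u = n1 (Sol.vdt fun k t x => u t x k) 0 ^ 2 + E2 ρ u * √(E2 ρ u)
    + E2 ρ u * LpN ⊤ (grad (ρ 0)) ^ 2 := by
  have h0 : 0 ≤ E2 ρ u := by rw [h.E2_eq hd]; exact (h.sol hd).eX_nonneg le_rfl
  have e : E2 ρ u ^ ((3 : ℝ) / 2) = E2 ρ u * √(E2 ρ u) := by
    rw [Real.sqrt_eq_rpow]
    nth_rewrite 2 [← Real.rpow_one (E2 ρ u)]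
    rw [← Real.rpow_add_of_nonneg h0 (by norm_num) (by norm_num)]
    norm_num
  rw [E3, h.LpN_grad_dt le_rfl, e]

lemma sum_pd_density_sq_le (h : IsSmoothSolution ρ u P) (hd : GoodData ρ u) (x : Plane) :
    ∑ i, pd i (fun x => ρ 0 x - 1) x ^ 2 ≤ LpN ⊤ (grad (ρ 0)) ^ 2 := by
  have hS := h.sol hd
  have hϱ : Hs fun x => ρ 0 x - 1 := hS.hϱ.hs le_rfl
  have e : grad (fun x => ρ 0 x - 1) = grad (ρ 0) := by
    funext x
    simp only [grad, fderiv_sub_const]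
  rw [← norm_grad_sq, ← e]
  obtain ⟨C0, -, hC0⟩ := (hϱ.pd 0).bounded
  obtain ⟨C1, -, hC1⟩ := (hϱ.pd 1).bounded
  have hb : ∀ x, ‖grad (fun x => ρ 0 x - 1) x‖ ≤ √(C0 ^ 2 + C1 ^ 2) := fun x => by
    refine Real.le_sqrt_of_sq_le ?_
    rw [norm_grad_sq, Fin.sum_univ_two]
    exact add_le_add (sq_le_sq' (_root_.abs_le.1 (hC0 x)).1 (_root_.abs_le.1 (hC0 x)).2)
      (sq_le_sq' (_root_.abs_le.1 (hC1 x)).1 (_root_.abs_le.1 (hC1 x)).2)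
  exact pow_le_pow_left₀ (norm_nonneg _)
    (norm_le_LpN_top (contDiff_grad hϱ.smooth).continuous hb x) 2

lemma LpN_density_sq (h : IsSmoothSolution ρ u P) (hd : GoodData ρ u) : LpN 2 (fun x => ρ 0 x - 1) ^ 2 = nrm (fun x => ρ 0 x - 1) ^ 2 := by
  rw [LpN, ← nrm_eq_toReal ((h.sol hd).hϱ.hs le_rfl).memL2]

lemma integrable_first_moment (h : IsSmoothSolution ρ u P) (hd : GoodData ρ u) (k : Fin 2) : Integrable fun x => ‖x‖ * |u 0 x k| := by
  refine hd.first_moment.mono' ?_ (ae_of_all _ fun x => ?_)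
  · exact (continuous_norm.mul (h.hs_velocity k).smooth.continuous.abs).aestronglyMeasurable
  · rw [Real.norm_eq_abs, abs_of_nonneg (by positivity)]
    gcongr
    exact PiLp.norm_apply_le (u 0 x) k

lemma integral_first_moment_le (h : IsSmoothSolution ρ u P) (hd : GoodData ρ u) (k : Fin 2) : ∫ x, ‖x‖ * |u 0 x k| ≤ U0 u := by
  refine integral_mono (h.integrable_first_moment hd k) hd.first_moment fun x => ?_
  dsimp only
  gcongr
  exact PiLp.norm_apply_le (u 0 x) k

lemma integrable_momentum (h : IsSmoothSolution ρ u P) (hd : GoodData ρ u) : Integrable fun x => ρ 0 x • u 0 x := by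
  have hc := h.continuous_density hd
  have hcu : Continuous (u 0) := (h.smoothOn_velocity.slice le_rfl).continuous
  have i1 : Integrable ((Metric.closedBall (0 : Plane) 1).indicator fun _ => (1 : ℝ)) :=
    (integrable_indicator_iff Metric.isClosed_closedBall.measurableSet).2
      (integrableOn_const measure_closedBall_lt_top.ne)
  have i2 : Integrable fun x => ‖u 0 x‖ ^ 2 := by
    simp only [EuclideanSpace.norm_sq_eq, Real.norm_eq_abs, sq_abs]
    exact integrable_finsetSum _ fun k _ => (h.hs_velocity k).memL2.integrable_sq
  refine (((i1.add i2).add hd.first_moment).const_mul (5 / 4)).mono'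
    (hc.smul hcu).aestronglyMeasurable (ae_of_all _ fun x => ?_)
  have hρ := hd.density_bounds x
  rw [norm_smul, Real.norm_eq_abs, abs_of_nonneg (by linarith)]
  simp only [Pi.add_apply]
  have hn := norm_nonneg (u 0 x)
  refine mul_le_mul hρ.2 ?_ hn (by norm_num)
  by_cases hx : ‖x‖ ≤ 1
  · rw [indicator_of_mem (by simpa using hx)]
    have : 0 ≤ ‖x‖ * ‖u 0 x‖ := by positivity
    nlinarith [sq_nonneg (‖u 0 x‖ - 1)]
  · rw [indicator_of_notMem (by simpa using hx)]
    nlinarith [sq_nonneg ‖u 0 x‖]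

lemma integral_mmt_eq_zero (h : IsSmoothSolution ρ u P) (hd : GoodData ρ u) (k : Fin 2) :
    ∫ x, Sol.mmt (fun t x => ρ t x - 1) (fun k t x => u t x k) k 0 x = 0 := by
  have h1 := (coordL k).integral_comp_comm (h.integrable_momentum hd)
  rw [hd.zero_momentum, map_zero] at h1
  refine Eq.trans ?_ h1
  congr 1
  funext x
  simp [Sol.mmt, coordL]
  ring

end IsSmoothSolution

/-- A monotone majorant of a sequence of constants. -/
def majorant (c : ℕ → ℝ) (x : ℝ) : ℝ := ∑ i ∈ Finset.range (⌈x⌉₊ + 1), c i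

lemma majorant_monotone {c : ℕ → ℝ} (hc : ∀ n, 0 ≤ c n) : Monotone (majorant c) := fun _ _ hxy =>
  Finset.sum_le_sum_of_subset_of_nonneg
    (Finset.range_subset_range.2 (Nat.add_le_add_right (Nat.ceil_mono hxy) 1)) fun i _ _ => hc i

lemma le_majorant {c : ℕ → ℝ} (hc : ∀ n, 0 ≤ c n) (x : ℝ) : c ⌈x⌉₊ ≤ majorant c x :=
  Finset.single_le_sum (f := c) (fun i _ => hc i) (Finset.mem_range.2 (Nat.lt_succ_self _))

lemma majorant_nonneg {c : ℕ → ℝ} (hc : ∀ n, 0 ≤ c n) (x : ℝ) : 0 ≤ majorant c x :=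
  Finset.sum_nonneg fun i _ => hc i

/-- Tails of the dissipation control the integral up to infinity. -/
lemma integrableOn_Ioi_and_integral_le {D : ℝ → ℝ} (cD : ContinuousOn D (Ici 0))
    (D0 : ∀ t, 0 ≤ t → 0 ≤ D t) {t I : ℝ} (ht : 0 ≤ t)
    (h : ∀ t', t ≤ t' → ∫ r in t..t', D r ≤ I) :
    IntegrableOn D (Ioi t) ∧ ∫ r in Ioi t, D r ≤ I := by
  have hloc : ∀ t' : ℝ, IntegrableOn D (Ioc t t') := fun t' => by
    rcases le_total t t' with htt | htt
    · exact (intervalIntegrable_iff_integrableOn_Ioc_of_le htt).1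
        (intervalIntegrable_of_continuousOn cD ht (ht.trans htt))
    · rw [Ioc_eq_empty (not_lt.2 htt)]; exact integrableOn_empty
  have hi : IntegrableOn D (Ioi t) := by
    refine integrableOn_Ioi_of_intervalIntegral_norm_bounded I t hloc tendsto_id ?_
    filter_upwards [eventually_ge_atTop t] with t' htt
    refine le_trans (le_of_eq (intervalIntegral.integral_congr fun r hr => ?_)) (h t' htt)
    rw [uIcc_of_le htt] at hr
    exact Real.norm_of_nonneg (D0 r (ht.trans hr.1))
  refine ⟨hi, le_of_tendsto (intervalIntegral_tendsto_integral_Ioi t hi tendsto_id) ?_⟩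
  filter_upwards [eventually_ge_atTop t] with t' htt using h t' htt

end INS2D

end

theorem stmt_11 :
    ∃ C : ℝ → ℝ, Monotone C ∧ ∃ K : ℝ → ℝ,
      ∀ (ρ : ℝ → INS2D.Plane → ℝ) (u : ℝ → INS2D.Plane → INS2D.Plane) (P : ℝ → INS2D.Plane → ℝ),
        INS2D.IsSmoothSolution ρ u P → INS2D.GoodData ρ u →
        ∀ T : ℝ, INS2D.T3 ρ u ≤ T →
        (∀ t : ℝ, 0 ≤ t →
          MeasureTheory.IntegrableOn (INS2D.dissipation u P) (Set.Ioi t) ∧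
          INS2D.LpN 2 (INS2D.grad (INS2D.dt u t)) ^ 2
              + ∫ t' in Set.Ioi t, INS2D.dissipation u P t'
            ≤ C (INS2D.E0 ρ u) * (INS2D.E3 ρ u * INS2D.bracket T t ^ (-5 : ℤ))) ∧
        (∀ s : ℝ, 0 ≤ s → s < 5 → ∀ t₀ t : ℝ, 0 ≤ t₀ → t₀ ≤ t →
          IntervalIntegrable (fun t' => INS2D.bracket T t' ^ s * INS2D.dissipation u P t')
            MeasureTheory.volume t₀ t ∧
          ∫ t' in t₀..t, INS2D.bracket T t' ^ s * INS2D.dissipation u P t'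
            ≤ C (INS2D.E0 ρ u) * K s *
              ((1 + T) * (1 + INS2D.LpN ⊤ (INS2D.grad (ρ 0)) ^ 2) * INS2D.E3 ρ u)) := by
  choose K hK hdec using fun n : ℕ => INS2D.Sol.exists_decay (n : ℝ)
  have hc : ∀ n, 0 ≤ 2 * K n := fun n => by linarith [hK n]
  refine ⟨INS2D.majorant fun n => 2 * K n, INS2D.majorant_monotone hc, fun s => 5 / (5 - s),
    fun ρ u P h hd T hT => ?_⟩
  have hS := h.sol hd
  have eE0 := h.E0_eq hd
  have eE1 := h.E1_eq
  have eE2 := h.E2_eq hd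
  have eE3 := h.E3_eq hd
  have eϱ := h.LpN_density_sq hd
  set ϱ : ℝ → INS2D.Plane → ℝ := fun t x => ρ t x - 1
  set v : Fin 2 → ℝ → INS2D.Plane → ℝ := fun k t x => u t x k
  have hdis : ∀ t, 0 ≤ t → INS2D.dissipation u P t = INS2D.Sol.dis v P t := fun t ht =>
    h.dissipation_eq hS ht
  have hdis0 : ∀ t, 0 ≤ t → 0 ≤ INS2D.dissipation u P t := fun t ht => by
    rw [hdis t ht]; exact INS2D.Sol.dis_nonneg
  have cdis : ContinuousOn (INS2D.dissipation u P) (Set.Ici 0) :=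
    hS.continuousOn_dis.congr fun t ht => hdis t ht
  have hX0 : 0 ≤ INS2D.E2 ρ u := by rw [eE2]; exact hS.eX_nonneg le_rfl
  have hE30 : 0 ≤ INS2D.E3 ρ u := by rw [eE3]; positivity
  simp only [INS2D.T3, INS2D.T2, INS2D.T1, INS2D.T0, max_le_iff] at hT
  obtain ⟨⟨⟨⟨hT1, hT2⟩, hT3⟩, -⟩, hT4⟩ := hT
  have hT0 : 0 ≤ T := (sq_nonneg _).trans hT2
  have hE00 : 0 ≤ INS2D.E0 ρ u := by rw [eE0]; exact hS.kin_nonneg le_rfl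
  have hC0 := INS2D.majorant_nonneg hc (INS2D.E0 ρ u)
  have hCK := INS2D.le_majorant hc (INS2D.E0 ρ u)
  have cw : ∀ s : ℝ, ContinuousOn (fun t => INS2D.bracket T t ^ s * INS2D.dissipation u P t)
      (Set.Ici 0) := fun s => by
    refine ContinuousOn.mul (ContinuousOn.rpow_const ?_ fun t ht => Or.inl ?_) cdis
    · unfold INS2D.bracket
      fun_prop
    · linarith [INS2D.one_le_bracket hT0 ht]
  suffices hmain : ∃ k, 0 ≤ k ∧ 2 * k ≤ INS2D.majorant (fun n => 2 * K n) (INS2D.E0 ρ u) ∧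
      (∀ t, 0 ≤ t → INS2D.LpN 2 (INS2D.grad (INS2D.dt u t)) ^ 2 * INS2D.bracket T t ^ 5
        ≤ k * INS2D.E3 ρ u) ∧
      (∀ t, 0 ≤ t → ∀ t', t ≤ t' → (∫ r in t..t', INS2D.dissipation u P r) * INS2D.bracket T t ^ 5
        ≤ k * INS2D.E3 ρ u) ∧
      (∀ s, 0 ≤ s → s < 5 → ∀ t₀ t, 0 ≤ t₀ → t₀ ≤ t →
        ∫ r in t₀..t, INS2D.bracket T r ^ s * INS2D.dissipation u P r
          ≤ 5 / (5 - s) * (k * INS2D.E3 ρ u)) by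
    obtain ⟨k, hk0, hk, hM, hD, hw⟩ := hmain
    refine ⟨fun t ht => ?_, fun s hs hs5 t₀ t ht₀ htt => ⟨?_, ?_⟩⟩
    · have hb : 0 < INS2D.bracket T t ^ 5 :=
        pow_pos (by linarith [INS2D.one_le_bracket hT0 ht]) 5
      have h1 := INS2D.integrableOn_Ioi_and_integral_le cdis hdis0 ht fun t' htt =>
        (le_div_iff₀ hb).2 (hD t ht t' htt)
      refine ⟨h1.1, ?_⟩
      have h2 := (le_div_iff₀ hb).2 (hM t ht)
      have e : INS2D.bracket T t ^ (-5 : ℤ) = (INS2D.bracket T t ^ 5)⁻¹ := by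
        rw [zpow_neg]; rfl
      have h3 : 0 ≤ INS2D.E3 ρ u / INS2D.bracket T t ^ 5 := div_nonneg hE30 hb.le
      rw [e, ← div_eq_mul_inv]
      calc _ ≤ k * INS2D.E3 ρ u / INS2D.bracket T t ^ 5 + k * INS2D.E3 ρ u / INS2D.bracket T t ^ 5 :=
            add_le_add h2 h1.2
        _ = 2 * k * (INS2D.E3 ρ u / INS2D.bracket T t ^ 5) := by ring
        _ ≤ _ := mul_le_mul_of_nonneg_right hk h3
    · exact INS2D.intervalIntegrable_of_continuousOn (cw s) ht₀ (ht₀.trans htt)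
    · refine (hw s hs hs5 t₀ t ht₀ htt).trans ?_
      have h5 : 0 ≤ 5 / (5 - s) := div_nonneg (by norm_num) (by linarith)
      have h6 : 1 ≤ (1 + T) * (1 + INS2D.LpN ⊤ (INS2D.grad (ρ 0)) ^ 2) :=
        one_le_mul_of_one_le_of_one_le (by linarith) (by linarith [sq_nonneg (INS2D.LpN ⊤ (INS2D.grad (ρ 0)))])
      have h7 := mul_le_mul_of_nonneg_right h6 hE30
      have h8 := mul_le_mul_of_nonneg_left (h7.trans' (one_mul (INS2D.E3 ρ u)).ge) hk0
      have h9 : k ≤ INS2D.majorant (fun n => 2 * K n) (INS2D.E0 ρ u) := by linarith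
      have h10 : 0 ≤ (1 + T) * (1 + INS2D.LpN ⊤ (INS2D.grad (ρ 0)) ^ 2) * INS2D.E3 ρ u := by
        positivity
      calc 5 / (5 - s) * (k * INS2D.E3 ρ u)
          ≤ 5 / (5 - s) * (k * ((1 + T) * (1 + INS2D.LpN ⊤ (INS2D.grad (ρ 0)) ^ 2) * INS2D.E3 ρ u)) :=
            mul_le_mul_of_nonneg_left h8 h5
        _ ≤ 5 / (5 - s) * (INS2D.majorant (fun n => 2 * K n) (INS2D.E0 ρ u)
            * ((1 + T) * (1 + INS2D.LpN ⊤ (INS2D.grad (ρ 0)) ^ 2) * INS2D.E3 ρ u)) :=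
            mul_le_mul_of_nonneg_left (mul_le_mul_of_nonneg_right h9 h10) h5
        _ = _ := by ring
  rcases hE00.eq_or_lt with hz | hpos
  · have hk : INS2D.Sol.kin ϱ v 0 = 0 := by rw [← eE0, ← hz]
    have hD : ∀ t, 0 ≤ t → INS2D.dissipation u P t = 0 := fun t ht => by
      rw [hdis t ht]; exact (hS.trivial_of_kin_zero hk ht).2
    have hint : ∀ (g : ℝ → ℝ) (t t' : ℝ), 0 ≤ t → t ≤ t' →
        ∫ r in t..t', g r * INS2D.dissipation u P r = 0 := fun g t t' ht htt => by
      rw [intervalIntegral.integral_congr (g := fun _ => 0) fun r hr => ?_]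
      · simp
      · rw [Set.uIcc_of_le htt] at hr
        simp [hD r (ht.trans hr.1)]
    refine ⟨0, le_rfl, by simpa using hC0, fun t ht => ?_, fun t ht t' htt => ?_,
      fun s _ _ t₀ t ht₀ htt => ?_⟩
    · rw [h.LpN_grad_dt ht, (hS.trivial_of_kin_zero hk ht).1]
      simp
    · have := hint (fun _ => 1) t t' ht htt
      simp only [one_mul] at this
      simp [this]
    · rw [hint _ t₀ t ht₀ htt]
      simp
  · have hE1pos : 0 < INS2D.E1 u := by
      rw [eE1]
      refine (sq_nonneg _).lt_of_ne fun hn => hpos.ne' ?_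
      rw [eE0]
      exact hS.kin_zero_of_n1_zero hn.symm
    have hE2pos : 0 < INS2D.E2 ρ u := by
      have h1 := hS.n1_pow_four_le le_rfl
      have h2 : 0 < (INS2D.n1 v 0 ^ 2) ^ 2 := by rw [← eE1]; positivity
      rw [eE2]
      nlinarith
    have hE3pos : 0 < INS2D.E3 ρ u := by rw [eE3]; positivity
    have hTpos : 0 < T := (div_pos hpos hE1pos).trans_le hT3
    rw [div_le_iff₀ hpos] at hT1
    rw [div_le_iff₀ hE1pos] at hT3
    rw [div_le_iff₀ hE3pos] at hT4
    rw [eE0] at hT1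
    rw [eE0, eE1] at hT3
    have hQ : 0 ≤ INS2D.E2 ρ u * INS2D.LpN ⊤ (INS2D.grad (ρ 0)) ^ 2 := by positivity
    have hQ' : 0 ≤ INS2D.E2 ρ u * √(INS2D.E2 ρ u) := by positivity
    have hn1 := sq_nonneg (INS2D.n1 (INS2D.Sol.vdt v) 0)
    have key := fun {t : ℝ} (ht : 0 ≤ t) => hdec ⌈INS2D.E0 ρ u⌉₊ hS (by rw [← eE0]; exact Nat.le_ceil _)
      (h.integrable_first_moment hd) (h.integral_first_moment_le hd) (h.integral_mmt_eq_zero hd)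
      hTpos hT1 (by rw [← eϱ]; exact hT2) hT3 (by rw [← eE2]; exact hE2pos)
      (sq_nonneg (INS2D.LpN ⊤ (INS2D.grad (ρ 0)))) (h.sum_pd_density_sq_le hd)
      (E := INS2D.E3 ρ u) (by linarith) (by rw [← eE2]; linarith) (by rw [← eE2]; linarith)
      (by rw [← eE2]; exact hT4) ht
    have hD : ∀ t, 0 ≤ t → ∀ t', t ≤ t' →
        (∫ r in t..t', INS2D.dissipation u P r) * INS2D.bracket T t ^ 5
          ≤ K ⌈INS2D.E0 ρ u⌉₊ * INS2D.E3 ρ u := fun t ht t' htt => by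
      rw [intervalIntegral.integral_congr (g := INS2D.Sol.dis v P) fun r hr => ?_]
      · exact (key ht).2 htt
      · rw [Set.uIcc_of_le htt] at hr
        exact hdis r (ht.trans hr.1)
    refine ⟨K ⌈INS2D.E0 ρ u⌉₊, by linarith [hK ⌈INS2D.E0 ρ u⌉₊], hCK, fun t ht => ?_, hD,
      fun s hs hs5 t₀ t ht₀ htt =>
        INS2D.integral_rpow_bracket_mul_le cdis hdis0 hTpos hD hs hs5 ht₀ htt⟩
    rw [h.LpN_grad_dt ht]
    exact (key ht).1
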